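/- Let n ≥ 2, 0 ≤ q ≤ n, s, k positive integers, 0 < λ < λ' < 1, δ > n/2, μ > 0, T > 0. Then the nonlinear map u ↦ Ψ_{μ,q} N_q(u) from F^{k,s(s,λ,λ',δ)}_{T,Λ^q} to itself is continuous and compact (maps bounded sets to relatively compact sets), and the map I + Ψ_{μ,q} N_q from F^{k,s(s,λ,λ',δ)}_{T,Λ^q} to itself is continuous, Fredholm (its Fréchet derivative at each point is a bounded Fredholm linear operator), injective, and open. -/

import Mathlib

open scoped BigOperators ENNReal Classical
open Filter MeasureTheory

noncomputable section

namespace NSdeRham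

/-- Euclidean space `ℝⁿ`. -/
abbrev Spc (n : ℕ) := EuclideanSpace ℝ (Fin n)

variable {n : ℕ}

/-- The weight `w(x) = √(1+|x|²)`. -/
def wt (x : Spc n) : ℝ := Real.sqrt (1 + ‖x‖ ^ 2)

/-- `w(x,y) = max (w x) (w y)`. -/
def wt2 (x y : Spc n) : ℝ := max (wt x) (wt y)

/-- Partial derivative in the `i`-th coordinate direction. -/
def pd (i : Fin n) (f : Spc n → ℝ) (x : Spc n) : ℝ :=
  fderiv ℝ f x (EuclideanSpace.single i 1)

/-- The Laplace operator `Δ = ∑ ∂²/∂xᵢ²`. -/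
def lap (f : Spc n → ℝ) (x : Spc n) : ℝ := ∑ i : Fin n, pd i (pd i f) x

section enorms

variable {F : Type*} [NormedAddCommGroup F]

/-- Weighted sup-"norm" `sup_x w(x)^δ ‖g x‖` (with values in `ℝ≥0∞`). -/
def eWSup (δ : ℝ) (g : Spc n → F) : ℝ≥0∞ :=
  ⨆ x : Spc n, ENNReal.ofReal (wt x ^ δ * ‖g x‖)

/-- Weighted Hölder seminorm `⟨g⟩_{λ,δ}`. -/
def eWHold (lam δ : ℝ) (g : Spc n → F) : ℝ≥0∞ :=
  ⨆ (x : Spc n) (y : Spc n) (_ : x ≠ y ∧ ‖x - y‖ ≤ ‖x‖ / 2),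
    ENNReal.ofReal (wt2 x y ^ (δ + lam) * ‖g x - g y‖ / ‖x - y‖ ^ lam)

/-- The ordinary Hölder norm on the (closed) unit ball around the origin. -/
def eOHold (lam : ℝ) (g : Spc n → F) : ℝ≥0∞ :=
  (⨆ (x : Spc n) (_ : ‖x‖ ≤ 1), ENNReal.ofReal ‖g x‖) +
    ⨆ (x : Spc n) (y : Spc n) (_ : ‖x‖ ≤ 1 ∧ ‖y‖ ≤ 1 ∧ x ≠ y),
      ENNReal.ofReal (‖g x - g y‖ / ‖x - y‖ ^ lam)

/-- The norm of `C^{0,λ,δ}`; for `λ = 0` this is just the weighted sup-norm. -/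
def eHol0 (lam δ : ℝ) (g : Spc n → F) : ℝ≥0∞ :=
  if lam = 0 then eWSup δ g else eOHold lam g + eWSup δ g + eWHold lam δ g

/-- The norm of the base anisotropic space `C^{𝐬(0,λ,δ)}_T`. -/
def eAniso0 (T lam δ : ℝ) (v : ℝ → Spc n → F) : ℝ≥0∞ :=
  (⨆ t : Set.Icc (0 : ℝ) T, eHol0 lam δ (v t)) +
    if lam = 0 then 0 else
      ⨆ (t₁ : Set.Icc (0 : ℝ) T) (t₂ : Set.Icc (0 : ℝ) T) (_ : (t₁ : ℝ) ≠ (t₂ : ℝ))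
        (x : Spc n),
        ENNReal.ofReal (wt x ^ δ * ‖v t₁ x - v t₂ x‖ / |(t₁ : ℝ) - (t₂ : ℝ)| ^ (lam / 2))

end enorms

/-- The norm of the static weighted Hölder space `C^{s,λ,δ}`. -/
def eHolS (s : ℕ) (lam δ : ℝ) (g : Spc n → ℝ) : ℝ≥0∞ :=
  ∑ m ∈ Finset.range (s + 1), eHol0 lam (δ + m) (iteratedFDeriv ℝ m g)

/-- Membership in the static weighted Hölder space `C^{s,λ,δ}`. -/
def HolSMem (s : ℕ) (lam δ : ℝ) (g : Spc n → ℝ) : Prop :=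
  ContDiff ℝ s g ∧ eHolS s lam δ g ≠ ⊤

/-- Time derivative of order `j` (within `[0,T]`). -/
def tDeriv (T : ℝ) (j : ℕ) (u : ℝ → Spc n → ℝ) (t : ℝ) (x : Spc n) : ℝ :=
  iteratedDerivWithin j (fun τ => u τ x) (Set.Icc 0 T) t

/-- Mixed derivative `∂_x^m ∂_t^j`. -/
def mixDeriv (T : ℝ) (m j : ℕ) (u : ℝ → Spc n → ℝ) (t : ℝ) :
    Spc n → ContinuousMultilinearMap ℝ (fun _ : Fin m => Spc n) ℝ :=
  iteratedFDeriv ℝ m (fun x => tDeriv T j u t x)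

/-- The norm of the anisotropic weighted parabolic Hölder space `C^{k,𝐬(s,λ,δ)}_T`. -/
def eAnisoKS (T : ℝ) (k s : ℕ) (lam δ : ℝ) (u : ℝ → Spc n → ℝ) : ℝ≥0∞ :=
  ∑ b ∈ Finset.range (k + 1), ∑ m ∈ Finset.range (2 * s + 1), ∑ j ∈ Finset.range (s + 1),
    if m + 2 * j ≤ 2 * s then eAniso0 T lam (δ + b + m) (mixDeriv T (b + m) j u) else 0

/-- Regularity required of members of `C^{k,𝐬(s,λ,δ)}_T`. -/
def AnisoReg (T : ℝ) (k s : ℕ) (u : ℝ → Spc n → ℝ) : Prop :=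
  (∀ x : Spc n, ContDiffOn ℝ s (fun t => u t x) (Set.Icc 0 T)) ∧
  (∀ j : ℕ, j ≤ s → ∀ t ∈ Set.Icc (0 : ℝ) T,
    ContDiff ℝ (2 * (s - j) + k) (fun x => tDeriv T j u t x)) ∧
  (∀ j m : ℕ, j ≤ s → m + 2 * j ≤ 2 * s + k →
    Continuous fun p : Set.Icc (0 : ℝ) T × Spc n => mixDeriv T m j u p.1 p.2)

/-- Membership in `C^{k,𝐬(s,λ,δ)}_T`. -/
def AnisoMem (T : ℝ) (k s : ℕ) (lam δ : ℝ) (u : ℝ → Spc n → ℝ) : Prop :=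
  AnisoReg T k s u ∧ eAnisoKS T k s lam δ u ≠ ⊤

/-- The norm of `𝓕^{k,𝐬(s,λ,λ',δ)}_T = C^{k+1,𝐬(s,λ,δ)}_T ∩ C^{k,𝐬(s,λ',δ)}_T`. -/
def eFn (T : ℝ) (k s : ℕ) (lam lam' δ : ℝ) (u : ℝ → Spc n → ℝ) : ℝ≥0∞ :=
  eAnisoKS T (k + 1) s lam δ u + eAnisoKS T k s lam' δ u

/-- Membership in `𝓕^{k,𝐬(s,λ,λ',δ)}_T`. -/
def FMem (T : ℝ) (k s : ℕ) (lam lam' δ : ℝ) (u : ℝ → Spc n → ℝ) : Prop :=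
  AnisoReg T (k + 1) s u ∧ eFn T k s lam lam' δ u ≠ ⊤

/-- Index set of a basis of `Λ^q`. -/
abbrev Idx (n q : ℕ) := {I : Finset (Fin n) // I.card = q}

/-- Static differential `q`-forms: coefficient functions. -/
abbrev FormS (n q : ℕ) := Idx n q → Spc n → ℝ

/-- Time-dependent differential `q`-forms. -/
abbrev FormT (n q : ℕ) := Idx n q → ℝ → Spc n → ℝ

/-- Fibre of the bundle `Λ^q`. -/
abbrev Fib (n q : ℕ) := Idx n q → ℝ

/-- The exterior derivative `d_q` on static `q`-forms. -/
def dS {q : ℕ} (u : FormS n q) : FormS n (q + 1) := fun J x =>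
  ∑ i : Fin n,
    if h : i ∈ J.1 then
      (-1 : ℝ) ^ (J.1.filter fun j => j < i).card *
        pd i (u ⟨J.1.erase i, by simp [Finset.card_erase_of_mem h, J.2]⟩) x
    else 0

/-- The exterior derivative `d_{q-1}` mapping `(q-1)`-forms to `q`-forms. -/
def dLowS {q : ℕ} (p : FormS n (q - 1)) : FormS n q := fun J x =>
  ∑ i : Fin n,
    if h : i ∈ J.1 ∧ (J.1.erase i).card = q - 1 then
      (-1 : ℝ) ^ (J.1.filter fun j => j < i).card * pd i (p ⟨J.1.erase i, h.2⟩) x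
    else 0

/-- The formal adjoint `d_{q-1}^*` mapping `q`-forms to `(q-1)`-forms. -/
def coDS {q : ℕ} (u : FormS n q) : FormS n (q - 1) := fun K x =>
  -∑ i : Fin n,
    if h : i ∉ K.1 ∧ (insert i K.1).card = q then
      (-1 : ℝ) ^ (K.1.filter fun j => j < i).card * pd i (u ⟨insert i K.1, h.2⟩) x
    else 0

/-- `d_q` on time-dependent forms. -/
def dT {q : ℕ} (u : FormT n q) : FormT n (q + 1) := fun J t => dS (fun I => u I t) J

/-- `d_{q-1}` on time-dependent forms. -/
def dLowT {q : ℕ} (p : FormT n (q - 1)) : FormT n q := fun J t => dLowS (fun I => p I t) J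

/-- `d_{q-1}^*` on time-dependent forms. -/
def coDT {q : ℕ} (u : FormT n q) : FormT n (q - 1) := fun K t => coDS (fun I => u I t) K

/-- Norm of `C^{k,𝐬(s,λ,δ)}_{T,Λ^q}`. -/
def eAnisoKSF {q : ℕ} (T : ℝ) (k s : ℕ) (lam δ : ℝ) (u : FormT n q) : ℝ≥0∞ :=
  ∑ I : Idx n q, eAnisoKS T k s lam δ (u I)

/-- Membership in `C^{k,𝐬(s,λ,δ)}_{T,Λ^q}`. -/
def CMemF {q : ℕ} (T : ℝ) (k s : ℕ) (lam δ : ℝ) (u : FormT n q) : Prop :=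
  (∀ I, AnisoReg T k s (u I)) ∧ eAnisoKSF T k s lam δ u ≠ ⊤

/-- Graph norm of `C^{k,𝐬(s,λ,δ)}_{T,Λ^q,𝒟_{d⊕d*}}`. -/
def eCD {q : ℕ} (T : ℝ) (k s : ℕ) (lam δ : ℝ) (u : FormT n q) : ℝ≥0∞ :=
  eAnisoKSF T k s lam δ u + eAnisoKSF T k s lam (δ + 1) (dT u) +
    eAnisoKSF T k s lam (δ + 1) (coDT u)

/-- Membership in `C^{k,𝐬(s,λ,δ)}_{T,Λ^q,𝒟_{d⊕d*}}`. -/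
def CMemD {q : ℕ} (T : ℝ) (k s : ℕ) (lam δ : ℝ) (u : FormT n q) : Prop :=
  CMemF T k s lam δ u ∧ CMemF T k s lam (δ + 1) (dT u) ∧ CMemF T k s lam (δ + 1) (coDT u)

/-- Norm of `𝓕^{k,𝐬(s,λ,λ',δ)}_{T,Λ^q}`. -/
def eFF {q : ℕ} (T : ℝ) (k s : ℕ) (lam lam' δ : ℝ) (u : FormT n q) : ℝ≥0∞ :=
  ∑ I : Idx n q, eFn T k s lam lam' δ (u I)

/-- Membership in `𝓕^{k,𝐬(s,λ,λ',δ)}_{T,Λ^q}`. -/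
def FMemF {q : ℕ} (T : ℝ) (k s : ℕ) (lam lam' δ : ℝ) (u : FormT n q) : Prop :=
  (∀ I, AnisoReg T (k + 1) s (u I)) ∧ eFF T k s lam lam' δ u ≠ ⊤

/-- Graph norm of `𝓕^{k,𝐬(s,λ,λ',δ)}_{T,Λ^q,𝒟_{d⊕d*}}`. -/
def eFD {q : ℕ} (T : ℝ) (k s : ℕ) (lam lam' δ : ℝ) (u : FormT n q) : ℝ≥0∞ :=
  eFF T k s lam lam' δ u + eFF T k s lam lam' (δ + 1) (dT u) +
    eFF T k s lam lam' (δ + 1) (coDT u)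

/-- Membership in `𝓕^{k,𝐬(s,λ,λ',δ)}_{T,Λ^q,𝒟_{d⊕d*}}`. -/
def FMemD {q : ℕ} (T : ℝ) (k s : ℕ) (lam lam' δ : ℝ) (u : FormT n q) : Prop :=
  FMemF T k s lam lam' δ u ∧ FMemF T k s lam lam' (δ + 1) (dT u) ∧
    FMemF T k s lam lam' (δ + 1) (coDT u)

/-- Norm of the static space `C^{s,λ,δ}_{Λ^q}`. -/
def eHolSF {q : ℕ} (s : ℕ) (lam δ : ℝ) (g : FormS n q) : ℝ≥0∞ :=
  ∑ I : Idx n q, eHolS s lam δ (g I)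

/-- Membership in the static space `C^{s,λ,δ}_{Λ^q}`. -/
def HolMemF {q : ℕ} (s : ℕ) (lam δ : ℝ) (g : FormS n q) : Prop :=
  (∀ I, ContDiff ℝ s (g I)) ∧ eHolSF s lam δ g ≠ ⊤

/-- Equality of time-dependent forms on `ℝⁿ × [0,T]`. -/
def EqOnT {q : ℕ} (T : ℝ) (u v : FormT n q) : Prop :=
  ∀ I, ∀ t ∈ Set.Icc (0 : ℝ) T, ∀ x, u I t x = v I t x

/-- The form `u` is co-closed (`d^* u = 0`) on `ℝⁿ × [0,T]`. -/
def CoClosed {q : ℕ} (T : ℝ) (u : FormT n q) : Prop :=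
  ∀ K, ∀ t ∈ Set.Icc (0 : ℝ) T, ∀ x, coDT u K t x = 0

/-- Type of the bilinear zero order operator `M₁^{(q)}`. -/
abbrev M1Type (n q : ℕ) := (Fib n (q + 1) × Fib n (q - 1)) →ₗ[ℝ] Fib n q →ₗ[ℝ] Fib n q

/-- Type of the bilinear zero order operator `M₂^{(q)}`. -/
abbrev M2Type (n q : ℕ) := Fib n q →ₗ[ℝ] Fib n q →ₗ[ℝ] Fib n (q - 1)

/-- Value of a time-dependent form at a point, as an element of the fibre. -/
def fib {q : ℕ} (u : FormT n q) (t : ℝ) (x : Spc n) : Fib n q := fun I => u I t x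

/-- Value of `(d_q ⊕ d_{q-1}^*) u` at a point. -/
def ddFib {q : ℕ} (u : FormT n q) (t : ℝ) (x : Spc n) : Fib n (q + 1) × Fib n (q - 1) :=
  (fun J => dT u J t x, fun K => coDT u K t x)

/-- The operator `W_q u = M₁((d⊕d^*)u, w) + M₁((d⊕d^*)w, u)`. -/
def Wop {q : ℕ} (M₁ : M1Type n q) (w u : FormT n q) : FormT n q := fun I t x =>
  M₁ (ddFib u t x) (fib w t x) I + M₁ (ddFib w t x) (fib u t x) I

/-- The symmetric bilinearization `B_q(w,u)` of the nonlinearity. -/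
def Bop {q : ℕ} (M₁ : M1Type n q) (M₂ : M2Type n q) (w u : FormT n q) : FormT n q :=
  fun I t x =>
    Wop M₁ w u I t x +
      dLowT (fun K t' x' =>
        M₂ (fib u t' x') (fib w t' x') K + M₂ (fib w t' x') (fib u t' x') K) I t x

/-- The nonlinearity `𝒩_q u = M₁((d⊕d^*)u, u) + d_{q-1} M₂(u,u)`. -/
def Nop {q : ℕ} (M₁ : M1Type n q) (M₂ : M2Type n q) (u : FormT n q) : FormT n q :=
  fun I t x =>
    M₁ (ddFib u t x) (fib u t x) I +
      dLowT (fun K t' x' => M₂ (fib u t' x') (fib u t' x') K) I t x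

/-- Fundamental solution of the heat operator `∂_t - μΔ`. -/
def heatKer (μ : ℝ) (x : Spc n) (t : ℝ) : ℝ :=
  if 0 < t then (4 * Real.pi * μ * t) ^ (-(n : ℝ) / 2) * Real.exp (-‖x‖ ^ 2 / (4 * μ * t))
  else 0

/-- Volume heat potential `Ψ_μ`. -/
def volPot (μ : ℝ) (f : ℝ → Spc n → ℝ) (t : ℝ) (x : Spc n) : ℝ :=
  ∫ τ in Set.Ioc (0 : ℝ) t, ∫ y : Spc n, heatKer μ (x - y) (t - τ) * f τ y

/-- Poisson heat potential `Ψ_{μ,0}`. -/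
def poisPot (μ : ℝ) (g : Spc n → ℝ) (t : ℝ) (x : Spc n) : ℝ :=
  ∫ y : Spc n, heatKer μ (x - y) t * g y

/-- Volume heat potential acting coefficient-wise on forms. -/
def volPotF {q : ℕ} (μ : ℝ) (f : FormT n q) : FormT n q := fun I => volPot μ (f I)

/-- Poisson heat potential acting coefficient-wise on forms. -/
def poisPotF {q : ℕ} (μ : ℝ) (g : FormS n q) : FormT n q := fun I => poisPot μ (g I)

/-- Area of the unit sphere in `ℝⁿ`. -/
def sphArea (n : ℕ) : ℝ := 2 * Real.pi ^ ((n : ℝ) / 2) / Real.Gamma ((n : ℝ) / 2)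

/-- Standard fundamental solution of the Laplace operator in `ℝⁿ`. -/
def lapKer (n : ℕ) (x : Spc n) : ℝ :=
  if n = 2 then (1 / Real.pi) * Real.log ‖x‖
  else ‖x‖ ^ (2 - (n : ℝ)) / (sphArea n * (2 - (n : ℝ)))

/-- Newtonian potential. -/
def newtPot (f : Spc n → ℝ) (x : Spc n) : ℝ := ∫ y : Spc n, lapKer n (x - y) * f y

/-- The integral operator `Φ_q` mapping `(q+1)`-forms to `q`-forms;
concretely `Φ_q f = -d^* (e * f)`. -/
def PhiOp {q : ℕ} (f : FormT n (q + 1)) : FormT n q := fun K t x =>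
  -coDS (n := n) (q := q + 1) (fun J y => newtPot (fun z => f J t z) y) K x

/-- Squared `L²` norm of a form at time `t`. -/
def l2Sq {q : ℕ} (u : FormT n q) (t : ℝ) : ℝ :=
  ∑ I : Idx n q, ∫ x : Spc n, (u I t x) ^ 2

/-- Squared `L²` norm of the spatial gradient of a form at time `t`. -/
def gradSq {q : ℕ} (u : FormT n q) (t : ℝ) : ℝ :=
  ∑ I : Idx n q, ∑ i : Fin n, ∫ x : Spc n, (pd i (fun y => u I t y) x) ^ 2

/-- The norm of `C^{0,𝐬(0,0,δ)}_{T,Λ^q}` (weighted sup-norm). -/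
def eSupT {q : ℕ} (T δ : ℝ) (u : FormT n q) : ℝ≥0∞ :=
  ∑ I : Idx n q,
    ⨆ (t : Set.Icc (0 : ℝ) T) (x : Spc n), ENNReal.ofReal (wt x ^ δ * |u I t x|)

/-- The norm `‖∇u‖_{C^{0,𝐬(0,0,δ)}_{T}}` of the spatial gradient. -/
def eSupGradT {q : ℕ} (T δ : ℝ) (u : FormT n q) : ℝ≥0∞ :=
  ∑ I : Idx n q, ∑ i : Fin n,
    ⨆ (t : Set.Icc (0 : ℝ) T) (x : Spc n),
      ENNReal.ofReal (wt x ^ δ * |pd i (fun y => u I t y) x|)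

/-- `q`-form with coefficients harmonic polynomials of degree at most `m`. -/
def HarmPolyForm {q : ℕ} (m : ℕ) (h : FormS n q) : Prop :=
  ∀ I, (∃ P : MvPolynomial (Fin n) ℝ, P.totalDegree ≤ m ∧
      ∀ x : Spc n, h I x = MvPolynomial.eval (fun i => x i) P) ∧
    ∀ x : Spc n, lap (h I) x = 0

/-- Classical solution of the Cauchy problem
`∂_t u - μ Δ u + extra = f` on `ℝⁿ × (0,T)`, `u(·,0) = u₀`. -/
def CauchySol {q : ℕ} (T μ : ℝ) (u extra f : FormT n q) (u₀ : FormS n q) : Prop :=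
  (∀ I, ∀ t ∈ Set.Ioo (0 : ℝ) T, ∀ x,
    deriv (fun τ => u I τ x) t - μ * lap (fun y => u I t y) x + extra I t x = f I t x) ∧
  ∀ I x, u I 0 x = u₀ I x

/-- `Ψ_{μ,q} 𝒩_q u`. -/
def NopPot {q : ℕ} (μ : ℝ) (M₁ : M1Type n q) (M₂ : M2Type n q) (u : FormT n q) : FormT n q :=
  volPotF μ (Nop M₁ M₂ u)

/-- `u + Ψ_{μ,q} 𝒩_q u`. -/
def TmapN {q : ℕ} (μ : ℝ) (M₁ : M1Type n q) (M₂ : M2Type n q) (u : FormT n q) : FormT n q :=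
  u + NopPot μ M₁ M₂ u

/-- The linearization `u + Ψ_{μ,q} B_q(v,u)`. -/
def LmapB {q : ℕ} (μ : ℝ) (M₁ : M1Type n q) (M₂ : M2Type n q) (v u : FormT n q) :
    FormT n q :=
  u + volPotF μ (Bop M₁ M₂ v u)

/-- `Φ_q d_q Ψ_{μ,q} 𝒩_q u`. -/
def PhiNpot {q : ℕ} (μ : ℝ) (M₁ : M1Type n q) (M₂ : M2Type n q) (u : FormT n q) :
    FormT n q :=
  PhiOp (dT (volPotF μ (Nop M₁ M₂ u)))

/-- `u + Φ_q d_q Ψ_{μ,q} 𝒩_q u`. -/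
def PhiNmap {q : ℕ} (μ : ℝ) (M₁ : M1Type n q) (M₂ : M2Type n q) (u : FormT n q) :
    FormT n q :=
  u + PhiNpot μ M₁ M₂ u

/-- The linearization `u + Φ_q d_q Ψ_{μ,q} B_q(v,u)`. -/
def PhiLmap {q : ℕ} (μ : ℝ) (M₁ : M1Type n q) (M₂ : M2Type n q) (v u : FormT n q) :
    FormT n q :=
  u + PhiOp (dT (volPotF μ (Bop M₁ M₂ v u)))

section Abstract

variable {V : Type*} [NormedAddCommGroup V] [NormedSpace ℝ V]

theorem isCompactOperator_of_seq (K : V →L[ℝ] V)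
    (h : ∀ u : ℕ → V, (∃ C : ℝ, ∀ m, ‖u m‖ ≤ C) →
      ∃ φ : ℕ → ℕ, StrictMono φ ∧ ∃ g, Tendsto (fun m => K (u (φ m))) atTop (nhds g)) :
    IsCompactOperator K := by
  refine (isCompactOperator_iff_isCompact_closure_image_closedBall (K : V →ₗ[ℝ] V) one_pos).2 ?_
  have hseq : ∀ y : ℕ → V, (∀ m, y m ∈ K '' Metric.closedBall 0 1) →
      ∃ φ : ℕ → ℕ, StrictMono φ ∧ ∃ g, Tendsto (fun m => y (φ m)) atTop (nhds g) := by
    intro y hy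
    choose u hu hKu using hy
    obtain ⟨φ, hφ, g, hg⟩ := h u ⟨1, fun m => by simpa using hu m⟩
    exact ⟨φ, hφ, g, by simpa [hKu] using hg⟩
  apply IsSeqCompact.isCompact
  intro y hy
  have : ∀ m : ℕ, ∃ z ∈ K '' Metric.closedBall 0 1, dist (y m) z < 1 / ((m : ℝ) + 1) :=
    fun m => Metric.mem_closure_iff.1 (hy m) _ (by positivity)
  choose z hz hyz using this
  obtain ⟨φ, hφ, g, hg⟩ := hseq z hz
  have hlim : Tendsto (fun m => y (φ m)) atTop (nhds g) := by
    refine hg.congr_dist ?_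
    have h0 : Tendsto (fun m : ℕ => 1 / ((φ m : ℝ) + 1)) atTop (nhds 0) :=
      tendsto_one_div_add_atTop_nhds_zero_nat.comp hφ.tendsto_atTop
    refine squeeze_zero (fun _ => dist_nonneg) (fun m => ?_) h0
    rw [dist_comm]
    exact (hyz (φ m)).le
  exact ⟨g, isClosed_closure.mem_of_tendsto hlim (Eventually.of_forall fun m => hy _), φ, hφ, hlim⟩

theorem exists_equiv_of_compact_of_injective [CompleteSpace V] (K : V →L[ℝ] V) (hK : IsCompactOperator K)
    (hinj : ∀ h, h + K h = 0 → h = 0) : ∃ e : V ≃L[ℝ] V, ∀ h, e h = h + K h := by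
  have h1 := IsCompactOperator.hasEigenvalue_or_mem_resolventSet (𝕜 := ℝ) (T := K) hK
    (μ := -1) (by norm_num)
  rcases h1 with h1 | h1
  · exfalso
    obtain ⟨v, hv⟩ := h1.exists_hasEigenvector
    refine hv.2 (hinj v ?_)
    have := hv.apply_eq_smul
    simp only [ContinuousLinearMap.coe_coe] at this
    rw [this]
    simp
  · rw [spectrum.mem_resolventSet_iff] at h1
    obtain ⟨U, hU⟩ := h1
    refine ⟨(ContinuousLinearEquiv.unitsEquiv ℝ V (-U)), fun h => ?_⟩
    change ((-U : (V →L[ℝ] V)ˣ) : V →L[ℝ] V) h = _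
    rw [Units.val_neg, hU]
    simp [Algebra.algebraMap_eq_smul_one, add_comm]

/-- The derivative of `u ↦ u + b(u,u)`. -/
def quadDeriv (b : V →L[ℝ] V →L[ℝ] V) (v : V) : V →L[ℝ] V :=
  ContinuousLinearMap.id ℝ V + (b.flip v + b v)

theorem quadDeriv_apply (b : V →L[ℝ] V →L[ℝ] V) (v h : V) :
    quadDeriv b v h = h + (b h v + b v h) := by
  simp [quadDeriv]

theorem exists_equiv_quadDeriv [CompleteSpace V] (b : V →L[ℝ] V →L[ℝ] V)
    (hcomp : ∀ u v : ℕ → V, (∃ C : ℝ, ∀ m, ‖u m‖ ≤ C) → (∃ C : ℝ, ∀ m, ‖v m‖ ≤ C) →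
      ∃ φ : ℕ → ℕ, StrictMono φ ∧ ∃ g,
        Tendsto (fun m => b (u (φ m)) (v (φ m))) atTop (nhds g))
    (hinj : ∀ v₁ v₂ h, h + (b h v₁ + b v₂ h) = 0 → h = 0) (v : V) :
    ∃ e : V ≃L[ℝ] V, (e : V →L[ℝ] V) = quadDeriv b v := by
  have hK : IsCompactOperator (b.flip v + b v : V →L[ℝ] V) := by
    have hA : IsCompactOperator (b.flip v) := by
      refine isCompactOperator_of_seq _ fun u hu => ?_
      simpa using hcomp u (fun _ => v) hu ⟨‖v‖, fun _ => le_rfl⟩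
    have hB : IsCompactOperator (b v) := by
      refine isCompactOperator_of_seq _ fun u hu => ?_
      simpa using hcomp (fun _ => v) u ⟨‖v‖, fun _ => le_rfl⟩ hu
    exact hA.add hB
  obtain ⟨e, he⟩ := exists_equiv_of_compact_of_injective _ hK
    (fun h hh => hinj v v h (by simpa using hh))
  exact ⟨e, by ext h; simp [he, quadDeriv]⟩

theorem hasStrictFDerivAt_quad (b : V →L[ℝ] V →L[ℝ] V) (v : V) :
    HasStrictFDerivAt (fun u => u + b u u) (quadDeriv b v) v := by
  have h := (hasStrictFDerivAt_id (𝕜 := ℝ) v).add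
    (HasStrictFDerivAt.comp v (g := fun p : V × V => b p.1 p.2) (f := fun x => (id x, id x))
      (b.isBoundedBilinearMap.hasStrictFDerivAt (v, v))
      ((hasStrictFDerivAt_id (𝕜 := ℝ) v).prodMk (hasStrictFDerivAt_id (𝕜 := ℝ) v)))
  refine h.congr_fderiv ?_
  ext h
  simp [quadDeriv, add_comm]

theorem quad_open [CompleteSpace V] (b : V →L[ℝ] V →L[ℝ] V)
    (he : ∀ v, ∃ e : V ≃L[ℝ] V, (e : V →L[ℝ] V) = quadDeriv b v) (u : V) (r : ℝ) (hr : 0 < r) :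
    ∃ ε : ℝ, 0 < ε ∧ ∀ f : V, ‖f - (u + b u u)‖ < ε →
      ∃ v, ‖v - u‖ < r ∧ v + b v v = f := by
  obtain ⟨e, he⟩ := he u
  have h := hasStrictFDerivAt_quad b u
  rw [← he] at h
  have h2 := h.map_nhds_eq_of_equiv
  have h3 : (fun u => u + b u u) '' Metric.ball u r ∈ nhds (u + b u u) := by
    rw [← h2]
    exact image_mem_map (Metric.ball_mem_nhds u hr)
  obtain ⟨ε, hε, hsub⟩ := Metric.mem_nhds_iff.1 h3
  refine ⟨ε, hε, fun f hf => ?_⟩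
  obtain ⟨v, hv, rfl⟩ := hsub (show f ∈ Metric.ball _ _ by rwa [mem_ball_iff_norm])
  exact ⟨v, by rwa [mem_ball_iff_norm] at hv, rfl⟩

end Abstract

section Jets

/-- Iterated partial derivatives along a word of coordinate directions. -/
def pdw : List (Fin n) → (Spc n → ℝ) → Spc n → ℝ
  | [], f => f
  | i :: w, f => pd i (pdw w f)

theorem contDiff_pd {m : ℕ} {f : Spc n → ℝ} (hf : ContDiff ℝ (m + 1 : ℕ) f) (i : Fin n) :
    ContDiff ℝ m (pd i f) := by
  have h : ContDiff ℝ m (fderiv ℝ f) := hf.fderiv_right (by norm_cast)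
  exact h.clm_apply contDiff_const

theorem contDiff_pdw (w : List (Fin n)) : ∀ {m : ℕ} {f : Spc n → ℝ},
    ContDiff ℝ (m + w.length : ℕ) f → ContDiff ℝ m (pdw w f) := by
  induction w with
  | nil => intro m f hf; simpa [pdw] using hf
  | cons i w ih =>
    intro m f hf
    exact contDiff_pd (ih (by simpa [add_assoc, add_comm, add_left_comm] using hf)) i

theorem iteratedFDeriv_single (p : ℕ) : ∀ {f : Spc n → ℝ}, ContDiff ℝ p f →
    ∀ (x : Spc n) (i : Fin p → Fin n),
      iteratedFDeriv ℝ p f x (fun a => EuclideanSpace.single (i a) (1 : ℝ)) =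
        pdw (List.ofFn i) f x := by
  induction p with
  | zero => intro f _ x i; simp [pdw]
  | succ p ih =>
    intro f hf x i
    have hf' : ContDiff ℝ p f := hf.of_le (by norm_cast; omega)
    rw [iteratedFDeriv_succ_apply_left, List.ofFn_succ, pdw, pd]
    have hd : DifferentiableAt ℝ (iteratedFDeriv ℝ p f) x :=
      (hf.differentiable_iteratedFDeriv (by norm_cast; omega)) x
    have heq : pdw (List.ofFn fun a : Fin p => i a.succ) f =
        fun y => iteratedFDeriv ℝ p f y
          (fun a : Fin p => EuclideanSpace.single (i a.succ) (1 : ℝ)) := by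
      funext y
      exact (ih hf' y _).symm
    rw [heq]
    have h2 := (hd.hasFDerivAt.continuousMultilinear_apply_const
      (fun a : Fin p => EuclideanSpace.single (i a.succ) (1 : ℝ))).fderiv
    rw [h2]
    simp [Fin.tail_def]

/-- The multilinear form `v ↦ ∏ (v a)_{i a}`. -/
def coordForm {p : ℕ} (i : Fin p → Fin n) :
    ContinuousMultilinearMap ℝ (fun _ : Fin p => Spc n) ℝ :=
  (ContinuousMultilinearMap.mkPiAlgebra ℝ (Fin p) ℝ).compContinuousLinearMap
    fun a => EuclideanSpace.proj (i a)

theorem coordForm_apply {p : ℕ} (i : Fin p → Fin n) (v : Fin p → Spc n) :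
    coordForm i v = ∏ a, v a (i a) := by
  simp [coordForm]

theorem norm_coordForm_le {p : ℕ} (i : Fin p → Fin n) : ‖coordForm i‖ ≤ 1 := by
  refine ContinuousMultilinearMap.opNorm_le_bound zero_le_one fun v => ?_
  rw [coordForm_apply, one_mul, norm_prod]
  exact Finset.prod_le_prod (fun _ _ => norm_nonneg _) fun a _ => PiLp.norm_apply_le _ _

theorem iteratedFDeriv_eq_sum {p : ℕ} {f : Spc n → ℝ} (hf : ContDiff ℝ p f) (x : Spc n) :
    iteratedFDeriv ℝ p f x = ∑ i : Fin p → Fin n, pdw (List.ofFn i) f x • coordForm i := by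
  apply ContinuousMultilinearMap.toMultilinearMap_injective
  refine Module.Basis.ext_multilinear
    (fun _ => (EuclideanSpace.basisFun (Fin n) ℝ).toBasis) fun v => ?_
  have h := iteratedFDeriv_single p hf x v
  simp only [OrthonormalBasis.coe_toBasis, EuclideanSpace.basisFun_apply,
    ContinuousMultilinearMap.coe_coe]
  rw [h, ContinuousMultilinearMap.sum_apply]
  rw [Finset.sum_eq_single v]
  · simp [coordForm_apply]
  · intro j _ hj
    obtain ⟨a, ha⟩ := Function.ne_iff.1 hj
    simp only [ContinuousMultilinearMap.smul_apply, coordForm_apply, smul_eq_mul]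
    rw [Finset.prod_eq_zero (Finset.mem_univ a), mul_zero]
    simp [ha]
  · simp

theorem norm_iteratedFDeriv_sub_le {p : ℕ} {f g : Spc n → ℝ} (hf : ContDiff ℝ p f)
    (hg : ContDiff ℝ p g) (x y : Spc n) {B : ℝ}
    (hB : ∀ w : List (Fin n), w.length = p → |pdw w f x - pdw w g y| ≤ B) :
    ‖iteratedFDeriv ℝ p f x - iteratedFDeriv ℝ p g y‖ ≤ (n : ℝ) ^ p * B := by
  rw [iteratedFDeriv_eq_sum hf, iteratedFDeriv_eq_sum hg, ← Finset.sum_sub_distrib]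
  calc _ ≤ ∑ _i : Fin p → Fin n, B := by
        refine norm_sum_le_of_le _ fun i _ => ?_
        rw [← sub_smul, norm_smul, Real.norm_eq_abs]
        calc _ ≤ B * 1 := mul_le_mul (hB _ (by simp)) (norm_coordForm_le i) (norm_nonneg _)
              ((abs_nonneg _).trans (hB (List.ofFn i) (by simp)))
          _ = B := mul_one B
    _ = _ := by simp

theorem norm_iteratedFDeriv_le {p : ℕ} {f : Spc n → ℝ} (hf : ContDiff ℝ p f) (x : Spc n) {B : ℝ}
    (hB : ∀ w : List (Fin n), w.length = p → |pdw w f x| ≤ B) :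
    ‖iteratedFDeriv ℝ p f x‖ ≤ (n : ℝ) ^ p * B := by
  rw [iteratedFDeriv_eq_sum hf]
  calc _ ≤ ∑ _i : Fin p → Fin n, B := by
        refine norm_sum_le_of_le _ fun i _ => ?_
        rw [norm_smul, Real.norm_eq_abs]
        calc _ ≤ B * 1 := mul_le_mul (hB _ (by simp)) (norm_coordForm_le i) (norm_nonneg _)
              ((abs_nonneg _).trans (hB (List.ofFn i) (by simp)))
          _ = B := mul_one B
    _ = _ := by simp

theorem pdw_eq_iteratedFDeriv {p : ℕ} {w : List (Fin n)} (hw : w.length = p) {f : Spc n → ℝ}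
    (hf : ContDiff ℝ p f) (x : Spc n) :
    pdw w f x =
      iteratedFDeriv ℝ p f x
        (fun a => EuclideanSpace.single (w.get (a.cast hw.symm)) (1 : ℝ)) := by
  subst hw
  rw [iteratedFDeriv_single _ hf]
  congr 1
  exact (List.ofFn_get w).symm

theorem abs_apply_single_le {p : ℕ} (M : ContinuousMultilinearMap ℝ (fun _ : Fin p => Spc n) ℝ)
    (i : Fin p → Fin n) : |M (fun a => EuclideanSpace.single (i a) (1 : ℝ))| ≤ ‖M‖ := by
  have := M.le_opNorm (fun a => EuclideanSpace.single (i a) (1 : ℝ))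
  simpa using this

theorem abs_pdw_le {p : ℕ} {w : List (Fin n)} (hw : w.length = p) {f : Spc n → ℝ}
    (hf : ContDiff ℝ p f) (x : Spc n) : |pdw w f x| ≤ ‖iteratedFDeriv ℝ p f x‖ := by
  rw [pdw_eq_iteratedFDeriv hw hf]
  exact abs_apply_single_le _ _

theorem abs_pdw_sub_le {p : ℕ} {w : List (Fin n)} (hw : w.length = p) {f g : Spc n → ℝ}
    (hf : ContDiff ℝ p f) (hg : ContDiff ℝ p g) (x y : Spc n) :
    |pdw w f x - pdw w g y| ≤ ‖iteratedFDeriv ℝ p f x - iteratedFDeriv ℝ p g y‖ := by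
  rw [pdw_eq_iteratedFDeriv hw hf, pdw_eq_iteratedFDeriv hw hg]
  exact abs_apply_single_le (_ - _) _

/-- Freeze the time variable outside `[0,T]`. -/
def ext (T : ℝ) (f : ℝ → Spc n → ℝ) (t : ℝ) (x : Spc n) : ℝ := f (max 0 (min t T)) x

theorem clamp_mem {T : ℝ} (hT : 0 < T) (t : ℝ) : max 0 (min t T) ∈ Set.Icc 0 T :=
  ⟨le_max_left _ _, max_le hT.le (min_le_right _ _)⟩

theorem ext_of_mem {T : ℝ} (f : ℝ → Spc n → ℝ) {t : ℝ} (ht : t ∈ Set.Icc 0 T) :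
    ext T f t = f t := by
  funext x
  simp [ext, ht.1, ht.2]

/-- Joint continuity on `[0,T] × ℝⁿ`. -/
def ContT (T : ℝ) (f : ℝ → Spc n → ℝ) : Prop :=
  ContinuousOn (fun p : ℝ × Spc n => f p.1 p.2) (Set.Icc 0 T ×ˢ Set.univ)

theorem ContT.continuous_ext {T : ℝ} (hT : 0 < T) {f : ℝ → Spc n → ℝ} (hf : ContT T f) :
    Continuous fun p : ℝ × Spc n => ext T f p.1 p.2 := by
  have : Continuous fun p : ℝ × Spc n => ((max 0 (min p.1 T), p.2) : ℝ × Spc n) := by fun_prop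
  exact ContinuousOn.comp_continuous hf this fun p => ⟨clamp_mem hT _, Set.mem_univ _⟩

/-- `g` is the spatial gradient of `f` on `[0,T] × ℝⁿ`. -/
def HasGrad (T : ℝ) (f : ℝ → Spc n → ℝ) (g : Fin n → ℝ → Spc n → ℝ) : Prop :=
  ∀ t ∈ Set.Icc (0 : ℝ) T, ∀ x,
    HasFDerivAt (f t) (∑ i, g i t x • (EuclideanSpace.proj i : Spc n →L[ℝ] ℝ)) x

/-- `h` is the time derivative of `f` on `[0,T] × ℝⁿ`. -/
def HasDt (T : ℝ) (f h : ℝ → Spc n → ℝ) : Prop :=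
  ∀ t ∈ Set.Icc (0 : ℝ) T, ∀ x,
    HasDerivWithinAt (fun τ => f τ x) (h t x) (Set.Icc 0 T) t

theorem sum_proj_single (a : Fin n → ℝ) (i : Fin n) :
    (∑ j, a j • (EuclideanSpace.proj j : Spc n →L[ℝ] ℝ)) (EuclideanSpace.single i (1 : ℝ)) =
      a i := by
  simp [ContinuousLinearMap.sum_apply, Finset.sum_ite_eq']

theorem HasGrad.pd_eq {T : ℝ} {f : ℝ → Spc n → ℝ} {g : Fin n → ℝ → Spc n → ℝ}
    (h : HasGrad T f g) {t : ℝ} (ht : t ∈ Set.Icc 0 T) (i : Fin n) (x : Spc n) :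
    pd i (f t) x = g i t x := by
  rw [pd, (h t ht x).fderiv, sum_proj_single]

theorem fderiv_eq_sum_pd (f : Spc n → ℝ) (x : Spc n) :
    fderiv ℝ f x = ∑ i, pd i f x • (EuclideanSpace.proj i : Spc n →L[ℝ] ℝ) := by
  apply ContinuousLinearMap.coe_injective
  refine (EuclideanSpace.basisFun (Fin n) ℝ).toBasis.ext fun i => ?_
  simp only [OrthonormalBasis.coe_toBasis, EuclideanSpace.basisFun_apply,
    ContinuousLinearMap.coe_coe]
  rw [sum_proj_single]
  rfl

theorem hasGrad_of_contDiff {T : ℝ} {f : ℝ → Spc n → ℝ}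
    (h : ∀ t ∈ Set.Icc (0 : ℝ) T, Differentiable ℝ (f t)) :
    HasGrad T f (fun i t => pd i (f t)) := by
  intro t ht x
  rw [← fderiv_eq_sum_pd]
  exact (h t ht x).hasFDerivAt

theorem HasGrad.line {T : ℝ} {f : ℝ → Spc n → ℝ} {g : Fin n → ℝ → Spc n → ℝ}
    (h : HasGrad T f g) {t : ℝ} (ht : t ∈ Set.Icc 0 T) (i : Fin n) (x : Spc n) (r : ℝ) :
    HasDerivAt (fun r : ℝ => f t (x + r • EuclideanSpace.single i (1 : ℝ)))
      (g i t (x + r • EuclideanSpace.single i (1 : ℝ))) r := by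
  have h1 := h t ht (x + r • EuclideanSpace.single i (1 : ℝ))
  have h2 : HasDerivAt (fun r : ℝ => x + r • EuclideanSpace.single i (1 : ℝ))
      (EuclideanSpace.single i (1 : ℝ)) r := by
    simpa using ((hasDerivAt_id r).smul_const (EuclideanSpace.single i (1 : ℝ))).const_add x
  have h3 := h1.comp_hasDerivAt r h2
  rwa [sum_proj_single] at h3

theorem HasDt.integral_eq {T : ℝ} (hT : 0 < T) {a b : ℝ → Spc n → ℝ} (h : HasDt T a b)
    (hb : ContT T b) {t : ℝ} (ht : t ∈ Set.Icc 0 T) (x : Spc n) :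
    ∫ τ in (0 : ℝ)..t, ext T b τ x = a t x - a 0 x := by
  have hc : Continuous fun τ => ext T b τ x :=
    (hb.continuous_ext hT).comp (Continuous.prodMk continuous_id continuous_const)
  refine intervalIntegral.integral_eq_sub_of_hasDerivAt_of_le ht.1 (f := fun τ => a τ x) ?_ ?_
    (hc.intervalIntegrable _ _)
  · intro τ hτ
    exact ((h τ ⟨hτ.1, hτ.2.trans ht.2⟩ x).continuousWithinAt).mono
      (Set.Icc_subset_Icc_right ht.2)
  · intro τ hτ
    have hτ' : τ ∈ Set.Icc 0 T := ⟨hτ.1.le, hτ.2.le.trans ht.2⟩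
    rw [ext_of_mem b hτ']
    exact (h τ hτ' x).hasDerivAt (Icc_mem_nhds hτ.1 (hτ.2.trans_le ht.2))

theorem hasDt_of_integral {T : ℝ} {a b : ℝ → Spc n → ℝ} (hT : 0 < T) (hb : ContT T b)
    (h : ∀ t ∈ Set.Icc (0 : ℝ) T, ∀ x, a t x = a 0 x + ∫ τ in (0 : ℝ)..t, ext T b τ x) :
    HasDt T a b := by
  intro t ht x
  have hc : Continuous fun τ => ext T b τ x :=
    (hb.continuous_ext hT).comp (Continuous.prodMk continuous_id continuous_const)
  have h1 := ((hc.integral_hasStrictDerivAt 0 t).hasDerivAt.const_add (a 0 x)).hasDerivWithinAt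
    (s := Set.Icc 0 T)
  rw [ext_of_mem b ht] at h1
  exact h1.congr (fun τ hτ => h τ hτ x) (h t ht x)

/-- Time and space derivatives commute. -/
theorem HasDt.grad {T : ℝ} (hT : 0 < T) {a b : ℝ → Spc n → ℝ} {ga gb : Fin n → ℝ → Spc n → ℝ}
    (h : HasDt T a b) (hga : HasGrad T a ga) (hgb : HasGrad T b gb)
    (hb : ContT T b) (hgbc : ∀ i, ContT T (gb i)) (i : Fin n) : HasDt T (ga i) (gb i) := by
  refine hasDt_of_integral hT (hgbc i) fun t ht x => ?_
  set e : Spc n := EuclideanSpace.single i (1 : ℝ) with he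
  have h0 : (0 : ℝ) ∈ Set.Icc 0 T := ⟨le_rfl, hT.le⟩
  have hline : Continuous fun p : ℝ × ℝ => ((p.1, x + p.2 • e) : ℝ × Spc n) := by fun_prop
  have hcb : Continuous fun p : ℝ × ℝ => ext T b p.1 (x + p.2 • e) :=
    (hb.continuous_ext hT).comp hline
  have hcg : Continuous fun p : ℝ × ℝ => ext T (gb i) p.1 (x + p.2 • e) :=
    ((hgbc i).continuous_ext hT).comp hline
  obtain ⟨M, hM⟩ := ((isCompact_Icc (a := (0 : ℝ)) (b := T)).prod
    (isCompact_Icc (a := (-1 : ℝ)) (b := 1))).exists_bound_of_continuousOn hcg.continuousOn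
  have hsub : Set.uIoc 0 t ⊆ Set.Icc 0 T := by
    rw [Set.uIoc_of_le ht.1]
    exact fun τ hτ => ⟨hτ.1.le, hτ.2.trans ht.2⟩
  have key := (intervalIntegral.hasDerivAt_integral_of_dominated_loc_of_deriv_le
    (μ := volume) (a := 0) (b := t)
    (F := fun r τ => ext T b τ (x + r • e)) (F' := fun r τ => ext T (gb i) τ (x + r • e))
    (x₀ := (0 : ℝ)) (s := Set.Icc (-1) 1) (bound := fun _ => M)
    (Icc_mem_nhds (by norm_num) (by norm_num))
    (Eventually.of_forall fun r =>
      (hcb.comp (Continuous.prodMk continuous_id continuous_const)).aestronglyMeasurable)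
    ((hcb.comp (Continuous.prodMk continuous_id continuous_const)).intervalIntegrable _ _)
    (hcg.comp (Continuous.prodMk continuous_id continuous_const)).aestronglyMeasurable
    (Eventually.of_forall fun τ hτ r hr => hM (τ, r) ⟨hsub hτ, hr⟩)
    intervalIntegrable_const
    (Eventually.of_forall fun τ hτ r hr => by
      rw [ext_of_mem b (hsub hτ), ext_of_mem (gb i) (hsub hτ)]
      exact hgb.line (hsub hτ) i x r)).2
  have h2 : HasDerivAt (fun r : ℝ => a t (x + r • e) - a 0 (x + r • e))
      (ga i t (x + (0 : ℝ) • e) - ga i 0 (x + (0 : ℝ) • e)) 0 :=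
    (hga.line ht i x 0).sub (hga.line h0 i x 0)
  have h3 : (fun r : ℝ => ∫ τ in (0 : ℝ)..t, ext T b τ (x + r • e)) =
      fun r : ℝ => a t (x + r • e) - a 0 (x + r • e) := by
    funext r
    exact h.integral_eq hT hb ht _
  rw [h3] at key
  have h4 := key.unique h2
  simp only [zero_smul, add_zero] at h4
  rw [h4]
  ring

end Jets

section Calculus

variable {T : ℝ} {f g : ℝ → Spc n → ℝ} {f' g' : Fin n → ℝ → Spc n → ℝ}
  {f₁ g₁ : ℝ → Spc n → ℝ}

theorem HasGrad.add (hf : HasGrad T f f') (hg : HasGrad T g g') :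
    HasGrad T (fun t x => f t x + g t x) (fun i t x => f' i t x + g' i t x) := by
  intro t ht x
  have h := (hf t ht x).add (hg t ht x)
  simp only [add_smul, Finset.sum_add_distrib]
  exact h

theorem HasGrad.smul (c : ℝ) (hf : HasGrad T f f') :
    HasGrad T (fun t x => c * f t x) (fun i t x => c * f' i t x) := by
  intro t ht x
  have h := (hf t ht x).const_mul c
  simp only [mul_smul, ← Finset.smul_sum]
  exact h

theorem HasGrad.mul (hf : HasGrad T f f') (hg : HasGrad T g g') :
    HasGrad T (fun t x => f t x * g t x)
      (fun i t x => f' i t x * g t x + f t x * g' i t x) := by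
  intro t ht x
  have h := (hf t ht x).mul (hg t ht x)
  refine h.congr_fderiv ?_
  simp only [add_smul, Finset.sum_add_distrib, Finset.smul_sum, smul_smul]
  rw [add_comm]
  congr 1
  exact Finset.sum_congr rfl fun i _ => by rw [mul_comm]

theorem HasGrad.congr (hf : HasGrad T f f') (h : ∀ t ∈ Set.Icc (0 : ℝ) T, ∀ x, f t x = g t x) :
    HasGrad T g f' := by
  intro t ht x
  have : g t = f t := funext fun x => (h t ht x).symm
  rw [this]
  exact hf t ht x

theorem HasGrad.congr_right (hf : HasGrad T f f')
    (h : ∀ i, ∀ t ∈ Set.Icc (0 : ℝ) T, ∀ x, f' i t x = g' i t x) : HasGrad T f g' := by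
  intro t ht x
  have := hf t ht x
  simp only [fun i => h i t ht x] at this
  exact this

theorem HasDt.add (hf : HasDt T f f₁) (hg : HasDt T g g₁) :
    HasDt T (fun t x => f t x + g t x) (fun t x => f₁ t x + g₁ t x) :=
  fun t ht x => (hf t ht x).add (hg t ht x)

theorem HasDt.smul (c : ℝ) (hf : HasDt T f f₁) :
    HasDt T (fun t x => c * f t x) (fun t x => c * f₁ t x) :=
  fun t ht x => (hf t ht x).const_mul c

theorem HasDt.mul (hf : HasDt T f f₁) (hg : HasDt T g g₁) :
    HasDt T (fun t x => f t x * g t x) (fun t x => f₁ t x * g t x + f t x * g₁ t x) :=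
  fun t ht x => (hf t ht x).mul (hg t ht x)

theorem HasDt.congr (hf : HasDt T f f₁) (h : ∀ t ∈ Set.Icc (0 : ℝ) T, ∀ x, f t x = g t x) :
    HasDt T g f₁ :=
  fun t ht x => (hf t ht x).congr (fun τ hτ => (h τ hτ x).symm) (h t ht x).symm

theorem HasDt.congr_right (hf : HasDt T f f₁)
    (h : ∀ t ∈ Set.Icc (0 : ℝ) T, ∀ x, f₁ t x = g₁ t x) : HasDt T f g₁ := by
  intro t ht x
  rw [← h t ht x]
  exact hf t ht x

theorem HasDt.derivWithin_eq (hT : 0 < T) (hf : HasDt T f f₁) {t : ℝ} (ht : t ∈ Set.Icc 0 T)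
    (x : Spc n) : derivWithin (fun τ => f τ x) (Set.Icc 0 T) t = f₁ t x :=
  (hf t ht x).derivWithin (uniqueDiffOn_Icc hT t ht)

theorem tDeriv_zero (f : ℝ → Spc n → ℝ) : tDeriv T 0 f = f := by
  funext t x
  simp [tDeriv]

theorem tDeriv_succ (j : ℕ) (f : ℝ → Spc n → ℝ) (t : ℝ) (x : Spc n) :
    tDeriv T (j + 1) f t x =
      derivWithin (fun τ => tDeriv T j f τ x) (Set.Icc 0 T) t := by
  simp only [tDeriv, iteratedDerivWithin_succ]

theorem tDeriv_congr (h : ∀ t ∈ Set.Icc (0 : ℝ) T, ∀ x, f t x = g t x) (j : ℕ) :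
    ∀ t ∈ Set.Icc (0 : ℝ) T, ∀ x, tDeriv T j f t x = tDeriv T j g t x := by
  intro t ht x
  exact iteratedDerivWithin_congr (fun τ hτ => h τ hτ x) ht

end Calculus

section Classes

/-- A class of functions with `N` parabolic derivatives, at most `s` of them in time, each
derivative being controlled by the predicate `P`.  A space derivative improves the weight. -/
def Cls (T : ℝ) (P : ℕ → ℝ → ℝ → (ℝ → Spc n → ℝ) → Prop) :
    ℕ → ℕ → ℝ → ℝ → (ℝ → Spc n → ℝ) → Prop
  | 0, _, W, C, f => P 0 W C f
  | 1, s, W, C, f =>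
      P 1 W C f ∧ ∃ g : Fin n → ℝ → Spc n → ℝ, HasGrad T f g ∧ ∀ i, Cls T P 0 s (W + 1) C (g i)
  | N + 2, 0, W, C, f =>
      P (N + 2) W C f ∧
        ∃ g : Fin n → ℝ → Spc n → ℝ, HasGrad T f g ∧ ∀ i, Cls T P (N + 1) 0 (W + 1) C (g i)
  | N + 2, s + 1, W, C, f =>
      P (N + 2) W C f ∧
        (∃ g : Fin n → ℝ → Spc n → ℝ,
          HasGrad T f g ∧ ∀ i, Cls T P (N + 1) (s + 1) (W + 1) C (g i)) ∧
        ∃ h : ℝ → Spc n → ℝ, HasDt T f h ∧ Cls T P N s W C h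

variable {T : ℝ} {P P' : ℕ → ℝ → ℝ → (ℝ → Spc n → ℝ) → Prop} {N s : ℕ} {W C : ℝ}
  {f g : ℝ → Spc n → ℝ}

theorem cls_zero : Cls T P 0 s W C f ↔ P 0 W C f := by
  rw [Cls]

theorem cls_succ : Cls T P (N + 1) s W C f ↔
    P (N + 1) W C f ∧
      (∃ g : Fin n → ℝ → Spc n → ℝ, HasGrad T f g ∧ ∀ i, Cls T P N s (W + 1) C (g i)) ∧
      ∀ N' s' : ℕ, N = N' + 1 → s = s' + 1 →
        ∃ h : ℝ → Spc n → ℝ, HasDt T f h ∧ Cls T P N' s' W C h := by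
  rcases N with _ | N
  · rw [Cls]
    simp
  · rcases s with _ | s
    · rw [Cls]
      simp
    · rw [Cls]
      constructor
      · rintro ⟨h1, h2, h3⟩
        refine ⟨h1, h2, fun N' s' hN hs => ?_⟩
        obtain rfl : N = N' := by omega
        obtain rfl : s = s' := by omega
        exact h3
      · rintro ⟨h1, h2, h3⟩
        exact ⟨h1, h2, h3 N s rfl rfl⟩

theorem Cls.base (h : Cls T P N s W C f) : P N W C f := by
  rcases N with _ | N
  · exact cls_zero.1 h
  · exact (cls_succ.1 h).1

theorem Cls.imp (h : Cls T P N s W C f) {W' C' : ℝ}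
    (H : ∀ (M p : ℕ) (f : ℝ → Spc n → ℝ), P M (W + p) C f → P' M (W' + p) C' f) :
    Cls T P' N s W' C' f := by
  induction N using Nat.strong_induction_on generalizing s W W' f with
  | _ N ih =>
    have H0 : ∀ (M : ℕ) (f : ℝ → Spc n → ℝ), P M W C f → P' M W' C' f := by
      intro M f hf
      simpa using H M 0 f (by simpa using hf)
    rcases N with _ | N
    · exact cls_zero.2 (H0 0 f (cls_zero.1 h))
    · obtain ⟨h1, ⟨g, hg, hg'⟩, h3⟩ := cls_succ.1 h
      refine cls_succ.2 ⟨H0 _ _ h1, ⟨g, hg, fun i => ?_⟩, fun N' s' hN hs => ?_⟩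
      · refine ih N (by omega) (hg' i) fun M p f hf => ?_
        have := H M (p + 1) f (by
          have e : W + ((p + 1 : ℕ) : ℝ) = W + 1 + p := by push_cast; ring
          rwa [e])
        have e : W' + ((p + 1 : ℕ) : ℝ) = W' + 1 + p := by push_cast; ring
        rwa [e] at this
      · obtain ⟨h, hh, hh'⟩ := h3 N' s' hN hs
        exact ⟨h, hh, ih N' (by omega) hh' H⟩

theorem Cls.pred (hP : ∀ N W C f, P (N + 1) W C f → P N W C f) (h : Cls T P (N + 1) s W C f) :
    Cls T P N s W C f := by
  induction N using Nat.strong_induction_on generalizing s W f with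
  | _ N ih =>
    rcases N with _ | N
    · exact cls_zero.2 (hP _ _ _ _ (cls_succ.1 h).1)
    · obtain ⟨h1, ⟨g, hg, hg'⟩, h3⟩ := cls_succ.1 h
      refine cls_succ.2 ⟨hP _ _ _ _ h1, ⟨g, hg, fun i => ih N (by omega) (hg' i)⟩,
        fun N' s' hN hs => ?_⟩
      subst hN
      obtain ⟨k, hk, hk'⟩ := h3 _ s' rfl hs
      exact ⟨k, hk, ih N' (by omega) hk'⟩

theorem Cls.mono_left (hP : ∀ N W C f, P (N + 1) W C f → P N W C f) {N' : ℕ}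
    (h : Cls T P N s W C f) (hN : N' ≤ N) : Cls T P N' s W C f := by
  induction N, hN using Nat.le_induction with
  | base => exact h
  | succ m _ ih => exact ih (h.pred hP)

theorem Cls.mono_s {s' : ℕ} (h : Cls T P N s W C f) (hs : s' ≤ s) : Cls T P N s' W C f := by
  induction N using Nat.strong_induction_on generalizing s s' W f with
  | _ N ih =>
    rcases N with _ | N
    · exact cls_zero.2 (cls_zero.1 h)
    · obtain ⟨h1, ⟨g, hg, hg'⟩, h3⟩ := cls_succ.1 h
      refine cls_succ.2 ⟨h1, ⟨g, hg, fun i => ih N (by omega) (hg' i) hs⟩,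
        fun N' r hN hr => ?_⟩
      obtain ⟨h, hh, hh'⟩ := h3 N' (s - 1) hN (by omega)
      exact ⟨h, hh, ih N' (by omega) hh' (by omega)⟩

theorem Cls.congr
    (hP : ∀ N W C (f g : ℝ → Spc n → ℝ),
      (∀ t ∈ Set.Icc (0 : ℝ) T, ∀ x, f t x = g t x) → P N W C f → P N W C g)
    (h : Cls T P N s W C f) (hfg : ∀ t ∈ Set.Icc (0 : ℝ) T, ∀ x, f t x = g t x) :
    Cls T P N s W C g := by
  rcases N with _ | N
  · exact cls_zero.2 (hP _ _ _ _ _ hfg (cls_zero.1 h))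
  · obtain ⟨h1, ⟨k, hk, hk'⟩, h3⟩ := cls_succ.1 h
    refine cls_succ.2 ⟨hP _ _ _ _ _ hfg h1, ⟨k, hk.congr hfg, hk'⟩, fun N' r hN hr => ?_⟩
    obtain ⟨h, hh, hh'⟩ := h3 N' r hN hr
    exact ⟨h, hh.congr hfg, hh'⟩

theorem Cls.add {C' : ℝ}
    (hP : ∀ N W f g, P N W C f → P N W C' g → P N W (C + C') (fun t x => f t x + g t x))
    (hf : Cls T P N s W C f) (hg : Cls T P N s W C' g) :
    Cls T P N s W (C + C') (fun t x => f t x + g t x) := by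
  induction N using Nat.strong_induction_on generalizing s W f g with
  | _ N ih =>
    rcases N with _ | N
    · exact cls_zero.2 (hP _ _ _ _ (cls_zero.1 hf) (cls_zero.1 hg))
    · obtain ⟨h1, ⟨a, ha, ha'⟩, h3⟩ := cls_succ.1 hf
      obtain ⟨k1, ⟨b, hb, hb'⟩, k3⟩ := cls_succ.1 hg
      refine cls_succ.2 ⟨hP _ _ _ _ h1 k1, ⟨_, ha.add hb, fun i => ih N (by omega) (ha' i) (hb' i)⟩,
        fun N' r hN hr => ?_⟩
      obtain ⟨h, hh, hh'⟩ := h3 N' r hN hr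
      obtain ⟨k, hk, hk'⟩ := k3 N' r hN hr
      exact ⟨_, hh.add hk, ih N' (by omega) hh' hk'⟩

theorem Cls.smul (c : ℝ)
    (hP : ∀ N W f, P N W C f → P N W (|c| * C) (fun t x => c * f t x))
    (hf : Cls T P N s W C f) : Cls T P N s W (|c| * C) (fun t x => c * f t x) := by
  induction N using Nat.strong_induction_on generalizing s W f with
  | _ N ih =>
    rcases N with _ | N
    · exact cls_zero.2 (hP _ _ _ (cls_zero.1 hf))
    · obtain ⟨h1, ⟨a, ha, ha'⟩, h3⟩ := cls_succ.1 hf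
      refine cls_succ.2 ⟨hP _ _ _ h1, ⟨_, ha.smul c, fun i => ih N (by omega) (ha' i)⟩,
        fun N' r hN hr => ?_⟩
      obtain ⟨h, hh, hh'⟩ := h3 N' r hN hr
      exact ⟨_, hh.smul c, ih N' (by omega) hh'⟩

theorem Cls.dx
    (hP : ∀ N W C (f g : ℝ → Spc n → ℝ),
      (∀ t ∈ Set.Icc (0 : ℝ) T, ∀ x, f t x = g t x) → P N W C f → P N W C g)
    (h : Cls T P (N + 1) s W C f) (i : Fin n) :
    Cls T P N s (W + 1) C (fun t => pd i (f t)) := by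
  obtain ⟨_, ⟨g, hg, hg'⟩, _⟩ := cls_succ.1 h
  exact (hg' i).congr hP fun t ht x => (hg.pd_eq ht i x).symm

theorem Cls.hasGrad (h : Cls T P (N + 1) s W C f) : HasGrad T f (fun i t => pd i (f t)) := by
  obtain ⟨_, ⟨g, hg, hg'⟩, _⟩ := cls_succ.1 h
  exact hg.congr_right fun i t ht x => (hg.pd_eq ht i x).symm

theorem Cls.dt (hT : 0 < T)
    (hP : ∀ N W C (f g : ℝ → Spc n → ℝ),
      (∀ t ∈ Set.Icc (0 : ℝ) T, ∀ x, f t x = g t x) → P N W C f → P N W C g)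
    (h : Cls T P (N + 2) (s + 1) W C f) :
    Cls T P N s W C (fun t x => derivWithin (fun τ => f τ x) (Set.Icc 0 T) t) := by
  obtain ⟨_, _, h3⟩ := cls_succ.1 h
  obtain ⟨h, hh, hh'⟩ := h3 N s rfl rfl
  exact hh'.congr hP fun t ht x => (hh.derivWithin_eq hT ht x).symm

theorem Cls.hasDt (hT : 0 < T) (h : Cls T P (N + 2) (s + 1) W C f) :
    HasDt T f (fun t x => derivWithin (fun τ => f τ x) (Set.Icc 0 T) t) := by
  obtain ⟨_, _, h3⟩ := cls_succ.1 h
  obtain ⟨h, hh, hh'⟩ := h3 N s rfl rfl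
  exact hh.congr_right fun t ht x => (hh.derivWithin_eq hT ht x).symm

theorem Cls.tDeriv (hT : 0 < T)
    (hP : ∀ N W C (f g : ℝ → Spc n → ℝ),
      (∀ t ∈ Set.Icc (0 : ℝ) T, ∀ x, f t x = g t x) → P N W C f → P N W C g) {j : ℕ}
    (h : Cls T P (N + 2 * j) (s + j) W C f) : Cls T P N s W C (NSdeRham.tDeriv T j f) := by
  induction j generalizing N s with
  | zero => rw [tDeriv_zero]; exact h
  | succ j ih =>
    have h1 : Cls T P (N + 2) (s + 1) W C (NSdeRham.tDeriv T j f) := by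
      apply ih
      convert h using 1 <;> ring
    have h2 := h1.dt hT hP
    refine h2.congr hP fun t _ x => ?_
    rw [tDeriv_succ]

theorem Cls.pdw
    (hP : ∀ N W C (f g : ℝ → Spc n → ℝ),
      (∀ t ∈ Set.Icc (0 : ℝ) T, ∀ x, f t x = g t x) → P N W C f → P N W C g)
    (w : List (Fin n)) (h : Cls T P (N + w.length) s W C f) :
    Cls T P N s (W + w.length) C (fun t => NSdeRham.pdw w (f t)) := by
  induction w generalizing N with
  | nil => simpa [NSdeRham.pdw] using h
  | cons i w ih =>
    have h1 := ih (N := N + 1) (by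
      convert h using 1
      simp; ring)
    have h2 := h1.dx hP i
    have e : W + ((i :: w).length : ℝ) = W + w.length + 1 := by simp; ring
    rw [e]
    exact h2

/-- The mixed derivative along the word `w` in space and of order `j` in time. -/
def mixD (T : ℝ) (w : List (Fin n)) (j : ℕ) (f : ℝ → Spc n → ℝ) (t : ℝ) (x : Spc n) : ℝ :=
  pdw w (fun y => tDeriv T j f t y) x

theorem Cls.mixD (hT : 0 < T)
    (hP : ∀ N W C (f g : ℝ → Spc n → ℝ),
      (∀ t ∈ Set.Icc (0 : ℝ) T, ∀ x, f t x = g t x) → P N W C f → P N W C g)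
    {M j : ℕ} {w : List (Fin n)} (hM : M + w.length + 2 * j ≤ N) (hN : N ≤ M + w.length + 2 * j)
    (hj : j ≤ s) (h : Cls T P N s W C f) :
    Cls T P M (s - j) (W + w.length) C (NSdeRham.mixD T w j f) := by
  obtain rfl : N = M + w.length + 2 * j := le_antisymm hN hM
  obtain ⟨r, rfl⟩ := Nat.exists_eq_add_of_le' hj
  rw [Nat.add_sub_cancel]
  exact (h.tDeriv hT hP).pdw hP w

end Classes

section JetFamilies

/-- A family of functions on `[0,T] × ℝⁿ` which behaves like the family of all mixed derivatives
of parabolic order at most `N`, with at most `s` time derivatives, of a single function. -/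
structure Jets (T : ℝ) (N s : ℕ) (G : List (Fin n) → ℕ → ℝ → Spc n → ℝ) : Prop where
  cont : ∀ w j, j ≤ s → w.length + 2 * j ≤ N → ContT T (G w j)
  grad : ∀ w j, j ≤ s → w.length + 2 * j < N → HasGrad T (G w j) (fun i => G (i :: w) j)
  dt : ∀ j, j < s → 2 * j + 2 ≤ N → HasDt T (G [] j) (G [] (j + 1))

theorem ContT.slice {T : ℝ} {f : ℝ → Spc n → ℝ} (hf : ContT T f) {t : ℝ}
    (ht : t ∈ Set.Icc 0 T) : Continuous (f t) :=
  ContinuousOn.comp_continuous (g := fun p : ℝ × Spc n => f p.1 p.2) hf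
    (Continuous.prodMk continuous_const continuous_id) fun _ => ⟨ht, Set.mem_univ _⟩

theorem ContT.slice_time {T : ℝ} {f : ℝ → Spc n → ℝ} (hf : ContT T f) (x : Spc n) :
    ContinuousOn (fun t => f t x) (Set.Icc 0 T) :=
  ContinuousOn.comp (g := fun p : ℝ × Spc n => f p.1 p.2) hf
    (Continuous.prodMk continuous_id continuous_const).continuousOn fun _ ht =>
      ⟨ht, Set.mem_univ _⟩

theorem ContT.congr {T : ℝ} {f g : ℝ → Spc n → ℝ} (hf : ContT T f)
    (h : ∀ t ∈ Set.Icc (0 : ℝ) T, ∀ x, f t x = g t x) : ContT T g :=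
  ContinuousOn.congr hf fun p hp => (h p.1 hp.1 p.2).symm

theorem contT_iff_subtype {T : ℝ} {f : ℝ → Spc n → ℝ} :
    ContT T f ↔ Continuous fun p : Set.Icc (0 : ℝ) T × Spc n => f p.1 p.2 := by
  constructor
  · intro h
    exact ContinuousOn.comp_continuous h
      ((continuous_subtype_val.comp continuous_fst).prodMk continuous_snd)
      fun p => ⟨p.1.2, Set.mem_univ _⟩
  · intro h
    rw [ContT, continuousOn_iff_continuous_domRestrict]
    have : Continuous fun p : (Set.Icc 0 T ×ˢ Set.univ : Set (ℝ × Spc n)) =>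
        ((⟨p.1.1, p.2.1⟩, p.1.2) : Set.Icc (0 : ℝ) T × Spc n) :=
      ((continuous_fst.comp continuous_subtype_val).subtype_mk _).prodMk
        (continuous_snd.comp continuous_subtype_val)
    exact h.comp this

variable {T : ℝ} {N s : ℕ} {G : List (Fin n) → ℕ → ℝ → Spc n → ℝ}

theorem Jets.tDeriv_eq (hT : 0 < T) (h : Jets T N s G) {j : ℕ} (hj : j ≤ s) (hN : 2 * j ≤ N) :
    ∀ t ∈ Set.Icc (0 : ℝ) T, ∀ x, tDeriv T j (G [] 0) t x = G [] j t x := by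
  induction j with
  | zero => intro t _ x; rw [tDeriv_zero]
  | succ j ih =>
    intro t ht x
    rw [tDeriv_succ]
    have := ih (by omega) (by omega)
    rw [derivWithin_congr (fun τ hτ => this τ hτ x) (this t ht x)]
    exact (h.dt j (by omega) (by omega)).derivWithin_eq hT ht x

theorem Jets.mixD_eq (hT : 0 < T) (h : Jets T N s G) {j : ℕ} {w : List (Fin n)} (hj : j ≤ s)
    (hN : w.length + 2 * j ≤ N) :
    ∀ t ∈ Set.Icc (0 : ℝ) T, ∀ x, mixD T w j (G [] 0) t x = G w j t x := by
  induction w with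
  | nil =>
    intro t ht x
    exact h.tDeriv_eq hT hj (by simpa using hN) t ht x
  | cons i w ih =>
    intro t ht x
    have hl : (i :: w).length = w.length + 1 := rfl
    have e : (fun y => mixD T w j (G [] 0) t y) = G w j t :=
      funext fun y => ih (by omega) t ht y
    change pd i (fun y => mixD T w j (G [] 0) t y) x = _
    rw [e]
    exact (h.grad w j hj (by omega)).pd_eq ht i x

theorem Jets.contDiff (h : Jets T N s G) {j m : ℕ} {w : List (Fin n)} (hj : j ≤ s)
    (hN : w.length + 2 * j + m ≤ N) {t : ℝ} (ht : t ∈ Set.Icc 0 T) :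
    ContDiff ℝ m (G w j t) := by
  induction m generalizing w with
  | zero =>
    exact contDiff_zero.2 ((h.cont w j hj (by omega)).slice ht)
  | succ m ih =>
    have hg := h.grad w j hj (by omega)
    push_cast
    rw [contDiff_succ_iff_hasFDerivAt]
    refine ⟨_, ContDiff.sum fun i _ => ?_, fun x => hg t ht x⟩
    exact (ih (w := i :: w) (by simp; omega)).smul contDiff_const

theorem jets_tDeriv_contDiff (hT : 0 < T) (h : Jets T N s G) {j m : ℕ} (hj : j ≤ s)
    (hN : 2 * j + m ≤ N) {t : ℝ} (ht : t ∈ Set.Icc 0 T) :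
    ContDiff ℝ m (fun x => tDeriv T j (G [] 0) t x) := by
  have e : (fun x => tDeriv T j (G [] 0) t x) = G [] j t :=
    funext fun x => h.tDeriv_eq hT hj (by omega) t ht x
  rw [e]
  exact h.contDiff hj (by simpa using hN) ht

theorem sub_cast_order {s j k : ℕ} :
    (2 * ((s : WithTop ℕ∞) - (j : WithTop ℕ∞)) + (k : WithTop ℕ∞)) =
      ((2 * (s - j) + k : ℕ) : WithTop ℕ∞) := by
  have : ((s : WithTop ℕ∞) - (j : WithTop ℕ∞)) = ((s - j : ℕ) : WithTop ℕ∞) := by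
    norm_cast
  rw [this]
  norm_cast

theorem Jets.reg (hT : 0 < T) {k : ℕ} (h : Jets T (2 * s + k) s G) :
    AnisoReg T k s (G [] 0) := by
  refine ⟨fun x => ?_, fun j hj t ht => ?_, fun j m hj hm => ?_⟩
  · rw [contDiffOn_nat_iff_continuousOn_differentiableOn_deriv (uniqueDiffOn_Icc hT)]
    constructor
    · intro m hm
      have hm' : m ≤ s := by exact hm
      exact ((h.cont [] m hm' (by simp; omega)).slice_time x).congr fun t ht =>
        h.tDeriv_eq hT hm' (by omega) t ht x
    · intro m hm
      have hm' : m < s := by exact hm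
      intro t ht
      have h1 := (h.dt m hm' (by omega)) t ht x
      exact (h1.congr (fun τ hτ => h.tDeriv_eq hT hm'.le (by omega) τ hτ x)
        (h.tDeriv_eq hT hm'.le (by omega) t ht x)).differentiableWithinAt
  · rw [sub_cast_order]
    exact jets_tDeriv_contDiff hT h hj (by omega) ht
  · have e : (fun p : Set.Icc (0 : ℝ) T × Spc n => mixDeriv T m j (G [] 0) p.1 p.2) =
        fun p => ∑ i : Fin m → Fin n, G (List.ofFn i) j p.1 p.2 • coordForm i := by
      funext p
      rw [mixDeriv, iteratedFDeriv_eq_sum (jets_tDeriv_contDiff hT h hj (by omega) p.1.2)]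
      refine Finset.sum_congr rfl fun i _ => ?_
      congr 1
      exact h.mixD_eq hT hj (by simpa using hm) p.1 p.1.2 p.2
    rw [e]
    refine continuous_finsetSum _ fun i _ => ?_
    exact (contT_iff_subtype.1 (h.cont _ j hj (by simpa using hm))).smul continuous_const

theorem AnisoReg.contDiff {k : ℕ} {f : ℝ → Spc n → ℝ} (h : AnisoReg T k s f) {j m : ℕ}
    (hj : j ≤ s) (hm : m + 2 * j ≤ 2 * s + k) {t : ℝ} (ht : t ∈ Set.Icc 0 T) :
    ContDiff ℝ m (fun x => tDeriv T j f t x) := by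
  have h1 := h.2.1 j hj t ht
  rw [sub_cast_order] at h1
  exact h1.of_le (by norm_cast; omega)

theorem AnisoReg.contT_mixD {k : ℕ} {f : ℝ → Spc n → ℝ} (h : AnisoReg T k s f) {j : ℕ}
    {w : List (Fin n)} (hj : j ≤ s) (hw : w.length + 2 * j ≤ 2 * s + k) :
    ContT T (mixD T w j f) := by
  rw [contT_iff_subtype]
  have h1 := h.2.2 j w.length hj hw
  have e : (fun p : Set.Icc (0 : ℝ) T × Spc n => mixD T w j f p.1 p.2) =
      fun p => mixDeriv T w.length j f p.1 p.2
        (fun a => EuclideanSpace.single (w.get (a.cast rfl)) (1 : ℝ)) := by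
    funext p
    exact pdw_eq_iteratedFDeriv rfl (h.contDiff hj hw p.1.2) _
  rw [e]
  exact (ContinuousMultilinearMap.apply ℝ (fun _ : Fin w.length => Spc n) ℝ
    (fun a => EuclideanSpace.single (w.get (a.cast rfl)) (1 : ℝ))).continuous.comp h1

theorem AnisoReg.hasGrad_mixD {k : ℕ} {f : ℝ → Spc n → ℝ} (h : AnisoReg T k s f) {j : ℕ}
    {w : List (Fin n)} (hj : j ≤ s) (hw : w.length + 2 * j < 2 * s + k) :
    HasGrad T (mixD T w j f) (fun i => mixD T (i :: w) j f) := by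
  refine hasGrad_of_contDiff fun t ht => ?_
  have h1 : ContDiff ℝ (1 + w.length : ℕ) (fun x => tDeriv T j f t x) :=
    h.contDiff hj (by omega) ht
  exact (contDiff_pdw w h1).differentiable (by norm_num)

theorem AnisoReg.hasDt_mixD (hT : 0 < T) {k : ℕ} {f : ℝ → Spc n → ℝ} (h : AnisoReg T k s f)
    {j : ℕ} {w : List (Fin n)} (hj : j < s) (hw : w.length + 2 * j + 2 ≤ 2 * s + k) :
    HasDt T (mixD T w j f) (mixD T w (j + 1) f) := by
  induction w with
  | nil =>
    intro t ht x
    have h1 := (contDiffOn_nat_iff_continuousOn_differentiableOn_deriv (uniqueDiffOn_Icc hT)).1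
      (h.1 x)
    have h2 := h1.2 j hj t ht
    have h3 := h2.hasDerivWithinAt
    have e : mixD T [] (j + 1) f t x =
        derivWithin (iteratedDerivWithin j (fun τ => f τ x) (Set.Icc 0 T)) (Set.Icc 0 T) t :=
      tDeriv_succ j f t x
    rw [e]
    exact h3
  | cons i w ih =>
    have hl : (i :: w).length = w.length + 1 := rfl
    exact (ih (by omega)).grad hT (h.hasGrad_mixD hj.le (by omega))
      (h.hasGrad_mixD hj (by omega)) (h.contT_mixD hj (by omega))
      (fun i => h.contT_mixD hj (by simp; omega)) i

theorem AnisoReg.jets (hT : 0 < T) {k : ℕ} {f : ℝ → Spc n → ℝ} (h : AnisoReg T k s f) :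
    Jets T (2 * s + k) s (fun w j => mixD T w j f) where
  cont _ _ hj hw := h.contT_mixD hj hw
  grad _ _ hj hw := h.hasGrad_mixD hj hw
  dt _ hj hw := h.hasDt_mixD hT hj (by simpa using hw)

theorem Jets.congr {G' : List (Fin n) → ℕ → ℝ → Spc n → ℝ} (h : Jets T N s G)
    (hG : ∀ w j, ∀ t ∈ Set.Icc (0 : ℝ) T, ∀ x, G w j t x = G' w j t x) : Jets T N s G' where
  cont w j hj hw := (h.cont w j hj hw).congr (hG w j)
  grad w j hj hw :=
    ((h.grad w j hj hw).congr (hG w j)).congr_right fun i => hG (i :: w) j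
  dt j hj hw := ((h.dt j hj hw).congr (hG [] j)).congr_right (hG [] (j + 1))

theorem Cls.jets (hT : 0 < T) {P : ℕ → ℝ → ℝ → (ℝ → Spc n → ℝ) → Prop}
    (hP : ∀ N W C (f g : ℝ → Spc n → ℝ),
      (∀ t ∈ Set.Icc (0 : ℝ) T, ∀ x, f t x = g t x) → P N W C f → P N W C g)
    (hc : ∀ N W C f, P N W C f → ContT T f) {W C : ℝ} {f : ℝ → Spc n → ℝ}
    (h : Cls T P N s W C f) : Jets T N s (fun w j => NSdeRham.mixD T w j f) where
  cont w j hj hw :=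
    hc _ _ _ _ (h.mixD (M := N - (w.length + 2 * j)) hT hP (by omega) (by omega) hj).base
  grad w j hj hw :=
    (h.mixD (M := N - (w.length + 2 * j) - 1 + 1) hT hP (by omega) (by omega) hj).hasGrad
  dt j hj hw := by
    have h1 := h.mixD (M := N - 2 * j - 2 + 2) (w := []) hT hP (by simp; omega) (by simp; omega)
      hj.le
    obtain ⟨r, hr⟩ : ∃ r, s - j = r + 1 := ⟨s - j - 1, by omega⟩
    rw [hr] at h1
    refine (h1.hasDt hT).congr_right fun t _ x => ?_
    exact (tDeriv_succ j f t x).symm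

/-- A function whose mixed derivatives are controlled belongs to the corresponding class. -/
theorem AnisoReg.cls (hT : 0 < T) {P : ℕ → ℝ → ℝ → (ℝ → Spc n → ℝ) → Prop} {k : ℕ}
    {f : ℝ → Spc n → ℝ} {W C : ℝ} (h : AnisoReg T k s f)
    (hP : ∀ (M : ℕ) (w : List (Fin n)) (j : ℕ), j ≤ s → M + w.length + 2 * j = 2 * s + k →
      P M (W + w.length) C (mixD T w j f)) :
    Cls T P (2 * s + k) s W C f := by
  have key : ∀ (M : ℕ) (w : List (Fin n)) (j : ℕ), j ≤ s → M + w.length + 2 * j = 2 * s + k →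
      Cls T P M (s - j) (W + w.length) C (NSdeRham.mixD T w j f) := by
    intro M
    induction M using Nat.strong_induction_on with
    | _ M ih =>
      intro w j hj hM
      rcases M with _ | M
      · exact cls_zero.2 (hP 0 w j hj hM)
      · refine cls_succ.2 ⟨hP _ w j hj hM, ⟨_, h.hasGrad_mixD hj (by omega), fun i => ?_⟩,
          fun N' s' hN hs => ?_⟩
        · have := ih M (by omega) (i :: w) j hj (by simp; omega)
          have e : W + ((i :: w).length : ℝ) = W + w.length + 1 := by simp; ring
          rwa [e] at this
        · refine ⟨_, h.hasDt_mixD hT (by omega) (by omega), ?_⟩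
          have := ih N' (by omega) w (j + 1) (by omega) (by omega)
          obtain rfl : s' = s - (j + 1) := by omega
          exact this
  have := key (2 * s + k) [] 0 (by omega) (by simp)
  have e : NSdeRham.mixD T [] 0 f = f := by
    funext t x
    exact congrFun (congrFun (tDeriv_zero f) t) x
  rw [e] at this
  simpa using this

end JetFamilies

section Weights

theorem one_le_wt (x : Spc n) : 1 ≤ wt x := by
  rw [wt, Real.one_le_sqrt]
  nlinarith [sq_nonneg ‖x‖]

theorem wt_pos (x : Spc n) : 0 < wt x := zero_lt_one.trans_le (one_le_wt x)

theorem norm_le_wt (x : Spc n) : ‖x‖ ≤ wt x := by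
  rw [wt]
  apply Real.le_sqrt_of_sq_le
  linarith

theorem wt_sq (x : Spc n) : wt x ^ 2 = 1 + ‖x‖ ^ 2 := by
  rw [wt, Real.sq_sqrt (by positivity)]

theorem wt_le_add (x y : Spc n) : wt x ≤ wt y + ‖x - y‖ := by
  have h1 : ‖x‖ ≤ ‖y‖ + ‖x - y‖ := by
    have := norm_add_le y (x - y)
    simpa using this
  have h2 := norm_le_wt y
  have h3 := wt_sq y
  rw [wt, Real.sqrt_le_left (by have := wt_pos y; positivity)]
  nlinarith [norm_nonneg x, norm_nonneg y, norm_nonneg (x - y)]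

theorem wt_le_mul (x y : Spc n) : wt x ≤ wt y * (1 + ‖x - y‖) := by
  have := wt_le_add x y
  nlinarith [one_le_wt y, norm_nonneg (x - y)]

theorem wt_rpow_le {W : ℝ} (hW : 0 ≤ W) (x y : Spc n) :
    wt y ^ (-W) ≤ wt x ^ (-W) * (1 + ‖x - y‖) ^ W := by
  have hx := wt_pos x
  have hy := wt_pos y
  have h : wt x ^ W ≤ wt y ^ W * (1 + ‖x - y‖) ^ W := by
    rw [← Real.mul_rpow hy.le (by positivity)]
    exact Real.rpow_le_rpow hx.le (wt_le_mul x y) hW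
  rw [Real.rpow_neg hx.le, Real.rpow_neg hy.le, inv_mul_eq_div, inv_eq_one_div,
    div_le_div_iff₀ (by positivity) (by positivity)]
  linarith

theorem wt_rpow_pos (W : ℝ) (x : Spc n) : 0 < wt x ^ W := Real.rpow_pos_of_pos (wt_pos x) _

theorem wt_rpow_mono {a b : ℝ} (h : a ≤ b) (x : Spc n) : wt x ^ a ≤ wt x ^ b :=
  Real.rpow_le_rpow_of_exponent_le (one_le_wt x) h

theorem wt_rpow_le_one {W : ℝ} (hW : 0 ≤ W) (x : Spc n) : wt x ^ (-W) ≤ 1 :=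
  Real.rpow_le_one_of_one_le_of_nonpos (one_le_wt x) (by linarith)

theorem wt_rpow_le_of_near {W : ℝ} (hW : 0 ≤ W) {x y : Spc n} (h : ‖x - y‖ ≤ 1) :
    wt y ^ (-W) ≤ 2 ^ W * wt x ^ (-W) := by
  refine (wt_rpow_le hW x y).trans ?_
  rw [mul_comm]
  have := wt_rpow_pos (-W) x
  gcongr
  linarith

end Weights

section HolderBounds

variable {T : ℝ}

/-- Weighted Hölder bounds on `[0,T] × ℝⁿ`. -/
structure HB (T lam W C : ℝ) (f : ℝ → Spc n → ℝ) : Prop where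
  sup : ∀ t ∈ Set.Icc (0 : ℝ) T, ∀ x, |f t x| ≤ C * wt x ^ (-W)
  space : ∀ t ∈ Set.Icc (0 : ℝ) T, ∀ x y,
    |f t x - f t y| ≤ C * (wt x ^ (-W) + wt y ^ (-W)) * ‖x - y‖ ^ lam
  time : ∀ t ∈ Set.Icc (0 : ℝ) T, ∀ t' ∈ Set.Icc (0 : ℝ) T, ∀ x,
    |f t x - f t' x| ≤ C * wt x ^ (-W) * |t - t'| ^ (lam / 2)

variable {lam W C : ℝ} {f g : ℝ → Spc n → ℝ}

theorem HB.congr (h : HB T lam W C f) (hfg : ∀ t ∈ Set.Icc (0 : ℝ) T, ∀ x, f t x = g t x) :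
    HB T lam W C g where
  sup t ht x := by rw [← hfg t ht]; exact h.sup t ht x
  space t ht x y := by rw [← hfg t ht, ← hfg t ht]; exact h.space t ht x y
  time t ht t' ht' x := by rw [← hfg t ht, ← hfg t' ht']; exact h.time t ht t' ht' x

theorem HB.mono {C' : ℝ} (h : HB T lam W C f) (hC : C ≤ C') : HB T lam W C' f where
  sup t ht x := (h.sup t ht x).trans (by have := wt_rpow_pos (-W) x; gcongr)
  space t ht x y := (h.space t ht x y).trans (by
    have := wt_rpow_pos (-W) x; have := wt_rpow_pos (-W) y; gcongr)
  time t ht t' ht' x := (h.time t ht t' ht' x).trans (by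
    have := wt_rpow_pos (-W) x; gcongr)

theorem HB.add {C' : ℝ} (h : HB T lam W C f) (h' : HB T lam W C' g) :
    HB T lam W (C + C') (fun t x => f t x + g t x) where
  sup t ht x := by
    have h1 := abs_add_le (f t x) (g t x)
    have := h.sup t ht x
    have := h'.sup t ht x
    linarith
  space t ht x y := by
    have h1 := abs_add_le (f t x - f t y) (g t x - g t y)
    have := h.space t ht x y
    have := h'.space t ht x y
    have e : f t x - f t y + (g t x - g t y) = f t x + g t x - (f t y + g t y) := by ring
    rw [e] at h1
    linarith
  time t ht t' ht' x := by
    have h1 := abs_add_le (f t x - f t' x) (g t x - g t' x)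
    have := h.time t ht t' ht' x
    have := h'.time t ht t' ht' x
    have e : f t x - f t' x + (g t x - g t' x) = f t x + g t x - (f t' x + g t' x) := by ring
    rw [e] at h1
    linarith

theorem HB.smul (c : ℝ) (h : HB T lam W C f) :
    HB T lam W (|c| * C) (fun t x => c * f t x) where
  sup t ht x := by
    rw [abs_mul, mul_assoc]
    exact mul_le_mul_of_nonneg_left (h.sup t ht x) (abs_nonneg c)
  space t ht x y := by
    rw [← mul_sub, abs_mul, mul_assoc, mul_assoc, ← mul_assoc C]
    exact mul_le_mul_of_nonneg_left (h.space t ht x y) (abs_nonneg c)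
  time t ht t' ht' x := by
    rw [← mul_sub, abs_mul, mul_assoc, mul_assoc, ← mul_assoc C]
    exact mul_le_mul_of_nonneg_left (h.time t ht t' ht' x) (abs_nonneg c)

theorem HB.nonneg (hT : 0 < T) (h : HB T lam W C f) : 0 ≤ C := by
  have h1 := (abs_nonneg _).trans (h.sup 0 ⟨le_rfl, hT.le⟩ 0)
  exact nonneg_of_mul_nonneg_left h1 (wt_rpow_pos _ _)

theorem HB.contT (hl : 0 < lam) (hW : 0 ≤ W) (hT : 0 < T) (h : HB T lam W C f) : ContT T f := by
  have hC := h.nonneg hT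
  rintro ⟨t, x⟩ ⟨ht, -⟩
  have hb : ∀ p ∈ Set.Icc (0 : ℝ) T ×ˢ (Set.univ : Set (Spc n)),
      |f p.1 p.2 - f t x| ≤ 2 * C * ‖p.2 - x‖ ^ lam + C * |p.1 - t| ^ (lam / 2) := by
    rintro ⟨t', y⟩ ⟨ht', -⟩
    have h1 := h.space t' ht' y x
    have h2 := h.time t' ht' t ht x
    have h3 := abs_sub_le (f t' y) (f t' x) (f t x)
    have h4 := wt_rpow_le_one hW x
    have h5 := wt_rpow_le_one hW y
    refine h3.trans (add_le_add (h1.trans ?_) (h2.trans ?_))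
    · exact mul_le_mul_of_nonneg_right (by nlinarith) (by positivity)
    · exact mul_le_mul_of_nonneg_right (by nlinarith) (by positivity)
  have hlim : Tendsto (fun p : ℝ × Spc n =>
      2 * C * ‖p.2 - x‖ ^ lam + C * |p.1 - t| ^ (lam / 2)) (nhds (t, x)) (nhds 0) := by
    have hc : Continuous fun p : ℝ × Spc n =>
        2 * C * ‖p.2 - x‖ ^ lam + C * |p.1 - t| ^ (lam / 2) := by
      refine Continuous.add (continuous_const.mul ?_) (continuous_const.mul ?_)
      · exact Continuous.rpow_const (by fun_prop) fun _ => Or.inr hl.le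
      · exact Continuous.rpow_const (by fun_prop) fun _ => Or.inr (by positivity)
    have h0 := hc.tendsto (t, x)
    simpa [Real.zero_rpow hl.ne', Real.zero_rpow (half_pos hl).ne'] using h0
  rw [ContinuousWithinAt, tendsto_iff_norm_sub_tendsto_zero]
  refine squeeze_zero' (Eventually.of_forall fun _ => norm_nonneg _) ?_
    (hlim.mono_left nhdsWithin_le_nhds)
  filter_upwards [self_mem_nhdsWithin] with p hp
  exact hb p hp

theorem HB.mono_exponent {lam' : ℝ} (hT : 0 < T) (hl' : 0 ≤ lam') (hll : lam' ≤ lam)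
    (h : HB T lam W C f) : HB T lam' W (2 * C) f := by
  have hC := h.nonneg hT
  refine ⟨fun t ht x => ?_, fun t ht x y => ?_, fun t ht t' ht' x => ?_⟩
  · refine (h.sup t ht x).trans ?_
    have := wt_rpow_pos (-W) x
    gcongr
    linarith
  · have hx := wt_rpow_pos (-W) x
    have hy := wt_rpow_pos (-W) y
    rcases le_total ‖x - y‖ 1 with h1 | h1
    · refine (h.space t ht x y).trans ?_
      rcases (norm_nonneg (x - y)).eq_or_lt with h0 | h0
      · have : x = y := by rw [← sub_eq_zero, ← norm_eq_zero, ← h0]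
        subst this
        have h2 := h.space t ht x x
        have h3 : (0 : ℝ) ^ lam ≤ 2 * 0 ^ lam' := by
          rcases hl'.eq_or_lt with h4 | h4
          · rw [← h4, Real.rpow_zero]
            have : (0 : ℝ) ^ lam ≤ 1 := Real.rpow_le_one le_rfl zero_le_one (hl'.trans hll)
            linarith
          · rw [Real.zero_rpow h4.ne', Real.zero_rpow (h4.trans_le hll).ne']
            simp
        simp only [sub_self, norm_zero]
        nlinarith [mul_nonneg hC (add_pos hx hy).le]
      · have := Real.rpow_le_rpow_of_exponent_ge h0 h1 hll
        have h5 : 0 ≤ ‖x - y‖ ^ lam' := by positivity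
        nlinarith [mul_nonneg hC (add_pos hx hy).le,
          mul_nonneg (mul_nonneg hC (add_pos hx hy).le) h5]
    · have h2 := h.sup t ht x
      have h3 := h.sup t ht y
      have h4 := abs_sub (f t x) (f t y)
      have h5 := Real.one_le_rpow h1 hl'
      nlinarith [mul_nonneg hC (add_pos hx hy).le]
  · have hx := wt_rpow_pos (-W) x
    rcases le_total |t - t'| 1 with h1 | h1
    · refine (h.time t ht t' ht' x).trans ?_
      have h3 : |t - t'| ^ (lam / 2) ≤ 2 * |t - t'| ^ (lam' / 2) := by
        rcases (abs_nonneg (t - t')).eq_or_lt with h0 | h0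
        · rw [← h0]
          rcases hl'.eq_or_lt with h4 | h4
          · rw [← h4]
            have : (0 : ℝ) ^ (lam / 2) ≤ 1 :=
              Real.rpow_le_one le_rfl zero_le_one (by linarith)
            simp only [zero_div, Real.rpow_zero]
            linarith
          · rw [Real.zero_rpow (half_pos h4).ne', Real.zero_rpow (half_pos (h4.trans_le hll)).ne']
            simp
        · have := Real.rpow_le_rpow_of_exponent_ge h0 h1 (show lam' / 2 ≤ lam / 2 by linarith)
          have h5 : 0 ≤ |t - t'| ^ (lam' / 2) := by positivity
          linarith
      nlinarith [mul_nonneg hC hx.le]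
    · have h2 := h.sup t ht x
      have h3 := h.sup t' ht' x
      have h4 := abs_sub (f t x) (f t' x)
      have h5 := Real.one_le_rpow h1 (show 0 ≤ lam' / 2 by linarith)
      nlinarith [mul_nonneg hC hx.le]

theorem norm_grad_le (a : Fin n → ℝ) {B : ℝ} (h : ∀ i, |a i| ≤ B) :
    ‖∑ i, a i • (EuclideanSpace.proj i : Spc n →L[ℝ] ℝ)‖ ≤ n * B := by
  calc _ ≤ ∑ _i : Fin n, B := by
        refine norm_sum_le_of_le _ fun i _ => ?_
        have h1 : ‖(EuclideanSpace.proj i : Spc n →L[ℝ] ℝ)‖ ≤ 1 := by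
          refine ContinuousLinearMap.opNorm_le_bound _ zero_le_one fun v => ?_
          rw [one_mul]
          exact PiLp.norm_apply_le v i
        rw [norm_smul, Real.norm_eq_abs]
        calc _ ≤ B * 1 := mul_le_mul (h i) h1 (norm_nonneg _) ((abs_nonneg _).trans (h i))
          _ = B := mul_one B
    _ = _ := by simp

/-- A weighted gradient bound yields a weighted Hölder bound in space. -/
theorem space_of_grad (hl0 : 0 ≤ lam) (hl1 : lam ≤ 1) (hW : 0 ≤ W) (hC : 0 ≤ C)
    {g : Fin n → ℝ → Spc n → ℝ} (hfg : HasGrad T f g)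
    (hf : ∀ t ∈ Set.Icc (0 : ℝ) T, ∀ x, |f t x| ≤ C * wt x ^ (-W))
    (hg : ∀ i, ∀ t ∈ Set.Icc (0 : ℝ) T, ∀ x, |g i t x| ≤ C * wt x ^ (-W)) :
    ∀ t ∈ Set.Icc (0 : ℝ) T, ∀ x y,
      |f t x - f t y| ≤ ((n + 1) * 2 ^ W * C) * (wt x ^ (-W) + wt y ^ (-W)) * ‖x - y‖ ^ lam := by
  intro t ht x y
  have hx := wt_rpow_pos (-W) x
  have hy := wt_rpow_pos (-W) y
  have h2W : (1 : ℝ) ≤ 2 ^ W := Real.one_le_rpow (by norm_num) hW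
  have hn : (0 : ℝ) ≤ n := Nat.cast_nonneg n
  have hA : (1 : ℝ) ≤ (n + 1) * 2 ^ W := by nlinarith
  have hCx := mul_nonneg hC (add_pos hx hy).le
  rcases le_total ‖x - y‖ 1 with h1 | h1
  · have key : ‖f t y - f t x‖ ≤ n * (C * (2 ^ W * wt x ^ (-W))) * ‖y - x‖ := by
      refine (convex_closedBall x 1).norm_image_sub_le_of_norm_hasFDerivWithin_le
        (fun z _ => (hfg t ht z).hasFDerivWithinAt) (fun z hz => ?_)
        (Metric.mem_closedBall_self zero_le_one)
        (by rw [Metric.mem_closedBall, dist_eq_norm, norm_sub_rev]; exact h1)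
      refine norm_grad_le _ fun i => (hg i t ht z).trans ?_
      have hz' : ‖x - z‖ ≤ 1 := by
        rw [norm_sub_rev, ← dist_eq_norm]; exact hz
      exact mul_le_mul_of_nonneg_left (wt_rpow_le_of_near hW hz') hC
    rw [norm_sub_rev y x, Real.norm_eq_abs, abs_sub_comm] at key
    have h3 : ‖x - y‖ ≤ ‖x - y‖ ^ lam := Real.self_le_rpow_of_le_one (norm_nonneg _) h1 hl1
    refine key.trans ?_
    have h4 : (n : ℝ) * (C * (2 ^ W * wt x ^ (-W))) ≤
        ((n + 1) * 2 ^ W * C) * (wt x ^ (-W) + wt y ^ (-W)) := by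
      have : 0 ≤ (2 : ℝ) ^ W * (C * wt y ^ (-W)) := by positivity
      have : 0 ≤ (2 : ℝ) ^ W * (C * wt x ^ (-W)) := by positivity
      have : 0 ≤ (n : ℝ) * (2 ^ W * (C * wt y ^ (-W))) := by positivity
      nlinarith
    have h5 : 0 ≤ ((n + 1) * 2 ^ W * C) * (wt x ^ (-W) + wt y ^ (-W)) := by positivity
    exact mul_le_mul h4 h3 (norm_nonneg _) h5
  · have h2 := hf t ht x
    have h3 := hf t ht y
    have h4 := abs_sub (f t x) (f t y)
    have h5 := Real.one_le_rpow h1 hl0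
    have h6 : C * (wt x ^ (-W) + wt y ^ (-W)) ≤
        ((n + 1) * 2 ^ W * C) * (wt x ^ (-W) + wt y ^ (-W)) := by nlinarith
    nlinarith

/-- A weighted bound of the time derivative yields a weighted Hölder bound in time. -/
theorem time_of_dt (hT : 0 < T) (hl0 : 0 ≤ lam) (hl1 : lam ≤ 2) (hC : 0 ≤ C)
    {h : ℝ → Spc n → ℝ} (hfh : HasDt T f h)
    (hh : ∀ t ∈ Set.Icc (0 : ℝ) T, ∀ x, |h t x| ≤ C * wt x ^ (-W)) :
    ∀ t ∈ Set.Icc (0 : ℝ) T, ∀ t' ∈ Set.Icc (0 : ℝ) T, ∀ x,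
      |f t x - f t' x| ≤ ((1 + T) * C) * wt x ^ (-W) * |t - t'| ^ (lam / 2) := by
  intro t ht t' ht' x
  have hx := wt_rpow_pos (-W) x
  have key : ‖f t x - f t' x‖ ≤ C * wt x ^ (-W) * ‖t - t'‖ :=
    (convex_Icc 0 T).norm_image_sub_le_of_norm_hasDerivWithin_le
      (f := fun τ => f τ x) (fun τ hτ => hfh τ hτ x) (fun τ hτ => hh τ hτ x) ht' ht
  rw [Real.norm_eq_abs, Real.norm_eq_abs] at key
  have h1 : |t - t'| ≤ (1 + T) * |t - t'| ^ (lam / 2) := by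
    have h0 : 0 ≤ |t - t'| ^ (lam / 2) := by positivity
    rcases le_total |t - t'| 1 with h2 | h2
    · have := Real.self_le_rpow_of_le_one (abs_nonneg (t - t')) h2 (show lam / 2 ≤ 1 by linarith)
      nlinarith
    · have h3 := Real.one_le_rpow h2 (show 0 ≤ lam / 2 by linarith)
      have h4 : |t - t'| ≤ T := by
        rw [abs_le]; constructor <;> linarith [ht.1, ht.2, ht'.1, ht'.2]
      nlinarith
  refine key.trans ?_
  have := mul_nonneg hC hx.le
  nlinarith

end HolderBounds

section Admissible

variable {T : ℝ} {P : ℕ → ℝ → ℝ → (ℝ → Spc n → ℝ) → Prop} {N s : ℕ} {W C : ℝ}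
  {f g : ℝ → Spc n → ℝ}

/-- Formal properties of a family of bounds. -/
structure Adm (T : ℝ) (P : ℕ → ℝ → ℝ → (ℝ → Spc n → ℝ) → Prop) : Prop where
  congr : ∀ N W C (f g : ℝ → Spc n → ℝ),
    (∀ t ∈ Set.Icc (0 : ℝ) T, ∀ x, f t x = g t x) → P N W C f → P N W C g
  add : ∀ N W C C' f g, P N W C f → P N W C' g → P N W (C + C') (fun t x => f t x + g t x)
  smul : ∀ N W C c f, P N W C f → P N W (|c| * C) (fun t x => c * f t x)
  zero : ∀ N W, P N W 0 (fun _ _ => 0)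
  mono : ∀ N W W' C C' f, W' ≤ W → C ≤ C' → 0 ≤ C' → P N W C f → P N W' C' f
  contT : ∀ N W C f, 0 ≤ W → P N W C f → ContT T f

theorem Adm.cls_mono (hP : Adm T P) {W' C' : ℝ} (hW : W' ≤ W) (hC : C ≤ C') (hC' : 0 ≤ C')
    (h : Cls T P N s W C f) : Cls T P N s W' C' f :=
  h.imp fun M p f hf => hP.mono _ _ _ _ _ _ (by linarith) hC hC' hf

theorem Adm.cls_congr (hP : Adm T P) (h : Cls T P N s W C f)
    (hfg : ∀ t ∈ Set.Icc (0 : ℝ) T, ∀ x, f t x = g t x) : Cls T P N s W C g :=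
  h.congr hP.congr hfg

theorem Adm.cls_add (hP : Adm T P) {C' : ℝ} (hf : Cls T P N s W C f) (hg : Cls T P N s W C' g) :
    Cls T P N s W (C + C') (fun t x => f t x + g t x) :=
  hf.add (fun N W f g => hP.add N W C C' f g) hg

theorem Adm.cls_smul (hP : Adm T P) (c : ℝ) (hf : Cls T P N s W C f) :
    Cls T P N s W (|c| * C) (fun t x => c * f t x) :=
  hf.smul c (fun N W f => hP.smul N W C c f)

theorem Adm.cls_zero (hP : Adm T P) (N s : ℕ) (W : ℝ) :
    Cls T P N s W 0 (fun _ _ => 0) := by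
  induction N using Nat.strong_induction_on generalizing s W with
  | _ N ih =>
    rcases N with _ | N
    · exact NSdeRham.cls_zero.2 (hP.zero _ _)
    · refine cls_succ.2 ⟨hP.zero _ _, ⟨fun _ _ _ => 0, fun t _ x => ?_, fun i => ih N (by omega) _ _⟩,
        fun N' s' hN _ => ⟨fun _ _ => 0, fun t _ x => ?_, ih N' (by omega) _ _⟩⟩
      · simpa using hasFDerivAt_const (0 : ℝ) x
      · exact hasDerivWithinAt_const _ _ _

theorem Adm.cls_sum (hP : Adm T P) {ι : Type*} (S : Finset ι) {F : ι → ℝ → Spc n → ℝ}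
    (h : ∀ i ∈ S, Cls T P N s W C (F i)) :
    Cls T P N s W (S.card * C) (fun t x => ∑ i ∈ S, F i t x) := by
  classical
  induction S using Finset.induction_on with
  | empty => simpa using hP.cls_zero N s W
  | insert a S ha ih =>
    have h1 := hP.cls_add (h a (by simp)) (ih fun i hi => h i (by simp [hi]))
    have e : C + S.card * C = ((insert a S).card : ℝ) * C := by
      rw [Finset.card_insert_of_notMem ha]; push_cast; ring
    rw [e] at h1
    refine hP.cls_congr h1 fun t _ x => ?_
    rw [Finset.sum_insert ha]

/-- Bounds on a datum: weighted sup bounds, and Hölder continuity in time below top order. -/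
def JP (T lam : ℝ) (N : ℕ) (W C : ℝ) (f : ℝ → Spc n → ℝ) : Prop :=
  ContT T f ∧ (∀ t ∈ Set.Icc (0 : ℝ) T, ∀ x, |f t x| ≤ C * wt x ^ (-W)) ∧
    (1 ≤ N → ∀ t ∈ Set.Icc (0 : ℝ) T, ∀ t' ∈ Set.Icc (0 : ℝ) T, ∀ x,
      |f t x - f t' x| ≤ C * wt x ^ (-W) * |t - t'| ^ (lam / 2))

/-- Bounds on a potential: weighted Hölder bounds, with a better exponent below top order. -/
def KP (T lam lam' : ℝ) (N : ℕ) (W C : ℝ) (f : ℝ → Spc n → ℝ) : Prop :=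
  HB T (if N = 0 then lam else lam') W C f

theorem ContT.add {T : ℝ} {f g : ℝ → Spc n → ℝ} (hf : ContT T f) (hg : ContT T g) :
    ContT T (fun t x => f t x + g t x) := ContinuousOn.add hf hg

theorem ContT.mul {T : ℝ} {f g : ℝ → Spc n → ℝ} (hf : ContT T f) (hg : ContT T g) :
    ContT T (fun t x => f t x * g t x) := ContinuousOn.mul hf hg

theorem contT_const {T : ℝ} (c : ℝ) : ContT T (fun (_ : ℝ) (_ : Spc n) => c) :=
  continuousOn_const

theorem adm_JP (T lam : ℝ) : Adm (n := n) T (JP T lam) where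
  congr N W C f g hfg h := by
    refine ⟨h.1.congr hfg, fun t ht x => ?_, fun hN t ht t' ht' x => ?_⟩
    · rw [← hfg t ht]; exact h.2.1 t ht x
    · rw [← hfg t ht, ← hfg t' ht']; exact h.2.2 hN t ht t' ht' x
  add N W C C' f g hf hg := by
    refine ⟨hf.1.add hg.1, fun t ht x => ?_, fun hN t ht t' ht' x => ?_⟩
    · have := hf.2.1 t ht x
      have := hg.2.1 t ht x
      have := abs_add_le (f t x) (g t x)
      linarith
    · have := hf.2.2 hN t ht t' ht' x
      have := hg.2.2 hN t ht t' ht' x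
      have h1 := abs_add_le (f t x - f t' x) (g t x - g t' x)
      have e : f t x - f t' x + (g t x - g t' x) = f t x + g t x - (f t' x + g t' x) := by ring
      rw [e] at h1
      linarith
  smul N W C c f hf := by
    refine ⟨(contT_const c).mul hf.1, fun t ht x => ?_, fun hN t ht t' ht' x => ?_⟩
    · rw [abs_mul, mul_assoc]
      exact mul_le_mul_of_nonneg_left (hf.2.1 t ht x) (abs_nonneg c)
    · rw [← mul_sub, abs_mul, mul_assoc, mul_assoc, ← mul_assoc C]
      exact mul_le_mul_of_nonneg_left (hf.2.2 hN t ht t' ht' x) (abs_nonneg c)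
  zero N W := ⟨contT_const 0, by simp, by simp⟩
  mono N W W' C C' f hW hC hC' h := by
    have key : ∀ x : Spc n, C * wt x ^ (-W) ≤ C' * wt x ^ (-W') := fun x =>
      mul_le_mul hC (wt_rpow_mono (by linarith) x) (wt_rpow_pos _ x).le hC'
    refine ⟨h.1, fun t ht x => (h.2.1 t ht x).trans (key x), fun hN t ht t' ht' x =>
      (h.2.2 hN t ht t' ht' x).trans ?_⟩
    exact mul_le_mul_of_nonneg_right (key x) (by positivity)
  contT N W C f _ h := h.1

theorem adm_KP {T lam lam' : ℝ} (hT : 0 < T) (hl : 0 < lam) (hl' : 0 < lam') :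
    Adm (n := n) T (KP T lam lam') where
  congr N W C f g hfg h := HB.congr h hfg
  add N W C C' f g hf hg := HB.add hf hg
  smul N W C c f hf := HB.smul c hf
  zero N W := ⟨by simp, by simp, by simp⟩
  mono N W W' C C' f hW hC hC' h := by
    have key : ∀ x : Spc n, C * wt x ^ (-W) ≤ C' * wt x ^ (-W') := fun x =>
      mul_le_mul hC (wt_rpow_mono (by linarith) x) (wt_rpow_pos _ x).le hC'
    refine ⟨fun t ht x => (h.sup t ht x).trans (key x), fun t ht x y =>
      (h.space t ht x y).trans ?_, fun t ht t' ht' x => (h.time t ht t' ht' x).trans ?_⟩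
    · refine mul_le_mul_of_nonneg_right ?_ (by positivity)
      rw [mul_add, mul_add]
      exact add_le_add (key x) (key y)
    · exact mul_le_mul_of_nonneg_right (key x) (by positivity)
  contT N W C f hW h := HB.contT (by split_ifs <;> assumption) hW hT h

theorem JP.pred (T lam : ℝ) : ∀ N W C (f : ℝ → Spc n → ℝ), JP T lam (N + 1) W C f →
    JP T lam N W C f :=
  fun _ _ _ _ h => ⟨h.1, h.2.1, fun _ => h.2.2 (by omega)⟩

theorem JP.nonneg {lam : ℝ} (hT : 0 < T) (h : JP T lam N W C f) : 0 ≤ C :=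
  nonneg_of_mul_nonneg_left ((abs_nonneg _).trans (h.2.1 0 ⟨le_rfl, hT.le⟩ 0)) (wt_rpow_pos _ _)

theorem JP.mul {lam W' C' : ℝ} (hT : 0 < T) (hf : JP T lam N W C f) (hg : JP T lam N W' C' g) :
    JP T lam N (W + W') (2 * (C * C')) (fun t x => f t x * g t x) := by
  have hC := hf.nonneg hT
  have hC' := hg.nonneg hT
  have e : ∀ x : Spc n, wt x ^ (-(W + W')) = wt x ^ (-W) * wt x ^ (-W') := fun x => by
    rw [← Real.rpow_add (wt_pos x)]; ring_nf
  refine ⟨hf.1.mul hg.1, fun t ht x => ?_, fun hN t ht t' ht' x => ?_⟩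
  · rw [e, abs_mul]
    have h1 := mul_le_mul (hf.2.1 t ht x) (hg.2.1 t ht x) (abs_nonneg _)
      ((abs_nonneg _).trans (hf.2.1 t ht x))
    have : 0 ≤ C * C' * (wt x ^ (-W) * wt x ^ (-W')) := by
      have := wt_rpow_pos (-W) x; have := wt_rpow_pos (-W') x; positivity
    linarith
  · rw [e]
    have e1 : f t x * g t x - f t' x * g t' x =
        (f t x - f t' x) * g t x + f t' x * (g t x - g t' x) := by ring
    rw [e1]
    refine (abs_add_le _ _).trans ?_
    rw [abs_mul, abs_mul]
    have h1 := mul_le_mul (hf.2.2 hN t ht t' ht' x) (hg.2.1 t ht x) (abs_nonneg _)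
      ((abs_nonneg _).trans (hf.2.2 hN t ht t' ht' x))
    have h2 := mul_le_mul (hf.2.1 t' ht' x) (hg.2.2 hN t ht t' ht' x) (abs_nonneg _)
      ((abs_nonneg _).trans (hf.2.1 t' ht' x))
    linarith

/-- Products of functions in the data classes. -/
theorem Cls.mul_JP {lam : ℝ} (hT : 0 < T) {W' C' : ℝ} (hf : Cls T (JP T lam) N s W C f)
    (hg : Cls T (JP T lam) N s W' C' g) :
    Cls T (JP T lam) N s (W + W') (2 ^ (N + 1) * (C * C')) (fun t x => f t x * g t x) := by
  have hJ := adm_JP (n := n) T lam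
  induction N using Nat.strong_induction_on generalizing s W W' f g with
  | _ N ih =>
    have hCC : 0 ≤ C * C' := mul_nonneg (hf.base.nonneg hT) (hg.base.nonneg hT)
    rcases N with _ | N
    · refine NSdeRham.cls_zero.2 ?_
      have := hf.base.mul hT hg.base
      simpa using this
    · have hpow : (1 : ℝ) ≤ 2 ^ (N + 1) := one_le_pow₀ (by norm_num)
      obtain ⟨hf0, ⟨f', hff, hf'⟩, hft⟩ := cls_succ.1 hf
      obtain ⟨hg0, ⟨g', hgg, hg'⟩, hgt⟩ := cls_succ.1 hg
      refine cls_succ.2 ⟨?_, ⟨_, hff.mul hgg, fun i => ?_⟩, fun N' s' hN hs => ?_⟩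
      · refine hJ.mono _ _ _ _ _ _ le_rfl ?_ (by positivity) (hf0.mul hT hg0)
        rw [pow_succ]
        nlinarith
      · have h1 := ih N (by omega) (hf' i) (hg.pred (JP.pred T lam))
        have h2 := ih N (by omega) (hf.pred (JP.pred T lam)) (hg' i)
        have h3 := hJ.cls_add
          (hJ.cls_mono (W' := W + W' + 1) (by linarith) le_rfl (by positivity) h1)
          (hJ.cls_mono (W' := W + W' + 1) (by linarith) le_rfl (by positivity) h2)
        refine hJ.cls_congr (hJ.cls_mono le_rfl ?_ (by positivity) h3) fun t _ x => ?_
        · rw [pow_succ (2 : ℝ) (N + 1)]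
          linarith
        · ring
      · obtain ⟨h, hh, hh'⟩ := hft N' s' hN hs
        obtain ⟨h₂, hh₂, hh₂'⟩ := hgt N' s' hN hs
        refine ⟨_, hh.mul hh₂, ?_⟩
        have h1 := ih N' (by omega) hh'
          ((hg.mono_left (JP.pred T lam) (by omega : N' ≤ N + 1)).mono_s (by omega : s' ≤ s))
        have h2 := ih N' (by omega)
          ((hf.mono_left (JP.pred T lam) (by omega : N' ≤ N + 1)).mono_s (by omega : s' ≤ s)) hh₂'
        refine hJ.cls_congr (hJ.cls_mono le_rfl ?_ (by positivity) (hJ.cls_add h1 h2))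
          fun t _ x => ?_
        · have hp : (2 : ℝ) ^ (N' + 1) ≤ 2 ^ (N + 1) :=
            pow_le_pow_right₀ (by norm_num) (by omega)
          rw [pow_succ (2 : ℝ) (N + 1)]
          nlinarith
        · ring

/-- Data with one more derivative obey Hölder bounds. -/
theorem Cls.JP_to_KP {lam lam' : ℝ} (hT : 0 < T) (hl : 0 ≤ lam) (hl1 : lam ≤ 1) (hl' : 0 ≤ lam')
    (hl1' : lam' ≤ 1) (N s : ℕ) (W : ℝ) (hW : 0 ≤ W) :
    ∃ A : ℝ, 0 ≤ A ∧ ∀ (C : ℝ) (f : ℝ → Spc n → ℝ),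
      Cls T (JP T lam) (N + 1) (s + 1) W C f → Cls T (KP T lam lam') N s W (A * C) f := by
  refine ⟨(n + 1) * 2 ^ (W + N) + (1 + T), by positivity, fun C f h => ?_⟩
  have key : ∀ (N : ℕ) (s : ℕ) (W B : ℝ) (f : ℝ → Spc n → ℝ), 0 ≤ W → W + N ≤ B →
      Cls T (JP T lam) (N + 1) (s + 1) W C f →
      Cls T (KP T lam lam') N s W (((n + 1) * 2 ^ B + (1 + T)) * C) f := by
    intro N
    induction N using Nat.strong_induction_on with
    | _ N ih =>
      intro s W B f hW hB h
      have hC : 0 ≤ C := h.base.nonneg hT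
      obtain ⟨h0, ⟨g, hg, hg'⟩, ht⟩ := cls_succ.1 h
      have hB0 : 0 ≤ B := le_trans (by positivity) hB
      have hn : (0 : ℝ) ≤ n := Nat.cast_nonneg n
      have h2B : (1 : ℝ) ≤ 2 ^ B := Real.one_le_rpow (by norm_num) hB0
      have hWB : (2 : ℝ) ^ W ≤ 2 ^ B := Real.rpow_le_rpow_of_exponent_le (by norm_num) (by
        have : (0 : ℝ) ≤ N := Nat.cast_nonneg N
        linarith)
      have hA1 : 1 ≤ (n + 1) * 2 ^ B + (1 + T) := by nlinarith
      have hsup : ∀ t ∈ Set.Icc (0 : ℝ) T, ∀ x,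
          |f t x| ≤ ((n + 1) * 2 ^ B + (1 + T)) * C * wt x ^ (-W) := fun t ht x => by
        refine (h0.2.1 t ht x).trans ?_
        have := mul_nonneg hC (wt_rpow_pos (-W) x).le
        nlinarith
      have hgrad : ∀ i, ∀ t ∈ Set.Icc (0 : ℝ) T, ∀ x, |g i t x| ≤ C * wt x ^ (-W) :=
        fun i t ht x => ((hg' i).base.2.1 t ht x).trans
          (mul_le_mul_of_nonneg_left (wt_rpow_mono (by linarith) x) hC)
      have hspace : ∀ l : ℝ, 0 ≤ l → l ≤ 1 → ∀ t ∈ Set.Icc (0 : ℝ) T, ∀ x y,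
          |f t x - f t y| ≤ ((n + 1) * 2 ^ B + (1 + T)) * C * (wt x ^ (-W) + wt y ^ (-W)) *
            ‖x - y‖ ^ l := fun l hl0 hl1 t ht x y => by
        refine (space_of_grad hl0 hl1 hW hC hg h0.2.1 hgrad t ht x y).trans ?_
        have := wt_rpow_pos (-W) x
        have := wt_rpow_pos (-W) y
        refine mul_le_mul_of_nonneg_right (mul_le_mul_of_nonneg_right
          (mul_le_mul_of_nonneg_right ?_ hC) (by positivity)) (by positivity)
        nlinarith
      rcases N with _ | N
      · refine NSdeRham.cls_zero.2 ⟨hsup, hspace _ (by simpa using hl) (by simpa using hl1),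
          fun t ht t' ht' x => ?_⟩
        refine (h0.2.2 le_rfl t ht t' ht' x).trans ?_
        have := mul_nonneg hC (wt_rpow_pos (-W) x).le
        have h3 : 0 ≤ |t - t'| ^ (lam / 2) := by positivity
        have := mul_nonneg this h3
        simp only [if_true]
        nlinarith
      · obtain ⟨k, hk, hk'⟩ := ht N s rfl rfl
        refine cls_succ.2 ⟨⟨hsup, hspace _ (by simpa using hl') (by simpa using hl1'),
          fun t ht t' ht' x => ?_⟩, ⟨g, hg, fun i => ?_⟩, fun N' s' hN hs => ?_⟩
        · simp only [Nat.add_eq_zero_iff, one_ne_zero, and_false, if_false]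
          refine (time_of_dt hT hl' (by linarith) hC hk hk'.base.2.1 t ht t' ht' x).trans ?_
          have := mul_nonneg hC (wt_rpow_pos (-W) x).le
          have h3 : 0 ≤ |t - t'| ^ (lam' / 2) := by positivity
          have := mul_nonneg (mul_nonneg (by positivity : 0 ≤ ((n : ℝ) + 1) * 2 ^ B) this) h3
          linarith
        · exact ih N (by omega) s _ B _ (by linarith) (by push_cast at hB; linarith) (hg' i)
        · obtain rfl : N = N' + 1 := by omega
          obtain rfl : s = s' + 1 := by omega
          exact ⟨k, hk, ih N' (by omega) s' _ B _ hW (by push_cast at hB ⊢; linarith) hk'⟩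
  exact key N s W (W + N) f hW le_rfl h

end Admissible

section Kernels

/-- An integrable majorant. -/
def maj (z : Spc n) : ℝ := (1 + ‖z‖) ^ (-((n : ℝ) + 1))

theorem maj_pos (z : Spc n) : 0 < maj z := Real.rpow_pos_of_pos (by positivity) _

theorem integrable_maj : Integrable (maj (n := n)) :=
  integrable_one_add_norm (by rw [finrank_euclideanSpace_fin]; linarith)

/-- Rapidly decaying differentiable kernels. -/
structure Ker (q : Spc n → ℝ) : Prop where
  diff : Differentiable ℝ q
  decay : ∀ W : ℝ, ∃ A : ℝ, 0 ≤ A ∧ ∀ z, |q z| * (1 + ‖z‖) ^ W ≤ A * maj z ∧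
    ‖fderiv ℝ q z‖ * (1 + ‖z‖) ^ W ≤ A * maj z

/-- The standard Gaussian. -/
def phi (z : Spc n) : ℝ := (2 * Real.pi) ^ (-(n : ℝ) / 2) * Real.exp (-(‖z‖ ^ 2 / 2))

theorem phi_pos (z : Spc n) : 0 < phi z := by
  unfold phi
  have := Real.pi_pos
  positivity

theorem phi_decay (W : ℝ) : ∃ A : ℝ, 0 ≤ A ∧ ∀ z : Spc n, phi z * (1 + ‖z‖) ^ W ≤ A * maj z := by
  obtain ⟨M, hM⟩ := exists_nat_ge (W + (n + 1))
  have hpi := Real.pi_pos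
  refine ⟨(2 * Real.pi) ^ (-(n : ℝ) / 2) * ((M.factorial : ℝ) * Real.exp (3 / 2)), by positivity,
    fun z => ?_⟩
  have h1 : 0 < 1 + ‖z‖ := by positivity
  have h2 : (1 + ‖z‖) ^ M ≤ M.factorial * Real.exp (1 + ‖z‖) := by
    have := Real.pow_div_factorial_le_exp (1 + ‖z‖) h1.le M
    rw [div_le_iff₀ (by positivity)] at this
    linarith
  have h3 : (1 + ‖z‖) ^ (W + (n + 1)) ≤ (1 + ‖z‖) ^ M := by
    rw [← Real.rpow_natCast]
    exact Real.rpow_le_rpow_of_exponent_le (by linarith [norm_nonneg z]) hM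
  have h4 : Real.exp (-(‖z‖ ^ 2 / 2)) * Real.exp (1 + ‖z‖) ≤ Real.exp (3 / 2) := by
    rw [← Real.exp_add]
    apply Real.exp_le_exp.2
    nlinarith [sq_nonneg (‖z‖ - 1)]
  have h5 : (1 + ‖z‖) ^ W = (1 + ‖z‖) ^ (W + (n + 1)) * maj z := by
    rw [maj, ← Real.rpow_add h1]
    ring_nf
  rw [phi, h5, ← mul_assoc]
  refine mul_le_mul_of_nonneg_right ?_ (maj_pos z).le
  rw [mul_assoc]
  refine mul_le_mul_of_nonneg_left ?_ (by positivity)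
  calc Real.exp (-(‖z‖ ^ 2 / 2)) * (1 + ‖z‖) ^ (W + (n + 1))
      ≤ Real.exp (-(‖z‖ ^ 2 / 2)) * (M.factorial * Real.exp (1 + ‖z‖)) :=
        mul_le_mul_of_nonneg_left (h3.trans h2) (Real.exp_pos _).le
    _ = M.factorial * (Real.exp (-(‖z‖ ^ 2 / 2)) * Real.exp (1 + ‖z‖)) := by ring
    _ ≤ _ := mul_le_mul_of_nonneg_left h4 (by positivity)

theorem hasFDerivAt_phi (z : Spc n) :
    HasFDerivAt phi ((-phi z) • (innerSL ℝ z : Spc n →L[ℝ] ℝ)) z := by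
  have h1 : HasFDerivAt (fun z : Spc n => ‖z‖ ^ 2) (2 • (innerSL ℝ z : Spc n →L[ℝ] ℝ)) z :=
    (hasStrictFDerivAt_norm_sq z).hasFDerivAt
  have h2 := ((h1.mul_const (1 / 2 : ℝ)).neg.exp).const_mul ((2 * Real.pi) ^ (-(n : ℝ) / 2))
  have e : (fun z : Spc n => (2 * Real.pi) ^ (-(n : ℝ) / 2) * Real.exp (-(‖z‖ ^ 2 * (1 / 2)))) =
      phi := by
    funext z
    rw [phi]
    ring_nf
  rw [← e]
  refine h2.congr_fderiv ?_
  ext v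
  simp
  ring

theorem ker_of_le {q : Spc n → ℝ} {q' : Spc n → (Spc n →L[ℝ] ℝ)}
    (hq : ∀ z, HasFDerivAt q (q' z) z) (h1 : ∀ z, |q z| ≤ phi z * (1 + ‖z‖) ^ (2 : ℝ))
    (h2 : ∀ z, ‖q' z‖ ≤ phi z * (1 + ‖z‖) ^ (2 : ℝ)) : Ker q where
  diff z := (hq z).differentiableAt
  decay W := by
    obtain ⟨A, hA, h⟩ := phi_decay (n := n) (2 + W)
    have key : ∀ (z : Spc n) (a : ℝ), a ≤ phi z * (1 + ‖z‖) ^ (2 : ℝ) →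
        a * (1 + ‖z‖) ^ W ≤ A * maj z := fun z a ha => by
      refine le_trans ?_ (h z)
      rw [Real.rpow_add (by positivity), ← mul_assoc]
      exact mul_le_mul_of_nonneg_right ha (by positivity)
    refine ⟨A, hA, fun z => ⟨key z _ (h1 z), ?_⟩⟩
    rw [(hq z).fderiv]
    exact key z _ (h2 z)

theorem ker_phi : Ker (phi (n := n)) := by
  refine ker_of_le hasFDerivAt_phi (fun z => ?_) fun z => ?_
  · rw [abs_of_pos (phi_pos z)]
    have := Real.one_le_rpow (show 1 ≤ 1 + ‖z‖ by linarith [norm_nonneg z])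
      (show (0 : ℝ) ≤ 2 by norm_num)
    nlinarith [phi_pos z]
  · rw [norm_smul, norm_neg, Real.norm_eq_abs, abs_of_pos (phi_pos z), innerSL_apply_norm,
      Real.rpow_two]
    refine mul_le_mul_of_nonneg_left ?_ (phi_pos z).le
    nlinarith [norm_nonneg z]

/-- The first moments `zᵢ φ(z)` of the Gaussian. -/
def phi1 (i : Fin n) (z : Spc n) : ℝ := z i * phi z

theorem ker_phi1 (i : Fin n) : Ker (phi1 i) := by
  have h1 : ∀ z : Spc n, HasFDerivAt (phi1 i)
      (z i • ((-phi z) • (innerSL ℝ z : Spc n →L[ℝ] ℝ)) +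
        phi z • (EuclideanSpace.proj i : Spc n →L[ℝ] ℝ)) z := fun z =>
    ((EuclideanSpace.proj i : Spc n →L[ℝ] ℝ).hasFDerivAt (x := z)).mul (hasFDerivAt_phi z)
  have hz : ∀ z : Spc n, |z i| ≤ ‖z‖ := fun z => PiLp.norm_apply_le z i
  refine ker_of_le h1 (fun z => ?_) fun z => ?_
  · rw [phi1, abs_mul, abs_of_pos (phi_pos z), Real.rpow_two]
    have := hz z
    nlinarith [phi_pos z, norm_nonneg z, mul_nonneg (phi_pos z).le (norm_nonneg z),
      mul_nonneg (phi_pos z).le (sq_nonneg ‖z‖)]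
  · have hp : ‖(EuclideanSpace.proj i : Spc n →L[ℝ] ℝ)‖ ≤ 1 :=
      ContinuousLinearMap.opNorm_le_bound _ zero_le_one fun v => by
        rw [one_mul]; exact PiLp.norm_apply_le v i
    refine (norm_add_le _ _).trans ?_
    rw [norm_smul, norm_smul, norm_smul, norm_neg, Real.norm_eq_abs, Real.norm_eq_abs,
      abs_of_pos (phi_pos z), innerSL_apply_norm, Real.rpow_two]
    have h3 : |z i| * (phi z * ‖z‖) ≤ ‖z‖ * (phi z * ‖z‖) :=
      mul_le_mul_of_nonneg_right (hz z) (mul_nonneg (phi_pos z).le (norm_nonneg z))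
    have h4 : phi z * ‖(EuclideanSpace.proj i : Spc n →L[ℝ] ℝ)‖ ≤ phi z * 1 :=
      mul_le_mul_of_nonneg_left hp (phi_pos z).le
    nlinarith [mul_nonneg (phi_pos z).le (norm_nonneg z)]

theorem integral_phi : ∫ z : Spc n, phi z = 1 := by
  have h := GaussianFourier.integral_rexp_neg_mul_sq_norm (V := Spc n)
    (show (0 : ℝ) < 1 / 2 by norm_num)
  simp only [phi]
  rw [integral_const_mul]
  have e : ∀ z : Spc n, -(‖z‖ ^ 2 / 2) = -(1 / 2) * ‖z‖ ^ 2 := fun z => by ring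
  simp only [e, h]
  rw [finrank_euclideanSpace_fin]
  have hpi := Real.pi_pos
  rw [show Real.pi / (1 / 2) = 2 * Real.pi by ring, ← Real.rpow_add (by positivity)]
  simp [neg_div]

theorem Ker.continuous {q : Spc n → ℝ} (hq : Ker q) : Continuous q := hq.diff.continuous

theorem Ker.abs_le {q : Spc n → ℝ} (hq : Ker q) :
    ∃ A : ℝ, 0 ≤ A ∧ ∀ z, |q z| ≤ A * maj z := by
  obtain ⟨A, hA, h⟩ := hq.decay 0
  exact ⟨A, hA, fun z => by simpa using (h z).1⟩

theorem Ker.integrable {q : Spc n → ℝ} (hq : Ker q) : Integrable q := by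
  obtain ⟨A, hA, h⟩ := hq.abs_le
  exact (integrable_maj.const_mul A).mono' hq.continuous.aestronglyMeasurable
    (Eventually.of_forall h)

theorem Ker.sub_translate {q : Spc n → ℝ} (hq : Ker q) (W : ℝ) (hW : 0 ≤ W) :
    ∃ A : ℝ, 0 ≤ A ∧ ∀ a : Spc n, ‖a‖ ≤ 1 → ∀ z,
      |q z - q (z + a)| * (1 + ‖z‖) ^ W ≤ A * ‖a‖ * maj z := by
  obtain ⟨A, hA, h⟩ := hq.decay W
  refine ⟨A * 2 ^ (W + (n + 1)), by positivity, fun a ha z => ?_⟩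
  have hz : 0 < 1 + ‖z‖ := by positivity
  have hbd : ∀ y ∈ Metric.closedBall z ‖a‖,
      ‖fderiv ℝ q y‖ ≤ A * 2 ^ (W + (n + 1)) * ((1 + ‖z‖) ^ (-W) * maj z) := by
    intro y hy
    have hy1 : 0 < 1 + ‖y‖ := by positivity
    have h1 : 1 + ‖z‖ ≤ 2 * (1 + ‖y‖) := by
      have : ‖z‖ ≤ ‖y‖ + ‖y - z‖ := by
        have := norm_sub_le y (y - z)
        simpa using this
      rw [Metric.mem_closedBall, dist_eq_norm] at hy
      linarith [norm_nonneg y]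
    have h2 := (h y).2
    have h3 : ‖fderiv ℝ q y‖ ≤ A * (1 + ‖y‖) ^ (-(W + (n + 1))) := by
      have : (1 + ‖y‖) ^ (-(W + (n + 1))) = (1 + ‖y‖) ^ (-W) * maj y := by
        rw [maj, ← Real.rpow_add hy1]; ring_nf
      rw [this, Real.rpow_neg hy1.le, ← mul_assoc, mul_right_comm, ← div_eq_mul_inv,
        le_div_iff₀ (by positivity)]
      exact h2
    refine h3.trans ?_
    rw [maj, ← Real.rpow_add hz, mul_assoc]
    refine mul_le_mul_of_nonneg_left ?_ hA
    rw [show -W + -((n : ℝ) + 1) = -(W + (n + 1)) by ring, Real.rpow_neg hy1.le,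
      Real.rpow_neg hz.le, inv_le_comm₀ (by positivity) (by positivity), mul_inv, inv_inv,
      inv_mul_le_iff₀ (by positivity), ← Real.mul_rpow (by norm_num) hy1.le]
    exact Real.rpow_le_rpow hz.le h1 (by positivity)
  have key := (convex_closedBall z ‖a‖).norm_image_sub_le_of_norm_fderiv_le
    (fun y _ => hq.diff y) hbd (y := z) (x := z + a)
    (by simp) (by simp)
  rw [Real.norm_eq_abs] at key
  have e1 : ‖z - (z + a)‖ = ‖a‖ := by simp
  rw [e1] at key
  have h5 : (1 + ‖z‖) ^ (-W) * (1 + ‖z‖) ^ W = 1 := by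
    rw [← Real.rpow_add hz]; simp
  calc |q z - q (z + a)| * (1 + ‖z‖) ^ W
      ≤ A * 2 ^ (W + (n + 1)) * ((1 + ‖z‖) ^ (-W) * maj z) * ‖a‖ * (1 + ‖z‖) ^ W :=
        mul_le_mul_of_nonneg_right key (by positivity)
    _ = A * 2 ^ (W + (n + 1)) * ‖a‖ * maj z * ((1 + ‖z‖) ^ (-W) * (1 + ‖z‖) ^ W) := by ring
    _ = _ := by rw [h5, mul_one]

theorem Ker.sub_dilate {q : Spc n → ℝ} (hq : Ker q) (W : ℝ) (hW : 0 ≤ W) :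
    ∃ A : ℝ, 0 ≤ A ∧ ∀ r : ℝ, 1 / 2 ≤ r → r ≤ 1 → ∀ z,
      |r ^ (n + 1) * q (r • z) - q z| * (1 + ‖z‖) ^ W ≤ A * (1 - r) * maj z := by
  obtain ⟨A, hA, h⟩ := hq.decay (W + 1)
  refine ⟨(n + 2) * (A * 2 ^ (W + 1 + (n + 1))), by positivity, fun r hr hr1 z => ?_⟩
  have hz : 0 < 1 + ‖z‖ := by positivity
  have hr' : 0 ≤ 1 - r := by linarith
  set E := (1 + ‖z‖) ^ (-(W + 1)) * maj z with hE
  have hEpos : 0 ≤ E := mul_nonneg (by positivity) (maj_pos z).le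
  have hbd : ∀ a : ℝ, ∀ ρ : ℝ, 1 / 2 ≤ ρ → a * (1 + ‖ρ • z‖) ^ (W + 1) ≤ A * maj (ρ • z) →
      a ≤ A * 2 ^ (W + 1 + (n + 1)) * E := by
    intro a ρ hρ h2
    set y := ρ • z with hy
    have hy1 : 0 < 1 + ‖y‖ := by positivity
    have h1 : 1 + ‖z‖ ≤ 2 * (1 + ‖y‖) := by
      rw [hy, norm_smul, Real.norm_eq_abs, abs_of_nonneg (by linarith)]
      nlinarith [norm_nonneg z]
    have h3 : a ≤ A * (1 + ‖y‖) ^ (-(W + 1 + (n + 1))) := by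
      have : (1 + ‖y‖) ^ (-(W + 1 + (n + 1))) = (1 + ‖y‖) ^ (-(W + 1)) * maj y := by
        rw [maj, ← Real.rpow_add hy1]; ring_nf
      rw [this, Real.rpow_neg hy1.le, ← mul_assoc, mul_right_comm, ← div_eq_mul_inv,
        le_div_iff₀ (by positivity)]
      exact h2
    refine h3.trans ?_
    rw [hE, maj, ← Real.rpow_add hz, mul_assoc]
    refine mul_le_mul_of_nonneg_left ?_ hA
    rw [show -(W + 1) + -((n : ℝ) + 1) = -(W + 1 + (n + 1)) by ring, Real.rpow_neg hy1.le,
      Real.rpow_neg hz.le, inv_le_comm₀ (by positivity) (by positivity), mul_inv, inv_inv,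
      inv_mul_le_iff₀ (by positivity), ← Real.mul_rpow (by norm_num) hy1.le]
    exact Real.rpow_le_rpow hz.le h1 (by positivity)
  have hseg : ∀ y ∈ segment ℝ (r • z) z, ‖fderiv ℝ q y‖ ≤ A * 2 ^ (W + 1 + (n + 1)) * E := by
    rintro y ⟨a, b, ha, hb, hab, rfl⟩
    have : a • r • z + b • z = (a * r + b) • z := by rw [add_smul, smul_smul]
    rw [this]
    exact hbd _ _ (by nlinarith) (h _).2
  have key := (convex_segment (r • z) z).norm_image_sub_le_of_norm_fderiv_le
    (fun y _ => hq.diff y) hseg (right_mem_segment ℝ _ _) (left_mem_segment ℝ _ _)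
  have e1 : ‖r • z - z‖ = (1 - r) * ‖z‖ := by
    rw [show r • z - z = -((1 - r) • z) by rw [sub_smul, one_smul]; abel, norm_neg, norm_smul,
      Real.norm_eq_abs, abs_of_nonneg hr']
  rw [Real.norm_eq_abs, e1] at key
  have hq0 : |q (r • z)| ≤ A * 2 ^ (W + 1 + (n + 1)) * E := hbd _ r hr (h _).1
  have hpow : |r ^ (n + 1) - 1| ≤ (n + 1) * (1 - r) := by
    have h1 := one_add_mul_le_pow (show (-2 : ℝ) ≤ r - 1 by linarith) (n + 1)
    have h2 : r ^ (n + 1) ≤ 1 := pow_le_one₀ (by linarith) hr1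
    rw [show 1 + (r - 1) = r by ring] at h1
    push_cast at h1
    rw [_root_.abs_le]
    constructor <;> nlinarith [(Nat.cast_nonneg n : (0 : ℝ) ≤ n)]
  have hsum : |r ^ (n + 1) * q (r • z) - q z| ≤
      (1 - r) * (A * 2 ^ (W + 1 + (n + 1)) * E) * ((n + 2) * (1 + ‖z‖)) := by
    have e2 : r ^ (n + 1) * q (r • z) - q z = (r ^ (n + 1) - 1) * q (r • z) + (q (r • z) - q z) := by
      ring
    rw [e2]
    refine (abs_add_le _ _).trans ?_
    rw [abs_mul]
    have h1 := mul_le_mul hpow hq0 (abs_nonneg _) (by positivity)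
    have hB : 0 ≤ A * 2 ^ (W + 1 + (n + 1)) * E := by positivity
    have h4 : 0 ≤ (1 - r) * (A * 2 ^ (W + 1 + (n + 1)) * E) := by positivity
    have h5 : 0 ≤ (1 - r) * (A * 2 ^ (W + 1 + (n + 1)) * E) * (n * ‖z‖) := by positivity
    have h6 : 0 ≤ (1 - r) * (A * 2 ^ (W + 1 + (n + 1)) * E) * ‖z‖ := by positivity
    linarith
  have h5 : (1 + ‖z‖) ^ (-(W + 1)) * (1 + ‖z‖) * (1 + ‖z‖) ^ W = 1 := by
    nth_rw 2 [← Real.rpow_one (1 + ‖z‖)]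
    rw [← Real.rpow_add hz, ← Real.rpow_add hz]; simp
  calc _ ≤ (1 - r) * (A * 2 ^ (W + 1 + (n + 1)) * E) * ((n + 2) * (1 + ‖z‖)) * (1 + ‖z‖) ^ W :=
        mul_le_mul_of_nonneg_right hsum (by positivity)
    _ = (n + 2) * (A * 2 ^ (W + 1 + (n + 1))) * (1 - r) * maj z *
        ((1 + ‖z‖) ^ (-(W + 1)) * (1 + ‖z‖) * (1 + ‖z‖) ^ W) := by rw [hE]; ring
    _ = _ := by rw [h5, mul_one]

end Kernels

section SingularIntegrals

theorem sing_intervalIntegrable {κ : ℝ} (hκ : κ < 1) (t a b : ℝ) :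
    IntervalIntegrable (fun τ => (t - τ) ^ (-κ)) volume a b := by
  have h := (intervalIntegral.intervalIntegrable_rpow' (a := t - a) (b := t - b)
    (show -1 < -κ by linarith)).comp_sub_left t
  simpa using h

theorem sing_integral {κ : ℝ} (hκ : κ < 1) (a t : ℝ) :
    ∫ τ in a..t, (t - τ) ^ (-κ) = (t - a) ^ (1 - κ) / (1 - κ) := by
  rw [intervalIntegral.integral_comp_sub_left (fun σ : ℝ => σ ^ (-κ)),
    integral_rpow (Or.inl (by linarith)), sub_self, neg_add_eq_sub,
    Real.zero_rpow (by linarith), sub_zero]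

theorem sing_integral_le {κ T a t : ℝ} (hκ : κ < 1) (ha : a ≤ t) (hT : t - a ≤ T) :
    ∫ τ in a..t, (t - τ) ^ (-κ) ≤ T ^ (1 - κ) / (1 - κ) := by
  rw [sing_integral hκ]
  have : 0 < 1 - κ := by linarith
  gcongr

/-- The parabolic scale `√(2μσ)`. -/
def cc (μ σ : ℝ) : ℝ := Real.sqrt (2 * μ * σ)

variable {μ : ℝ}

theorem cc_nonneg (μ σ : ℝ) : 0 ≤ cc μ σ := Real.sqrt_nonneg _

theorem cc_pos (hμ : 0 < μ) {σ : ℝ} (hσ : 0 < σ) : 0 < cc μ σ := Real.sqrt_pos.2 (by positivity)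

theorem cc_sq (hμ : 0 < μ) {σ : ℝ} (hσ : 0 ≤ σ) : cc μ σ ^ 2 = 2 * μ * σ :=
  Real.sq_sqrt (by positivity)

theorem cc_mono (hμ : 0 < μ) {σ σ' : ℝ} (h : σ ≤ σ') : cc μ σ ≤ cc μ σ' :=
  Real.sqrt_le_sqrt (by gcongr)

theorem continuous_cc (μ : ℝ) : Continuous (cc μ) := by
  unfold cc
  fun_prop

theorem cc_rpow (hμ : 0 < μ) {σ : ℝ} (hσ : 0 ≤ σ) (p : ℝ) :
    cc μ σ ^ (-p) = (2 * μ) ^ (-(p / 2)) * σ ^ (-(p / 2)) := by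
  rw [cc, Real.sqrt_eq_rpow, ← Real.rpow_mul (by positivity),
    Real.mul_rpow (by positivity) hσ]
  ring_nf

theorem cc_inv (hμ : 0 < μ) {σ : ℝ} (hσ : 0 ≤ σ) :
    (cc μ σ)⁻¹ = (2 * μ) ^ (-(1 / 2 : ℝ)) * σ ^ (-(1 / 2 : ℝ)) := by
  rw [← cc_rpow hμ hσ 1, Real.rpow_neg_one]

theorem cc_inv_intervalIntegrable (hμ : 0 < μ) {a b t : ℝ} (hb : b ≤ t) (ha : a ≤ t) :
    IntervalIntegrable (fun τ => (cc μ (t - τ))⁻¹) volume a b := by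
  refine ((sing_intervalIntegrable (show (1 / 2 : ℝ) < 1 by norm_num) t a b).const_mul
    ((2 * μ) ^ (-(1 / 2 : ℝ)))).congr fun τ hτ => ?_
  refine (cc_inv hμ ?_).symm
  have := hτ.2
  have : τ ≤ t := this.trans (max_le ha hb)
  linarith

end SingularIntegrals

section HeatScaling

/-- Averages of `g` at scale `c` against the kernel `q`. -/
def Tq (q : Spc n → ℝ) (c : ℝ) (g : Spc n → ℝ) (x : Spc n) : ℝ := ∫ z, q z * g (x + c • z)

/-- Continuous functions with a weighted bound. -/
structure Dat (W C : ℝ) (g : ℝ → Spc n → ℝ) : Prop where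
  cont : Continuous fun p : ℝ × Spc n => g p.1 p.2
  bd : ∀ τ x, |g τ x| ≤ C * wt x ^ (-W)

variable {W C : ℝ} {g : ℝ → Spc n → ℝ} {q : Spc n → ℝ}

theorem Dat.nonneg (h : Dat W C g) : 0 ≤ C :=
  nonneg_of_mul_nonneg_left ((abs_nonneg _).trans (h.bd 0 0)) (wt_rpow_pos _ _)

theorem Dat.le (h : Dat W C g) (hW : 0 ≤ W) (τ : ℝ) (x : Spc n) : |g τ x| ≤ C :=
  (h.bd τ x).trans (mul_le_of_le_one_right h.nonneg (wt_rpow_le_one hW x))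

theorem Dat.slice (h : Dat W C g) (τ : ℝ) : Continuous (g τ) :=
  h.cont.comp (by fun_prop : Continuous fun x : Spc n => ((τ, x) : ℝ × Spc n))

theorem Ker.integrable_mul (hq : Ker q) {G : Spc n → ℝ} (hG : Continuous G) {B : ℝ}
    (hB : ∀ z, |G z| ≤ B) : Integrable fun z => q z * G z := by
  have := hq.integrable.bdd_mul (c := B) hG.aestronglyMeasurable
    (Eventually.of_forall hB)
  simpa only [mul_comm] using this

theorem weighted_integral_bound (hW : 0 ≤ W) {Q G : Spc n → ℝ} {B c c₀ : ℝ} (hB : 0 ≤ B)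
    (hQ : ∀ z, |Q z| * (1 + ‖z‖) ^ W ≤ B * maj z) (hC : 0 ≤ C)
    (hG : ∀ y, |G y| ≤ C * wt y ^ (-W)) (hc : 0 ≤ c) (hc₀ : c ≤ c₀) (x : Spc n) :
    |∫ z, Q z * G (x + c • z)| ≤ (1 + c₀) ^ W * (∫ z : Spc n, maj z) * B * C * wt x ^ (-W) := by
  have hx := wt_rpow_pos (-W) x
  have key : ∀ z, ‖Q z * G (x + c • z)‖ ≤ (1 + c₀) ^ W * B * C * wt x ^ (-W) * maj z := by
    intro z
    rw [Real.norm_eq_abs, abs_mul]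
    have h1 : |G (x + c • z)| ≤ C * (wt x ^ (-W) * ((1 + c₀) ^ W * (1 + ‖z‖) ^ W)) := by
      refine (hG _).trans (mul_le_mul_of_nonneg_left ?_ hC)
      refine (wt_rpow_le hW x _).trans (mul_le_mul_of_nonneg_left ?_ hx.le)
      rw [← Real.mul_rpow (by linarith) (by positivity)]
      refine Real.rpow_le_rpow (by positivity) ?_ hW
      have : ‖x - (x + c • z)‖ = c * ‖z‖ := by
        rw [sub_add_cancel_left, norm_neg, norm_smul, Real.norm_eq_abs, abs_of_nonneg hc]
      rw [this]
      nlinarith [norm_nonneg z, mul_le_mul_of_nonneg_right hc₀ (norm_nonneg z)]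
    calc |Q z| * |G (x + c • z)|
        ≤ |Q z| * (C * (wt x ^ (-W) * ((1 + c₀) ^ W * (1 + ‖z‖) ^ W))) :=
          mul_le_mul_of_nonneg_left h1 (abs_nonneg _)
      _ = (C * wt x ^ (-W) * (1 + c₀) ^ W) * (|Q z| * (1 + ‖z‖) ^ W) := by ring
      _ ≤ (C * wt x ^ (-W) * (1 + c₀) ^ W) * (B * maj z) :=
          mul_le_mul_of_nonneg_left (hQ z) (by
            have : 0 ≤ (1 + c₀) ^ W := Real.rpow_nonneg (by linarith) _
            positivity)
      _ = _ := by ring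
  have h := norm_integral_le_of_norm_le
    (integrable_maj.const_mul ((1 + c₀) ^ W * B * C * wt x ^ (-W))) (Eventually.of_forall key)
  rw [integral_const_mul, Real.norm_eq_abs] at h
  linarith

theorem tq_continuous (hq : Ker q) (hW : 0 ≤ W) (hg : Dat W C g) :
    Continuous fun p : ℝ × ℝ × Spc n => Tq q p.2.1 (g p.1) p.2.2 := by
  refine continuous_of_dominated (bound := fun z => |q z| * C) (fun p => ?_) (fun p => ?_)
    (hq.integrable.abs.mul_const C) (Eventually.of_forall fun z => ?_)
  · exact (hq.continuous.mul ((hg.slice p.1).comp (by fun_prop))).aestronglyMeasurable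
  · refine Eventually.of_forall fun z => ?_
    rw [Real.norm_eq_abs, abs_mul]
    exact mul_le_mul_of_nonneg_left (hg.le hW _ _) (abs_nonneg _)
  · refine continuous_const.mul (hg.cont.comp (f := fun p : ℝ × ℝ × Spc n =>
      (p.1, p.2.2 + p.2.1 • z)) (by fun_prop))

theorem tq_bound (hq : Ker q) (hW : 0 ≤ W) (c₀ : ℝ) (hc₀ : 0 ≤ c₀) :
    ∃ A : ℝ, 0 ≤ A ∧ ∀ (C : ℝ) (g : ℝ → Spc n → ℝ), Dat W C g → ∀ c, 0 ≤ c → c ≤ c₀ → ∀ τ x,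
      |Tq q c (g τ) x| ≤ A * C * wt x ^ (-W) := by
  obtain ⟨A, hA, h⟩ := hq.decay W
  have hI : 0 ≤ ∫ z : Spc n, maj z := integral_nonneg fun z => (maj_pos z).le
  refine ⟨(1 + c₀) ^ W * (∫ z : Spc n, maj z) * A, by positivity,
    fun C g hg c hc hcc τ x => ?_⟩
  exact weighted_integral_bound hW hA (fun z => (h z).1) hg.nonneg (hg.bd τ) hc hcc x

theorem tq_sub_space (hq : Ker q) (hW : 0 ≤ W) (c₀ : ℝ) (hc₀ : 0 ≤ c₀) :
    ∃ A : ℝ, 0 ≤ A ∧ ∀ (C : ℝ) (g : ℝ → Spc n → ℝ), Dat W C g → ∀ c, 0 < c → c ≤ c₀ →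
      ∀ lam : ℝ, 0 ≤ lam → lam ≤ 1 → ∀ τ x y,
      |Tq q c (g τ) x - Tq q c (g τ) y| ≤
        A * C * (wt x ^ (-W) + wt y ^ (-W)) * (‖x - y‖ / c) ^ lam := by
  obtain ⟨A, hA, h⟩ := hq.sub_translate W hW
  obtain ⟨B, hB, h'⟩ := tq_bound hq hW c₀ hc₀
  have hI : 0 ≤ ∫ z : Spc n, maj z := integral_nonneg fun z => (maj_pos z).le
  refine ⟨(1 + c₀) ^ W * (∫ z : Spc n, maj z) * A + B, by positivity,
    fun C g hg c hc hcc lam hl0 hl1 τ x y => ?_⟩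
  have hC := hg.nonneg
  have hx := wt_rpow_pos (-W) x
  have hy := wt_rpow_pos (-W) y
  have hD : 0 ≤ (1 + c₀) ^ W * (∫ z : Spc n, maj z) * A := by positivity
  rcases le_total (‖x - y‖ / c) 1 with hle | hle
  · set a : Spc n := c⁻¹ • (x - y) with ha
    have hna : ‖a‖ = ‖x - y‖ / c := by
      rw [ha, norm_smul, norm_inv, Real.norm_eq_abs, abs_of_pos hc, inv_mul_eq_div]
    have e1 : Tq q c (g τ) y = ∫ z, q (z + a) * g τ (x + c • z) := by
      rw [Tq, ← integral_add_right_eq_self _ a]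
      refine integral_congr_ae (Eventually.of_forall fun z => ?_)
      have : y + c • (z + a) = x + c • z := by
        rw [ha, smul_add, smul_smul, mul_inv_cancel₀ hc.ne', one_smul]; abel
      simp only [this]
    have hcont : Continuous fun z : Spc n => g τ (x + c • z) := (hg.slice τ).comp (by fun_prop)
    have hi1 := hq.integrable_mul hcont fun z => hg.le hW τ _
    have hi2 : Integrable fun z => q (z + a) * g τ (x + c • z) := by
      have := (hq.integrable.comp_add_right a).bdd_mul (c := C) hcont.aestronglyMeasurable
        (Eventually.of_forall fun z => hg.le hW τ _)
      simpa only [mul_comm] using this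
    rw [e1, Tq, ← integral_sub hi1 hi2]
    simp only [← sub_mul]
    have := weighted_integral_bound hW (Q := fun z => q z - q (z + a)) (by positivity)
      (fun z => h a (hna.trans_le hle) z) hC (hg.bd τ) hc.le hcc x
    refine this.trans ?_
    rw [hna]
    have h1 : ‖x - y‖ / c ≤ (‖x - y‖ / c) ^ lam :=
      Real.self_le_rpow_of_le_one (by positivity) hle hl1
    calc _ = (1 + c₀) ^ W * (∫ z : Spc n, maj z) * A * C * wt x ^ (-W) * (‖x - y‖ / c) := by ring
      _ ≤ ((1 + c₀) ^ W * (∫ z : Spc n, maj z) * A + B) * C * (wt x ^ (-W) + wt y ^ (-W)) *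
          (‖x - y‖ / c) ^ lam := by
        refine mul_le_mul (mul_le_mul (mul_le_mul_of_nonneg_right (by linarith) hC)
          (by linarith) hx.le (by positivity)) h1 (by positivity) (by positivity)
  · have h1 := h' C g hg c hc.le hcc τ x
    have h2 := h' C g hg c hc.le hcc τ y
    have h3 := Real.one_le_rpow hle hl0
    have h4 := abs_sub (Tq q c (g τ) x) (Tq q c (g τ) y)
    calc _ ≤ B * C * (wt x ^ (-W) + wt y ^ (-W)) * 1 := by linarith
      _ ≤ _ := mul_le_mul (mul_le_mul_of_nonneg_right
          (mul_le_mul_of_nonneg_right (by linarith) hC) (by positivity)) h3 zero_le_one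
          (by positivity)

theorem tq_rescale {c c' : ℝ} (hc : 0 < c) (hc' : 0 < c') (G : Spc n → ℝ) (x : Spc n) :
    Tq q c' G x = (c / c') ^ n * ∫ z, q ((c / c') • z) * G (x + c • z) := by
  have h := Measure.integral_comp_smul_of_nonneg volume
    (fun z : Spc n => q z * G (x + c' • z)) (c / c') (hR := by positivity)
  rw [finrank_euclideanSpace_fin, smul_eq_mul] at h
  have e : ∀ z : Spc n, c' • (c / c') • z = c • z := fun z => by
    rw [smul_smul, mul_div_cancel₀ _ hc'.ne']
  simp only [e] at h
  rw [h, ← mul_assoc, mul_inv_cancel₀ (by positivity), one_mul, Tq]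

theorem tq_sub_scale (hq : Ker q) (hW : 0 ≤ W) (c₀ : ℝ) (hc₀ : 0 ≤ c₀) :
    ∃ A : ℝ, 0 ≤ A ∧ ∀ (C : ℝ) (g : ℝ → Spc n → ℝ), Dat W C g → ∀ c c', 0 < c → c ≤ c' →
      c' ≤ c₀ → ∀ τ x,
      |c'⁻¹ * Tq q c' (g τ) x - c⁻¹ * Tq q c (g τ) x| ≤
        A * C * wt x ^ (-W) * c⁻¹ * (1 - c / c') := by
  obtain ⟨A, hA, h⟩ := hq.sub_dilate W hW
  obtain ⟨B, hB, h'⟩ := tq_bound hq hW c₀ hc₀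
  have hI : 0 ≤ ∫ z : Spc n, maj z := integral_nonneg fun z => (maj_pos z).le
  refine ⟨(1 + c₀) ^ W * (∫ z : Spc n, maj z) * A + 4 * B, by positivity,
    fun C g hg c c' hc hcc hcc₀ τ x => ?_⟩
  have hC := hg.nonneg
  have hx := wt_rpow_pos (-W) x
  have hc' : 0 < c' := hc.trans_le hcc
  have hD : 0 ≤ (1 + c₀) ^ W * (∫ z : Spc n, maj z) * A := by positivity
  have hr1 : c / c' ≤ 1 := (div_le_one hc').2 hcc
  rcases le_total (1 / 2) (c / c') with hr | hr
  · set r := c / c' with hrdef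
    have hr0 : 0 < r := by positivity
    have hcont : Continuous fun z : Spc n => g τ (x + c • z) := (hg.slice τ).comp (by fun_prop)
    have hi1 := hq.integrable_mul hcont fun z => hg.le hW τ _
    have hi2 : Integrable fun z => r ^ (n + 1) * q (r • z) * g τ (x + c • z) := by
      have := ((hq.integrable.comp_smul hr0.ne').const_mul (r ^ (n + 1))).bdd_mul (c := C)
        hcont.aestronglyMeasurable (Eventually.of_forall fun z => hg.le hW τ _)
      simpa only [mul_comm, mul_left_comm] using this
    have e1 : c'⁻¹ * Tq q c' (g τ) x = c⁻¹ * ∫ z, r ^ (n + 1) * q (r • z) * g τ (x + c • z) := by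
      rw [tq_rescale hc hc']
      simp only [mul_assoc]
      rw [integral_const_mul, pow_succ]
      have : c'⁻¹ = c⁻¹ * r := by rw [hrdef]; field_simp
      rw [this]
      ring
    rw [e1, Tq, ← mul_sub, ← integral_sub hi2 hi1, abs_mul, abs_of_pos (inv_pos.2 hc)]
    simp only [← sub_mul]
    have := weighted_integral_bound hW (Q := fun z => r ^ (n + 1) * q (r • z) - q z)
      (mul_nonneg hA (sub_nonneg.2 hr1)) (fun z => h r hr hr1 z) hC (hg.bd τ) hc.le
      (hcc.trans hcc₀) x
    refine (mul_le_mul_of_nonneg_left this (inv_pos.2 hc).le).trans ?_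
    calc _ = (1 + c₀) ^ W * (∫ z : Spc n, maj z) * A * C * wt x ^ (-W) * c⁻¹ * (1 - r) := by ring
      _ ≤ _ := by
        have : 0 ≤ 1 - r := sub_nonneg.2 hr1
        gcongr
        linarith
  · have h1 := h' C g hg c hc.le (hcc.trans hcc₀) τ x
    have h2 := h' C g hg c' hc'.le hcc₀ τ x
    have h4 := abs_sub (c'⁻¹ * Tq q c' (g τ) x) (c⁻¹ * Tq q c (g τ) x)
    rw [abs_mul, abs_mul, abs_of_pos (inv_pos.2 hc), abs_of_pos (inv_pos.2 hc')] at h4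
    have h5 : c'⁻¹ ≤ c⁻¹ := inv_anti₀ hc hcc
    have h6 : c'⁻¹ * |Tq q c' (g τ) x| ≤ c⁻¹ * (B * C * wt x ^ (-W)) :=
      mul_le_mul h5 h2 (abs_nonneg _) (inv_pos.2 hc).le
    have h7 := mul_le_mul_of_nonneg_left h1 (inv_pos.2 hc).le
    have h8 : (1 : ℝ) / 2 ≤ 1 - c / c' := by linarith
    calc _ ≤ 4 * B * C * wt x ^ (-W) * c⁻¹ * (1 / 2) := by linarith
      _ ≤ _ := by
        have hi := (inv_pos.2 hc).le
        gcongr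
        linarith

end HeatScaling

section Potential

variable {W C : ℝ} {g : ℝ → Spc n → ℝ} {q : Spc n → ℝ} {μ : ℝ} {ρ : ℝ → ℝ}

/-- Parabolic potential with kernel profile `q` and scalar factor `ρ`. -/
def pot (q : Spc n → ℝ) (ρ : ℝ → ℝ) (μ : ℝ) (g : ℝ → Spc n → ℝ) (t : ℝ) (x : Spc n) : ℝ :=
  ∫ τ in (0 : ℝ)..t, ρ (t - τ) * Tq q (cc μ (t - τ)) (g τ) x

/-- Scalar factors for which `pot` converges. -/
def Rho (ρ : ℝ → ℝ) : Prop :=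
  ∀ t a b : ℝ, a ≤ t → b ≤ t → IntervalIntegrable (fun τ => ρ (t - τ)) volume a b

theorem rho_one : Rho fun _ => 1 := fun _ _ _ _ _ => intervalIntegrable_const

theorem rho_cc (hμ : 0 < μ) : Rho fun σ => (cc μ σ)⁻¹ :=
  fun _ _ _ ha hb => cc_inv_intervalIntegrable hμ hb ha

theorem pot_intervalIntegrable (hq : Ker q) (hW : 0 ≤ W) (hg : Dat W C g) (hρ : Rho ρ) (μ : ℝ)
    {t a b : ℝ} (ha : a ≤ t) (hb : b ≤ t) (x : Spc n) :
    IntervalIntegrable (fun τ => ρ (t - τ) * Tq q (cc μ (t - τ)) (g τ) x) volume a b := by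
  refine (hρ t a b ha hb).mul_continuousOn (Continuous.continuousOn ?_)
  have := continuous_cc μ
  exact (tq_continuous hq hW hg).comp (f := fun τ : ℝ => (τ, cc μ (t - τ), x)) (by fun_prop)

theorem cc_le (hμ : 0 < μ) {σ T : ℝ} (h : σ ≤ T) : cc μ σ ≤ cc μ T := cc_mono hμ h

/-- The Riesz-type constant of the singular time integral. -/
theorem grd_sup (hq : Ker q) (hμ : 0 < μ) (hW : 0 ≤ W) {T : ℝ} (hT : 0 < T) :
    ∃ A : ℝ, 0 ≤ A ∧ ∀ C g, Dat W C g → ∀ t ∈ Set.Icc (0 : ℝ) T, ∀ x,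
      |pot q (fun σ => (cc μ σ)⁻¹) μ g t x| ≤ A * C * wt x ^ (-W) := by
  obtain ⟨A, hA, h⟩ := tq_bound hq hW (cc μ T) (cc_nonneg μ T)
  set K : ℝ := (2 * μ) ^ (-(1 / 2 : ℝ)) with hK
  have hK0 : 0 < K := Real.rpow_pos_of_pos (by linarith) _
  refine ⟨A * K * (T ^ (1 - 1 / 2 : ℝ) / (1 - 1 / 2)), by positivity, fun C g hg t ht x => ?_⟩
  have hx := wt_rpow_pos (-W) x
  have hC := hg.nonneg
  have hb : ∀ τ ∈ Set.Ioc 0 t, ‖(cc μ (t - τ))⁻¹ * Tq q (cc μ (t - τ)) (g τ) x‖ ≤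
      A * C * wt x ^ (-W) * K * (t - τ) ^ (-(1 / 2 : ℝ)) := by
    intro τ hτ
    have hσ : 0 ≤ t - τ := by linarith [hτ.2]
    rw [Real.norm_eq_abs, abs_mul, abs_of_nonneg (inv_nonneg.2 (cc_nonneg _ _)), cc_inv hμ hσ]
    have := h C g hg (cc μ (t - τ)) (cc_nonneg _ _) (cc_le hμ (by linarith [hτ.1, ht.2])) τ x
    calc _ ≤ K * (t - τ) ^ (-(1 / 2 : ℝ)) * (A * C * wt x ^ (-W)) := by gcongr
      _ = _ := by ring
  have h1 := intervalIntegral.norm_integral_le_of_norm_le ht.1 (Eventually.of_forall hb)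
    ((sing_intervalIntegrable (κ := 1 / 2) (by norm_num) t 0 t).const_mul _)
  rw [intervalIntegral.integral_const_mul] at h1
  have h2 := sing_integral_le (κ := 1 / 2) (T := T) (by norm_num) ht.1 (by linarith [ht.2])
  have h3 : 0 ≤ A * C * wt x ^ (-W) * K := by positivity
  have h4 := mul_le_mul_of_nonneg_left h2 h3
  rw [pot, ← Real.norm_eq_abs]
  linarith

theorem vol_sup (hq : Ker q) (hμ : 0 < μ) (hW : 0 ≤ W) {T : ℝ} (hT : 0 < T) :
    ∃ A : ℝ, 0 ≤ A ∧ ∀ C g, Dat W C g → ∀ t ∈ Set.Icc (0 : ℝ) T, ∀ x,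
      |pot q (fun _ => 1) μ g t x| ≤ A * C * wt x ^ (-W) := by
  obtain ⟨A, hA, h⟩ := tq_bound hq hW (cc μ T) (cc_nonneg μ T)
  refine ⟨A * T, by positivity, fun C g hg t ht x => ?_⟩
  have hx := wt_rpow_pos (-W) x
  have hC := hg.nonneg
  have hb : ∀ τ ∈ Set.uIoc 0 t, ‖1 * Tq q (cc μ (t - τ)) (g τ) x‖ ≤ A * C * wt x ^ (-W) := by
    intro τ hτ
    rw [Set.uIoc_of_le ht.1] at hτ
    rw [Real.norm_eq_abs, one_mul]
    exact h C g hg (cc μ (t - τ)) (cc_nonneg _ _) (cc_le hμ (by linarith [hτ.1, ht.2])) τ x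
  have h1 := intervalIntegral.norm_integral_le_of_norm_le_const hb
  rw [pot, ← Real.norm_eq_abs]
  refine h1.trans ?_
  rw [sub_zero, abs_of_nonneg ht.1]
  have h3 : 0 ≤ A * C * wt x ^ (-W) := by positivity
  nlinarith [mul_le_mul_of_nonneg_left ht.2 h3]

theorem grd_space (hq : Ker q) (hμ : 0 < μ) (hW : 0 ≤ W) {T lam : ℝ} (hT : 0 < T)
    (hl0 : 0 ≤ lam) (hl1 : lam < 1) :
    ∃ A : ℝ, 0 ≤ A ∧ ∀ C g, Dat W C g → ∀ t ∈ Set.Icc (0 : ℝ) T, ∀ x y,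
      |pot q (fun σ => (cc μ σ)⁻¹) μ g t x - pot q (fun σ => (cc μ σ)⁻¹) μ g t y| ≤
        A * C * (wt x ^ (-W) + wt y ^ (-W)) * ‖x - y‖ ^ lam := by
  obtain ⟨A, hA, h⟩ := tq_sub_space hq hW (cc μ T) (cc_nonneg μ T)
  set κ : ℝ := (1 + lam) / 2 with hκ
  have hκ1 : κ < 1 := by rw [hκ]; linarith
  set K : ℝ := (2 * μ) ^ (-κ) with hK
  have hK0 : 0 < K := Real.rpow_pos_of_pos (by linarith) _
  have hκ0 : 0 < 1 - κ := by linarith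
  refine ⟨A * K * (T ^ (1 - κ) / (1 - κ)), by positivity, fun C g hg t ht x y => ?_⟩
  have hx := wt_rpow_pos (-W) x
  have hy := wt_rpow_pos (-W) y
  have hC := hg.nonneg
  have hD : 0 ≤ ‖x - y‖ ^ lam := by positivity
  have hb : ∀ τ ∈ Set.Ioo 0 t, ‖(cc μ (t - τ))⁻¹ * Tq q (cc μ (t - τ)) (g τ) x -
      (cc μ (t - τ))⁻¹ * Tq q (cc μ (t - τ)) (g τ) y‖ ≤
      A * C * (wt x ^ (-W) + wt y ^ (-W)) * ‖x - y‖ ^ lam * K * (t - τ) ^ (-κ) := by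
    intro τ hτ
    have hσ : 0 < t - τ := by linarith [hτ.2]
    have hc := cc_pos hμ hσ
    rw [← mul_sub, Real.norm_eq_abs, abs_mul, abs_of_nonneg (inv_nonneg.2 hc.le)]
    have h1 := h C g hg (cc μ (t - τ)) hc (cc_le hμ (by linarith [hτ.1, ht.2])) lam hl0 hl1.le τ x y
    have h2 : (cc μ (t - τ))⁻¹ * (‖x - y‖ / cc μ (t - τ)) ^ lam =
        ‖x - y‖ ^ lam * (K * (t - τ) ^ (-κ)) := by
      have h3 := cc_rpow hμ hσ.le (1 + lam)
      rw [← hκ] at h3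
      rw [hK, ← h3, Real.div_rpow (norm_nonneg _) hc.le, Real.rpow_neg hc.le,
        Real.rpow_add hc, Real.rpow_one]
      field_simp
    calc _ ≤ (cc μ (t - τ))⁻¹ * (A * C * (wt x ^ (-W) + wt y ^ (-W)) *
          (‖x - y‖ / cc μ (t - τ)) ^ lam) :=
          mul_le_mul_of_nonneg_left h1 (inv_nonneg.2 hc.le)
      _ = A * C * (wt x ^ (-W) + wt y ^ (-W)) *
          ((cc μ (t - τ))⁻¹ * (‖x - y‖ / cc μ (t - τ)) ^ lam) := by ring
      _ = _ := by rw [h2]; ring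
  have hb' : ∀ᵐ τ ∂volume, τ ∈ Set.Ioc 0 t → ‖(cc μ (t - τ))⁻¹ * Tq q (cc μ (t - τ)) (g τ) x -
      (cc μ (t - τ))⁻¹ * Tq q (cc μ (t - τ)) (g τ) y‖ ≤
      A * C * (wt x ^ (-W) + wt y ^ (-W)) * ‖x - y‖ ^ lam * K * (t - τ) ^ (-κ) := by
    filter_upwards [Measure.ae_ne volume t] with τ hτ hτ'
    exact hb τ ⟨hτ'.1, lt_of_le_of_ne hτ'.2 hτ⟩
  have h1 := intervalIntegral.norm_integral_le_of_norm_le ht.1 hb'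
    ((sing_intervalIntegrable hκ1 t 0 t).const_mul _)
  rw [intervalIntegral.integral_const_mul] at h1
  have h2 := sing_integral_le (T := T) hκ1 ht.1 (by linarith [ht.2])
  have h3 : 0 ≤ A * C * (wt x ^ (-W) + wt y ^ (-W)) * ‖x - y‖ ^ lam * K := by positivity
  have h4 := mul_le_mul_of_nonneg_left h2 h3
  rw [pot, pot, ← intervalIntegral.integral_sub
    (pot_intervalIntegrable hq hW hg (rho_cc hμ) μ ht.1 le_rfl x)
    (pot_intervalIntegrable hq hW hg (rho_cc hμ) μ ht.1 le_rfl y), ← Real.norm_eq_abs]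
  linarith

theorem grd_time_aux (hq : Ker q) (hμ : 0 < μ) (hW : 0 ≤ W) {T lam : ℝ} (hT : 0 < T)
    (hl0 : 0 < lam) (hl1 : lam < 1) :
    ∃ A : ℝ, 0 ≤ A ∧ ∀ C g, Dat W C g → ∀ t' t, 0 ≤ t' → t' ≤ t → t ≤ T → ∀ x,
      |pot q (fun σ => (cc μ σ)⁻¹) μ g t x - pot q (fun σ => (cc μ σ)⁻¹) μ g t' x| ≤
        A * C * wt x ^ (-W) * (t - t') ^ (lam / 2) := by
  obtain ⟨A, hA, h⟩ := tq_sub_scale hq hW (cc μ T) (cc_nonneg μ T)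
  obtain ⟨B, hB, h'⟩ := tq_bound hq hW (cc μ T) (cc_nonneg μ T)
  set κ : ℝ := (1 + lam) / 2 with hκ
  have hκ1 : κ < 1 := by rw [hκ]; linarith
  set K : ℝ := (2 * μ) ^ (-(1 / 2 : ℝ)) with hK
  have hK0 : 0 < K := Real.rpow_pos_of_pos (by linarith) _
  have hκ0 : 0 < 1 - κ := by linarith
  refine ⟨(A + B) * K * (T ^ (1 - κ) / (1 - κ)), by positivity, fun C g hg t' t h0 htt htT x => ?_⟩
  have hx := wt_rpow_pos (-W) x
  have hC := hg.nonneg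
  set H : ℝ := (t - t') ^ (lam / 2) with hH
  have hH0 : 0 ≤ H := Real.rpow_nonneg (by linarith) _
  have e1 : pot q (fun σ => (cc μ σ)⁻¹) μ g t x - pot q (fun σ => (cc μ σ)⁻¹) μ g t' x =
      (∫ τ in (0 : ℝ)..t', ((cc μ (t - τ))⁻¹ * Tq q (cc μ (t - τ)) (g τ) x -
        (cc μ (t' - τ))⁻¹ * Tq q (cc μ (t' - τ)) (g τ) x)) +
      ∫ τ in t'..t, (cc μ (t - τ))⁻¹ * Tq q (cc μ (t - τ)) (g τ) x := by
    rw [intervalIntegral.integral_sub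
      (pot_intervalIntegrable hq hW hg (rho_cc hμ) μ (h0.trans htt) htt x)
      (pot_intervalIntegrable hq hW hg (rho_cc hμ) μ h0 le_rfl x), pot, pot,
      ← intervalIntegral.integral_add_adjacent_intervals
        (pot_intervalIntegrable hq hW hg (rho_cc hμ) μ (h0.trans htt) htt x)
        (pot_intervalIntegrable hq hW hg (rho_cc hμ) μ htt le_rfl x)]
    ring
  have hb1 : ∀ᵐ τ ∂volume, τ ∈ Set.Ioc 0 t' →
      ‖(cc μ (t - τ))⁻¹ * Tq q (cc μ (t - τ)) (g τ) x -
        (cc μ (t' - τ))⁻¹ * Tq q (cc μ (t' - τ)) (g τ) x‖ ≤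
        A * C * wt x ^ (-W) * K * H * (t' - τ) ^ (-κ) := by
    filter_upwards [Measure.ae_ne volume t'] with τ hτ hτ'
    have hσ : 0 < t' - τ := sub_pos.2 (lt_of_le_of_ne hτ'.2 hτ)
    have hσ2 : 0 < t - τ := by linarith
    have h1 := h C g hg (cc μ (t' - τ)) (cc μ (t - τ)) (cc_pos hμ hσ) (cc_mono hμ (by linarith))
      (cc_mono hμ (by linarith [hτ'.1])) τ x
    rw [Real.norm_eq_abs]
    refine h1.trans ?_
    have hcp := cc_pos hμ hσ
    have hcp2 := cc_pos hμ hσ2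
    have hr1 : cc μ (t' - τ) / cc μ (t - τ) ≤ 1 := (div_le_one hcp2).2 (cc_mono hμ (by linarith))
    have hr0 : 0 ≤ cc μ (t' - τ) / cc μ (t - τ) := by positivity
    have h2 : 1 - cc μ (t' - τ) / cc μ (t - τ) ≤ ((t - t') / (t' - τ)) ^ (lam / 2) := by
      have hsq : 1 - cc μ (t' - τ) / cc μ (t - τ) ≤ (t - t') / (t - τ) := by
        have : (cc μ (t' - τ) / cc μ (t - τ)) ^ 2 = 1 - (t - t') / (t - τ) := by
          rw [div_pow, cc_sq hμ hσ.le, cc_sq hμ hσ2.le]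
          field_simp
          ring
        nlinarith
      have hle1 : (t - t') / (t - τ) ≤ 1 := (div_le_one hσ2).2 (by linarith)
      have hn : 0 ≤ (t - t') / (t - τ) := div_nonneg (by linarith) hσ2.le
      refine hsq.trans ?_
      calc (t - t') / (t - τ) ≤ ((t - t') / (t - τ)) ^ (lam / 2) := by
            conv_lhs => rw [← Real.rpow_one ((t - t') / (t - τ))]
            exact Real.rpow_le_rpow_of_exponent_ge' hn hle1 (by linarith) (by linarith)
        _ ≤ _ := by
            refine Real.rpow_le_rpow hn ?_ (by linarith)
            exact div_le_div_of_nonneg_left (by linarith) hσ (by linarith)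
    have h3 : (cc μ (t' - τ))⁻¹ * ((t - t') / (t' - τ)) ^ (lam / 2) = K * H * (t' - τ) ^ (-κ) := by
      rw [cc_inv hμ hσ.le, Real.div_rpow (by linarith) hσ.le, hκ,
        show -((1 + lam) / 2) = -(1 / 2) - lam / 2 by ring, Real.rpow_sub hσ]
      ring
    have h4 : 0 ≤ A * C * wt x ^ (-W) := by positivity
    calc _ ≤ A * C * wt x ^ (-W) * (cc μ (t' - τ))⁻¹ * ((t - t') / (t' - τ)) ^ (lam / 2) :=
          mul_le_mul_of_nonneg_left h2 (by positivity)
      _ = A * C * wt x ^ (-W) * ((cc μ (t' - τ))⁻¹ * ((t - t') / (t' - τ)) ^ (lam / 2)) := by ring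
      _ = _ := by rw [h3]; ring
  have hb2 : ∀ᵐ τ ∂volume, τ ∈ Set.Ioc t' t →
      ‖(cc μ (t - τ))⁻¹ * Tq q (cc μ (t - τ)) (g τ) x‖ ≤
        B * C * wt x ^ (-W) * K * H * (t - τ) ^ (-κ) := by
    filter_upwards [Measure.ae_ne volume t] with τ hτ hτ'
    have hσ : 0 < t - τ := sub_pos.2 (lt_of_le_of_ne hτ'.2 hτ)
    rw [Real.norm_eq_abs, abs_mul, abs_of_nonneg (inv_nonneg.2 (cc_nonneg _ _)), cc_inv hμ hσ.le]
    have h1 := h' C g hg (cc μ (t - τ)) (cc_nonneg _ _) (cc_le hμ (by linarith [hτ'.1])) τ x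
    have h2 : (t - τ) ^ (-(1 / 2) : ℝ) ≤ H * (t - τ) ^ (-κ) := by
      calc (t - τ) ^ (-(1 / 2) : ℝ) = (t - τ) ^ (lam / 2) * (t - τ) ^ (-κ) := by
            rw [← Real.rpow_add hσ, hκ]; ring_nf
        _ ≤ _ := by
            refine mul_le_mul_of_nonneg_right ?_ (by positivity)
            exact Real.rpow_le_rpow hσ.le (by linarith [hτ'.1]) (by linarith)
    calc _ ≤ K * (H * (t - τ) ^ (-κ)) * (B * C * wt x ^ (-W)) := by gcongr
      _ = _ := by ring
  have n1 := intervalIntegral.norm_integral_le_of_norm_le h0 hb1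
    ((sing_intervalIntegrable hκ1 t' 0 t').const_mul _)
  have n2 := intervalIntegral.norm_integral_le_of_norm_le htt hb2
    ((sing_intervalIntegrable hκ1 t t' t).const_mul _)
  rw [intervalIntegral.integral_const_mul] at n1 n2
  have s1 := sing_integral_le (T := T) hκ1 h0 (by linarith)
  have s2 := sing_integral_le (T := T) hκ1 htt (by linarith)
  have p1 : 0 ≤ A * C * wt x ^ (-W) * K * H := by positivity
  have p2 : 0 ≤ B * C * wt x ^ (-W) * K * H := by positivity
  have m1 := mul_le_mul_of_nonneg_left s1 p1
  have m2 := mul_le_mul_of_nonneg_left s2 p2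
  rw [e1]
  refine (abs_add_le _ _).trans ?_
  rw [← Real.norm_eq_abs, ← Real.norm_eq_abs]
  linarith

/-- The gradient-type potential maps bounded data to Hölder functions. -/
theorem grd_HB (hq : Ker q) (hμ : 0 < μ) (hW : 0 ≤ W) {T lam : ℝ} (hT : 0 < T)
    (hl0 : 0 < lam) (hl1 : lam < 1) :
    ∃ A : ℝ, 0 ≤ A ∧ ∀ C g, Dat W C g →
      HB T lam W (A * C) (pot q (fun σ => (cc μ σ)⁻¹) μ g) := by
  obtain ⟨A₁, hA₁, h₁⟩ := grd_sup hq hμ hW hT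
  obtain ⟨A₂, hA₂, h₂⟩ := grd_space hq hμ hW hT hl0.le hl1
  obtain ⟨A₃, hA₃, h₃⟩ := grd_time_aux hq hμ hW hT hl0 hl1
  refine ⟨A₁ + A₂ + A₃, by positivity, fun C g hg => ⟨fun t ht x => ?_, fun t ht x y => ?_,
    fun t ht t' ht' x => ?_⟩⟩
  · refine (h₁ C g hg t ht x).trans ?_
    have := wt_rpow_pos (-W) x
    have := hg.nonneg
    gcongr
    linarith
  · refine (h₂ C g hg t ht x y).trans ?_
    have := wt_rpow_pos (-W) x
    have := wt_rpow_pos (-W) y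
    have := hg.nonneg
    gcongr
    linarith
  · have := wt_rpow_pos (-W) x
    have := hg.nonneg
    rcases le_total t' t with hle | hle
    · refine (h₃ C g hg t' t ht'.1 hle ht.2 x).trans ?_
      rw [abs_of_nonneg (sub_nonneg.2 hle)]
      have : 0 ≤ t - t' := sub_nonneg.2 hle
      gcongr
      linarith
    · rw [abs_sub_comm, abs_sub_comm t]
      refine (h₃ C g hg t t' ht.1 hle ht'.2 x).trans ?_
      rw [abs_of_nonneg (sub_nonneg.2 hle)]
      have : 0 ≤ t' - t := sub_nonneg.2 hle
      gcongr
      linarith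

end Potential

section PotentialDerivatives

variable {W C : ℝ} {g : ℝ → Spc n → ℝ} {gi : Fin n → ℝ → Spc n → ℝ} {q : Spc n → ℝ} {μ : ℝ}
  {ρ : ℝ → ℝ}

theorem Ker.integrable_comp (hq : Ker q) {G : Spc n → ℝ} (hG : Continuous G) {B : ℝ}
    (hB : ∀ z, |G z| ≤ B) (c : ℝ) (x : Spc n) : Integrable fun z => q z * G (x + c • z) :=
  hq.integrable_mul (hG.comp (by fun_prop)) (B := B) fun _ => hB _

theorem tq_hasFDerivAt (hq : Ker q) {G : Spc n → ℝ} {G' : Fin n → Spc n → ℝ} {B : ℝ}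
    (hG : ∀ y, HasFDerivAt G (∑ i, G' i y • (EuclideanSpace.proj i : Spc n →L[ℝ] ℝ)) y)
    (hB : ∀ y, |G y| ≤ B) (hc : ∀ i, Continuous (G' i)) (hB' : ∀ i y, |G' i y| ≤ B)
    (c : ℝ) (x : Spc n) :
    HasFDerivAt (Tq q c G)
      (∑ i, Tq q c (G' i) x • (EuclideanSpace.proj i : Spc n →L[ℝ] ℝ)) x := by
  have hGc : Continuous G := continuous_iff_continuousAt.2 fun y => (hG y).continuousAt
  have h := hasFDerivAt_integral_of_dominated_of_fderiv_le (𝕜 := ℝ) (μ := volume)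
    (F := fun x z => q z * G (x + c • z)) (x₀ := x) (s := Set.univ)
    (F' := fun x z => ∑ i, (q z * G' i (x + c • z)) •
      (EuclideanSpace.proj i : Spc n →L[ℝ] ℝ)) (bound := fun z => |q z| * (n * B)) univ_mem
    (Eventually.of_forall fun y => (hq.integrable_comp hGc hB c y).aestronglyMeasurable)
    (hq.integrable_comp hGc hB c x) ?_ ?_ (hq.integrable.abs.mul_const _) ?_
  · refine h.congr_fderiv ?_
    rw [integral_finsetSum _ fun i _ =>
      (hq.integrable_comp (hc i) (hB' i) c x).smul_const _]
    exact Finset.sum_congr rfl fun i _ => integral_smul_const _ _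
  · refine Continuous.aestronglyMeasurable ?_
    have := hq.continuous
    refine continuous_finsetSum _ fun i _ => Continuous.smul (hq.continuous.mul ?_) continuous_const
    exact (hc i).comp (by fun_prop)
  · refine Eventually.of_forall fun z y _ => ?_
    have e : ∑ i, (q z * G' i (y + c • z)) • (EuclideanSpace.proj i : Spc n →L[ℝ] ℝ) =
        q z • ∑ i, G' i (y + c • z) • (EuclideanSpace.proj i : Spc n →L[ℝ] ℝ) := by
      simp only [Finset.smul_sum, smul_smul]
    rw [e, norm_smul, Real.norm_eq_abs]
    exact mul_le_mul_of_nonneg_left (norm_grad_le _ fun i => hB' i _) (abs_nonneg _)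
  · refine Eventually.of_forall fun z y _ => ?_
    have h1 : HasFDerivAt (fun y : Spc n => y + c • z) (ContinuousLinearMap.id ℝ (Spc n)) y :=
      (hasFDerivAt_id y).add_const _
    have h2 := ((hG (y + c • z)).comp y h1).const_mul (q z)
    refine h2.congr_fderiv ?_
    rw [ContinuousLinearMap.comp_id, Finset.smul_sum]
    simp only [smul_smul]

theorem abs_tq_le (hq : Ker q) {G : Spc n → ℝ} {B : ℝ} (hB : ∀ y, |G y| ≤ B) (c : ℝ) (x : Spc n) :
    |Tq q c G x| ≤ (∫ z, |q z|) * B := by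
  rw [← integral_mul_const, ← Real.norm_eq_abs]
  refine norm_integral_le_of_norm_le (hq.integrable.abs.mul_const _)
    (Eventually.of_forall fun z => ?_)
  rw [Real.norm_eq_abs, abs_mul]
  exact mul_le_mul_of_nonneg_left (hB _) (abs_nonneg _)

theorem pot_hasFDerivAt (hq : Ker q) (hρ : Rho ρ) (hW : 0 ≤ W) (hg : Dat W C g)
    (hgi : ∀ i, Dat W C (gi i))
    (hgr : ∀ τ y, HasFDerivAt (g τ) (∑ i, gi i τ y • (EuclideanSpace.proj i : Spc n →L[ℝ] ℝ)) y)
    {t : ℝ} (ht : 0 ≤ t) (x : Spc n) :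
    HasFDerivAt (pot q ρ μ g t)
      (∑ i, pot q ρ μ (gi i) t x • (EuclideanSpace.proj i : Spc n →L[ℝ] ℝ)) x := by
  have hgint : ∀ i, IntervalIntegrable (fun τ => ρ (t - τ) * Tq q (cc μ (t - τ)) (gi i τ) x)
      volume 0 t := fun i => pot_intervalIntegrable hq hW (hgi i) hρ μ ht le_rfl x
  have hgint' : ∀ i, IntervalIntegrable (fun τ => (ρ (t - τ) * Tq q (cc μ (t - τ)) (gi i τ) x) •
      (EuclideanSpace.proj i : Spc n →L[ℝ] ℝ)) volume 0 t := fun i =>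
    ⟨(hgint i).1.smul_const _, (hgint i).2.smul_const _⟩
  have h := intervalIntegral.hasFDerivAt_integral_of_dominated_of_fderiv_le (𝕜 := ℝ)
    (μ := volume) (a := 0) (b := t) (s := Set.univ) (x₀ := x)
    (F := fun x τ => ρ (t - τ) * Tq q (cc μ (t - τ)) (g τ) x)
    (F' := fun x τ => ∑ i, (ρ (t - τ) * Tq q (cc μ (t - τ)) (gi i τ) x) •
      (EuclideanSpace.proj i : Spc n →L[ℝ] ℝ))
    (bound := fun τ => |ρ (t - τ)| * (n * ((∫ z, |q z|) * C))) univ_mem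
    (Eventually.of_forall fun y =>
      (pot_intervalIntegrable hq hW hg hρ μ ht le_rfl y).def'.aestronglyMeasurable)
    (pot_intervalIntegrable hq hW hg hρ μ ht le_rfl x) ?_ ?_
    ((hρ t 0 t ht le_rfl).abs.mul_const _) ?_
  · refine h.congr_fderiv ?_
    rw [intervalIntegral.integral_finsetSum fun i _ => hgint' i]
    exact Finset.sum_congr rfl fun i _ => intervalIntegral.integral_smul_const _ _
  · refine Finset.aestronglyMeasurable_fun_sum _ fun i _ => ?_
    exact (hgint' i).def'.aestronglyMeasurable
  · refine Eventually.of_forall fun τ _ y _ => ?_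
    have e : ∑ i, (ρ (t - τ) * Tq q (cc μ (t - τ)) (gi i τ) y) •
        (EuclideanSpace.proj i : Spc n →L[ℝ] ℝ) = ρ (t - τ) •
        ∑ i, Tq q (cc μ (t - τ)) (gi i τ) y • (EuclideanSpace.proj i : Spc n →L[ℝ] ℝ) := by
      simp only [Finset.smul_sum, smul_smul]
    rw [e, norm_smul, Real.norm_eq_abs]
    refine mul_le_mul_of_nonneg_left (norm_grad_le _ fun i => ?_) (abs_nonneg _)
    exact abs_tq_le hq ((hgi i).le hW τ) _ _
  · refine Eventually.of_forall fun τ _ y _ => ?_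
    have h2 := (tq_hasFDerivAt hq (hgr τ) (hg.le hW τ) (fun i => (hgi i).slice τ)
      (fun i => (hgi i).le hW τ) (cc μ (t - τ)) y).const_mul (ρ (t - τ))
    refine h2.congr_fderiv ?_
    rw [Finset.smul_sum]
    simp only [smul_smul]

theorem fderiv_phi_single (z : Spc n) (i : Fin n) :
    fderiv ℝ phi z (EuclideanSpace.single i 1) = -phi1 i z := by
  rw [(hasFDerivAt_phi z).fderiv]
  simp [phi1, EuclideanSpace.inner_single_right, mul_comm]

/-- Gaussian integration by parts. -/
theorem tq_phi_grad {G : Spc n → ℝ} {G' : Fin n → Spc n → ℝ} {B : ℝ}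
    (hG : ∀ y, HasFDerivAt G (∑ i, G' i y • (EuclideanSpace.proj i : Spc n →L[ℝ] ℝ)) y)
    (hB : ∀ y, |G y| ≤ B) (hc : ∀ i, Continuous (G' i)) (hB' : ∀ i y, |G' i y| ≤ B)
    {c : ℝ} (hc0 : 0 < c) (x : Spc n) (i : Fin n) :
    Tq phi c (G' i) x = c⁻¹ * Tq (phi1 i) c G x := by
  have hGc : Continuous G := continuous_iff_continuousAt.2 fun y => (hG y).continuousAt
  have hd : ∀ z, HasFDerivAt (fun z : Spc n => G (x + c • z))
      (∑ i, (c * G' i (x + c • z)) • (EuclideanSpace.proj i : Spc n →L[ℝ] ℝ)) z := by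
    intro z
    have h1 : HasFDerivAt (fun z : Spc n => x + c • z) (c • ContinuousLinearMap.id ℝ (Spc n)) z :=
      ((hasFDerivAt_id z).const_smul c).const_add x
    refine ((hG (x + c • z)).comp z h1).congr_fderiv ?_
    rw [ContinuousLinearMap.comp_smul, ContinuousLinearMap.comp_id, Finset.smul_sum]
    simp only [smul_smul]
  have hd' : ∀ z, fderiv ℝ (fun z : Spc n => G (x + c • z)) z (EuclideanSpace.single i 1) =
      c * G' i (x + c • z) := fun z => by
    rw [(hd z).fderiv, sum_proj_single]
  have h := integral_mul_fderiv_eq_neg_fderiv_mul_of_integrable (μ := (volume : Measure (Spc n)))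
    (f := phi) (g := fun z : Spc n => G (x + c • z)) (v := EuclideanSpace.single i (1 : ℝ)) ?_ ?_
    (ker_phi.integrable_comp hGc hB c x) (fun z _ => (hasFDerivAt_phi z).differentiableAt)
    (fun z _ => (hd z).differentiableAt)
  · simp only [hd', fderiv_phi_single, neg_mul, integral_neg, neg_neg] at h
    have e : ∀ z : Spc n, phi z * (c * G' i (x + c • z)) = c * (phi z * G' i (x + c • z)) :=
      fun z => by ring
    simp only [e, integral_const_mul] at h
    rw [Tq, Tq, ← h, inv_mul_cancel_left₀ hc0.ne']
  · simp only [fderiv_phi_single, neg_mul]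
    exact ((ker_phi1 i).integrable_comp hGc hB c x).neg
  · simp only [hd']
    have := (ker_phi.integrable_comp (hc i) (hB' i) c x).const_mul c
    refine this.congr (Eventually.of_forall fun z => ?_)
    dsimp only
    ring

theorem pot_phi_grad (hμ : 0 < μ) (hW : 0 ≤ W) (hg : Dat W C g) (hgi : ∀ i, Dat W C (gi i))
    (hgr : ∀ τ y, HasFDerivAt (g τ) (∑ i, gi i τ y • (EuclideanSpace.proj i : Spc n →L[ℝ] ℝ)) y)
    {t : ℝ} (ht : 0 ≤ t) (x : Spc n) (i : Fin n) :
    pot phi (fun _ => 1) μ (gi i) t x = pot (phi1 i) (fun σ => (cc μ σ)⁻¹) μ g t x := by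
  refine intervalIntegral.integral_congr_ae ?_
  filter_upwards [Measure.ae_ne volume t] with τ hτ hτ'
  rw [Set.uIoc_of_le ht] at hτ'
  have hσ : 0 < t - τ := sub_pos.2 (lt_of_le_of_ne hτ'.2 hτ)
  rw [one_mul]
  exact tq_phi_grad (hgr τ) (hg.le hW τ) (fun i => (hgi i).slice τ) (fun i => (hgi i).le hW τ)
    (cc_pos hμ hσ) x i

theorem tq_hasDerivAt {G : Spc n → ℝ} {G' : Fin n → Spc n → ℝ} {B : ℝ}
    (hG : ∀ y, HasFDerivAt G (∑ i, G' i y • (EuclideanSpace.proj i : Spc n →L[ℝ] ℝ)) y)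
    (hB : ∀ y, |G y| ≤ B) (hc : ∀ i, Continuous (G' i)) (hB' : ∀ i y, |G' i y| ≤ B)
    (c : ℝ) (x : Spc n) :
    HasDerivAt (fun c => Tq phi c G x) (∑ i, Tq (phi1 i) c (G' i) x) c := by
  have hGc : Continuous G := continuous_iff_continuousAt.2 fun y => (hG y).continuousAt
  have h := (hasDerivAt_integral_of_dominated_loc_of_deriv_le (𝕜 := ℝ) (μ := volume)
    (F := fun c z => phi z * G (x + c • z)) (x₀ := c) (s := Set.univ)
    (F' := fun c z => ∑ i, phi1 i z * G' i (x + c • z))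
    (bound := fun z => ∑ i, |phi1 i z| * B) univ_mem
    (Eventually.of_forall fun c => (ker_phi.integrable_comp hGc hB c x).aestronglyMeasurable)
    (ker_phi.integrable_comp hGc hB c x) ?_ ?_
    (integrable_finsetSum _ fun i _ => (ker_phi1 i).integrable.abs.mul_const _) ?_).2
  · rwa [integral_finsetSum _ fun i _ => (ker_phi1 i).integrable_comp (hc i) (hB' i) c x] at h
  · refine (integrable_finsetSum _ fun i _ =>
      (ker_phi1 i).integrable_comp (hc i) (hB' i) c x).aestronglyMeasurable
  · refine Eventually.of_forall fun z c _ => norm_sum_le_of_le _ fun i _ => ?_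
    rw [Real.norm_eq_abs, abs_mul]
    exact mul_le_mul_of_nonneg_left (hB' i _) (abs_nonneg _)
  · refine Eventually.of_forall fun z c _ => ?_
    have h1 : HasDerivAt (fun c : ℝ => x + c • z) z c := by
      simpa using ((hasDerivAt_id c).smul_const z).const_add x
    have h2 := ((hG (x + c • z)).comp_hasDerivAt c h1).const_mul (phi z)
    refine h2.congr_deriv ?_
    simp only [sum_apply, smul_apply, Finset.mul_sum, smul_eq_mul, phi1]
    refine Finset.sum_congr rfl fun i _ => ?_
    change phi z * (G' i (x + c • z) * z i) = z i * phi z * _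
    ring

theorem hasDerivAt_cc (hμ : 0 < μ) {σ : ℝ} (hσ : 0 < σ) : HasDerivAt (cc μ) (μ * (cc μ σ)⁻¹) σ := by
  have h1 : HasDerivAt (fun σ : ℝ => 2 * μ * σ) (2 * μ) σ := by
    simpa using (hasDerivAt_id σ).const_mul (2 * μ)
  have h2 := h1.sqrt (by positivity)
  refine h2.congr_deriv ?_
  have := cc_pos hμ hσ
  change 2 * μ / (2 * cc μ σ) = _
  field_simp

/-- Heat evolution as a time integral. -/
theorem tq_phi_eq (hμ : 0 < μ) (hW : 0 ≤ W) (hg : Dat W C g) (hgi : ∀ i, Dat W C (gi i))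
    (hgr : ∀ τ y, HasFDerivAt (g τ) (∑ i, gi i τ y • (EuclideanSpace.proj i : Spc n →L[ℝ] ℝ)) y)
    {σ : ℝ} (hσ : 0 ≤ σ) (τ : ℝ) (x : Spc n) :
    Tq phi (cc μ σ) (g τ) x = g τ x +
      ∫ r in (0 : ℝ)..σ, (cc μ r)⁻¹ * (μ * ∑ i, Tq (phi1 i) (cc μ r) (gi i τ) x) := by
  have hcc := continuous_cc μ
  have hcont : ∀ i, Continuous fun r => Tq (phi1 i) (cc μ r) (gi i τ) x := fun i =>
    (tq_continuous (ker_phi1 i) hW (hgi i)).comp (f := fun r : ℝ => (τ, cc μ r, x)) (by fun_prop)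
  have h := intervalIntegral.integral_eq_sub_of_hasDerivAt_of_le
    (f := fun r => Tq phi (cc μ r) (g τ) x)
    (f' := fun r => (cc μ r)⁻¹ * (μ * ∑ i, Tq (phi1 i) (cc μ r) (gi i τ) x)) hσ
    ((tq_continuous ker_phi hW hg).comp
      (f := fun r : ℝ => (τ, cc μ r, x)) (by fun_prop)).continuousOn ?_ ?_
  · rw [h]
    have : Tq phi (cc μ 0) (g τ) x = g τ x := by
      have : cc μ 0 = 0 := by simp [cc]
      simp [this, Tq, integral_mul_const, integral_phi]
    rw [this]
    ring
  · intro r hr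
    have h1 := (tq_hasDerivAt (hgr τ) (hg.le hW τ) (fun i => (hgi i).slice τ)
      (fun i => (hgi i).le hW τ) (cc μ r) x).comp r (hasDerivAt_cc hμ hr.1)
    refine h1.congr_deriv ?_
    ring
  · have h1 := rho_cc hμ 0 0 (-σ) le_rfl (by linarith)
    have h2 := (h1.comp_sub_left 0)
    simp only [zero_sub, neg_neg, neg_zero] at h2
    refine h2.mul_continuousOn (Continuous.continuousOn ?_)
    exact continuous_const.mul (continuous_finsetSum _ fun i _ => hcont i)

theorem triangle_swap (hμ : 0 < μ) {B : ℝ → ℝ → ℝ} (hB : Continuous (Function.uncurry B)) {t : ℝ}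
    (ht : 0 ≤ t) :
    ∫ τ in (0 : ℝ)..t, ∫ r in (0 : ℝ)..(t - τ), (cc μ r)⁻¹ * B r τ =
      ∫ s in (0 : ℝ)..t, ∫ τ in (0 : ℝ)..s, (cc μ (s - τ))⁻¹ * B (s - τ) τ := by
  have hzero : ∀ s τ : ℝ, s ≤ τ → (cc μ (s - τ))⁻¹ * B (s - τ) τ = 0 := by
    intro s τ h
    have : cc μ (s - τ) = 0 := Real.sqrt_eq_zero_of_nonpos (by nlinarith)
    rw [this, inv_zero, zero_mul]
  have hii : ∀ (τ a b : ℝ), τ ≤ a → τ ≤ b →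
      IntervalIntegrable (fun s => (cc μ (s - τ))⁻¹ * B (s - τ) τ) volume a b := by
    intro τ a b ha hb
    have h2 := (rho_cc hμ (-τ) (-a) (-b) (by linarith) (by linarith)).comp_sub_left 0
    simp only [zero_sub, neg_neg] at h2
    have e : ∀ x : ℝ, -τ - -x = x - τ := fun x => by ring
    simp only [e] at h2
    exact h2.mul_continuousOn (hB.comp (by fun_prop : Continuous fun s : ℝ => (s - τ, τ))).continuousOn
  have hz : ∀ (τ a b : ℝ), a ≤ b → b ≤ τ →
      IntervalIntegrable (fun s => (cc μ (s - τ))⁻¹ * B (s - τ) τ) volume a b ∧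
      ∫ s in a..b, (cc μ (s - τ))⁻¹ * B (s - τ) τ = 0 := by
    intro τ a b hab hb
    have hE : Set.EqOn (fun _ => (0 : ℝ)) (fun s => (cc μ (s - τ))⁻¹ * B (s - τ) τ)
        (Set.uIcc a b) := by
      intro s hs
      rw [Set.uIcc_of_le hab] at hs
      exact (hzero s τ (hs.2.trans hb)).symm
    refine ⟨IntervalIntegrable.congr (fun s hs => hE (Set.uIoc_subset_uIcc hs))
      intervalIntegrable_const, ?_⟩
    rw [← intervalIntegral.integral_congr hE]
    simp
  have L : ∀ τ ∈ Set.uIcc 0 t, ∫ r in (0 : ℝ)..(t - τ), (cc μ r)⁻¹ * B r τ =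
      ∫ s in (0 : ℝ)..t, (cc μ (s - τ))⁻¹ * B (s - τ) τ := by
    intro τ hτ
    rw [Set.uIcc_of_le ht] at hτ
    have h1 := intervalIntegral.integral_comp_sub_right (a := τ) (b := t)
      (fun r => (cc μ r)⁻¹ * B r τ) τ
    rw [sub_self] at h1
    rw [← h1, ← intervalIntegral.integral_add_adjacent_intervals (hz τ 0 τ hτ.1 le_rfl).1
      (hii τ τ t le_rfl hτ.2), (hz τ 0 τ hτ.1 le_rfl).2, zero_add]
  have R : ∀ s ∈ Set.uIcc 0 t, ∫ τ in (0 : ℝ)..s, (cc μ (s - τ))⁻¹ * B (s - τ) τ =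
      ∫ τ in (0 : ℝ)..t, (cc μ (s - τ))⁻¹ * B (s - τ) τ := by
    intro s hs
    rw [Set.uIcc_of_le ht] at hs
    have h1 : IntervalIntegrable (fun τ => (cc μ (s - τ))⁻¹ * B (s - τ) τ) volume 0 s :=
      (rho_cc hμ s 0 s hs.1 le_rfl).mul_continuousOn
        (hB.comp (by fun_prop : Continuous fun τ : ℝ => (s - τ, τ))).continuousOn
    have hE : Set.EqOn (fun _ => (0 : ℝ)) (fun τ => (cc μ (s - τ))⁻¹ * B (s - τ) τ)
        (Set.uIcc s t) := by
      intro τ hτ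
      rw [Set.uIcc_of_le hs.2] at hτ
      exact (hzero s τ hτ.1).symm
    have h2 : IntervalIntegrable (fun τ => (cc μ (s - τ))⁻¹ * B (s - τ) τ) volume s t :=
      IntervalIntegrable.congr (fun s hs => hE (Set.uIoc_subset_uIcc hs)) intervalIntegrable_const
    rw [← intervalIntegral.integral_add_adjacent_intervals h1 h2,
      ← intervalIntegral.integral_congr hE]
    simp
  rw [intervalIntegral.integral_congr L, intervalIntegral.integral_congr R]
  refine intervalIntegral_intervalIntegral_swap (F := fun τ s => (cc μ (s - τ))⁻¹ * B (s - τ) τ) ?_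
  rw [Set.uIoc_of_le ht]
  have hf : Integrable ((Set.Ioc 0 t).indicator fun _ : ℝ => (1 : ℝ)) :=
    (integrable_indicator_iff measurableSet_Ioc).2
      (integrableOn_const (by simp) (by simp))
  have hcc : IntegrableOn (fun r => (cc μ r)⁻¹) (Set.Ioc (-t) t) := by
    have h2 := (rho_cc hμ 0 0 (-t) le_rfl (by linarith)).comp_sub_left 0
    simp only [zero_sub, neg_neg, neg_zero] at h2
    have h3 : IntervalIntegrable (fun r => (cc μ r)⁻¹) volume (-t) 0 := by
      have hE : Set.EqOn (fun _ => (0 : ℝ)) (fun r => (cc μ r)⁻¹) (Set.uIcc (-t) 0) := by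
        intro r hr
        rw [Set.uIcc_of_le (by linarith)] at hr
        have : cc μ r = 0 := Real.sqrt_eq_zero_of_nonpos (by nlinarith [hr.2])
        simp [this]
      exact IntervalIntegrable.congr (fun s hs => hE (Set.uIoc_subset_uIcc hs))
        intervalIntegrable_const
    exact (intervalIntegrable_iff_integrableOn_Ioc_of_le (by linarith)).1 (h3.trans h2)
  have hk : Integrable ((Set.Ioc (-t) t).indicator fun r : ℝ => (cc μ r)⁻¹) :=
    (integrable_indicator_iff measurableSet_Ioc).2 hcc
  have hconv := (Integrable.convolution_integrand (L := ContinuousLinearMap.mul ℝ ℝ) hf hk).swap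
  have hrect : IntegrableOn (fun p : ℝ × ℝ => (cc μ (p.2 - p.1))⁻¹)
      (Set.Ioc 0 t ×ˢ Set.Ioc 0 t) := by
    refine (hconv.integrableOn (s := Set.Ioc 0 t ×ˢ Set.Ioc 0 t)).congr_fun ?_
      (measurableSet_Ioc.prod measurableSet_Ioc)
    rintro ⟨τ, s⟩ ⟨h1, h2⟩
    have h3 : s - τ ∈ Set.Ioc (-t) t := ⟨by linarith [h1.2, h2.1], by linarith [h1.1, h2.2]⟩
    simp [Set.indicator_of_mem h1, Set.indicator_of_mem h3]
  have hBc : Continuous fun p : ℝ × ℝ => B (p.2 - p.1) p.1 :=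
    hB.comp (f := fun p : ℝ × ℝ => (p.2 - p.1, p.1)) (by fun_prop)
  have hbd := ((isCompact_Icc (a := (0 : ℝ)) (b := t)).prod
    (isCompact_Icc (a := (0 : ℝ)) (b := t))).exists_bound_of_continuousOn hBc.continuousOn
  obtain ⟨M, hM⟩ := hbd
  refine (hrect.mul_bdd (c := M) hBc.aestronglyMeasurable ?_)
  refine (ae_restrict_iff' (measurableSet_Ioc.prod measurableSet_Ioc)).2
    (Eventually.of_forall fun p hp => hM p ⟨⟨hp.1.1.le, hp.1.2⟩, ⟨hp.2.1.le, hp.2.2⟩⟩)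

theorem pot_phi_eq (hμ : 0 < μ) (hW : 0 ≤ W) (hg : Dat W C g) (hgi : ∀ i, Dat W C (gi i))
    (hgr : ∀ τ y, HasFDerivAt (g τ) (∑ i, gi i τ y • (EuclideanSpace.proj i : Spc n →L[ℝ] ℝ)) y)
    {t : ℝ} (ht : 0 ≤ t) (x : Spc n) :
    pot phi (fun _ => 1) μ g t x = ∫ s in (0 : ℝ)..t,
      (g s x + μ * ∑ i, pot (phi1 i) (fun σ => (cc μ σ)⁻¹) μ (gi i) s x) := by
  have hcc := continuous_cc μ
  have hBc : Continuous (Function.uncurry fun r τ : ℝ =>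
      μ * ∑ i, Tq (phi1 i) (cc μ r) (gi i τ) x) := by
    refine continuous_const.mul (continuous_finsetSum _ fun i _ => ?_)
    exact (tq_continuous (ker_phi1 i) hW (hgi i)).comp
      (f := fun p : ℝ × ℝ => (p.2, cc μ p.1, x)) (by fun_prop)
  have hgc : Continuous fun τ => g τ x := hg.cont.comp (f := fun τ : ℝ => (τ, x)) (by fun_prop)
  have hT : Continuous fun τ => Tq phi (cc μ (t - τ)) (g τ) x :=
    (tq_continuous ker_phi hW hg).comp (f := fun τ : ℝ => (τ, cc μ (t - τ), x)) (by fun_prop)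
  have e1 : ∀ τ ∈ Set.uIcc 0 t, 1 * Tq phi (cc μ (t - τ)) (g τ) x = g τ x +
      ∫ r in (0 : ℝ)..(t - τ), (cc μ r)⁻¹ * (μ * ∑ i, Tq (phi1 i) (cc μ r) (gi i τ) x) := by
    intro τ hτ
    rw [Set.uIcc_of_le ht] at hτ
    rw [one_mul, tq_phi_eq hμ hW hg hgi hgr (by linarith [hτ.2]) τ x]
  have hi2 : IntervalIntegrable (fun τ => ∫ r in (0 : ℝ)..(t - τ), (cc μ r)⁻¹ *
      (μ * ∑ i, Tq (phi1 i) (cc μ r) (gi i τ) x)) volume 0 t := by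
    have : IntervalIntegrable (fun τ => Tq phi (cc μ (t - τ)) (g τ) x - g τ x) volume 0 t :=
      (hT.sub hgc).intervalIntegrable _ _
    refine this.congr fun τ hτ => ?_
    have := e1 τ (Set.uIoc_subset_uIcc hτ)
    rw [one_mul] at this
    rw [this]
    ring
  have e2 : ∀ s ∈ Set.uIcc 0 t, ∫ τ in (0 : ℝ)..s, (cc μ (s - τ))⁻¹ *
      (μ * ∑ i, Tq (phi1 i) (cc μ (s - τ)) (gi i τ) x) =
      μ * ∑ i, pot (phi1 i) (fun σ => (cc μ σ)⁻¹) μ (gi i) s x := by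
    intro s hs
    rw [Set.uIcc_of_le ht] at hs
    simp only [pot]
    rw [← intervalIntegral.integral_finsetSum fun i _ =>
      pot_intervalIntegrable (ker_phi1 i) hW (hgi i) (rho_cc hμ) μ hs.1 le_rfl x,
      ← intervalIntegral.integral_const_mul]
    refine intervalIntegral.integral_congr fun τ _ => ?_
    simp only [← Finset.mul_sum]
    ring
  rcases ht.eq_or_lt with rfl | ht0
  · simp [pot]
  have hi3 : IntervalIntegrable (fun s => μ * ∑ i,
      pot (phi1 i) (fun σ => (cc μ σ)⁻¹) μ (gi i) s x) volume 0 t := by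
    refine ContinuousOn.intervalIntegrable ?_
    rw [Set.uIcc_of_le ht]
    refine continuousOn_const.mul (continuousOn_finsetSum _ fun i _ => ?_)
    obtain ⟨A, -, hA⟩ := grd_HB (ker_phi1 i) hμ hW ht0 (lam := 1 / 2) (by norm_num) (by norm_num)
    have h := (hA C (gi i) (hgi i)).contT (by norm_num) hW ht0
    exact ContinuousOn.comp h (t := Set.Icc (0 : ℝ) t ×ˢ Set.univ) (f := fun s : ℝ => (s, x))
      (by fun_prop) fun s hs => ⟨hs, Set.mem_univ _⟩
  rw [pot, intervalIntegral.integral_congr e1,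
    intervalIntegral.integral_add (hgc.intervalIntegrable _ _) hi2,
    intervalIntegral.integral_add (hgc.intervalIntegrable _ _) hi3,
    triangle_swap hμ hBc ht, intervalIntegral.integral_congr e2]

end PotentialDerivatives

/-! ### The heat potential as a parabolic potential -/

section heat

variable {T μ : ℝ} {f : ℝ → Spc n → ℝ} {fi : Fin n → ℝ → Spc n → ℝ} {W C : ℝ}

theorem heatKer_eq (hμ : 0 < μ) {σ : ℝ} (hσ : 0 < σ) (z : Spc n) :
    heatKer μ z σ = ((cc μ σ) ^ n)⁻¹ * phi ((cc μ σ)⁻¹ • z) := by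
  have hc := cc_pos hμ hσ
  have h2 := cc_sq hμ hσ.le
  have hpi := Real.pi_pos
  rw [heatKer, if_pos hσ, phi]
  have e1 : 4 * Real.pi * μ * σ = (2 * Real.pi) * cc μ σ ^ 2 := by rw [h2]; ring
  have e2 : (cc μ σ ^ 2) ^ (-(n : ℝ) / 2) = ((cc μ σ) ^ n)⁻¹ := by
    rw [← Real.rpow_natCast (cc μ σ) 2, ← Real.rpow_mul hc.le, ← Real.rpow_natCast (cc μ σ) n,
      ← Real.rpow_neg hc.le]
    congr 1
    push_cast
    ring
  have e3 : -‖z‖ ^ 2 / (4 * μ * σ) = -(‖(cc μ σ)⁻¹ • z‖ ^ 2 / 2) := by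
    rw [norm_smul, norm_inv, Real.norm_eq_abs, abs_of_pos hc, mul_pow, inv_pow, h2]
    field_simp
    ring
  rw [e1, Real.mul_rpow (by positivity) (by positivity), e2, e3]
  ring

theorem integral_heatKer (hμ : 0 < μ) {σ : ℝ} (hσ : 0 < σ) (F : Spc n → ℝ) (x : Spc n) :
    ∫ y, heatKer μ (x - y) σ * F y = Tq phi (cc μ σ) F x := by
  have hc := cc_pos hμ hσ
  have h := Measure.integral_comp_smul_of_nonneg volume
    (fun z : Spc n => phi ((cc μ σ)⁻¹ • z) * F (x + z)) (cc μ σ) (hR := hc.le)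
  rw [finrank_euclideanSpace_fin, smul_eq_mul] at h
  have e : ∀ z : Spc n, (cc μ σ)⁻¹ • cc μ σ • z = z := fun z => inv_smul_smul₀ hc.ne' z
  simp only [e] at h
  rw [Tq, h, ← integral_const_mul,
    ← integral_sub_right_eq_self (fun z : Spc n =>
      ((cc μ σ) ^ n)⁻¹ * (phi ((cc μ σ)⁻¹ • z) * F (x + z))) x]
  refine integral_congr_ae (Eventually.of_forall fun y => ?_)
  have e1 : phi ((cc μ σ)⁻¹ • (x - y)) = phi ((cc μ σ)⁻¹ • (y - x)) := by
    simp only [phi, norm_smul, norm_sub_rev x y]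
  simp only [heatKer_eq hμ hσ, e1, add_sub_cancel]
  ring

/-- First order heat potential of data frozen outside `[0,T]`. -/
def gpot (T μ : ℝ) (i : Fin n) (f : ℝ → Spc n → ℝ) : ℝ → Spc n → ℝ :=
  pot (phi1 i) (fun σ => (cc μ σ)⁻¹) μ (ext T f)

/-- Heat potential of data frozen outside `[0,T]`. -/
def vpot (T μ : ℝ) (f : ℝ → Spc n → ℝ) : ℝ → Spc n → ℝ := pot phi (fun _ => 1) μ (ext T f)

theorem volPot_eq (hμ : 0 < μ) (f : ℝ → Spc n → ℝ) {t : ℝ} (ht : t ∈ Set.Icc 0 T) (x : Spc n) :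
    volPot μ f t x = vpot T μ f t x := by
  rw [volPot, vpot, pot, ← intervalIntegral.integral_of_le ht.1]
  refine intervalIntegral.integral_congr_ae ?_
  filter_upwards [Measure.ae_ne volume t] with τ hτ hτ'
  rw [Set.uIoc_of_le ht.1] at hτ'
  have hσ : 0 < t - τ := sub_pos.2 (lt_of_le_of_ne hτ'.2 hτ)
  rw [one_mul, ext_of_mem f ⟨hτ'.1.le, hτ'.2.trans ht.2⟩, integral_heatKer hμ hσ]

theorem dat_ext (hT : 0 < T) (hf : ContT T f)
    (hb : ∀ t ∈ Set.Icc (0 : ℝ) T, ∀ x, |f t x| ≤ C * wt x ^ (-W)) : Dat W C (ext T f) :=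
  ⟨hf.continuous_ext hT, fun τ x => hb _ (clamp_mem hT τ) x⟩

theorem grad_ext (hT : 0 < T) (h : HasGrad T f fi) (τ : ℝ) (y : Spc n) :
    HasFDerivAt (ext T f τ)
      (∑ i, ext T (fi i) τ y • (EuclideanSpace.proj i : Spc n →L[ℝ] ℝ)) y :=
  h _ (clamp_mem hT τ) y

theorem vpot_eq_gpot (hμ : 0 < μ) (hT : 0 < T) (hW : 0 ≤ W) (hf : Dat W C (ext T f))
    (hfi : ∀ i, Dat W C (ext T (fi i))) (h : HasGrad T f fi) {t : ℝ} (ht : t ∈ Set.Icc 0 T)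
    (x : Spc n) (i : Fin n) : vpot T μ (fi i) t x = gpot T μ i f t x :=
  pot_phi_grad hμ hW hf hfi (grad_ext hT h) ht.1 x i

theorem hasGrad_gpot (hμ : 0 < μ) (hT : 0 < T) (hW : 0 ≤ W) (hf : Dat W C (ext T f))
    (hfi : ∀ i, Dat W C (ext T (fi i))) (h : HasGrad T f fi) (j : Fin n) :
    HasGrad T (gpot T μ j f) (fun i => gpot T μ j (fi i)) := fun _ ht x =>
  pot_hasFDerivAt (ker_phi1 j) (rho_cc hμ) hW hf hfi (grad_ext hT h) ht.1 x

theorem hasGrad_vpot (hμ : 0 < μ) (hT : 0 < T) (hW : 0 ≤ W) (hf : Dat W C (ext T f))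
    (hfi : ∀ i, Dat W C (ext T (fi i))) (h : HasGrad T f fi) :
    HasGrad T (vpot T μ f) (fun i => gpot T μ i f) := by
  have h1 : HasGrad T (vpot T μ f) (fun i => vpot T μ (fi i)) := fun _ ht x =>
    pot_hasFDerivAt ker_phi rho_one hW hf hfi (grad_ext hT h) ht.1 x
  exact h1.congr_right fun i t ht x => vpot_eq_gpot hμ hT hW hf hfi h ht x i

theorem contT_gpot (hμ : 0 < μ) (hT : 0 < T) (hW : 0 ≤ W) (hf : Dat W C (ext T f)) (j : Fin n) :
    ContT T (gpot T μ j f) := by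
  obtain ⟨A, -, h⟩ := grd_HB (lam := 1 / 2) (ker_phi1 j) hμ hW hT (by norm_num) (by norm_num)
  exact (h C _ hf).contT (by norm_num) hW hT

theorem ContT.sum {ι : Type*} (S : Finset ι) {F : ι → ℝ → Spc n → ℝ} (h : ∀ i ∈ S, ContT T (F i)) :
    ContT T (fun t x => ∑ i ∈ S, F i t x) := continuousOn_finsetSum _ h

theorem contT_of_dat (hf : Dat W C (ext T f)) : ContT T f :=
  hf.cont.continuousOn.congr fun p hp => (congrFun (ext_of_mem f hp.1) p.2).symm

theorem hasDt_vpot (hμ : 0 < μ) (hT : 0 < T) (hW : 0 ≤ W) (hf : Dat W C (ext T f))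
    (hfi : ∀ i, Dat W C (ext T (fi i))) (h : HasGrad T f fi) :
    HasDt T (vpot T μ f) (fun t x => f t x + μ * ∑ i, gpot T μ i (fi i) t x) := by
  refine hasDt_of_integral hT ((contT_of_dat hf).add ((contT_const μ).mul
    (ContT.sum _ fun i _ => contT_gpot hμ hT hW (hfi i) i))) fun t ht x => ?_
  have h0 : vpot T μ f 0 x = 0 := by simp [vpot, pot]
  rw [h0, zero_add, vpot, pot_phi_eq hμ hW hf hfi (grad_ext hT h) ht.1 x]
  refine intervalIntegral.integral_congr fun s hs => ?_
  rw [Set.uIcc_of_le ht.1] at hs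
  have hs' : s ∈ Set.Icc 0 T := ⟨hs.1, hs.2.trans ht.2⟩
  simp only [ext_of_mem _ hs']
  rfl

theorem hasDt_gpot (hμ : 0 < μ) (hT : 0 < T) (hW : 0 ≤ W) (hf : Dat W C (ext T f))
    {fij : Fin n → Fin n → ℝ → Spc n → ℝ}
    (hfi : ∀ i, Dat W C (ext T (fi i))) (hfij : ∀ i j, Dat W C (ext T (fij i j)))
    (h : HasGrad T f fi) (h' : ∀ i, HasGrad T (fi i) (fij i)) (i : Fin n) :
    HasDt T (gpot T μ i f) (fun t x => fi i t x + μ * ∑ j, gpot T μ j (fij i j) t x) :=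
  (hasDt_vpot hμ hT hW (hfi i) (hfij i) (h' i)).congr fun _ ht x =>
    vpot_eq_gpot hμ hT hW hf hfi h ht x i

end heat

/-! ### Heat potentials of the regularity classes -/

section classes

variable {T μ l l' : ℝ} {f : ℝ → Spc n → ℝ} {N s : ℕ} {W C : ℝ}

theorem Cls.nonneg (hT : 0 < T) (h : Cls T (JP T l) N s W C f) : 0 ≤ C := h.base.nonneg hT

theorem Cls.dat (hT : 0 < T) {W' : ℝ} (hW : W' ≤ W) (h : Cls T (JP T l) N s W C f) :
    Dat W' C (ext T f) :=
  dat_ext hT h.base.1 ((adm_JP T l).mono _ _ _ _ _ _ hW le_rfl (h.nonneg hT) h.base).2.1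

theorem cls_heat_rhs (hT : 0 < T) (hl : 0 < l) (hl1 : l < 1) (hl' : 0 < l') (hl1' : l' < 1)
    (hW : 0 ≤ W)
    (ih : ∃ A : ℝ, 0 ≤ A ∧ ∀ i C f, Cls T (JP T l) N (s + 1) (W + 1) C f →
      Cls T (KP (n := n) T l l') N (s + 1) (W + 1) (A * C) (gpot T μ i f)) :
    ∃ A : ℝ, 0 ≤ A ∧ ∀ C f (fi : Fin n → ℝ → Spc n → ℝ), Cls T (JP T l) (N + 1) (s + 1) W C f →
      (∀ i, Cls T (JP T l) N (s + 1) (W + 1) C (fi i)) →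
      Cls T (KP T l l') N s W (A * C) (fun t x => f t x + μ * ∑ i, gpot T μ i (fi i) t x) := by
  obtain ⟨A₂, hA₂, h₂⟩ := ih
  obtain ⟨A₁, hA₁, h₁⟩ :=
    Cls.JP_to_KP (n := n) (lam := l) (lam' := l') hT hl.le hl1.le hl'.le hl1'.le N s W hW
  have hK := adm_KP (n := n) hT hl hl'
  refine ⟨A₁ + |μ| * (n * A₂), by positivity, fun C f fi hf hfi => ?_⟩
  have hC := hf.nonneg hT
  have h := hK.cls_sum Finset.univ (F := fun i => gpot T μ i (fi i)) (N := N) (s := s) (W := W)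
    (C := A₂ * C) fun i _ => hK.cls_mono (W' := W) (by linarith) le_rfl (by positivity)
      ((h₂ i C _ (hfi i)).mono_s (Nat.le_succ s))
  have h' := hK.cls_add (h₁ C f hf) (hK.cls_smul μ h)
  refine hK.cls_mono le_rfl (le_of_eq ?_) (by positivity) h'
  rw [Finset.card_univ, Fintype.card_fin]
  ring

theorem cls_gpot (hμ : 0 < μ) (hT : 0 < T) (hl : 0 < l) (hl1 : l < 1) (hl' : 0 < l')
    (hl1' : l' < 1) (N s : ℕ) (W : ℝ) (hW : 0 ≤ W) :
    ∃ A : ℝ, 0 ≤ A ∧ ∀ i C f, Cls T (JP T l) N s W C f →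
      Cls T (KP (n := n) T l l') N s W (A * C) (gpot T μ i f) := by
  induction N using Nat.strong_induction_on generalizing s W with
  | _ N ih =>
    have hK := adm_KP (n := n) hT hl hl'
    have hJ := adm_JP (n := n) T l
    have hbase : ∃ A : ℝ, 0 ≤ A ∧ ∀ i C f, Cls T (JP T l) N s W C f →
        KP (n := n) T l l' N W (A * C) (gpot T μ i f) := by
      have h0 : 0 < (if N = 0 then l else l') := by split_ifs <;> assumption
      have h1 : (if N = 0 then l else l') < 1 := by split_ifs <;> assumption
      choose A hA h using fun i : Fin n => grd_HB (ker_phi1 i) hμ hW hT h0 h1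
      refine ⟨∑ i, A i, Finset.sum_nonneg fun i _ => hA i, fun i C f hf => ?_⟩
      refine (h i C _ (hf.dat hT le_rfl)).mono ?_
      exact mul_le_mul_of_nonneg_right
        (Finset.single_le_sum (fun i _ => hA i) (Finset.mem_univ i)) (hf.nonneg hT)
    obtain ⟨A₀, hA₀, h₀⟩ := hbase
    rcases N with _ | N
    · exact ⟨A₀, hA₀, fun i C f hf => NSdeRham.cls_zero.2 (h₀ i C f hf)⟩
    · obtain ⟨A₁, hA₁, h₁⟩ := ih N (by omega) s (W + 1) (by linarith)
      have hdt : ∃ A : ℝ, 0 ≤ A ∧ ∀ i C f, Cls T (JP T l) (N + 1) s W C f →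
          ∀ N' s' : ℕ, N = N' + 1 → s = s' + 1 →
            ∃ h : ℝ → Spc n → ℝ, HasDt T (gpot T μ i f) h ∧ Cls T (KP T l l') N' s' W (A * C) h := by
        rcases N with _ | N'
        · exact ⟨0, le_rfl, fun i C f _ N' s' h => by omega⟩
        rcases s with _ | s'
        · exact ⟨0, le_rfl, fun i C f _ N' s' _ h => by omega⟩
        obtain ⟨A₂, hA₂, h₂⟩ := cls_heat_rhs (μ := μ) (W := W + 1) (s := s') (N := N') hT hl hl1
          hl' hl1' (by linarith) (ih N' (by omega) (s' + 1) (W + 1 + 1) (by linarith))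
        refine ⟨A₂, hA₂, fun i C f hf N'' s'' h h' => ?_⟩
        obtain rfl : N' = N'' := by omega
        obtain rfl : s' = s'' := by omega
        have hC := hf.nonneg hT
        obtain ⟨-, ⟨fi, hfi, hfi'⟩, -⟩ := cls_succ.1 hf
        have hx : ∀ i, ∃ g : Fin n → ℝ → Spc n → ℝ, HasGrad T (fi i) g ∧
            ∀ j, Cls T (JP T l) N' (s' + 1) (W + 1 + 1) C (g j) :=
          fun i => (cls_succ.1 (hfi' i)).2.1
        choose fij hfij hfij' using hx
        refine ⟨_, hasDt_gpot hμ hT hW (hf.dat hT le_rfl) (fun i => (hfi' i).dat hT (by linarith))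
          (fun i j => (hfij' i j).dat hT (by linarith)) hfi hfij i, ?_⟩
        exact hK.cls_mono (by linarith) le_rfl (by positivity) (h₂ C _ _ (hfi' i) (hfij' i))
      obtain ⟨A₂, hA₂, h₂⟩ := hdt
      refine ⟨A₀ + A₁ + A₂, by positivity, fun i C f hf => ?_⟩
      have hC := hf.nonneg hT
      obtain ⟨-, ⟨fi, hfi, hfi'⟩, -⟩ := cls_succ.1 hf
      refine cls_succ.2 ⟨(h₀ i C f hf).mono ?_, ⟨_, hasGrad_gpot hμ hT hW (hf.dat hT le_rfl)
        (fun i => (hfi' i).dat hT (by linarith)) hfi i, fun j => ?_⟩, fun N' s' hN hs => ?_⟩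
      · have := mul_nonneg hA₁ hC
        have := mul_nonneg hA₂ hC
        linarith
      · refine hK.cls_mono le_rfl ?_ (by positivity) (h₁ i C _ (hfi' j))
        have := mul_nonneg hA₀ hC
        have := mul_nonneg hA₂ hC
        linarith
      · obtain ⟨h, hh, hh'⟩ := h₂ i C f hf N' s' hN hs
        refine ⟨h, hh, hK.cls_mono le_rfl ?_ (by positivity) hh'⟩
        have := mul_nonneg hA₀ hC
        have := mul_nonneg hA₁ hC
        linarith

/-- The heat potential gains one derivative and loses one order of decay. -/
theorem cls_vpot (hμ : 0 < μ) (hT : 0 < T) (hl : 0 < l) (hl1 : l < 1) (hl' : 0 < l')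
    (hl1' : l' < 1) (N s : ℕ) (W : ℝ) (hW : 0 ≤ W) :
    ∃ A : ℝ, 0 ≤ A ∧ ∀ C f, Cls T (JP T l) (N + 1) (s + 1) (W + 1) C f →
      Cls T (KP (n := n) T l l') (N + 2) (s + 1) W (A * C) (vpot T μ f) := by
  have hK := adm_KP (n := n) hT hl hl'
  obtain ⟨A₁, hA₁, h₁⟩ := cls_gpot (n := n) (l := l) hμ hT hl hl1 hl' hl1' (N + 1) (s + 1)
    (W + 1) (by linarith)
  obtain ⟨A₂, hA₂, h₂⟩ := cls_heat_rhs (n := n) (μ := μ) (W := W + 1) (s := s) (N := N) hT hl hl1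
    hl' hl1' (by linarith) (cls_gpot hμ hT hl hl1 hl' hl1' N (s + 1) (W + 1 + 1) (by linarith))
  obtain ⟨A₃, hA₃, h₃⟩ := vol_sup (n := n) ker_phi hμ hW hT
  set B := A₁ + A₂ + A₃ with hB
  refine ⟨((n + 1) * 2 ^ W + (1 + T) + 1) * B, by positivity, fun C f hf => ?_⟩
  have hC := hf.nonneg hT
  obtain ⟨-, ⟨fi, hfi, hfi'⟩, -⟩ := cls_succ.1 hf
  have hdf := hf.dat hT (W' := W) (by linarith)
  have hdfi : ∀ i, Dat W C (ext T (fi i)) := fun i => (hfi' i).dat hT (by linarith)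
  have hg := hasGrad_vpot hμ hT hW hdf hdfi hfi
  have ht := hasDt_vpot hμ hT hW hdf hdfi hfi
  have c1 : ∀ i, Cls T (KP T l l') (N + 1) (s + 1) (W + 1) (B * C) (gpot T μ i f) := fun i =>
    hK.cls_mono le_rfl (by gcongr; rw [hB]; linarith) (by positivity) (h₁ i C f hf)
  have c2 := hK.cls_mono (W' := W) (C' := B * C) (by linarith)
    (by gcongr; rw [hB]; linarith) (by positivity) (h₂ C f fi hf hfi')
  have hsup : ∀ t ∈ Set.Icc (0 : ℝ) T, ∀ x, |vpot T μ f t x| ≤ B * C * wt x ^ (-W) := by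
    intro t ht x
    refine (h₃ C _ hdf t ht x).trans ?_
    have := wt_rpow_pos (-W) x
    gcongr
    rw [hB]; linarith
  have hsup' : ∀ i, ∀ t ∈ Set.Icc (0 : ℝ) T, ∀ x, |gpot T μ i f t x| ≤ B * C * wt x ^ (-W) := by
    intro i t ht x
    exact (hK.mono _ _ W _ _ _ (by linarith) le_rfl (by positivity) (c1 i).base).sup t ht x
  have hBC : 0 ≤ B * C := by positivity
  have hle : B * C ≤ ((n + 1) * 2 ^ W + (1 + T) + 1) * B * C := by
    have : (0 : ℝ) ≤ (n + 1) * 2 ^ W + (1 + T) := by positivity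
    nlinarith
  have hBC' := hBC.trans hle
  have hle1 : (n + 1) * 2 ^ W * (B * C) ≤ ((n + 1) * 2 ^ W + (1 + T) + 1) * B * C := by
    have : 0 ≤ (1 + T + 1) * (B * C) := by positivity
    linarith
  have hle2 : (1 + T) * (B * C) ≤ ((n + 1) * 2 ^ W + (1 + T) + 1) * B * C := by
    have : 0 ≤ ((n + 1) * 2 ^ W + 1) * (B * C) := by positivity
    linarith
  refine cls_succ.2 ⟨⟨fun t ht x => ?_, fun t ht x y => ?_, fun t h t' h' x => ?_⟩,
    ⟨_, hg, fun i => hK.cls_mono le_rfl hle hBC' (c1 i)⟩,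
    fun N' s' hN hs => ?_⟩
  · have := wt_rpow_pos (-W) x
    exact (hsup t ht x).trans (by gcongr)
  · have := wt_rpow_pos (-W) x
    have := wt_rpow_pos (-W) y
    rw [if_neg (Nat.succ_ne_zero _)]
    refine (space_of_grad hl'.le hl1'.le hW hBC hg hsup hsup' t ht x y).trans ?_
    exact mul_le_mul_of_nonneg_right (mul_le_mul_of_nonneg_right hle1 (by positivity))
      (by positivity)
  · have := wt_rpow_pos (-W) x
    rw [if_neg (Nat.succ_ne_zero _)]
    refine (time_of_dt hT hl'.le (by linarith) hBC ht c2.base.sup t h t' h' x).trans ?_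
    exact mul_le_mul_of_nonneg_right (mul_le_mul_of_nonneg_right hle2 (by positivity))
      (by positivity)
  · obtain rfl : N = N' := by omega
    obtain rfl : s = s' := by omega
    exact ⟨_, ht, hK.cls_mono le_rfl hle hBC' c2⟩

end classes

section Seminorms

variable {T : ℝ} {F : Type*} [NormedAddCommGroup F] [NormedSpace ℝ F]

/-- An extended seminorm on functions on `[0,T] × ℝⁿ` which is lower semicontinuous, up to the
factor `K`, with respect to pointwise convergence. -/
structure PSemi (T : ℝ) (K : ℝ≥0∞) (E : (ℝ → Spc n → F) → ℝ≥0∞) : Prop where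
  congr : ∀ u v, (∀ t ∈ Set.Icc (0 : ℝ) T, ∀ x, u t x = v t x) → E u = E v
  add : ∀ u v, E (fun t x => u t x + v t x) ≤ E u + E v
  smul : ∀ (c : ℝ) u, E (fun t x => c • u t x) ≤ ENNReal.ofReal |c| * E u
  lsc : ∀ (u : ℕ → ℝ → Spc n → F) v B, (∀ m, E (u m) ≤ B) →
    (∀ t ∈ Set.Icc (0 : ℝ) T, ∀ x, Tendsto (fun m => u m t x) atTop (nhds (v t x))) →
    E v ≤ K * B

theorem pSemi_base {t t' : ℝ} (ht : t ∈ Set.Icc 0 T) (ht' : t' ∈ Set.Icc 0 T) (x y : Spc n)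
    (b : ℝ) {c : ℝ} (hc : 0 ≤ c) :
    PSemi T 1 (fun v : ℝ → Spc n → F => ENNReal.ofReal (c * ‖v t x - b • v t' y‖)) where
  congr u v h := by simp only [h t ht x, h t' ht' y]
  add u v := by
    rw [← ENNReal.ofReal_add (by positivity) (by positivity), ← mul_add]
    apply ENNReal.ofReal_le_ofReal
    refine mul_le_mul_of_nonneg_left ?_ hc
    refine le_of_eq_of_le (congrArg norm ?_) (norm_add_le _ _)
    rw [smul_add, add_sub_add_comm]
  smul a u := by
    rw [← ENNReal.ofReal_mul (abs_nonneg a)]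
    apply ENNReal.ofReal_le_ofReal
    rw [smul_comm b a, ← smul_sub, norm_smul, Real.norm_eq_abs]
    exact le_of_eq (by ring)
  lsc u v B hB h := by
    rw [one_mul]
    have h1 : Tendsto (fun m => ENNReal.ofReal (c * ‖u m t x - b • u m t' y‖)) atTop
        (nhds (ENNReal.ofReal (c * ‖v t x - b • v t' y‖))) :=
      ENNReal.tendsto_ofReal
        (((h t ht x).sub ((h t' ht' y).const_smul b)).norm.const_mul c)
    exact le_of_tendsto' h1 hB

variable {K K' : ℝ≥0∞} {E E' : (ℝ → Spc n → F) → ℝ≥0∞}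

theorem PSemi.of_eq (h : PSemi T K E) (hE : ∀ v, E v = E' v) : PSemi T K E' := by
  rwa [← funext hE]

theorem PSemi.iSup {ι : Sort*} {E : ι → (ℝ → Spc n → F) → ℝ≥0∞}
    (h : ∀ i, PSemi T K (E i)) : PSemi T K (fun v => ⨆ i, E i v) where
  congr u v huv := iSup_congr fun i => (h i).congr u v huv
  add u v := iSup_le fun i =>
    ((h i).add u v).trans (add_le_add (le_iSup (fun i => E i u) i) (le_iSup (fun i => E i v) i))
  smul c u := iSup_le fun i =>
    ((h i).smul c u).trans (mul_le_mul_right (le_iSup (fun i => E i u) i) _)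
  lsc u v B hB huv := iSup_le fun i =>
    (h i).lsc u v B (fun m => (le_iSup (fun i => E i (u m)) i).trans (hB m)) huv

theorem PSemi.sum_two (h : PSemi T K E) (h' : PSemi T K' E') :
    PSemi T (K + K') (fun v => E v + E' v) where
  congr u v huv := by rw [h.congr u v huv, h'.congr u v huv]
  add u v := (add_le_add (h.add u v) (h'.add u v)).trans (le_of_eq (by ring))
  smul c u := (add_le_add (h.smul c u) (h'.smul c u)).trans (le_of_eq (by ring))
  lsc u v B hB huv := by
    rw [add_mul]
    exact add_le_add (h.lsc u v B (fun m => le_self_add.trans (hB m)) huv)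
      (h'.lsc u v B (fun m => le_add_self.trans (hB m)) huv)

theorem pSemi_base_single {t : ℝ} (ht : t ∈ Set.Icc 0 T) (x : Spc n) {c : ℝ} (hc : 0 ≤ c) :
    PSemi T 1 (fun v : ℝ → Spc n → F => ENNReal.ofReal (c * ‖v t x‖)) :=
  (pSemi_base ht ht x x 0 hc).of_eq fun v => by simp

theorem pSemi_eAniso0 {lam : ℝ} (hl : 0 < lam) (δ : ℝ) :
    PSemi T 5 (fun v : ℝ → Spc n → F => eAniso0 T lam δ v) := by
  have hsup : ∀ t ∈ Set.Icc (0 : ℝ) T,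
      PSemi T 1 (fun v : ℝ → Spc n → F => eWSup δ (v t)) := fun t ht =>
    PSemi.iSup fun x => pSemi_base_single ht x (wt_rpow_pos δ x).le
  have hwh : ∀ t ∈ Set.Icc (0 : ℝ) T,
      PSemi T 1 (fun v : ℝ → Spc n → F => eWHold lam δ (v t)) := fun t ht =>
    PSemi.iSup fun x => PSemi.iSup fun y => PSemi.iSup fun _ =>
      (pSemi_base ht ht x y 1 (c := wt2 x y ^ (δ + lam) / ‖x - y‖ ^ lam) (by
        have : 0 ≤ wt2 x y := (wt_pos x).le.trans (le_max_left _ _)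
        positivity)).of_eq fun v => by rw [one_smul, div_mul_eq_mul_div]
  have hoh : ∀ t ∈ Set.Icc (0 : ℝ) T,
      PSemi T 2 (fun v : ℝ → Spc n → F => eOHold lam (v t)) := fun t ht => by
    rw [← one_add_one_eq_two]
    refine PSemi.sum_two ?_ ?_
    · exact PSemi.iSup fun x => PSemi.iSup fun _ =>
        (pSemi_base_single ht x zero_le_one).of_eq fun v => by rw [one_mul]
    · exact PSemi.iSup fun x => PSemi.iSup fun y => PSemi.iSup fun _ =>
        (pSemi_base ht ht x y 1 (c := 1 / ‖x - y‖ ^ lam) (by positivity)).of_eq fun v => by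
          rw [one_smul, div_mul_eq_mul_div, one_mul]
  have e : (5 : ℝ≥0∞) = (2 + 1 + 1) + 1 := by norm_num
  rw [e]
  simp only [eAniso0, if_neg hl.ne']
  refine PSemi.sum_two ?_ ?_
  · refine PSemi.iSup fun t => ?_
    simp only [eHol0, if_neg hl.ne']
    exact ((hoh t t.2).sum_two (hsup t t.2)).sum_two (hwh t t.2)
  · exact PSemi.iSup fun t => PSemi.iSup fun t' => PSemi.iSup fun _ => PSemi.iSup fun x =>
      (pSemi_base t.2 t'.2 x x 1 (c := wt x ^ δ / |(t : ℝ) - (t' : ℝ)| ^ (lam / 2)) (by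
        have := (wt_rpow_pos δ x).le
        positivity)).of_eq fun v => by rw [one_smul, div_mul_eq_mul_div]

end Seminorms

section BaseNorm

variable {T lam δ : ℝ} {F : Type*} [NormedAddCommGroup F]

theorem eAniso0_sup (hl : 0 < lam) {v : ℝ → Spc n → F} {R : ℝ} (hR : 0 ≤ R)
    (h : eAniso0 T lam δ v ≤ ENNReal.ofReal R) :
    ∀ t ∈ Set.Icc (0 : ℝ) T, ∀ x, ‖v t x‖ ≤ R * wt x ^ (-δ) := by
  intro t ht x
  have h1 : ENNReal.ofReal (wt x ^ δ * ‖v t x‖) ≤ ENNReal.ofReal R := by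
    refine le_trans ?_ h
    rw [eAniso0]
    refine le_add_right ?_
    refine le_trans ?_ (le_iSup (fun t : Set.Icc (0 : ℝ) T => eHol0 lam δ (v t)) ⟨t, ht⟩)
    simp only [eHol0, if_neg hl.ne']
    refine le_add_right (le_add_left ?_)
    exact le_iSup (fun x => ENNReal.ofReal (wt x ^ δ * ‖v t x‖)) x
  rw [ENNReal.ofReal_le_ofReal_iff hR] at h1
  have hp := wt_rpow_pos δ x
  rw [Real.rpow_neg (wt_pos x).le, ← div_eq_mul_inv, le_div_iff₀ hp]
  linarith

theorem eAniso0_time (hl : 0 < lam) {v : ℝ → Spc n → F} {R : ℝ} (hR : 0 ≤ R)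
    (h : eAniso0 T lam δ v ≤ ENNReal.ofReal R) :
    ∀ t ∈ Set.Icc (0 : ℝ) T, ∀ t' ∈ Set.Icc (0 : ℝ) T, ∀ x,
      ‖v t x - v t' x‖ ≤ R * wt x ^ (-δ) * |t - t'| ^ (lam / 2) := by
  intro t ht t' ht' x
  by_cases hne : t = t'
  · subst hne
    have := wt_rpow_pos (-δ) x
    simp only [sub_self, norm_zero]
    positivity
  have h1 : ENNReal.ofReal (wt x ^ δ * ‖v t x - v t' x‖ / |t - t'| ^ (lam / 2)) ≤
      ENNReal.ofReal R := by
    refine le_trans ?_ h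
    rw [eAniso0, if_neg hl.ne']
    refine le_add_left ?_
    refine le_iSup_of_le ⟨t, ht⟩ (le_iSup_of_le ⟨t', ht'⟩ (le_iSup_of_le hne ?_))
    exact le_iSup (fun x => ENNReal.ofReal (wt x ^ δ * ‖v t x - v t' x‖ / |t - t'| ^ (lam / 2))) x
  rw [ENNReal.ofReal_le_ofReal_iff hR] at h1
  have hp := wt_rpow_pos δ x
  have hq : 0 < |t - t'| ^ (lam / 2) := Real.rpow_pos_of_pos (abs_pos.2 (sub_ne_zero.2 hne)) _
  rw [div_le_iff₀ hq] at h1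
  rw [Real.rpow_neg (wt_pos x).le, mul_right_comm, ← div_eq_mul_inv, le_div_iff₀ hp]
  linarith

theorem wt_le_two_mul_of_cone {x y : Spc n} (h : ‖x - y‖ ≤ ‖x‖ / 2) :
    wt x ≤ 2 * wt y ∧ wt y ≤ 2 * wt x := by
  have hx := norm_le_wt x
  constructor
  · have := wt_le_add x y
    linarith
  · have := wt_le_add y x
    rw [norm_sub_rev] at this
    linarith [wt_pos x]

theorem eAniso0_le (hl : 0 < lam) (hl1 : lam ≤ 1) (hδ : 0 ≤ δ) {v : ℝ → Spc n → F} {D : ℝ}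
    (hD : 0 ≤ D)
    (hsup : ∀ t ∈ Set.Icc (0 : ℝ) T, ∀ x, ‖v t x‖ ≤ D * wt x ^ (-(δ + 1)))
    (hspace : ∀ t ∈ Set.Icc (0 : ℝ) T, ∀ x y,
      ‖v t x - v t y‖ ≤ D * (wt x ^ (-(δ + 1)) + wt y ^ (-(δ + 1))) * ‖x - y‖ ^ lam)
    (htime : ∀ t ∈ Set.Icc (0 : ℝ) T, ∀ t' ∈ Set.Icc (0 : ℝ) T, ∀ x,
      ‖v t x - v t' x‖ ≤ D * wt x ^ (-(δ + 1)) * |t - t'| ^ (lam / 2)) :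
    eAniso0 T lam δ v ≤ ENNReal.ofReal ((5 + 2 * 2 ^ (δ + 1)) * D) := by
  have e : (5 + 2 * 2 ^ (δ + 1)) * D = ((D + 2 * D) + D) + 2 * 2 ^ (δ + 1) * D + D := by ring
  have h2 : (0 : ℝ) < 2 ^ (δ + 1) := by positivity
  have hw1 : ∀ x : Spc n, wt x ^ (-(δ + 1)) ≤ 1 := wt_rpow_le_one (by linarith)
  have hwδ : ∀ x : Spc n, wt x ^ δ * wt x ^ (-(δ + 1)) ≤ 1 := fun x => by
    rw [← Real.rpow_add (wt_pos x)]
    exact Real.rpow_le_one_of_one_le_of_nonpos (one_le_wt x) (by linarith)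
  rw [e, ENNReal.ofReal_add (by positivity) hD, ENNReal.ofReal_add (by positivity) (by positivity),
    ENNReal.ofReal_add (by positivity) (by positivity),
    ENNReal.ofReal_add (by positivity) (by positivity), eAniso0, if_neg hl.ne']
  refine add_le_add (iSup_le fun t => ?_) ?_
  · simp only [eHol0, if_neg hl.ne', eOHold]
    refine add_le_add (add_le_add (add_le_add ?_ ?_) ?_) ?_
    · refine iSup_le fun x => iSup_le fun _ => ENNReal.ofReal_le_ofReal ?_
      refine (hsup t t.2 x).trans ?_
      exact mul_le_of_le_one_right hD (hw1 x)
    · refine iSup_le fun x => iSup_le fun y => iSup_le fun hxy => ENNReal.ofReal_le_ofReal ?_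
      have hp : 0 < ‖x - y‖ ^ lam :=
        Real.rpow_pos_of_pos (norm_pos_iff.2 (sub_ne_zero.2 hxy.2.2)) _
      rw [div_le_iff₀ hp]
      refine (hspace t t.2 x y).trans (mul_le_mul_of_nonneg_right ?_ hp.le)
      have := mul_le_mul_of_nonneg_left (add_le_add (hw1 x) (hw1 y)) hD
      linarith
    · refine iSup_le fun x => ENNReal.ofReal_le_ofReal ?_
      have h3 := mul_le_mul_of_nonneg_left (hsup t t.2 x) (wt_rpow_pos δ x).le
      have h4 := mul_le_mul_of_nonneg_left (hwδ x) hD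
      linarith
    · refine iSup_le fun x => iSup_le fun y => iSup_le fun hxy => ENNReal.ofReal_le_ofReal ?_
      have hp : 0 < ‖x - y‖ ^ lam :=
        Real.rpow_pos_of_pos (norm_pos_iff.2 (sub_ne_zero.2 hxy.1)) _
      rw [div_le_iff₀ hp]
      have hm : 0 < wt2 x y := (wt_pos x).trans_le (le_max_left _ _)
      have hm1 : 1 ≤ wt2 x y := (one_le_wt x).trans (le_max_left _ _)
      obtain ⟨c1, c2⟩ := wt_le_two_mul_of_cone hxy.2
      have hmx : wt2 x y ≤ 2 * wt x := max_le (by linarith [wt_pos x]) c2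
      have hmy : wt2 x y ≤ 2 * wt y := max_le c1 (by linarith [wt_pos y])
      have key : ∀ z : Spc n, wt2 x y ≤ 2 * wt z →
          wt2 x y ^ (δ + lam) * wt z ^ (-(δ + 1)) ≤ 2 ^ (δ + 1) := fun z hz => by
        have k1 : wt2 x y ^ (δ + lam) ≤ wt2 x y ^ (δ + 1) :=
          Real.rpow_le_rpow_of_exponent_le hm1 (by linarith)
        have k2 : wt2 x y ^ (δ + 1) ≤ (2 * wt z) ^ (δ + 1) :=
          Real.rpow_le_rpow hm.le hz (by linarith)
        rw [Real.mul_rpow (by norm_num) (wt_pos z).le] at k2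
        calc _ ≤ 2 ^ (δ + 1) * wt z ^ (δ + 1) * wt z ^ (-(δ + 1)) :=
              mul_le_mul_of_nonneg_right (k1.trans k2) (wt_rpow_pos _ z).le
          _ = 2 ^ (δ + 1) := by
              rw [mul_assoc, ← Real.rpow_add (wt_pos z)]; simp
      have h3 := mul_le_mul_of_nonneg_left (hspace t t.2 x y) (Real.rpow_nonneg hm.le (δ + lam))
      refine h3.trans ?_
      have h5 := mul_le_mul_of_nonneg_left (add_le_add (key x hmx) (key y hmy)) hD
      have h6 := mul_le_mul_of_nonneg_right h5 hp.le
      refine le_trans (le_of_eq ?_) (h6.trans (le_of_eq ?_)) <;> ring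
  · refine iSup_le fun t => iSup_le fun t' => iSup_le fun htt => iSup_le fun x =>
      ENNReal.ofReal_le_ofReal ?_
    have hq : 0 < |(t : ℝ) - t'| ^ (lam / 2) :=
      Real.rpow_pos_of_pos (abs_pos.2 (sub_ne_zero.2 htt)) _
    rw [div_le_iff₀ hq]
    have h3 := mul_le_mul_of_nonneg_left (htime t t.2 t' t'.2 x) (wt_rpow_pos δ x).le
    have h4 := mul_le_mul_of_nonneg_right (mul_le_mul_of_nonneg_left (hwδ x) hD) hq.le
    linarith

end BaseNorm

section SpaceNorm

variable {T : ℝ} {K s : ℕ} {lam δ : ℝ} {u v : ℝ → Spc n → ℝ}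

theorem le_eAnisoKS {j p : ℕ} (hj : j ≤ s) (hp : p + 2 * j ≤ 2 * s + K) :
    eAniso0 T lam (δ + p) (mixDeriv T p j u) ≤ eAnisoKS T K s lam δ u := by
  obtain ⟨m, b, hb, hm, hmj, hbm⟩ : ∃ m b : ℕ, b ≤ K ∧ m ≤ 2 * s ∧ m + 2 * j ≤ 2 * s ∧ b + m = p := by
    refine ⟨min p (2 * s - 2 * j), p - min p (2 * s - 2 * j), ?_, ?_, ?_, ?_⟩ <;> omega
  subst hbm
  rw [eAnisoKS]
  refine le_trans ?_ (Finset.single_le_sum (fun _ _ => zero_le)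
    (Finset.mem_range.2 (Nat.lt_succ_of_le hb)))
  refine le_trans ?_ (Finset.single_le_sum (fun _ _ => zero_le)
    (Finset.mem_range.2 (Nat.lt_succ_of_le hm)))
  refine le_trans ?_ (Finset.single_le_sum (fun _ _ => zero_le)
    (Finset.mem_range.2 (Nat.lt_succ_of_le hj)))
  rw [if_pos hmj]
  push_cast
  rw [add_assoc]

theorem eAnisoKS_congr_le {K' : ℝ≥0∞} {u v : ℝ → Spc n → ℝ} {lam' δ' : ℝ}
    (h : ∀ j p, j ≤ s → p + 2 * j ≤ 2 * s + K →
      eAniso0 T lam' (δ' + p) (mixDeriv T p j u) ≤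
        K' * eAniso0 T lam (δ + p) (mixDeriv T p j v)) :
    eAnisoKS T K s lam' δ' u ≤ K' * eAnisoKS T K s lam δ v := by
  simp only [eAnisoKS, Finset.mul_sum]
  refine Finset.sum_le_sum fun b hb => Finset.sum_le_sum fun m _ => Finset.sum_le_sum fun j hj => ?_
  rw [Finset.mem_range] at hb hj
  split_ifs with hmj
  · have := h j (b + m) (by omega) (by omega)
    push_cast at this
    rwa [← add_assoc, ← add_assoc] at this
  · simp

theorem eAnisoKS_add_le {u v z : ℝ → Spc n → ℝ}
    (h : ∀ j p, j ≤ s → p + 2 * j ≤ 2 * s + K →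
      eAniso0 T lam (δ + p) (mixDeriv T p j z) ≤
        eAniso0 T lam (δ + p) (mixDeriv T p j u) + eAniso0 T lam (δ + p) (mixDeriv T p j v)) :
    eAnisoKS T K s lam δ z ≤ eAnisoKS T K s lam δ u + eAnisoKS T K s lam δ v := by
  simp only [eAnisoKS, ← Finset.sum_add_distrib]
  refine Finset.sum_le_sum fun b hb => Finset.sum_le_sum fun m _ => Finset.sum_le_sum fun j hj => ?_
  rw [Finset.mem_range] at hb hj
  split_ifs with hmj
  · have := h j (b + m) (by omega) (by omega)
    push_cast at this
    rwa [← add_assoc] at this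
  · simp

/-- The number of terms in the definition of the norm. -/
def termCount (K s : ℕ) : ℕ := (K + 1) * ((2 * s + 1) * (s + 1))

theorem eAnisoKS_le_of_terms {B : ℝ≥0∞}
    (h : ∀ j p, j ≤ s → p + 2 * j ≤ 2 * s + K →
      eAniso0 T lam (δ + p) (mixDeriv T p j u) ≤ B) :
    eAnisoKS T K s lam δ u ≤ termCount K s * B := by
  have : ∀ b ∈ Finset.range (K + 1), ∀ m ∈ Finset.range (2 * s + 1), ∀ j ∈ Finset.range (s + 1),
      (if m + 2 * j ≤ 2 * s then eAniso0 T lam (δ + b + m) (mixDeriv T (b + m) j u) else 0) ≤ B := by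
    intro b hb m _ j hj
    rw [Finset.mem_range] at hb hj
    split_ifs with hmj
    · have := h j (b + m) (by omega) (by omega)
      push_cast at this
      rwa [← add_assoc] at this
    · simp
  rw [eAnisoKS]
  refine (Finset.sum_le_sum fun b hb => Finset.sum_le_sum fun m hm => Finset.sum_le_sum fun j hj =>
    this b hb m hm j hj).trans (le_of_eq ?_)
  simp [termCount, mul_assoc]

theorem Jets.add {N : ℕ} {G G' : List (Fin n) → ℕ → ℝ → Spc n → ℝ} (h : Jets T N s G)
    (h' : Jets T N s G') : Jets T N s (fun w j t x => G w j t x + G' w j t x) where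
  cont w j hj hw := (h.cont w j hj hw).add (h'.cont w j hj hw)
  grad w j hj hw := (h.grad w j hj hw).add (h'.grad w j hj hw)
  dt j hj hw := (h.dt j hj hw).add (h'.dt j hj hw)

theorem Jets.smul {N : ℕ} {G : List (Fin n) → ℕ → ℝ → Spc n → ℝ} (c : ℝ) (h : Jets T N s G) :
    Jets T N s (fun w j t x => c * G w j t x) where
  cont w j hj hw := (contT_const c).mul (h.cont w j hj hw)
  grad w j hj hw := (h.grad w j hj hw).smul c
  dt j hj hw := (h.dt j hj hw).smul c

theorem mixD_nil_zero (f : ℝ → Spc n → ℝ) : mixD T [] 0 f = f := by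
  funext t x
  simp [NSdeRham.mixD, pdw, tDeriv_zero]

theorem AnisoReg.add (hT : 0 < T) (hu : AnisoReg T K s u) (hv : AnisoReg T K s v) :
    AnisoReg T K s (fun t x => u t x + v t x) := by
  have h := ((hu.jets hT).add (hv.jets hT)).reg hT
  simpa only [mixD_nil_zero] using h

theorem AnisoReg.smul (hT : 0 < T) (c : ℝ) (hu : AnisoReg T K s u) :
    AnisoReg T K s (fun t x => c * u t x) := by
  have h := ((hu.jets hT).smul c).reg hT
  simpa only [mixD_nil_zero] using h

theorem AnisoReg.mixD_add (hT : 0 < T) (hu : AnisoReg T K s u) (hv : AnisoReg T K s v) {j : ℕ}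
    {w : List (Fin n)} (hj : j ≤ s) (hw : w.length + 2 * j ≤ 2 * s + K) :
    ∀ t ∈ Set.Icc (0 : ℝ) T, ∀ x, NSdeRham.mixD T w j (fun t x => u t x + v t x) t x =
      NSdeRham.mixD T w j u t x + NSdeRham.mixD T w j v t x := by
  have h := ((hu.jets hT).add (hv.jets hT)).mixD_eq hT hj hw
  simpa only [mixD_nil_zero] using h

theorem AnisoReg.mixD_smul (hT : 0 < T) (c : ℝ) (hu : AnisoReg T K s u) {j : ℕ}
    {w : List (Fin n)} (hj : j ≤ s) (hw : w.length + 2 * j ≤ 2 * s + K) :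
    ∀ t ∈ Set.Icc (0 : ℝ) T, ∀ x, NSdeRham.mixD T w j (fun t x => c * u t x) t x =
      c * NSdeRham.mixD T w j u t x := by
  have h := ((hu.jets hT).smul c).mixD_eq hT hj hw
  simpa only [mixD_nil_zero] using h

theorem AnisoReg.congr (hT : 0 < T) (hu : AnisoReg T K s u)
    (h : ∀ t ∈ Set.Icc (0 : ℝ) T, ∀ x, u t x = v t x) : AnisoReg T K s v := by
  have h1 := ((hu.jets hT).congr (G' := fun w j => if w = [] ∧ j = 0 then v else mixD T w j u)
    (fun w j t ht x => by
      split_ifs with hwj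
      · rw [hwj.1, hwj.2, mixD_nil_zero, h t ht x]
      · rfl)).reg hT
  simpa using h1

theorem mixDeriv_congr (h : ∀ t ∈ Set.Icc (0 : ℝ) T, ∀ x, u t x = v t x) (p j : ℕ) :
    ∀ t ∈ Set.Icc (0 : ℝ) T, ∀ x, mixDeriv T p j u t x = mixDeriv T p j v t x := by
  intro t ht x
  rw [mixDeriv, mixDeriv]
  congr 1
  funext x
  exact tDeriv_congr h j t ht x

theorem AnisoReg.mixDeriv_eq_sum (hu : AnisoReg T K s u) {p j : ℕ} (hj : j ≤ s)
    (hp : p + 2 * j ≤ 2 * s + K) :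
    ∀ t ∈ Set.Icc (0 : ℝ) T, ∀ x, mixDeriv T p j u t x =
      ∑ i : Fin p → Fin n, NSdeRham.mixD T (List.ofFn i) j u t x • coordForm i :=
  fun _ ht x => iteratedFDeriv_eq_sum (hu.contDiff hj hp ht) x

theorem AnisoReg.mixDeriv_add (hT : 0 < T) (hu : AnisoReg T K s u) (hv : AnisoReg T K s v)
    {p j : ℕ} (hj : j ≤ s) (hp : p + 2 * j ≤ 2 * s + K) :
    ∀ t ∈ Set.Icc (0 : ℝ) T, ∀ x, mixDeriv T p j (fun t x => u t x + v t x) t x =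
      mixDeriv T p j u t x + mixDeriv T p j v t x := by
  intro t ht x
  rw [(hu.add hT hv).mixDeriv_eq_sum hj hp t ht, hu.mixDeriv_eq_sum hj hp t ht,
    hv.mixDeriv_eq_sum hj hp t ht, ← Finset.sum_add_distrib]
  refine Finset.sum_congr rfl fun i _ => ?_
  rw [hu.mixD_add hT hv hj (by simpa using hp) t ht, add_smul]

theorem AnisoReg.mixDeriv_smul (hT : 0 < T) (c : ℝ) (hu : AnisoReg T K s u)
    {p j : ℕ} (hj : j ≤ s) (hp : p + 2 * j ≤ 2 * s + K) :
    ∀ t ∈ Set.Icc (0 : ℝ) T, ∀ x, mixDeriv T p j (fun t x => c * u t x) t x =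
      c • mixDeriv T p j u t x := by
  intro t ht x
  rw [(hu.smul hT c).mixDeriv_eq_sum hj hp t ht, hu.mixDeriv_eq_sum hj hp t ht, Finset.smul_sum]
  refine Finset.sum_congr rfl fun i _ => ?_
  rw [hu.mixD_smul hT c hj (by simpa using hp) t ht, mul_smul]

theorem eAnisoKS_congr (hl : 0 < lam) (h : ∀ t ∈ Set.Icc (0 : ℝ) T, ∀ x, u t x = v t x) :
    eAnisoKS T K s lam δ u = eAnisoKS T K s lam δ v := by
  simp only [eAnisoKS]
  refine Finset.sum_congr rfl fun b _ => Finset.sum_congr rfl fun m _ =>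
    Finset.sum_congr rfl fun j _ => ?_
  rw [(pSemi_eAniso0 hl _).congr _ _ (mixDeriv_congr h (b + m) j)]

theorem AnisoReg.eAnisoKS_add (hT : 0 < T) (hl : 0 < lam) {K' : ℕ} (hK : K' ≤ K)
    (hu : AnisoReg T K s u) (hv : AnisoReg T K s v) :
    eAnisoKS T K' s lam δ (fun t x => u t x + v t x) ≤
      eAnisoKS T K' s lam δ u + eAnisoKS T K' s lam δ v := by
  refine eAnisoKS_add_le fun j p hj hp => ?_
  rw [(pSemi_eAniso0 hl _).congr _ _ (hu.mixDeriv_add hT hv hj (by omega))]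
  exact (pSemi_eAniso0 hl _).add _ _

theorem AnisoReg.eAnisoKS_smul (hT : 0 < T) (hl : 0 < lam) {K' : ℕ} (hK : K' ≤ K) (c : ℝ)
    (hu : AnisoReg T K s u) :
    eAnisoKS T K' s lam δ (fun t x => c * u t x) ≤
      ENNReal.ofReal |c| * eAnisoKS T K' s lam δ u := by
  refine eAnisoKS_congr_le fun j p hj hp => ?_
  rw [(pSemi_eAniso0 hl _).congr _ _ (hu.mixDeriv_smul hT c hj (by omega))]
  exact (pSemi_eAniso0 hl _).smul _ _

theorem eAnisoKS_lsc (hl : 0 < lam) {K' : ℕ} (hK : K' ≤ K) {z : ℕ → ℝ → Spc n → ℝ}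
    (hz : ∀ m, AnisoReg T K s (z m)) (hv : AnisoReg T K s v) {B : ℝ≥0∞}
    (hB : ∀ m, eAnisoKS T K' s lam δ (z m) ≤ B)
    (h : ∀ (w : List (Fin n)) (j : ℕ), j ≤ s → w.length + 2 * j ≤ 2 * s + K →
      ∀ t ∈ Set.Icc (0 : ℝ) T, ∀ x,
        Tendsto (fun m => mixD T w j (z m) t x) atTop (nhds (mixD T w j v t x))) :
    eAnisoKS T K' s lam δ v ≤ termCount K' s * (5 * B) := by
  refine eAnisoKS_le_of_terms fun j p hj hp => ?_
  refine (pSemi_eAniso0 hl _).lsc (fun m => mixDeriv T p j (z m)) _ B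
    (fun m => (le_eAnisoKS hj hp).trans (hB m)) fun t ht x => ?_
  rw [hv.mixDeriv_eq_sum hj (by omega) t ht]
  simp only [fun m => (hz m).mixDeriv_eq_sum hj (show p + 2 * j ≤ 2 * s + K by omega) t ht]
  exact tendsto_finsetSum _ fun i _ =>
    (h (List.ofFn i) j hj (by simpa using (show p + 2 * j ≤ 2 * s + K by omega)) t ht x).smul_const _

variable {k : ℕ} {lam' : ℝ}

theorem AnisoReg.cls_JP (hT : 0 < T) (hl : 0 < lam) (hl' : 0 < lam')
    (hu : AnisoReg T (k + 1) s u) {R : ℝ} (hR : 0 ≤ R)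
    (h : eFn T k s lam lam' δ u ≤ ENNReal.ofReal R) :
    Cls T (JP T lam') (2 * s + (k + 1)) s δ R u := by
  refine hu.cls hT fun M w j hj hM => ?_
  have hc : ∀ t ∈ Set.Icc (0 : ℝ) T, ContDiff ℝ w.length (fun x => tDeriv T j u t x) :=
    fun t ht => hu.contDiff hj (by omega) ht
  refine ⟨hu.contT_mixD hj (by omega), fun t ht x => ?_, fun hM1 t ht t' ht' x => ?_⟩
  · have h1 : eAniso0 T lam (δ + w.length) (mixDeriv T w.length j u) ≤ ENNReal.ofReal R :=
      (le_eAnisoKS hj (by omega)).trans (le_self_add.trans h)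
    exact (abs_pdw_le rfl (hc t ht) x).trans (eAniso0_sup hl hR h1 t ht x)
  · have h1 : eAniso0 T lam' (δ + w.length) (mixDeriv T w.length j u) ≤ ENNReal.ofReal R :=
      (le_eAnisoKS hj (by omega)).trans (le_add_self.trans h)
    exact (abs_pdw_sub_le rfl (hc t ht) (hc t' ht') x x).trans
      (eAniso0_time hl' hR h1 t ht t' ht' x)

theorem AnisoReg.eAniso0_mixDeriv_le (hl : 0 < lam) (hl1 : lam ≤ 1) (hδ : 0 ≤ δ)
    (hu : AnisoReg T K s u) {p j : ℕ} (hj : j ≤ s) (hp : p + 2 * j ≤ 2 * s + K) {C : ℝ}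
    (hC : 0 ≤ C)
    (h : ∀ w : List (Fin n), w.length = p → HB T lam (δ + 1) C (NSdeRham.mixD T w j u)) :
    eAniso0 T lam δ (mixDeriv T p j u) ≤
      ENNReal.ofReal ((5 + 2 * 2 ^ (δ + 1)) * ((n : ℝ) ^ p * C)) := by
  have hc : ∀ t ∈ Set.Icc (0 : ℝ) T, ContDiff ℝ p (fun x => tDeriv T j u t x) :=
    fun t ht => hu.contDiff hj (by omega) ht
  refine eAniso0_le hl hl1 hδ (by positivity) (fun t ht x => ?_) (fun t ht x y => ?_)
    fun t ht t' ht' x => ?_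
  · rw [mul_assoc]
    exact norm_iteratedFDeriv_le (hc t ht) x fun w hw => (h w hw).sup t ht x
  · rw [mul_assoc, mul_assoc, ← mul_assoc C]
    exact norm_iteratedFDeriv_sub_le (hc t ht) (hc t ht) x y fun w hw => (h w hw).space t ht x y
  · rw [mul_assoc, mul_assoc, ← mul_assoc C]
    exact norm_iteratedFDeriv_sub_le (hc t ht) (hc t' ht') x x
      fun w hw => (h w hw).time t ht t' ht' x

theorem exists_eFn_le (hl : 0 < lam) (hl1 : lam ≤ 1) (hl' : 0 < lam') (hl1' : lam' ≤ 1)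
    (hδ : 0 ≤ δ) (k s : ℕ) : ∃ A : ℝ, 0 ≤ A ∧ ∀ (C : ℝ) (u : ℝ → Spc n → ℝ), 0 ≤ C →
      AnisoReg T (k + 1) s u →
      (∀ (w : List (Fin n)) (j : ℕ), j ≤ s → w.length + 2 * j ≤ 2 * s + (k + 1) →
        HB T lam (δ + w.length + 1) C (mixD T w j u)) →
      (∀ (w : List (Fin n)) (j : ℕ), j ≤ s → w.length + 2 * j ≤ 2 * s + k →
        HB T lam' (δ + w.length + 1) C (mixD T w j u)) →
      eFn T k s lam lam' δ u ≤ ENNReal.ofReal (A * C) := by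
  set N := 2 * s + (k + 1) with hN
  set A₀ : ℝ := (5 + 2 * 2 ^ (δ + N + 1)) * ((n : ℝ) + 1) ^ N with hA₀
  have hA₀' : 0 ≤ A₀ := by positivity
  refine ⟨termCount (k + 1) s * A₀ + termCount k s * A₀, by positivity, fun C u hC hu h1 h2 => ?_⟩
  have hpow : ∀ p : ℕ, p ≤ N → (5 + 2 * (2 : ℝ) ^ (δ + p + 1)) * ((n : ℝ) ^ p * C) ≤ A₀ * C := by
    intro p hp
    have a1 : (2 : ℝ) ^ (δ + p + 1) ≤ 2 ^ (δ + N + 1) := by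
      apply Real.rpow_le_rpow_of_exponent_le (by norm_num)
      have : (p : ℝ) ≤ N := by exact_mod_cast hp
      linarith
    have a2 : (n : ℝ) ^ p ≤ ((n : ℝ) + 1) ^ N :=
      (pow_le_pow_left₀ (by positivity) (by linarith) p).trans
        (pow_le_pow_right₀ (by linarith [Nat.cast_nonneg (α := ℝ) n]) hp)
    rw [hA₀, ← mul_assoc]
    refine mul_le_mul_of_nonneg_right ?_ hC
    exact mul_le_mul (by linarith) a2 (by positivity) (by positivity)
  clear_value A₀
  rw [eFn, add_mul, ENNReal.ofReal_add (by positivity) (by positivity), mul_assoc, mul_assoc,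
    ENNReal.ofReal_mul (p := (termCount (k + 1) s : ℝ)) (by positivity),
    ENNReal.ofReal_mul (p := (termCount k s : ℝ)) (by positivity), ENNReal.ofReal_natCast,
    ENNReal.ofReal_natCast]
  refine add_le_add (eAnisoKS_le_of_terms fun j p hj hp => ?_)
    (eAnisoKS_le_of_terms fun j p hj hp => ?_)
  · refine (hu.eAniso0_mixDeriv_le hl hl1 (by positivity) hj hp hC fun w hw => ?_).trans
      (ENNReal.ofReal_le_ofReal (hpow p (by omega)))
    subst hw
    exact h1 w j hj hp
  · refine (hu.eAniso0_mixDeriv_le hl' hl1' (by positivity) hj (by omega) hC fun w hw => ?_).trans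
      (ENNReal.ofReal_le_ofReal (hpow p (by omega)))
    subst hw
    exact h2 w j hj hp

end SpaceNorm

section Limits

variable {T : ℝ}

/-- Uniform convergence on `[0,T] × ℝⁿ`. -/
def UConv (T : ℝ) (f : ℕ → ℝ → Spc n → ℝ) (g : ℝ → Spc n → ℝ) : Prop :=
  ∀ ε > 0, ∃ N, ∀ m ≥ N, ∀ t ∈ Set.Icc (0 : ℝ) T, ∀ x, |f m t x - g t x| < ε

theorem UConv.tendsto {f : ℕ → ℝ → Spc n → ℝ} {g : ℝ → Spc n → ℝ} (h : UConv T f g) {t : ℝ}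
    (ht : t ∈ Set.Icc 0 T) (x : Spc n) : Tendsto (fun m => f m t x) atTop (nhds (g t x)) := by
  rw [Metric.tendsto_atTop]
  intro ε hε
  obtain ⟨N, hN⟩ := h ε hε
  exact ⟨N, fun m hm => by rw [Real.dist_eq]; exact hN m hm t ht x⟩

theorem UConv.contT {f : ℕ → ℝ → Spc n → ℝ} {g : ℝ → Spc n → ℝ} (h : UConv T f g)
    (hf : ∀ m, ContT T (f m)) : ContT T g := by
  refine TendstoUniformlyOn.continuousOn (p := atTop)
    (F := fun m => fun p : ℝ × Spc n => f m p.1 p.2) ?_ (Frequently.of_forall hf)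
  rw [Metric.tendstoUniformlyOn_iff]
  intro ε hε
  obtain ⟨N, hN⟩ := h ε hε
  filter_upwards [eventually_ge_atTop N] with m hm p hp
  rw [dist_comm, Real.dist_eq]
  exact hN m hm p.1 hp.1 p.2

theorem norm_sum_smul_proj_le (a : Fin n → ℝ) {B : ℝ} (h : ∀ i, |a i| ≤ B) :
    ‖∑ i, a i • (EuclideanSpace.proj i : Spc n →L[ℝ] ℝ)‖ ≤ n * B := by
  refine (norm_sum_le_of_le (f := fun i => a i • (EuclideanSpace.proj i : Spc n →L[ℝ] ℝ)) _
    (n := fun _ => B) fun i _ => ?_).trans (by simp)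
  rw [norm_smul, Real.norm_eq_abs]
  have h1 : ‖(EuclideanSpace.proj i : Spc n →L[ℝ] ℝ)‖ ≤ 1 :=
    ContinuousLinearMap.opNorm_le_bound _ zero_le_one fun x => by
      rw [one_mul]; exact PiLp.norm_apply_le x i
  calc _ ≤ |a i| * 1 := mul_le_mul_of_nonneg_left h1 (abs_nonneg _)
    _ ≤ B := by rw [mul_one]; exact h i

theorem UConv.hasGrad {f : ℕ → ℝ → Spc n → ℝ} {g : ℝ → Spc n → ℝ}
    {f' : ℕ → Fin n → ℝ → Spc n → ℝ} {g' : Fin n → ℝ → Spc n → ℝ} (h : UConv T f g)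
    (h' : ∀ i, UConv T (fun m => f' m i) (g' i)) (hf : ∀ m, HasGrad T (f m) (f' m)) :
    HasGrad T g g' := by
  intro t ht x
  refine hasFDerivAt_of_tendstoUniformly (l := atTop) (f := fun m => f m t)
    (f' := fun m x => ∑ i, f' m i t x • (EuclideanSpace.proj i : Spc n →L[ℝ] ℝ))
    (g' := fun x => ∑ i, g' i t x • (EuclideanSpace.proj i : Spc n →L[ℝ] ℝ)) ?_
    (fun m x => hf m t ht x) (fun x => h.tendsto ht x) x
  rw [Metric.tendstoUniformly_iff]
  intro ε hε
  have hn : (0 : ℝ) < n + 1 := by positivity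
  choose N hN using fun i => h' i (ε / (n + 1)) (by positivity)
  filter_upwards [eventually_ge_atTop (Finset.univ.sup N)] with m hm y
  rw [dist_comm, dist_eq_norm, ← Finset.sum_sub_distrib]
  simp only [← sub_smul]
  refine (norm_sum_smul_proj_le _ fun i =>
    (hN i m ((Finset.le_sup (Finset.mem_univ i)).trans hm) t ht y).le).trans_lt ?_
  rw [mul_div_assoc', div_lt_iff₀ hn]
  nlinarith

theorem UConv.hasDt (hT : 0 < T) {f : ℕ → ℝ → Spc n → ℝ} {g : ℝ → Spc n → ℝ}
    {f' : ℕ → ℝ → Spc n → ℝ} {g' : ℝ → Spc n → ℝ} (h : UConv T f g)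
    (h' : UConv T f' g') (hc : ∀ m, ContT T (f' m)) (hf : ∀ m, HasDt T (f m) (f' m)) :
    HasDt T g g' := by
  have h0 : (0 : ℝ) ∈ Set.Icc 0 T := ⟨le_rfl, hT.le⟩
  have hc' := h'.contT hc
  have cont : ∀ b : ℝ → Spc n → ℝ, ContT T b → ∀ x, Continuous fun τ => ext T b τ x :=
    fun b hb x => (hb.continuous_ext hT).comp (Continuous.prodMk continuous_id continuous_const)
  refine hasDt_of_integral hT hc' fun t ht x => ?_
  have h1 : Tendsto (fun m => ∫ τ in (0 : ℝ)..t, ext T (f' m) τ x) atTop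
      (nhds (∫ τ in (0 : ℝ)..t, ext T g' τ x)) := by
    rw [Metric.tendsto_atTop]
    intro ε hε
    obtain ⟨N, hN⟩ := h' (ε / (T + 1)) (by positivity)
    refine ⟨N, fun m hm => ?_⟩
    rw [dist_eq_norm, ← intervalIntegral.integral_sub ((cont _ (hc m) x).intervalIntegrable _ _)
      ((cont _ hc' x).intervalIntegrable _ _)]
    refine (intervalIntegral.norm_integral_le_of_norm_le_const (C := ε / (T + 1))
      fun τ _ => ?_).trans_lt ?_
    · rw [Real.norm_eq_abs]
      exact (hN m hm _ (clamp_mem hT τ) x).le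
    · rw [sub_zero, abs_of_nonneg ht.1, div_mul_eq_mul_div, div_lt_iff₀ (by positivity)]
      nlinarith [ht.2]
  simp only [fun m => (hf m).integral_eq hT (hc m) ht x] at h1
  have h2 := tendsto_nhds_unique h1 ((h.tendsto ht x).sub (h.tendsto h0 x))
  linarith

theorem Jets.lim (hT : 0 < T) {N s : ℕ} {G : ℕ → List (Fin n) → ℕ → ℝ → Spc n → ℝ}
    {G' : List (Fin n) → ℕ → ℝ → Spc n → ℝ} (hG : ∀ m, Jets T N s (G m))
    (h : ∀ w j, j ≤ s → w.length + 2 * j ≤ N → UConv T (fun m => G m w j) (G' w j)) :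
    Jets T N s G' where
  cont w j hj hw := (h w j hj hw).contT fun m => (hG m).cont w j hj hw
  grad w j hj hw := (h w j hj hw.le).hasGrad
    (fun i => h (i :: w) j hj (by simp; omega)) fun m => (hG m).grad w j hj hw
  dt j hj hw := (h [] j hj.le (by simp; omega)).hasDt hT (h [] (j + 1) hj (by simp; omega))
    (fun m => (hG m).cont _ _ hj (by simp; omega)) fun m => (hG m).dt j hj hw

theorem exists_uConv {f : ℕ → ℝ → Spc n → ℝ}
    (h : ∀ ε > 0, ∃ N, ∀ m ≥ N, ∀ l ≥ N, ∀ t ∈ Set.Icc (0 : ℝ) T, ∀ x, |f m t x - f l t x| ≤ ε) :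
    ∃ g, UConv T f g := by
  have key : ∀ (t : ℝ) (x : Spc n), ∃ y : ℝ, t ∈ Set.Icc 0 T →
      Tendsto (fun m => f m t x) atTop (nhds y) := by
    intro t x
    by_cases ht : t ∈ Set.Icc 0 T
    · obtain ⟨y, hy⟩ := cauchySeq_tendsto_of_complete (u := fun m => f m t x) (by
        rw [Metric.cauchySeq_iff]
        intro ε hε
        obtain ⟨N, hN⟩ := h (ε / 2) (by positivity)
        exact ⟨N, fun m hm l hl => by
          rw [Real.dist_eq]; exact (hN m hm l hl t ht x).trans_lt (by linarith)⟩)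
      exact ⟨y, fun _ => hy⟩
    · exact ⟨0, fun h => absurd h ht⟩
  choose g hg using key
  refine ⟨g, fun ε hε => ?_⟩
  obtain ⟨N, hN⟩ := h (ε / 2) (by positivity)
  refine ⟨N, fun m hm t ht x => ?_⟩
  have h1 : |f m t x - g t x| ≤ ε / 2 :=
    le_of_tendsto ((tendsto_const_nhds.sub (hg t x ht)).abs) (by
      filter_upwards [eventually_ge_atTop N] with l hl using hN m hm l hl t ht x)
  linarith

variable {k s : ℕ} {lam lam' δ : ℝ}

theorem AnisoReg.mixD_sub (hT : 0 < T) {K : ℕ} {u v : ℝ → Spc n → ℝ} (hu : AnisoReg T K s u)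
    (hv : AnisoReg T K s v) {j : ℕ}
    {w : List (Fin n)} (hj : j ≤ s) (hw : w.length + 2 * j ≤ 2 * s + K) :
    ∀ t ∈ Set.Icc (0 : ℝ) T, ∀ x, NSdeRham.mixD T w j (fun t x => u t x - v t x) t x =
      NSdeRham.mixD T w j u t x - NSdeRham.mixD T w j v t x := by
  intro t ht x
  have h := hu.mixD_add hT (hv.smul hT (-1)) hj hw t ht x
  rw [hv.mixD_smul hT (-1) hj hw t ht] at h
  simpa [← sub_eq_add_neg] using h

theorem AnisoReg.sub (hT : 0 < T) {K : ℕ} {u v : ℝ → Spc n → ℝ} (hu : AnisoReg T K s u)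
    (hv : AnisoReg T K s v) : AnisoReg T K s (fun t x => u t x - v t x) := by
  have h := hu.add hT (hv.smul hT (-1))
  simpa [← sub_eq_add_neg] using h

theorem AnisoReg.abs_mixD_le (hl : 0 < lam) {u : ℝ → Spc n → ℝ}
    (hu : AnisoReg T (k + 1) s u) {R : ℝ} (hR : 0 ≤ R)
    (h : eFn T k s lam lam' δ u ≤ ENNReal.ofReal R) {j : ℕ} {w : List (Fin n)} (hj : j ≤ s)
    (hw : w.length + 2 * j ≤ 2 * s + (k + 1)) :
    ∀ t ∈ Set.Icc (0 : ℝ) T, ∀ x, |NSdeRham.mixD T w j u t x| ≤ R * wt x ^ (-(δ + w.length)) := by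
  intro t ht x
  have h1 : eAniso0 T lam (δ + w.length) (mixDeriv T w.length j u) ≤ ENNReal.ofReal R :=
    (le_eAnisoKS hj (by omega)).trans (le_self_add.trans h)
  exact (abs_pdw_le rfl (hu.contDiff hj (by omega) ht) x).trans (eAniso0_sup hl hR h1 t ht x)

theorem exists_limit (hT : 0 < T) (hl : 0 < lam) (hl' : 0 < lam') (hδ : 0 ≤ δ)
    {z : ℕ → ℝ → Spc n → ℝ} (hz : ∀ m, AnisoReg T (k + 1) s (z m))
    (hC : ∀ ε > 0, ∃ N, ∀ m ≥ N, ∀ l ≥ N,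
      eFn T k s lam lam' δ (fun t x => z m t x - z l t x) ≤ ENNReal.ofReal ε) :
    ∃ v, AnisoReg T (k + 1) s v ∧ ∀ ε > 0, ∃ N, ∀ m ≥ N,
      eFn T k s lam lam' δ (fun t x => z m t x - v t x) ≤ ENNReal.ofReal ε := by
  have hlim : ∀ (w : List (Fin n)) (j : ℕ), ∃ g, j ≤ s → w.length + 2 * j ≤ 2 * s + (k + 1) →
      UConv T (fun m => mixD T w j (z m)) g := by
    intro w j
    by_cases hwj : j ≤ s ∧ w.length + 2 * j ≤ 2 * s + (k + 1)
    · obtain ⟨g, hg⟩ := exists_uConv (T := T) (f := fun m => mixD T w j (z m))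
        (fun ε hε => by
          obtain ⟨N, hN⟩ := hC ε hε
          refine ⟨N, fun m hm l hl1 t ht x => ?_⟩
          have h1 := ((hz m).sub hT (hz l)).abs_mixD_le hl hε.le (hN m hm l hl1) hwj.1 hwj.2 t ht x
          rw [(hz m).mixD_sub hT (hz l) hwj.1 hwj.2 t ht] at h1
          exact h1.trans (mul_le_of_le_one_right hε.le (wt_rpow_le_one (by positivity) x)))
      exact ⟨g, fun _ _ => hg⟩
    · exact ⟨fun _ _ => 0, fun h1 h2 => absurd ⟨h1, h2⟩ hwj⟩
  choose G hG using hlim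
  have hJ : Jets T (2 * s + (k + 1)) s G := Jets.lim hT (fun m => (hz m).jets hT) hG
  have hreg := hJ.reg hT
  refine ⟨G [] 0, hreg, fun ε hε => ?_⟩
  set A : ℝ := termCount (k + 1) s * 5 + termCount k s * 5 + 1 with hA
  have hA0 : 0 < A := by positivity
  obtain ⟨N, hN⟩ := hC (ε / A) (by positivity)
  refine ⟨N, fun m hm => ?_⟩
  have hconv : ∀ (w : List (Fin n)) (j : ℕ), j ≤ s → w.length + 2 * j ≤ 2 * s + (k + 1) →
      ∀ t ∈ Set.Icc (0 : ℝ) T, ∀ x,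
        Tendsto (fun l => mixD T w j (fun t x => z m t x - z (N + l) t x) t x) atTop
          (nhds (mixD T w j (fun t x => z m t x - G [] 0 t x) t x)) := by
    intro w j hj hw t ht x
    rw [(hz m).mixD_sub hT hreg hj hw t ht, hJ.mixD_eq hT hj hw t ht]
    simp only [fun l => (hz m).mixD_sub hT (hz l) hj hw t ht]
    have h1 := (hG w j hj hw).tendsto ht x
    have h2 : Tendsto (fun l => N + l) atTop atTop := 
      tendsto_atTop_mono (fun l => Nat.le_add_left l N) tendsto_id
    exact tendsto_const_nhds.sub (h1.comp h2)
  have hB : ∀ l, eFn T k s lam lam' δ (fun t x => z m t x - z (N + l) t x) ≤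
      ENNReal.ofReal (ε / A) := fun l => hN m hm _ (by omega)
  have e1 := eAnisoKS_lsc hl (K' := k + 1) le_rfl (fun l => (hz m).sub hT (hz (N + l)))
    ((hz m).sub hT hreg) (fun l => le_self_add.trans (hB l)) hconv
  have e2 := eAnisoKS_lsc hl' (K' := k) (Nat.le_succ k) (fun l => (hz m).sub hT (hz (N + l)))
    ((hz m).sub hT hreg) (fun l => le_add_self.trans (hB l)) hconv
  refine (add_le_add e1 e2).trans ?_
  have e3 : ((termCount (k + 1) s : ℝ≥0∞) * (5 * ENNReal.ofReal (ε / A)) +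
      termCount k s * (5 * ENNReal.ofReal (ε / A))) =
      ENNReal.ofReal ((termCount (k + 1) s * 5 + termCount k s * 5) * (ε / A)) := by
    rw [add_mul, ENNReal.ofReal_add (by positivity) (by positivity),
      ENNReal.ofReal_mul (p := (termCount (k + 1) s : ℝ) * 5) (by positivity),
      ENNReal.ofReal_mul (p := (termCount k s : ℝ) * 5) (by positivity),
      ENNReal.ofReal_mul (p := (termCount (k + 1) s : ℝ)) (by positivity),
      ENNReal.ofReal_mul (p := (termCount k s : ℝ)) (by positivity), ENNReal.ofReal_natCast,
      ENNReal.ofReal_natCast, ENNReal.ofReal_ofNat, mul_assoc, mul_assoc]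
  rw [e3]
  apply ENNReal.ofReal_le_ofReal
  rw [mul_div_assoc', div_le_iff₀ hA0, mul_comm]
  exact mul_le_mul_of_nonneg_left (by linarith) hε.le

end Limits

section Compactness

variable {T : ℝ}

theorem exists_interp {a b : ℝ} (hb : 0 ≤ b) (hab : b < a) {C ε : ℝ} (hC : 0 ≤ C) (hε : 0 < ε) :
    ∃ η > 0, ∀ r w X : ℝ, 0 ≤ r → 0 ≤ w → X ≤ C * w * r ^ a → X ≤ η * w → X ≤ ε * w * r ^ b := by
  have hq : 0 < ε / (C + 1) := by positivity
  set ρ : ℝ := (ε / (C + 1)) ^ (1 / (a - b)) with hρ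
  have hρ0 : 0 < ρ := Real.rpow_pos_of_pos hq _
  refine ⟨ε * ρ ^ b, mul_pos hε (Real.rpow_pos_of_pos hρ0 _), fun r w X hr hw h1 h2 => ?_⟩
  rcases le_total r ρ with hrρ | hrρ
  · have h3 : r ^ (a - b) ≤ ε / (C + 1) := by
      refine (Real.rpow_le_rpow hr hrρ (by linarith)).trans (le_of_eq ?_)
      rw [hρ, ← Real.rpow_mul hq.le, one_div_mul_cancel (by linarith), Real.rpow_one]
    have h4 : C * r ^ (a - b) ≤ ε := by
      rw [le_div_iff₀ (by positivity)] at h3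
      nlinarith [Real.rpow_nonneg hr (a - b)]
    have h5 : r ^ a = r ^ (a - b) * r ^ b := by
      rw [← Real.rpow_add_of_nonneg hr (by linarith) hb]; congr 1; ring
    rw [h5] at h1
    have h6 := mul_le_mul_of_nonneg_right h4 (mul_nonneg hw (Real.rpow_nonneg hr b))
    linarith
  · have h3 := mul_le_mul_of_nonneg_left (Real.rpow_le_rpow hρ0.le hrρ hb) (mul_nonneg hε.le hw)
    linarith

theorem HB.exists_small {l lam : ℝ} (hlam : 0 < lam) (hl : lam < l) {C ε : ℝ} (hC : 0 ≤ C)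
    (hε : 0 < ε) : ∃ η > 0, ∀ (W : ℝ) (f : ℝ → Spc n → ℝ), HB T l W C f →
      (∀ t ∈ Set.Icc (0 : ℝ) T, ∀ x, |f t x| ≤ η * wt x ^ (-W)) → HB T lam W ε f := by
  obtain ⟨η₁, hη₁, H₁⟩ := exists_interp hlam.le hl hC hε
  obtain ⟨η₂, hη₂, H₂⟩ := exists_interp (half_pos hlam).le (div_lt_div_of_pos_right hl two_pos) hC hε
  refine ⟨min ε (min η₁ (η₂ / 2)), by positivity, fun W f hf hs => ?_⟩
  have hs' : ∀ c, min ε (min η₁ (η₂ / 2)) ≤ c → ∀ t ∈ Set.Icc (0 : ℝ) T, ∀ x,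
      |f t x| ≤ c * wt x ^ (-W) := fun c hc t ht x =>
    (hs t ht x).trans (mul_le_mul_of_nonneg_right hc (wt_rpow_pos _ x).le)
  refine ⟨hs' ε (min_le_left _ _), fun t ht x y => ?_, fun t ht t' ht' x => ?_⟩
  · refine H₁ _ _ _ (norm_nonneg _) (add_pos (wt_rpow_pos _ x) (wt_rpow_pos _ y)).le
      (hf.space t ht x y) ?_
    have h1 := hs' η₁ ((min_le_right _ _).trans (min_le_left _ _)) t ht
    exact (abs_sub _ _).trans (by rw [mul_add]; exact add_le_add (h1 x) (h1 y))
  · refine H₂ _ _ _ (abs_nonneg _) (wt_rpow_pos _ x).le (hf.time t ht t' ht' x) ?_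
    have h1 := hs' (η₂ / 2) ((min_le_right _ _).trans (min_le_right _ _))
    exact (abs_sub _ _).trans (by linarith [h1 t ht x, h1 t' ht' x])

theorem HB.weaken {l W W' C : ℝ} {f : ℝ → Spc n → ℝ} (hC : 0 ≤ C) (hW : W' ≤ W)
    (h : HB T l W C f) : HB T l W' C f := by
  have key : ∀ x : Spc n, C * wt x ^ (-W) ≤ C * wt x ^ (-W') := fun x =>
    mul_le_mul_of_nonneg_left (wt_rpow_mono (by linarith) x) hC
  refine ⟨fun t ht x => (h.sup t ht x).trans (key x), fun t ht x y => (h.space t ht x y).trans ?_,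
    fun t ht t' ht' x => (h.time t ht t' ht' x).trans ?_⟩
  · refine mul_le_mul_of_nonneg_right ?_ (Real.rpow_nonneg (norm_nonneg _) _)
    rw [mul_add, mul_add]
    exact add_le_add (key x) (key y)
  · exact mul_le_mul_of_nonneg_right (key x) (Real.rpow_nonneg (abs_nonneg _) _)

theorem HB.sub {l W C C' : ℝ} {f g : ℝ → Spc n → ℝ} (h : HB T l W C f) (h' : HB T l W C' g) :
    HB T l W (C + C') (fun t x => f t x - g t x) := by
  have h1 := h.add (h'.smul (-1))
  have e : |(-1 : ℝ)| * C' = C' := by simp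
  rw [e] at h1
  simpa [← sub_eq_add_neg] using h1

theorem HB.dist_le {l W C : ℝ} (hW : 0 ≤ W) (hC : 0 ≤ C) {f : ℝ → Spc n → ℝ} (h : HB T l W C f)
    {t t' : ℝ} (ht : t ∈ Set.Icc 0 T) (ht' : t' ∈ Set.Icc 0 T) (x y : Spc n) :
    |f t x - f t' y| ≤ C * (2 * ‖x - y‖ ^ l + |t - t'| ^ (l / 2)) := by
  have h1 := h.space t ht x y
  have h2 := h.time t ht t' ht' y
  have h3 := abs_add_le (f t x - f t y) (f t y - f t' y)
  rw [sub_add_sub_cancel] at h3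
  have hx := mul_le_mul_of_nonneg_left (wt_rpow_le_one hW x) hC
  have hy := mul_le_mul_of_nonneg_left (wt_rpow_le_one hW y) hC
  have a1 := mul_le_mul_of_nonneg_right (add_le_add hx hy) (Real.rpow_nonneg (norm_nonneg (x - y)) l)
  have a2 := mul_le_mul_of_nonneg_right hy (Real.rpow_nonneg (abs_nonneg (t - t')) (l / 2))
  linarith

/-- A dense sequence of points of `[0,T] × ℝⁿ`. -/
def dpt (n : ℕ) {T : ℝ} (hT : 0 < T) : ℕ → Set.Icc (0 : ℝ) T × Spc n :=
  have : Nonempty (Set.Icc (0 : ℝ) T) := ⟨⟨0, le_rfl, hT.le⟩⟩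
  TopologicalSpace.denseSeq _

theorem exists_subseq_dpt (hT : 0 < T) {α : Type*} [Countable α]
    {f : ℕ → α → ℝ → Spc n → ℝ} {C : ℝ}
    (h : ∀ m a, ∀ t ∈ Set.Icc (0 : ℝ) T, ∀ x, |f m a t x| ≤ C) :
    ∃ φ : ℕ → ℕ, StrictMono φ ∧ ∀ a i, CauchySeq fun m =>
      f (φ m) a (dpt n hT i).1 (dpt n hT i).2 := by
  have hc : IsCompact (Set.pi Set.univ fun _ : α × ℕ => Set.Icc (-C) C) :=
    isCompact_univ_pi fun _ => isCompact_Icc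
  obtain ⟨y, _, φ, hφ, hy⟩ := hc.tendsto_subseq
    (x := fun m (p : α × ℕ) => f m p.1 (dpt n hT p.2).1 (dpt n hT p.2).2)
    fun m p _ => abs_le.1 (h m p.1 _ (dpt n hT p.2).1.2 _)
  exact ⟨φ, hφ, fun a i => ((tendsto_pi_nhds.1 hy) (a, i)).cauchySeq⟩

theorem exists_weighted_cauchy (hT : 0 < T) {l W W' C : ℝ} (hl : 0 < l) (hW' : 0 ≤ W')
    (hWW : W' < W) (hC : 0 ≤ C) {f : ℕ → ℝ → Spc n → ℝ} (hf : ∀ m, HB T l W C (f m))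
    (hd : ∀ i, CauchySeq fun m => f m (dpt n hT i).1 (dpt n hT i).2) {η : ℝ} (hη : 0 < η) :
    ∃ N, ∀ m ≥ N, ∀ p ≥ N, ∀ t ∈ Set.Icc (0 : ℝ) T, ∀ x,
      |f m t x - f p t x| ≤ η * wt x ^ (-W') := by
  set κ := W - W' with hκ
  have hκ0 : 0 < κ := by linarith
  obtain ⟨R, hR1, hR⟩ : ∃ R : ℝ, 1 ≤ R ∧ 2 * C ≤ η * R ^ κ := by
    have h1 : Tendsto (fun R : ℝ => η * R ^ κ) atTop atTop :=
      (tendsto_rpow_atTop hκ0).const_mul_atTop hη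
    obtain ⟨R, h2, h3⟩ := ((h1.eventually_ge_atTop (2 * C)).and (eventually_ge_atTop 1)).exists
    exact ⟨R, h3, h2⟩
  set η' := η * R ^ (-W') with hη'
  have hη'0 : 0 < η' := mul_pos hη (Real.rpow_pos_of_pos (by linarith) _)
  obtain ⟨ρ, hρ, hρη⟩ : ∃ ρ > 0, C * (2 * ρ ^ l + ρ ^ (l / 2)) ≤ η' / 3 := by
    have h1 : Tendsto (fun ρ : ℝ => C * (2 * ρ ^ l + ρ ^ (l / 2))) (nhdsWithin 0 (Set.Ioi 0))
        (nhds (C * (2 * 0 ^ l + 0 ^ (l / 2)))) := by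
      refine Tendsto.mono_left (Continuous.tendsto ?_ 0) nhdsWithin_le_nhds
      have := Real.continuous_rpow_const hl.le
      have := Real.continuous_rpow_const (half_pos hl).le
      fun_prop
    rw [Real.zero_rpow hl.ne', Real.zero_rpow (half_pos hl).ne'] at h1
    simp only [mul_zero, add_zero] at h1
    obtain ⟨ρ, h2, h3⟩ := ((h1.eventually (ge_mem_nhds (by positivity : (0 : ℝ) < η' / 3))).and
      self_mem_nhdsWithin).exists
    exact ⟨ρ, h3, h2⟩
  have hcomp : IsCompact (Set.univ ×ˢ Metric.closedBall 0 R : Set (Set.Icc (0 : ℝ) T × Spc n)) :=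
    isCompact_univ.prod (isCompact_closedBall 0 R)
  have hdense : DenseRange (dpt n hT) := by
    have : Nonempty (Set.Icc (0 : ℝ) T) := ⟨⟨0, le_rfl, hT.le⟩⟩
    exact TopologicalSpace.denseRange_denseSeq _
  obtain ⟨S, hS⟩ := hcomp.elim_finite_subcover (fun i => Metric.ball (dpt n hT i) ρ)
    (fun i => Metric.isOpen_ball) fun p _ => by
      obtain ⟨i, hi⟩ := hdense.exists_dist_lt p hρ
      exact Set.mem_iUnion.2 ⟨i, hi⟩
  choose N hN using fun i => Metric.cauchySeq_iff.1 (hd i) (η' / 3) (by positivity)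
  refine ⟨S.sup N, fun m hm p hp t ht x => ?_⟩
  rcases le_total R (wt x) with hx | hx
  · have h1 := (hf m).sup t ht x
    have h2 := (hf p).sup t ht x
    have h3 := abs_sub (f m t x) (f p t x)
    have e : wt x ^ (-W') = wt x ^ κ * wt x ^ (-W) := by
      rw [← Real.rpow_add (wt_pos x)]; congr 1; rw [hκ]; ring
    have h4 : R ^ κ ≤ wt x ^ κ := Real.rpow_le_rpow (by linarith) hx hκ0.le
    have h5 : 2 * C ≤ η * wt x ^ κ := hR.trans (mul_le_mul_of_nonneg_left h4 hη.le)
    have h6 := mul_le_mul_of_nonneg_right h5 (wt_rpow_pos (-W) x).le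
    rw [e]
    linarith
  · have h1 : η' ≤ η * wt x ^ (-W') := by
      refine mul_le_mul_of_nonneg_left ?_ hη.le
      exact Real.rpow_le_rpow_of_nonpos (wt_pos x) hx (by linarith)
    refine le_trans ?_ h1
    have hmem : ((⟨t, ht⟩, x) : Set.Icc (0 : ℝ) T × Spc n) ∈
        (Set.univ ×ˢ Metric.closedBall 0 R : Set (Set.Icc (0 : ℝ) T × Spc n)) :=
      ⟨Set.mem_univ _, mem_closedBall_zero_iff.2 ((norm_le_wt x).trans hx)⟩
    obtain ⟨i, hiS, hi⟩ := Set.mem_iUnion₂.1 (hS hmem)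
    rw [Metric.mem_ball, Prod.dist_eq, max_lt_iff, Subtype.dist_eq, Real.dist_eq, dist_eq_norm] at hi
    have hle : N i ≤ S.sup N := Finset.le_sup hiS
    have h2 := hN i m (hle.trans hm) p (hle.trans hp)
    rw [Real.dist_eq] at h2
    have key : ∀ a, |f a t x - f a (dpt n hT i).1 (dpt n hT i).2| ≤ η' / 3 := fun a =>
      ((hf a).dist_le (by linarith) hC ht (dpt n hT i).1.2 _ _).trans (by
        refine le_trans (mul_le_mul_of_nonneg_left (add_le_add ?_ ?_) hC) hρη
        · have := Real.rpow_le_rpow (norm_nonneg _) hi.2.le hl.le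
          linarith
        · exact Real.rpow_le_rpow (abs_nonneg _) hi.1.le (half_pos hl).le)
    have k1 := abs_le.1 (key m)
    have k2 := abs_le.1 (key p)
    have k3 := abs_lt.1 h2
    rw [abs_le]
    constructor <;> linarith

theorem exists_subseq_cauchy (hT : 0 < T) {k s : ℕ} {lam lam' l l' δ W C : ℝ} (hlam : 0 < lam)
    (hll : lam < l) (hlam' : 0 < lam') (hll' : lam' < l') (hl1 : lam ≤ 1) (hl1' : lam' ≤ 1)
    (hδ : 0 ≤ δ) (hW : δ + 1 < W) (hC : 0 ≤ C) {ι : Type*} [Countable ι]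
    {z : ℕ → ι → ℝ → Spc n → ℝ} (hz : ∀ m I, AnisoReg T (k + 1) s (z m I))
    (h1 : ∀ m I (w : List (Fin n)) (j : ℕ), j ≤ s → w.length + 2 * j ≤ 2 * s + (k + 1) →
        HB T l (W + w.length) C (mixD T w j (z m I)))
    (h2 : ∀ m I (w : List (Fin n)) (j : ℕ), j ≤ s → w.length + 2 * j ≤ 2 * s + k →
        HB T l' (W + w.length) C (mixD T w j (z m I))) :
    ∃ φ : ℕ → ℕ, StrictMono φ ∧ ∀ I, ∀ ε > 0, ∃ N, ∀ m ≥ N, ∀ p ≥ N,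
      eFn T k s lam lam' δ (fun t x => z (φ m) I t x - z (φ p) I t x) ≤ ENNReal.ofReal ε := by
  set f : ℕ → ι × List (Fin n) × ℕ → ℝ → Spc n → ℝ := fun m a =>
    if a.2.2 ≤ s ∧ a.2.1.length + 2 * a.2.2 ≤ 2 * s + (k + 1) then mixD T a.2.1 a.2.2 (z m a.1)
    else fun _ _ => 0 with hf
  have hW0 : 0 ≤ W := by linarith
  obtain ⟨φ, hφ, hcau⟩ := exists_subseq_dpt hT (f := f) (C := C) fun m a t ht x => by
    simp only [hf]
    split_ifs with ha
    · exact ((h1 m a.1 _ _ ha.1 ha.2).sup t ht x).trans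
        (mul_le_of_le_one_right hC (wt_rpow_le_one (by positivity) x))
    · simpa using hC
  refine ⟨φ, hφ, fun I ε hε => ?_⟩
  obtain ⟨A, hA, HA⟩ := exists_eFn_le (n := n) (T := T) hlam hl1 hlam' hl1' hδ k s
  have hε' : 0 < ε / (A + 1) := by positivity
  obtain ⟨η₁, hη₁, H₁⟩ := HB.exists_small (n := n) (T := T) hlam hll (C := C + C) (by positivity) hε'
  obtain ⟨η₂, hη₂, H₂⟩ := HB.exists_small (n := n) (T := T) hlam' hll' (C := C + C)
    (by positivity) hε'
  have hcau' : ∀ (w : List (Fin n)) (j : ℕ), ∃ N, j ≤ s → w.length + 2 * j ≤ 2 * s + (k + 1) →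
      ∀ m ≥ N, ∀ p ≥ N, ∀ t ∈ Set.Icc (0 : ℝ) T, ∀ x,
        |mixD T w j (z (φ m) I) t x - mixD T w j (z (φ p) I) t x| ≤
          min η₁ η₂ * wt x ^ (-(δ + w.length + 1)) := by
    intro w j
    by_cases hwj : j ≤ s ∧ w.length + 2 * j ≤ 2 * s + (k + 1)
    · obtain ⟨N, hN⟩ := exists_weighted_cauchy hT (W' := δ + w.length + 1) (hlam.trans hll)
        (by positivity) (by linarith) hC
        (fun m => h1 (φ m) I w j hwj.1 hwj.2) (fun i => by
          have := hcau (I, w, j) i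
          simp only [hf, if_pos hwj] at this
          exact this) (lt_min hη₁ hη₂)
      exact ⟨N, fun _ _ => hN⟩
    · exact ⟨0, fun a b => absurd ⟨a, b⟩ hwj⟩
  choose N hN using hcau'
  set L : Finset (List (Fin n)) := (Finset.range (2 * s + (k + 1) + 1)).biUnion fun p =>
    Finset.univ.image fun i : Fin p → Fin n => List.ofFn i with hL
  have hmemL : ∀ w : List (Fin n), w.length ≤ 2 * s + (k + 1) → w ∈ L := fun w hw => by
    rw [hL, Finset.mem_biUnion]
    refine ⟨w.length, Finset.mem_range.2 (by omega), Finset.mem_image.2 ⟨w.get, Finset.mem_univ _, ?_⟩⟩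
    exact List.ofFn_get w
  refine ⟨L.sup fun w => (Finset.range (s + 1)).sup fun j => N w j, fun m hm p hp => ?_⟩
  have hNle : ∀ (w : List (Fin n)) (j : ℕ), j ≤ s → w.length + 2 * j ≤ 2 * s + (k + 1) →
      N w j ≤ L.sup fun w => (Finset.range (s + 1)).sup fun j => N w j := fun w j hj hw =>
    (Finset.le_sup (f := fun j => N w j) (Finset.mem_range.2 (by omega))).trans
      (Finset.le_sup (f := fun w => (Finset.range (s + 1)).sup fun j => N w j)
        (hmemL w (by omega)))
  have hreg := (hz (φ m) I).sub hT (hz (φ p) I)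
  have hsmall : ∀ (w : List (Fin n)) (j : ℕ), j ≤ s → w.length + 2 * j ≤ 2 * s + (k + 1) →
      ∀ c, min η₁ η₂ ≤ c → ∀ t ∈ Set.Icc (0 : ℝ) T, ∀ x,
        |mixD T w j (z (φ m) I) t x - mixD T w j (z (φ p) I) t x| ≤
          c * wt x ^ (-(δ + w.length + 1)) := fun w j hj hw c hc t ht x =>
    (hN w j hj hw m ((hNle w j hj hw).trans hm) p ((hNle w j hj hw).trans hp) t ht x).trans
      (mul_le_mul_of_nonneg_right hc (wt_rpow_pos _ x).le)
  refine (HA (ε / (A + 1)) _ hε'.le hreg (fun w j hj hw => ?_) fun w j hj hw => ?_).trans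
    (ENNReal.ofReal_le_ofReal ?_)
  · refine HB.congr (H₁ _ _ (((h1 _ I w j hj hw).sub (h1 _ I w j hj hw)).weaken (by positivity)
      (by linarith)) (hsmall w j hj hw _ (min_le_left _ _))) fun t ht x => ?_
    exact ((hz (φ m) I).mixD_sub hT (hz (φ p) I) hj hw t ht x).symm
  · have hw' : w.length + 2 * j ≤ 2 * s + (k + 1) := by omega
    refine HB.congr (H₂ _ _ (((h2 _ I w j hj hw).sub (h2 _ I w j hj hw)).weaken (by positivity)
      (by linarith)) (hsmall w j hj hw' _ (min_le_right _ _))) fun t ht x => ?_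
    exact ((hz (φ m) I).mixD_sub hT (hz (φ p) I) hj hw' t ht x).symm
  · rw [mul_div_assoc', div_le_iff₀ (by positivity)]
    nlinarith

end Compactness

section Nonlinearity

variable {q : ℕ}

/-- The bilinear first order form with coefficients `c`, the derivative acting on the first
argument. -/
def bilc (c : Idx n q → Fin n → Idx n q → Idx n q → ℝ) (u v : FormT n q) : FormT n q :=
  fun I t x => ∑ i, ∑ J, ∑ K, c I i J K * (pd i (u J t) x * v K t x)

/-- Symbol of `d ⊕ d^*`. -/
def ddSymb (p : Fin n → Fib n q) : Fib n (q + 1) × Fib n (q - 1) :=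
  (fun J => ∑ i : Fin n, if h : i ∈ J.1 then (-1 : ℝ) ^ (J.1.filter fun j => j < i).card *
      p i ⟨J.1.erase i, by simp [Finset.card_erase_of_mem h, J.2]⟩ else 0,
   fun K => -∑ i : Fin n, if h : i ∉ K.1 ∧ (insert i K.1).card = q then
      (-1 : ℝ) ^ (K.1.filter fun j => j < i).card * p i ⟨insert i K.1, h.2⟩ else 0)

/-- Symbol of `d_{q-1}`. -/
def dLowSymb (r : Fin n → Fib n (q - 1)) : Fib n q := fun J =>
  ∑ i : Fin n, if h : i ∈ J.1 ∧ (J.1.erase i).card = q - 1 then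
    (-1 : ℝ) ^ (J.1.filter fun j => j < i).card * r i ⟨J.1.erase i, h.2⟩ else 0

theorem ddSymb_add (p p' : Fin n → Fib n q) : ddSymb (p + p') = ddSymb p + ddSymb p' := by
  refine Prod.ext (funext fun J => ?_) (funext fun K => ?_)
  · simp only [ddSymb, Prod.fst_add, Pi.add_apply, ← Finset.sum_add_distrib]
    refine Finset.sum_congr rfl fun i _ => ?_
    split_ifs <;> ring
  · simp only [ddSymb, Prod.snd_add, Pi.add_apply, ← neg_add, ← Finset.sum_add_distrib]
    refine congrArg _ (Finset.sum_congr rfl fun i _ => ?_)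
    split_ifs <;> ring

theorem ddSymb_smul (a : ℝ) (p : Fin n → Fib n q) : ddSymb (a • p) = a • ddSymb p := by
  refine Prod.ext (funext fun J => ?_) (funext fun K => ?_)
  · simp only [ddSymb, Prod.smul_fst, Pi.smul_apply, smul_eq_mul, Finset.mul_sum]
    refine Finset.sum_congr rfl fun i _ => ?_
    split_ifs <;> ring
  · simp only [ddSymb, Prod.smul_snd, Pi.smul_apply, smul_eq_mul, mul_neg, Finset.mul_sum]
    refine congrArg _ (Finset.sum_congr rfl fun i _ => ?_)
    split_ifs <;> ring

theorem dLowSymb_add (r r' : Fin n → Fib n (q - 1)) (J : Idx n q) :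
    dLowSymb (r + r') J = dLowSymb r J + dLowSymb r' J := by
  simp only [dLowSymb, Pi.add_apply, ← Finset.sum_add_distrib]
  refine Finset.sum_congr rfl fun i _ => ?_
  split_ifs <;> ring

theorem dLowSymb_smul (a : ℝ) (r : Fin n → Fib n (q - 1)) (J : Idx n q) :
    dLowSymb (a • r) J = a * dLowSymb r J := by
  simp only [dLowSymb, Pi.smul_apply, smul_eq_mul, Finset.mul_sum]
  refine Finset.sum_congr rfl fun i _ => ?_
  split_ifs <;> ring

/-- Pointwise form of the nonlinearity: a bilinear form in the gradient and the value. -/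
def nlSymb (M₁ : M1Type n q) (M₂ : M2Type n q) (I : Idx n q) :
    (Fin n → Fib n q) →ₗ[ℝ] Fib n q →ₗ[ℝ] ℝ :=
  LinearMap.mk₂ ℝ (fun p f => M₁ (ddSymb p) f I + dLowSymb (fun i => M₂ (p i) f + M₂ f (p i)) I)
    (fun p p' f => by
      have e : (fun i => M₂ ((p + p') i) f + M₂ f ((p + p') i)) =
          (fun i => M₂ (p i) f + M₂ f (p i)) + fun i => M₂ (p' i) f + M₂ f (p' i) := by
        funext i
        simp only [Pi.add_apply, map_add, LinearMap.add_apply]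
        abel
      rw [e, dLowSymb_add, ddSymb_add, map_add, LinearMap.add_apply, Pi.add_apply]
      ring)
    (fun a p f => by
      have e : (fun i => M₂ ((a • p) i) f + M₂ f ((a • p) i)) =
          a • (fun i => M₂ (p i) f + M₂ f (p i)) := by
        funext i
        simp only [Pi.smul_apply, map_smul, LinearMap.smul_apply, smul_add]
      rw [e, dLowSymb_smul, ddSymb_smul, map_smul, LinearMap.smul_apply, Pi.smul_apply,
        smul_eq_mul, smul_eq_mul]
      ring)
    (fun p f f' => by
      have e : (fun i => M₂ (p i) (f + f') + M₂ (f + f') (p i)) =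
          (fun i => M₂ (p i) f + M₂ f (p i)) + fun i => M₂ (p i) f' + M₂ f' (p i) := by
        funext i
        simp only [Pi.add_apply, map_add, LinearMap.add_apply]
        abel
      rw [e, dLowSymb_add, map_add, Pi.add_apply]
      ring)
    (fun a p f => by
      have e : (fun i => M₂ (p i) (a • f) + M₂ (a • f) (p i)) =
          a • (fun i => M₂ (p i) f + M₂ f (p i)) := by
        funext i
        simp only [Pi.smul_apply, map_smul, LinearMap.smul_apply, smul_add]
      rw [e, dLowSymb_smul, map_smul, Pi.smul_apply, smul_eq_mul, smul_eq_mul]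
      ring)

/-- The spatial gradient of a form at a point. -/
def gradFib (u : FormT n q) (t : ℝ) (x : Spc n) : Fin n → Fib n q := fun i J => pd i (u J t) x

theorem nlSymb_apply (M₁ : M1Type n q) (M₂ : M2Type n q) (I : Idx n q) (p : Fin n → Fib n q)
    (f : Fib n q) : nlSymb M₁ M₂ I p f =
      M₁ (ddSymb p) f I + dLowSymb (fun i => M₂ (p i) f + M₂ f (p i)) I := rfl

theorem nlSymb_eq_sum (M₁ : M1Type n q) (M₂ : M2Type n q) (I : Idx n q) (p : Fin n → Fib n q)
    (f : Fib n q) : nlSymb M₁ M₂ I p f = ∑ i, ∑ J, ∑ K,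
      nlSymb M₁ M₂ I (Pi.single i (Pi.single J 1)) (Pi.single K 1) * (p i J * f K) := by
  have hp : p = ∑ i, ∑ J, p i J • (Pi.single i (Pi.single J 1) : Fin n → Fib n q) := by
    funext a b
    simp [Finset.sum_apply, Pi.single_apply, ite_apply]
  have hf : f = ∑ K, f K • (Pi.single K 1 : Fib n q) := by
    funext b
    simp [Finset.sum_apply, Pi.single_apply]
  conv_lhs => rw [hp, hf]
  simp only [map_sum, LinearMap.sum_apply, map_smul, LinearMap.smul_apply, smul_eq_mul,
    Finset.mul_sum]
  rw [Finset.sum_comm]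
  refine Finset.sum_congr rfl fun i _ => ?_
  rw [Finset.sum_comm]
  refine Finset.sum_congr rfl fun J _ => Finset.sum_congr rfl fun K _ => ?_
  ring

theorem pd_bilinear (M₂ : M2Type n q) {u w : FormT n q} {t : ℝ}
    (hu : ∀ J, Differentiable ℝ (u J t)) (hw : ∀ J, Differentiable ℝ (w J t)) (K : Idx n (q - 1))
    (x : Spc n) : DifferentiableAt ℝ (fun y => M₂ (fib u t y) (fib w t y) K) x ∧ ∀ i,
      pd i (fun y => M₂ (fib u t y) (fib w t y) K) x =
        M₂ (gradFib u t x i) (fib w t x) K + M₂ (fib u t x) (gradFib w t x i) K := by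
  have hf : ∀ v : FormT n q, (∀ J, Differentiable ℝ (v J t)) →
      HasFDerivAt (fun y => fib v t y) (ContinuousLinearMap.pi fun J => fderiv ℝ (v J t) x) x :=
    fun v hv => hasFDerivAt_pi.2 fun J => (hv J x).hasFDerivAt
  have h := (M₂.toContinuousBilinearMap).hasFDerivAt_of_bilinear (hf u hu) (hf w hw)
  have h2 := hasFDerivAt_pi'.1 h K
  refine ⟨h2.differentiableAt, fun i => ?_⟩
  rw [pd]
  refine (congrArg (fun L : Spc n →L[ℝ] ℝ => L (EuclideanSpace.single i 1)) h2.fderiv).trans ?_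
  simp
  rw [add_comm]
  rfl

theorem nop_eq (M₁ : M1Type n q) (M₂ : M2Type n q) {u : FormT n q} {t : ℝ}
    (hu : ∀ J, Differentiable ℝ (u J t)) (x : Spc n) (I : Idx n q) :
    Nop M₁ M₂ u I t x = nlSymb M₁ M₂ I (gradFib u t x) (fib u t x) := by
  rw [nlSymb_apply]
  refine congrArg₂ (· + ·) rfl ?_
  simp only [dLowT, dLowS, dLowSymb]
  refine Finset.sum_congr rfl fun i _ => ?_
  split_ifs with h
  · exact congrArg _ ((pd_bilinear M₂ hu hu _ x).2 i)
  · rfl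

theorem bop_eq (M₁ : M1Type n q) (M₂ : M2Type n q) {u w : FormT n q} {t : ℝ}
    (hu : ∀ J, Differentiable ℝ (u J t)) (hw : ∀ J, Differentiable ℝ (w J t)) (x : Spc n)
    (I : Idx n q) : Bop M₁ M₂ w u I t x = nlSymb M₁ M₂ I (gradFib u t x) (fib w t x) +
      nlSymb M₁ M₂ I (gradFib w t x) (fib u t x) := by
  rw [nlSymb_apply, nlSymb_apply, add_add_add_comm, ← dLowSymb_add]
  refine congrArg₂ (· + ·) rfl ?_
  simp only [dLowT, dLowS, dLowSymb]
  refine Finset.sum_congr rfl fun i _ => ?_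
  split_ifs with h
  · refine congrArg _ ?_
    have h1 := pd_bilinear M₂ hu hw ⟨I.1.erase i, h.2⟩ x
    have h2 := pd_bilinear M₂ hw hu ⟨I.1.erase i, h.2⟩ x
    have h3 : pd i (fun y => M₂ (fib u t y) (fib w t y) ⟨I.1.erase i, h.2⟩ +
        M₂ (fib w t y) (fib u t y) ⟨I.1.erase i, h.2⟩) x =
        pd i (fun y => M₂ (fib u t y) (fib w t y) ⟨I.1.erase i, h.2⟩) x +
        pd i (fun y => M₂ (fib w t y) (fib u t y) ⟨I.1.erase i, h.2⟩) x := by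
      rw [pd, fderiv_fun_add h1.1 h2.1]
      rfl
    refine h3.trans ?_
    rw [h1.2, h2.2]
    simp only [Pi.add_apply]
    ring
  · rfl

theorem exists_bilc (M₁ : M1Type n q) (M₂ : M2Type n q) :
    ∃ c : Idx n q → Fin n → Idx n q → Idx n q → ℝ, ∀ (u w : FormT n q) (t : ℝ),
      (∀ J, Differentiable ℝ (u J t)) → (∀ J, Differentiable ℝ (w J t)) → ∀ I x,
        Nop M₁ M₂ u I t x = bilc c u u I t x ∧
        Bop M₁ M₂ w u I t x = bilc c u w I t x + bilc c w u I t x := by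
  refine ⟨fun I i J K => nlSymb M₁ M₂ I (Pi.single i (Pi.single J 1)) (Pi.single K 1),
    fun u w t hu hw I x => ⟨?_, ?_⟩⟩
  · rw [nop_eq M₁ M₂ hu, nlSymb_eq_sum]
    rfl
  · rw [bop_eq M₁ M₂ hu hw, nlSymb_eq_sum, nlSymb_eq_sum M₁ M₂ I (gradFib w t x)]
    rfl

end Nonlinearity

section PotentialBound

variable {q k s : ℕ} {T μ lam lam' δ : ℝ}

theorem cls_bilc (hT : 0 < T) (hl : 0 < lam) (hl' : 0 < lam')
    (c : Idx n q → Fin n → Idx n q → Idx n q → ℝ) : ∃ A : ℝ, 0 ≤ A ∧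
      ∀ (u v : FormT n q) (R R' : ℝ), 0 ≤ R → 0 ≤ R' → (∀ J, AnisoReg T (k + 1) s (u J)) →
        (∀ J, AnisoReg T (k + 1) s (v J)) → (∀ J, eFn T k s lam lam' δ (u J) ≤ ENNReal.ofReal R) →
        (∀ J, eFn T k s lam lam' δ (v J) ≤ ENNReal.ofReal R') → ∀ I,
          Cls T (JP T lam') (2 * s + k) s (2 * δ + 1) (A * (R * R')) (bilc c u v I) := by
  obtain ⟨M, hM⟩ := Finite.exists_le fun a : Idx n q × Fin n × Idx n q × Idx n q =>
    |c a.1 a.2.1 a.2.2.1 a.2.2.2|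
  have hJ := adm_JP (n := n) T lam'
  refine ⟨(Finset.univ : Finset (Fin n)).card * ((Finset.univ : Finset (Idx n q)).card *
    ((Finset.univ : Finset (Idx n q)).card * (|M| * 2 ^ (2 * s + k + 1)))), by positivity,
    fun u v R R' hR hR' hu hv hur hvr I => ?_⟩
  have h1 : ∀ i J K, Cls T (JP T lam') (2 * s + k) s (2 * δ + 1) (|M| * 2 ^ (2 * s + k + 1) * (R * R'))
      (fun t x => c I i J K * (pd i (u J t) x * v K t x)) := fun i J K => by
    have a := ((hu J).cls_JP hT hl hl' hR (hur J)).dx hJ.congr i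
    have b := ((hv K).cls_JP hT hl hl' hR' (hvr K)).pred (JP.pred T lam')
    have d := hJ.cls_smul (c I i J K) (a.mul_JP hT b)
    refine hJ.cls_mono (by linarith) ?_ (by positivity) d
    have := (hM (I, i, J, K)).trans (le_abs_self M)
    rw [mul_assoc |M|]
    exact mul_le_mul_of_nonneg_right this (by positivity)
  have h2 := hJ.cls_sum Finset.univ fun i _ => hJ.cls_sum Finset.univ fun J _ =>
    hJ.cls_sum Finset.univ fun K _ => h1 i J K
  refine hJ.cls_mono le_rfl (le_of_eq ?_) (by positivity) h2
  ring

theorem exists_potential_bound (hμ : 0 < μ) (hT : 0 < T) (hl : 0 < lam) (hll : lam < lam')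
    (hl1 : lam' < 1) (hδ : 0 ≤ δ) (hs : 1 ≤ s) (hk : 1 ≤ k)
    (c : Idx n q → Fin n → Idx n q → Idx n q → ℝ) : ∃ A : ℝ, 0 ≤ A ∧
      ∀ (u v : FormT n q) (R R' : ℝ), 0 ≤ R → 0 ≤ R' → (∀ J, AnisoReg T (k + 1) s (u J)) →
        (∀ J, AnisoReg T (k + 1) s (v J)) → (∀ J, eFn T k s lam lam' δ (u J) ≤ ENNReal.ofReal R) →
        (∀ J, eFn T k s lam lam' δ (v J) ≤ ENNReal.ofReal R') → ∀ I,
          AnisoReg T (k + 1) s (volPot μ (bilc c u v I)) ∧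
          (∀ (w : List (Fin n)) (j : ℕ), j ≤ s → w.length + 2 * j ≤ 2 * s + (k + 1) →
            HB T lam' (2 * δ + w.length) (A * (R * R')) (mixD T w j (volPot μ (bilc c u v I)))) ∧
          (∀ (w : List (Fin n)) (j : ℕ), j ≤ s → w.length + 2 * j ≤ 2 * s + k →
            HB T ((1 + lam') / 2) (2 * δ + w.length) (A * (R * R'))
              (mixD T w j (volPot μ (bilc c u v I)))) := by
  have hl' : 0 < lam' := hl.trans hll
  obtain ⟨s, rfl⟩ := Nat.exists_eq_add_of_le' hs
  obtain ⟨k, rfl⟩ := Nat.exists_eq_add_of_le' hk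
  obtain ⟨A, hA, HA⟩ := cls_bilc (k := k + 1) (s := s + 1) (δ := δ) hT hl hl' c
  obtain ⟨B, hB, HB'⟩ := cls_vpot (n := n) (l' := (1 + lam') / 2) hμ hT hl' hl1 (by linarith)
    (by linarith) (2 * s + 2 + k) s (2 * δ) (by linarith)
  have hK := adm_KP (n := n) hT hl' (lam' := (1 + lam') / 2) (by linarith)
  refine ⟨2 * (B * A), by positivity, fun u v R R' hR hR' hu hv hur hvr I => ?_⟩
  have h0 : Cls T (KP T lam' ((1 + lam') / 2)) (2 * (s + 1) + (k + 1 + 1)) (s + 1) (2 * δ)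
      (B * A * (R * R')) (volPot μ (bilc c u v I)) := by
    have h1 := HB' _ _ (HA u v R R' hR hR' hu hv hur hvr I)
    have h2 := hK.cls_congr h1 fun t ht x => (volPot_eq hμ (bilc c u v I) ht x).symm
    rw [mul_assoc]
    exact h2
  have hle : B * A * (R * R') ≤ 2 * (B * A) * (R * R') := by
    have : 0 ≤ B * A * (R * R') := by positivity
    linarith
  have hbase : ∀ (w : List (Fin n)) (j : ℕ), j ≤ s + 1 →
      w.length + 2 * j ≤ 2 * (s + 1) + (k + 1 + 1) →
      KP T lam' ((1 + lam') / 2) (2 * (s + 1) + (k + 1 + 1) - (w.length + 2 * j))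
        (2 * δ + w.length) (B * A * (R * R')) (mixD T w j (volPot μ (bilc c u v I))) :=
    fun w j hj hw => (h0.mixD (M := 2 * (s + 1) + (k + 1 + 1) - (w.length + 2 * j)) hT hK.congr
      (by omega) (by omega) hj).base
  refine ⟨?_, fun w j hj hw => ?_, fun w j hj hw => ?_⟩
  · have h1 : Cls T (fun _ _ _ f => ContT T f) (2 * (s + 1) + (k + 1 + 1)) (s + 1) (2 * δ)
        (B * A * (R * R')) (volPot μ (bilc c u v I)) :=
      h0.imp fun M p f h => hK.contT _ _ _ _ (by positivity) h
    have h2 := (h1.jets hT (fun _ _ _ _ _ hfg hf => hf.congr hfg) fun _ _ _ _ h => h).reg hT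
    simpa only [mixD_nil_zero] using h2
  · have h1 := hbase w j hj hw
    rw [KP] at h1
    split_ifs at h1
    · exact h1.mono hle
    · have := h1.mono_exponent hT hl'.le (by linarith)
      rwa [← mul_assoc] at this
  · have h1 := hbase w j hj (by omega)
    rw [KP, if_neg (by omega)] at h1
    exact h1.mono hle

theorem exists_potential_norm (hμ : 0 < μ) (hT : 0 < T) (hl : 0 < lam) (hll : lam < lam')
    (hl1 : lam' < 1) (hδ : 1 ≤ δ) (hs : 1 ≤ s) (hk : 1 ≤ k)
    (c : Idx n q → Fin n → Idx n q → Idx n q → ℝ) : ∃ A : ℝ, 0 ≤ A ∧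
      ∀ (u v : FormT n q) (R R' : ℝ), 0 ≤ R → 0 ≤ R' → (∀ J, AnisoReg T (k + 1) s (u J)) →
        (∀ J, AnisoReg T (k + 1) s (v J)) → (∀ J, eFn T k s lam lam' δ (u J) ≤ ENNReal.ofReal R) →
        (∀ J, eFn T k s lam lam' δ (v J) ≤ ENNReal.ofReal R') → ∀ I,
          AnisoReg T (k + 1) s (volPot μ (bilc c u v I)) ∧
          eFn T k s lam lam' δ (volPot μ (bilc c u v I)) ≤ ENNReal.ofReal (A * (R * R')) := by
  obtain ⟨A, hA, HA⟩ := exists_potential_bound (δ := δ) hμ hT hl hll hl1 (by linarith) hs hk c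
  obtain ⟨B, hB, HB'⟩ := exists_eFn_le (n := n) (T := T) (δ := δ) hl (by linarith)
    (hl.trans hll) hl1.le (by linarith) k s
  refine ⟨B * (2 * A), by positivity, fun u v R R' hR hR' hu hv hur hvr I => ?_⟩
  obtain ⟨h1, h2, h3⟩ := HA u v R R' hR hR' hu hv hur hvr I
  refine ⟨h1, ?_⟩
  rw [mul_assoc]
  have e : 2 * (A * (R * R')) = 2 * A * (R * R') := by ring
  refine HB' _ _ (by positivity) h1 (fun w j hj hw => ?_) fun w j hj hw => ?_
  · have := ((h2 w j hj hw).mono_exponent hT hl.le hll.le).weaken (W' := δ + w.length + 1)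
      (by positivity) (by linarith)
    rwa [e] at this
  · have := ((h3 w j hj hw).mono_exponent hT (hl.trans hll).le (lam' := lam') (by linarith)).weaken
      (W' := δ + w.length + 1) (by positivity) (by linarith)
    rwa [e] at this

theorem exists_potential_subseq (hμ : 0 < μ) (hT : 0 < T) (hl : 0 < lam) (hll : lam < lam')
    (hl1 : lam' < 1) (hδ : 1 < δ) (hs : 1 ≤ s) (hk : 1 ≤ k)
    (c : Idx n q → Fin n → Idx n q → Idx n q → ℝ) (u v : ℕ → FormT n q) {R : ℝ} (hR : 0 ≤ R)
    (hu : ∀ m J, AnisoReg T (k + 1) s (u m J)) (hv : ∀ m J, AnisoReg T (k + 1) s (v m J))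
    (hur : ∀ m J, eFn T k s lam lam' δ (u m J) ≤ ENNReal.ofReal R)
    (hvr : ∀ m J, eFn T k s lam lam' δ (v m J) ≤ ENNReal.ofReal R) :
    ∃ φ : ℕ → ℕ, StrictMono φ ∧ ∀ I, ∀ ε > 0, ∃ N, ∀ m ≥ N, ∀ p ≥ N,
      eFn T k s lam lam' δ (fun t x => volPot μ (bilc c (u (φ m)) (v (φ m)) I) t x -
        volPot μ (bilc c (u (φ p)) (v (φ p)) I) t x) ≤ ENNReal.ofReal ε := by
  obtain ⟨A, hA, HA⟩ := exists_potential_bound (δ := δ) hμ hT hl hll hl1 (by linarith) hs hk c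
  have h := fun m I => HA (u m) (v m) R R hR hR (hu m) (hv m) (hur m) (hvr m) I
  exact exists_subseq_cauchy (z := fun m I => volPot μ (bilc c (u m) (v m) I)) (l := lam')
    (l' := (1 + lam') / 2) (W := 2 * δ) (C := A * (R * R)) hT hl hll (hl.trans hll) (by linarith)
    (by linarith) hl1.le (by linarith) (by linarith) (by positivity) (fun m I => (h m I).1)
    (fun m I => (h m I).2.1) fun m I => (h m I).2.2

end PotentialBound

section Uniqueness

variable {q k s : ℕ} {T μ lam lam' δ : ℝ}

theorem exp_neg_le_rpow {y : ℝ} (hy : 0 < y) : Real.exp (-y) ≤ y ^ (-(1 / 4 : ℝ)) := by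
  rw [Real.exp_neg, Real.rpow_neg hy.le]
  refine inv_anti₀ (by positivity) ?_
  calc y ^ (1 / 4 : ℝ) ≤ (1 + y) ^ (1 / 4 : ℝ) := by gcongr; linarith
    _ ≤ (1 + y) ^ (1 : ℝ) := Real.rpow_le_rpow_of_exponent_le (by linarith) (by norm_num)
    _ ≤ Real.exp y := by rw [Real.rpow_one, add_comm]; exact Real.add_one_le_exp y

theorem abs_pot_le_exp {p : Spc n → ℝ} (hp : Ker p) {ρ : ℝ → ℝ} {B : ℝ}
    (hρ : ∀ r, 0 < r → r ≤ T → |ρ r| ≤ B * r ^ (-(1 / 2 : ℝ))) {F : ℝ → Spc n → ℝ} {M σ : ℝ}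
    (hσ : 0 < σ) (hF : ∀ τ ∈ Set.Icc (0 : ℝ) T, ∀ y, |F τ y| ≤ M * Real.exp (σ * τ)) {t : ℝ}
    (ht : t ∈ Set.Icc (0 : ℝ) T) (x : Spc n) :
    |pot p ρ μ F t x| ≤
      B * (∫ z, |p z|) * (4 * T ^ (1 / 4 : ℝ)) * M * Real.exp (σ * t) * σ ^ (-(1 / 4 : ℝ)) := by
  have hQ : 0 ≤ ∫ z, |p z| := integral_nonneg fun z => abs_nonneg _
  have hM : 0 ≤ M := nonneg_of_mul_nonneg_left ((abs_nonneg _).trans (hF t ht x)) (Real.exp_pos _)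
  have h34 : (3 / 4 : ℝ) < 1 := by norm_num
  have hB : 0 ≤ B ∨ t = 0 := by
    rcases ht.1.eq_or_lt with h | h
    · exact Or.inr h.symm
    · exact Or.inl (nonneg_of_mul_nonneg_left ((abs_nonneg _).trans (hρ t h ht.2))
        (Real.rpow_pos_of_pos h _))
  rcases hB with hB | rfl
  swap
  · have hT : 0 ≤ T := ht.2
    have : 0 ≤ B ∨ T = 0 := by
      rcases hT.eq_or_lt with h | h
      · exact Or.inr h.symm
      · exact Or.inl (nonneg_of_mul_nonneg_left ((abs_nonneg _).trans (hρ T h le_rfl))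
          (Real.rpow_pos_of_pos h _))
    rcases this with hB | rfl
    · simp only [pot, intervalIntegral.integral_same, abs_zero]
      positivity
    · simp [pot]
  set D := B * (∫ z, |p z|) * M * Real.exp (σ * t) * σ ^ (-(1 / 4 : ℝ)) with hD
  have hD0 : 0 ≤ D := by positivity
  have h1 : ∀ᵐ τ, τ ∈ Set.Ioc 0 t →
      ‖ρ (t - τ) * Tq p (cc μ (t - τ)) (F τ) x‖ ≤ D * (t - τ) ^ (-(3 / 4 : ℝ)) := by
    filter_upwards [Measure.ae_ne volume t] with τ hτ hτ'
    have hr : 0 < t - τ := sub_pos.2 (lt_of_le_of_ne hτ'.2 hτ)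
    have a := hρ (t - τ) hr (by linarith [ht.2, hτ'.1])
    have b := abs_tq_le hp (hF τ ⟨hτ'.1.le, hτ'.2.trans ht.2⟩) (cc μ (t - τ)) x
    have e : Real.exp (σ * τ) = Real.exp (σ * t) * Real.exp (-(σ * (t - τ))) := by
      rw [← Real.exp_add]
      congr 1
      ring
    have d := exp_neg_le_rpow (mul_pos hσ hr)
    rw [Real.mul_rpow hσ.le hr.le] at d
    have e2 : (t - τ) ^ (-(3 / 4 : ℝ)) = (t - τ) ^ (-(1 / 2 : ℝ)) * (t - τ) ^ (-(1 / 4 : ℝ)) := by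
      rw [← Real.rpow_add hr]
      norm_num
    rw [Real.norm_eq_abs, abs_mul]
    calc |ρ (t - τ)| * |Tq p (cc μ (t - τ)) (F τ) x|
        ≤ (B * (t - τ) ^ (-(1 / 2 : ℝ))) * ((∫ z, |p z|) * (M * Real.exp (σ * τ))) := by
          refine mul_le_mul a b (abs_nonneg _) (by positivity)
      _ = B * (∫ z, |p z|) * M * Real.exp (σ * t) * (t - τ) ^ (-(1 / 2 : ℝ)) *
          Real.exp (-(σ * (t - τ))) := by rw [e]; ring
      _ ≤ B * (∫ z, |p z|) * M * Real.exp (σ * t) * (t - τ) ^ (-(1 / 2 : ℝ)) *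
          (σ ^ (-(1 / 4 : ℝ)) * (t - τ) ^ (-(1 / 4 : ℝ))) :=
        mul_le_mul_of_nonneg_left d (by positivity)
      _ = D * (t - τ) ^ (-(3 / 4 : ℝ)) := by rw [e2, hD]; ring
  have h2 := intervalIntegral.norm_integral_le_of_norm_le ht.1 h1
    ((sing_intervalIntegrable h34 t 0 t).const_mul D)
  rw [intervalIntegral.integral_const_mul] at h2
  have h3 := sing_integral_le h34 ht.1 (T := T) (by linarith [ht.2])
  have h4 : T ^ (1 - 3 / 4 : ℝ) / (1 - 3 / 4) = 4 * T ^ (1 / 4 : ℝ) := by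
    norm_num
    ring
  rw [h4] at h3
  rw [← Real.norm_eq_abs, pot]
  refine h2.trans ((mul_le_mul_of_nonneg_left h3 hD0).trans (le_of_eq ?_))
  rw [hD]
  ring

theorem exists_exp_potential_bound (hμ : 0 < μ) (T : ℝ) : ∃ P : ℝ, 0 ≤ P ∧
    ∀ (f : ℝ → Spc n → ℝ) (M σ : ℝ), 0 ≤ M → 0 < σ →
      (∀ τ ∈ Set.Icc (0 : ℝ) T, ∀ y, |f τ y| ≤ M * Real.exp (σ * τ)) →
      ∀ t ∈ Set.Icc (0 : ℝ) T, ∀ x,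
        |vpot T μ f t x| ≤ P * M * Real.exp (σ * t) * σ ^ (-(1 / 4 : ℝ)) ∧
        ∀ i, |gpot T μ i f t x| ≤ P * M * Real.exp (σ * t) * σ ^ (-(1 / 4 : ℝ)) := by
  obtain ⟨G, hG⟩ := Finite.exists_le fun i : Fin n =>
    (2 * μ) ^ (-(1 / 2 : ℝ)) * (∫ z, |phi1 i z|) * (4 * T ^ (1 / 4 : ℝ))
  set V := T ^ (1 / 2 : ℝ) * (∫ z : Spc n, |phi z|) * (4 * T ^ (1 / 4 : ℝ)) with hV
  refine ⟨max 0 (max V G), le_max_left _ _, fun f M σ hM hσ hf t ht x => ?_⟩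
  have hf' : ∀ τ ∈ Set.Icc (0 : ℝ) T, ∀ y, |ext T f τ y| ≤ M * Real.exp (σ * τ) :=
    fun τ hτ y => by rw [ext_of_mem f hτ]; exact hf τ hτ y
  have key : ∀ a, a ≤ max V G → a * M * Real.exp (σ * t) * σ ^ (-(1 / 4 : ℝ)) ≤
      max 0 (max V G) * M * Real.exp (σ * t) * σ ^ (-(1 / 4 : ℝ)) := fun a ha => by
    have : a ≤ max 0 (max V G) := ha.trans (le_max_right _ _)
    gcongr
  refine ⟨(abs_pot_le_exp ker_phi (B := T ^ (1 / 2 : ℝ)) (fun r hr hrT => ?_) hσ hf' ht x).trans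
    (key _ (le_max_left _ _)), fun i => (abs_pot_le_exp (ker_phi1 i)
      (B := (2 * μ) ^ (-(1 / 2 : ℝ))) (fun r hr hrT => ?_) hσ hf' ht x).trans
    (key _ ((hG i).trans (le_max_right _ _)))⟩
  · rw [abs_one, Real.rpow_neg hr.le, ← div_eq_mul_inv, one_le_div (by positivity)]
    gcongr
  · rw [cc_inv hμ hr.le, abs_of_nonneg (by positivity)]

theorem exists_abs_bilc_le (c : Idx n q → Fin n → Idx n q → Idx n q → ℝ) : ∃ L : ℝ, 0 ≤ L ∧
    ∀ (u v : FormT n q) (t : ℝ) (x : Spc n) (a b : ℝ), 0 ≤ a →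
      (∀ i J, |pd i (u J t) x| ≤ a) → (∀ K, |v K t x| ≤ b) →
      ∀ I, |bilc c u v I t x| ≤ L * (a * b) := by
  obtain ⟨M, hM⟩ := Finite.exists_le fun I : Idx n q => ∑ i, ∑ J, ∑ K, |c I i J K|
  refine ⟨|M|, abs_nonneg _, fun u v t x a b ha hu hv I => ?_⟩
  have h1 : |bilc c u v I t x| ≤ ∑ i, ∑ J, ∑ K, |c I i J K| * (a * b) := by
    refine (Finset.abs_sum_le_sum_abs _ _).trans (Finset.sum_le_sum fun i _ => ?_)
    refine (Finset.abs_sum_le_sum_abs _ _).trans (Finset.sum_le_sum fun J _ => ?_)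
    refine (Finset.abs_sum_le_sum_abs _ _).trans (Finset.sum_le_sum fun K _ => ?_)
    rw [abs_mul, abs_mul]
    exact mul_le_mul_of_nonneg_left (mul_le_mul (hu i J) (hv K) (abs_nonneg _) ha) (abs_nonneg _)
  refine h1.trans ?_
  simp only [← Finset.sum_mul]
  have hab : 0 ≤ a * b := mul_nonneg ha ((abs_nonneg _).trans (hv I))
  exact mul_le_mul_of_nonneg_right ((hM I).trans (le_abs_self M)) hab

theorem AnisoReg.abs_le_of_eFn (hl : 0 < lam) (hδ : 0 ≤ δ) {u : ℝ → Spc n → ℝ} {R : ℝ}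
    (hR : 0 ≤ R) (hu : AnisoReg T (k + 1) s u) (h : eFn T k s lam lam' δ u ≤ ENNReal.ofReal R)
    {t : ℝ} (ht : t ∈ Set.Icc (0 : ℝ) T) (x : Spc n) :
    |u t x| ≤ R ∧ ∀ i, |pd i (u t) x| ≤ R := by
  have h1 := fun w hj hw => hu.abs_mixD_le (w := w) (j := 0) hl hR h hj hw t ht x
  have h2 : ∀ W : ℝ, 0 ≤ W → R * wt x ^ (-W) ≤ R := fun W hW =>
    mul_le_of_le_one_right hR (wt_rpow_le_one hW x)
  refine ⟨?_, fun i => ?_⟩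
  · have := (h1 [] (by omega) (by simp)).trans (h2 _ (by simpa using hδ))
    simpa [NSdeRham.mixD_nil_zero] using this
  · have := (h1 [i] (by omega) (by simp; omega)).trans (h2 _ (by positivity))
    simpa [NSdeRham.mixD, NSdeRham.pdw, NSdeRham.tDeriv] using this

/-- Uniqueness for the linear integral equation with the potentials of `bilc`. -/
theorem eq_zero_of_potential_eq (hμ : 0 < μ) (hT : 0 < T) (hl : 0 < lam) (hl' : 0 < lam')
    (hδ : 0 ≤ δ) (hk : 1 ≤ k) (c : Idx n q → Fin n → Idx n q → Idx n q → ℝ)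
    {w v₁ v₂ : FormT n q} {R : ℝ} (hR : 0 ≤ R)
    (hw : ∀ J, AnisoReg T (k + 1) s (w J)) (hv₁ : ∀ J, AnisoReg T (k + 1) s (v₁ J))
    (hv₂ : ∀ J, AnisoReg T (k + 1) s (v₂ J))
    (hwr : ∀ J, eFn T k s lam lam' δ (w J) ≤ ENNReal.ofReal R)
    (hv₁r : ∀ J, eFn T k s lam lam' δ (v₁ J) ≤ ENNReal.ofReal R)
    (hv₂r : ∀ J, eFn T k s lam lam' δ (v₂ J) ≤ ENNReal.ofReal R)
    (h : ∀ I, ∀ t ∈ Set.Icc (0 : ℝ) T, ∀ x, w I t x + (volPot μ (bilc c w v₁ I) t x +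
      volPot μ (bilc c v₂ w I) t x) = 0) :
    ∀ I, ∀ t ∈ Set.Icc (0 : ℝ) T, ∀ x, w I t x = 0 := by
  obtain ⟨k, rfl⟩ := Nat.exists_eq_add_of_le' hk
  obtain ⟨P, hP, HP⟩ := exists_exp_potential_bound (n := n) hμ T
  obtain ⟨L, hL, HL⟩ := exists_abs_bilc_le c
  obtain ⟨A, hA, HA⟩ := cls_bilc (k := k + 1) (s := s) (δ := δ) hT hl hl' c
  have hgrad : ∀ u v : FormT n q, (∀ J, AnisoReg T (k + 1 + 1) s (u J)) →
      (∀ J, AnisoReg T (k + 1 + 1) s (v J)) →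
      (∀ J, eFn T (k + 1) s lam lam' δ (u J) ≤ ENNReal.ofReal R) →
      (∀ J, eFn T (k + 1) s lam lam' δ (v J) ≤ ENNReal.ofReal R) → ∀ I,
      HasGrad T (vpot T μ (bilc c u v I)) (fun i => gpot T μ i (bilc c u v I)) := by
    intro u v hu hv hur hvr I
    have h1 := HA u v R R hR hR hu hv hur hvr I
    exact hasGrad_vpot hμ hT le_rfl (h1.dat hT (by linarith))
      (fun i => (h1.dx (adm_JP T lam').congr i).dat hT (by linarith)) h1.hasGrad
  have g1 := hgrad w v₁ hw hv₁ hwr hv₁r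
  have g2 := hgrad v₂ w hv₂ hw hv₂r hwr
  have hweq : ∀ I, ∀ t ∈ Set.Icc (0 : ℝ) T, ∀ x,
      (-1) * (vpot T μ (bilc c w v₁ I) t x + vpot T μ (bilc c v₂ w I) t x) = w I t x :=
    fun I t ht x => by
      have := h I t ht x
      rw [volPot_eq hμ _ ht, volPot_eq hμ _ ht] at this
      linarith
  have hgw : ∀ I, HasGrad T (w I) (fun i t x =>
      (-1) * (gpot T μ i (bilc c w v₁ I) t x + gpot T μ i (bilc c v₂ w I) t x)) := fun I =>
    (((g1 I).add (g2 I)).smul (-1)).congr (hweq I)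
  set σ : ℝ := (4 * P * L * R + 1) ^ (4 : ℕ) with hσ
  have hb : 0 < 4 * P * L * R + 1 := by positivity
  have hσ0 : 0 < σ := by positivity
  have hσ' : σ ^ (-(1 / 4 : ℝ)) = (4 * P * L * R + 1)⁻¹ := by
    rw [hσ, ← Real.rpow_natCast, ← Real.rpow_mul hb.le, ← Real.rpow_neg_one]
    norm_num
  have main : ∀ N : ℕ, ∀ I, ∀ t ∈ Set.Icc (0 : ℝ) T, ∀ x,
      |w I t x| ≤ R * (1 / 2) ^ N * Real.exp (σ * t) ∧
      ∀ i, |pd i (w I t) x| ≤ R * (1 / 2) ^ N * Real.exp (σ * t) := by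
    intro N
    induction N with
    | zero =>
      intro I t ht x
      have h1 := (hw I).abs_le_of_eFn hl hδ hR (hwr I) ht x
      have h2 : R ≤ R * (1 / 2) ^ 0 * Real.exp (σ * t) := by
        rw [pow_zero, mul_one]
        exact le_mul_of_one_le_right hR (Real.one_le_exp (mul_nonneg hσ0.le ht.1))
      exact ⟨h1.1.trans h2, fun i => (h1.2 i).trans h2⟩
    | succ N ih =>
      set m := R * (1 / 2 : ℝ) ^ N with hm
      have hm0 : 0 ≤ m := by positivity
      have b1 : ∀ I, ∀ t ∈ Set.Icc (0 : ℝ) T, ∀ x,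
          |bilc c w v₁ I t x| ≤ L * m * R * Real.exp (σ * t) := fun I t ht x => by
        refine (HL w v₁ t x _ R (by positivity) (fun i J => (ih J t ht x).2 i)
          (fun K => ((hv₁ K).abs_le_of_eFn hl hδ hR (hv₁r K) ht x).1) I).trans (le_of_eq ?_)
        ring
      have b2 : ∀ I, ∀ t ∈ Set.Icc (0 : ℝ) T, ∀ x,
          |bilc c v₂ w I t x| ≤ L * m * R * Real.exp (σ * t) := fun I t ht x => by
        refine (HL v₂ w t x R _ hR
          (fun i K => ((hv₂ K).abs_le_of_eFn hl hδ hR (hv₂r K) ht x).2 i)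
          (fun J => (ih J t ht x).1) I).trans (le_of_eq ?_)
        ring
      intro I t ht x
      have p1 := HP _ _ σ (by positivity) hσ0 (b1 I) t ht x
      have p2 := HP _ _ σ (by positivity) hσ0 (b2 I) t ht x
      have hsmall : 2 * (P * (L * m * R) * Real.exp (σ * t) * σ ^ (-(1 / 4 : ℝ))) ≤
          R * (1 / 2) ^ (N + 1) * Real.exp (σ * t) := by
        have e : R * (1 / 2 : ℝ) ^ (N + 1) = m / 2 := by rw [hm, pow_succ]; ring
        rw [e, hσ']
        have h5 : 4 * P * L * R * (4 * P * L * R + 1)⁻¹ ≤ 1 := by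
          rw [← div_eq_mul_inv, div_le_one hb]
          linarith
        have h6 := mul_le_mul_of_nonneg_left h5
          (show 0 ≤ m / 2 * Real.exp (σ * t) by positivity)
        refine le_trans (le_of_eq ?_) (h6.trans (le_of_eq (mul_one _)))
        ring
      have comb : ∀ a b B : ℝ, |a| ≤ B → |b| ≤ B → |(-1) * (a + b)| ≤ 2 * B :=
        fun a b B ha hb => by
          rw [neg_one_mul, abs_neg]
          linarith [abs_add_le a b]
      refine ⟨?_, fun i => ?_⟩
      · rw [← hweq I t ht x]
        exact (comb _ _ _ p1.1 p2.1).trans hsmall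
      · rw [(hgw I).pd_eq ht i x]
        exact (comb _ _ _ (p1.2 i) (p2.2 i)).trans hsmall
  intro I t ht x
  have lim : Tendsto (fun N : ℕ => R * (1 / 2 : ℝ) ^ N * Real.exp (σ * t)) atTop (nhds 0) := by
    have := ((tendsto_pow_atTop_nhds_zero_of_lt_one (show (0 : ℝ) ≤ 1 / 2 by norm_num)
      (by norm_num)).const_mul R).mul_const (Real.exp (σ * t))
    simpa using this
  exact abs_nonpos_iff.1 (ge_of_tendsto' lim fun N => (main N I t ht x).1)

end Uniqueness

section FormAlgebra

variable {q k s : ℕ} {T μ lam lam' δ : ℝ}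

theorem anisoReg_zero (hT : 0 < T) (K : ℕ) : AnisoReg (n := n) T K s (fun _ _ => 0) := by
  have h := ((adm_JP (n := n) T 1).cls_zero (2 * s + K) s 0).jets hT (adm_JP T 1).congr
    fun _ _ _ _ h => h.1
  simpa only [mixD_nil_zero] using h.reg hT

theorem eFn_congr (hl : 0 < lam) (hl' : 0 < lam') {u v : ℝ → Spc n → ℝ}
    (h : ∀ t ∈ Set.Icc (0 : ℝ) T, ∀ x, u t x = v t x) :
    eFn T k s lam lam' δ u = eFn T k s lam lam' δ v := by
  rw [eFn, eFn, eAnisoKS_congr hl h, eAnisoKS_congr hl' h]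

theorem AnisoReg.eFn_add (hT : 0 < T) (hl : 0 < lam) (hl' : 0 < lam') {u v : ℝ → Spc n → ℝ}
    (hu : AnisoReg T (k + 1) s u) (hv : AnisoReg T (k + 1) s v) :
    eFn T k s lam lam' δ (fun t x => u t x + v t x) ≤
      eFn T k s lam lam' δ u + eFn T k s lam lam' δ v := by
  refine (add_le_add (hu.eAnisoKS_add hT hl le_rfl hv)
    (hu.eAnisoKS_add hT hl' (Nat.le_succ k) hv)).trans (le_of_eq ?_)
  rw [eFn, eFn]
  abel

theorem AnisoReg.eFn_smul (hT : 0 < T) (hl : 0 < lam) (hl' : 0 < lam') (c : ℝ)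
    {u : ℝ → Spc n → ℝ} (hu : AnisoReg T (k + 1) s u) :
    eFn T k s lam lam' δ (fun t x => c * u t x) ≤
      ENNReal.ofReal |c| * eFn T k s lam lam' δ u := by
  rw [eFn, eFn, mul_add]
  exact add_le_add (hu.eAnisoKS_smul hT hl le_rfl c) (hu.eAnisoKS_smul hT hl' (Nat.le_succ k) c)

theorem eFF_congr (hl : 0 < lam) (hl' : 0 < lam') {u v : FormT n q} (h : EqOnT T u v) :
    eFF T k s lam lam' δ u = eFF T k s lam lam' δ v :=
  Finset.sum_congr rfl fun I _ => eFn_congr hl hl' (h I)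

theorem FMemF.congr (hT : 0 < T) (hl : 0 < lam) (hl' : 0 < lam') {u v : FormT n q}
    (hu : FMemF T k s lam lam' δ u) (h : EqOnT T u v) : FMemF T k s lam lam' δ v :=
  ⟨fun I => (hu.1 I).congr hT (h I), eFF_congr (k := k) (s := s) (δ := δ) hl hl' h ▸ hu.2⟩

theorem eFF_add (hT : 0 < T) (hl : 0 < lam) (hl' : 0 < lam') {u v : FormT n q}
    (hu : ∀ I, AnisoReg T (k + 1) s (u I)) (hv : ∀ I, AnisoReg T (k + 1) s (v I)) :
    eFF T k s lam lam' δ (u + v) ≤ eFF T k s lam lam' δ u + eFF T k s lam lam' δ v := by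
  rw [eFF, eFF, eFF, ← Finset.sum_add_distrib]
  exact Finset.sum_le_sum fun I _ => (hu I).eFn_add hT hl hl' (hv I)

theorem eFF_smul (hT : 0 < T) (hl : 0 < lam) (hl' : 0 < lam') (c : ℝ) {u : FormT n q}
    (hu : ∀ I, AnisoReg T (k + 1) s (u I)) :
    eFF T k s lam lam' δ (c • u) ≤ ENNReal.ofReal |c| * eFF T k s lam lam' δ u := by
  rw [eFF, eFF, Finset.mul_sum]
  exact Finset.sum_le_sum fun I _ => (hu I).eFn_smul hT hl hl' c

theorem FMemF.add (hT : 0 < T) (hl : 0 < lam) (hl' : 0 < lam') {u v : FormT n q}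
    (hu : FMemF T k s lam lam' δ u) (hv : FMemF T k s lam lam' δ v) :
    FMemF T k s lam lam' δ (u + v) :=
  ⟨fun I => (hu.1 I).add hT (hv.1 I), ne_top_of_le_ne_top (ENNReal.add_ne_top.2 ⟨hu.2, hv.2⟩)
    (eFF_add hT hl hl' hu.1 hv.1)⟩

theorem FMemF.smul (hT : 0 < T) (hl : 0 < lam) (hl' : 0 < lam') (c : ℝ) {u : FormT n q}
    (hu : FMemF T k s lam lam' δ u) : FMemF T k s lam lam' δ (c • u) :=
  ⟨fun I => (hu.1 I).smul hT c, ne_top_of_le_ne_top (ENNReal.mul_ne_top ENNReal.ofReal_ne_top hu.2)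
    (eFF_smul hT hl hl' c hu.1)⟩

theorem eFF_zero (hT : 0 < T) (hl : 0 < lam) (hl' : 0 < lam') :
    eFF T k s lam lam' δ (0 : FormT n q) = 0 := by
  have h := eFF_smul (k := k) (s := s) (δ := δ) hT hl hl' 0 (u := (0 : FormT n q))
    fun _ => anisoReg_zero hT _
  simpa using h

theorem eFn_le_eFF (u : FormT n q) (I : Idx n q) :
    eFn T k s lam lam' δ (u I) ≤ eFF T k s lam lam' δ u :=
  Finset.single_le_sum (f := fun I => eFn T k s lam lam' δ (u I)) (fun _ _ => zero_le)
    (Finset.mem_univ I)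

theorem eqOnT_zero_of_eFF (hl : 0 < lam) (hδ : 0 ≤ δ) {u : FormT n q}
    (hu : ∀ I, AnisoReg T (k + 1) s (u I)) (h : eFF T k s lam lam' δ u = 0) : EqOnT T u 0 :=
  fun I t ht x => abs_nonpos_iff.1 ((hu I).abs_le_of_eFn (lam' := lam') hl hδ le_rfl
    ((eFn_le_eFF u I).trans (by simp [h])) ht x).1

theorem volPot_congr (hμ : 0 < μ) (hT : 0 < T) {f g : ℝ → Spc n → ℝ}
    (h : ∀ t ∈ Set.Icc (0 : ℝ) T, ∀ x, f t x = g t x) {t : ℝ} (ht : t ∈ Set.Icc (0 : ℝ) T)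
    (x : Spc n) : volPot μ f t x = volPot μ g t x := by
  have e : ext T f = ext T g := by
    funext τ y
    exact h _ (clamp_mem hT τ) y
  rw [volPot_eq hμ f ht, volPot_eq hμ g ht, vpot, vpot, e]

theorem volPot_linear (hμ : 0 < μ) (hT : 0 < T) {f g h : ℝ → Spc n → ℝ} {C C' a b : ℝ}
    (hf : Dat 0 C (ext T f)) (hg : Dat 0 C' (ext T g))
    (hh : ∀ t ∈ Set.Icc (0 : ℝ) T, ∀ x, h t x = a * f t x + b * g t x) {t : ℝ}
    (ht : t ∈ Set.Icc (0 : ℝ) T) (x : Spc n) :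
    volPot μ h t x = a * volPot μ f t x + b * volPot μ g t x := by
  have e : ∀ τ y, ext T h τ y = a * ext T f τ y + b * ext T g τ y := fun τ y =>
    hh _ (clamp_mem hT τ) y
  have i1 := pot_intervalIntegrable (n := n) ker_phi le_rfl hf rho_one μ ht.1 le_rfl x
  have i2 := pot_intervalIntegrable (n := n) ker_phi le_rfl hg rho_one μ ht.1 le_rfl x
  rw [volPot_eq hμ f ht, volPot_eq hμ g ht, volPot_eq hμ h ht, vpot, vpot, vpot, pot, pot, pot,
    ← intervalIntegral.integral_const_mul, ← intervalIntegral.integral_const_mul,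
    ← intervalIntegral.integral_add (i1.const_mul a) (i2.const_mul b)]
  refine intervalIntegral.integral_congr fun τ _ => ?_
  have j1 := ker_phi.integrable_comp (hf.slice τ) (hf.le le_rfl τ) (cc μ (t - τ)) x
  have j2 := ker_phi.integrable_comp (hg.slice τ) (hg.le le_rfl τ) (cc μ (t - τ)) x
  simp only [Tq, one_mul]
  rw [← integral_const_mul, ← integral_const_mul,
    ← integral_add (j1.const_mul a) (j2.const_mul b)]
  refine integral_congr_ae (Eventually.of_forall fun z => ?_)
  simp only [e]
  ring

theorem bilc_linear_left (c : Idx n q → Fin n → Idx n q → Idx n q → ℝ) {u u' v : FormT n q} {t : ℝ}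
    (hu : ∀ J, Differentiable ℝ (u J t)) (hu' : ∀ J, Differentiable ℝ (u' J t)) (a b : ℝ)
    (I : Idx n q) (x : Spc n) :
    bilc c (a • u + b • u') v I t x = a * bilc c u v I t x + b * bilc c u' v I t x := by
  have h : ∀ i J, pd i ((a • u + b • u') J t) x = a * pd i (u J t) x + b * pd i (u' J t) x := by
    intro i J
    have : HasFDerivAt ((a • u + b • u') J t) (a • fderiv ℝ (u J t) x + b • fderiv ℝ (u' J t) x) x :=
      ((hu J x).hasFDerivAt.const_smul a).add ((hu' J x).hasFDerivAt.const_smul b)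
    rw [pd, this.fderiv]
    rfl
  simp only [bilc, h, Finset.mul_sum, ← Finset.sum_add_distrib]
  refine Finset.sum_congr rfl fun i _ => Finset.sum_congr rfl fun J _ =>
    Finset.sum_congr rfl fun K _ => ?_
  ring

theorem bilc_linear_right (c : Idx n q → Fin n → Idx n q → Idx n q → ℝ) (u v v' : FormT n q)
    (t a b : ℝ) (I : Idx n q) (x : Spc n) :
    bilc c u (a • v + b • v') I t x = a * bilc c u v I t x + b * bilc c u v' I t x := by
  have h : ∀ K, (a • v + b • v') K t x = a * v K t x + b * v' K t x := fun K => rfl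
  simp only [bilc, h, Finset.mul_sum, ← Finset.sum_add_distrib]
  refine Finset.sum_congr rfl fun i _ => Finset.sum_congr rfl fun J _ =>
    Finset.sum_congr rfl fun K _ => ?_
  ring

theorem AnisoReg.differentiable {u : ℝ → Spc n → ℝ} (hu : AnisoReg T (k + 1) s u) {t : ℝ}
    (ht : t ∈ Set.Icc (0 : ℝ) T) : Differentiable ℝ (u t) := by
  have h := (hu.contDiff (j := 0) (m := 1) (by omega) (by omega) ht).differentiable (by simp)
  simpa [NSdeRham.tDeriv] using h

theorem FMemF.eFn_le {u : FormT n q} (hu : FMemF T k s lam lam' δ u) (J : Idx n q) :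
    eFn T k s lam lam' δ (u J) ≤ ENNReal.ofReal (eFF T k s lam lam' δ u).toReal := by
  rw [ENNReal.ofReal_toReal hu.2]
  exact eFn_le_eFF u J

theorem FMemF.dat_bilc (hT : 0 < T) (hl : 0 < lam) (hl' : 0 < lam') (hδ : 0 ≤ δ)
    (c : Idx n q → Fin n → Idx n q → Idx n q → ℝ) {u v : FormT n q}
    (hu : FMemF T k s lam lam' δ u) (hv : FMemF T k s lam lam' δ v) (I : Idx n q) :
    ∃ C, Dat 0 C (ext T (bilc c u v I)) := by
  obtain ⟨A, -, HA⟩ := cls_bilc (k := k) (s := s) (δ := δ) (lam := lam) hT hl hl' c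
  exact ⟨_, (HA u v _ _ ENNReal.toReal_nonneg ENNReal.toReal_nonneg hu.1 hv.1 hu.eFn_le hv.eFn_le
    I).dat hT (by linarith)⟩

theorem FMemF.volPot_bilc_linear_left (hμ : 0 < μ) (hT : 0 < T) (hl : 0 < lam) (hl' : 0 < lam')
    (hδ : 0 ≤ δ) (c : Idx n q → Fin n → Idx n q → Idx n q → ℝ) {u u' v : FormT n q}
    (hu : FMemF T k s lam lam' δ u) (hu' : FMemF T k s lam lam' δ u')
    (hv : FMemF T k s lam lam' δ v) (a b : ℝ) :
    EqOnT T (volPotF μ (bilc c (a • u + b • u') v))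
      (a • volPotF μ (bilc c u v) + b • volPotF μ (bilc c u' v)) := by
  intro I t ht x
  obtain ⟨C, h1⟩ := hu.dat_bilc hT hl hl' hδ c hv I
  obtain ⟨C', h2⟩ := hu'.dat_bilc hT hl hl' hδ c hv I
  exact volPot_linear hμ hT h1 h2 (fun t ht x => bilc_linear_left c
    (fun J => (hu.1 J).differentiable ht) (fun J => (hu'.1 J).differentiable ht) a b I x) ht x

theorem FMemF.volPot_bilc_linear_right (hμ : 0 < μ) (hT : 0 < T) (hl : 0 < lam) (hl' : 0 < lam')
    (hδ : 0 ≤ δ) (c : Idx n q → Fin n → Idx n q → Idx n q → ℝ) {u v v' : FormT n q}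
    (hu : FMemF T k s lam lam' δ u) (hv : FMemF T k s lam lam' δ v)
    (hv' : FMemF T k s lam lam' δ v') (a b : ℝ) :
    EqOnT T (volPotF μ (bilc c u (a • v + b • v')))
      (a • volPotF μ (bilc c u v) + b • volPotF μ (bilc c u v')) := by
  intro I t ht x
  obtain ⟨C, h1⟩ := hu.dat_bilc hT hl hl' hδ c hv I
  obtain ⟨C', h2⟩ := hu.dat_bilc hT hl hl' hδ c hv' I
  exact volPot_linear hμ hT h1 h2 (fun t _ x => bilc_linear_right c u v v' t a b I x) ht x

theorem exists_eFF_volPot_le (hμ : 0 < μ) (hT : 0 < T) (hl : 0 < lam) (hll : lam < lam')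
    (hl1 : lam' < 1) (hδ : 1 ≤ δ) (hs : 1 ≤ s) (hk : 1 ≤ k)
    (c : Idx n q → Fin n → Idx n q → Idx n q → ℝ) : ∃ A : ℝ, 0 ≤ A ∧ ∀ u v : FormT n q,
      FMemF T k s lam lam' δ u → FMemF T k s lam lam' δ v →
        FMemF T k s lam lam' δ (volPotF μ (bilc c u v)) ∧
        (eFF T k s lam lam' δ (volPotF μ (bilc c u v))).toReal ≤
          A * (eFF T k s lam lam' δ u).toReal * (eFF T k s lam lam' δ v).toReal := by
  obtain ⟨A, hA, HA⟩ := exists_potential_norm (q := q) (n := n) hμ hT hl hll hl1 hδ hs hk c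
  refine ⟨(Finset.univ : Finset (Idx n q)).card * A, by positivity, fun u v hu hv => ?_⟩
  have h := HA u v _ _ ENNReal.toReal_nonneg ENNReal.toReal_nonneg hu.1 hv.1 hu.eFn_le hv.eFn_le
  have h1 : eFF T k s lam lam' δ (volPotF μ (bilc c u v)) ≤ ENNReal.ofReal
      ((Finset.univ : Finset (Idx n q)).card * A * (eFF T k s lam lam' δ u).toReal *
        (eFF T k s lam lam' δ v).toReal) := by
    refine (Finset.sum_le_card_nsmul _ _ _ fun I _ => (h I).2).trans (le_of_eq ?_)
    rw [nsmul_eq_mul, ← ENNReal.ofReal_natCast, ← ENNReal.ofReal_mul (by positivity)]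
    congr 1
    ring
  exact ⟨⟨fun I => (h I).1, ne_top_of_le_ne_top ENNReal.ofReal_ne_top h1⟩,
    ENNReal.toReal_le_of_le_ofReal (by positivity) h1⟩

end FormAlgebra

section Space

/-- Admissible parameters of the spaces `𝓕^{k,𝐬(s,λ,λ',δ)}_T`. -/
structure Par where
  T : ℝ
  lam : ℝ
  lam' : ℝ
  δ : ℝ
  k : ℕ
  s : ℕ
  hT : 0 < T
  hl : 0 < lam
  hl' : 0 < lam'
  hδ : 0 ≤ δ

variable {q : ℕ}

/-- Membership in the space with parameters `P`. -/
def Par.Mem (P : Par) (u : FormT n q) : Prop := FMemF P.T P.k P.s P.lam P.lam' P.δ u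

/-- The norm of the space with parameters `P`. -/
def Par.eN (P : Par) (u : FormT n q) : ℝ≥0∞ := eFF P.T P.k P.s P.lam P.lam' P.δ u

/-- The representative vanishing outside of the time interval. -/
def cut (T : ℝ) (u : FormT n q) : FormT n q := fun I t x => if t ∈ Set.Icc 0 T then u I t x else 0

theorem eqOnT_cut (T : ℝ) (u : FormT n q) : EqOnT T (cut T u) u := fun _ _ ht _ => if_pos ht

variable (n q) in
/-- The space `𝓕^{k,𝐬(s,λ,λ',δ)}_{T,Λ^q}`, realised by forms vanishing outside of `[0,T]`. -/
def Par.space (P : Par) : Submodule ℝ (FormT n q) where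
  carrier := {u | P.Mem u ∧ ∀ I, ∀ t ∉ Set.Icc 0 P.T, ∀ x, u I t x = 0}
  zero_mem' := ⟨⟨fun _ => anisoReg_zero P.hT _, by
    rw [eFF_zero P.hT P.hl P.hl']; exact ENNReal.zero_ne_top⟩, fun _ _ _ _ => rfl⟩
  add_mem' := fun {u v} hu hv => ⟨hu.1.add P.hT P.hl P.hl' hv.1, fun I t ht x => by
    simp [hu.2 I t ht x, hv.2 I t ht x]⟩
  smul_mem' := fun c u hu => ⟨hu.1.smul P.hT P.hl P.hl' c, fun I t ht x => by
    simp [hu.2 I t ht x]⟩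

variable (n q) in
/-- The space with parameters `P`, as a type carrying its own topology. -/
def Par.Sp (P : Par) : Type := ↥(P.space n q)

variable {P : Par}

instance : AddCommGroup (P.Sp n q) := inferInstanceAs (AddCommGroup ↥(P.space n q))

instance : Module ℝ (P.Sp n q) := inferInstanceAs (Module ℝ ↥(P.space n q))

instance : Norm (P.Sp n q) := ⟨fun u => (P.eN u.1).toReal⟩

theorem Par.mem (U : P.Sp n q) : P.Mem U.1 := U.2.1

theorem Par.norm_def (U : P.Sp n q) : ‖U‖ = (P.eN U.1).toReal := rfl

theorem Par.ofReal_norm (U : P.Sp n q) : ENNReal.ofReal ‖U‖ = P.eN U.1 :=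
  ENNReal.ofReal_toReal (Par.mem U).2

theorem Par.ext_of_eqOnT {U V : P.Sp n q} (h : EqOnT P.T U.1 V.1) : U = V := by
  refine Subtype.ext ?_
  funext I t x
  by_cases ht : t ∈ Set.Icc 0 P.T
  · exact h I t ht x
  · rw [U.2.2 I t ht x, V.2.2 I t ht x]

theorem Par.norm_smul_le (c : ℝ) (U : P.Sp n q) : ‖c • U‖ ≤ |c| * ‖U‖ := by
  have h := eFF_smul (k := P.k) (s := P.s) (δ := P.δ) P.hT P.hl P.hl' c (Par.mem U).1
  refine ENNReal.toReal_le_of_le_ofReal (mul_nonneg (abs_nonneg _) ENNReal.toReal_nonneg) ?_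
  rw [ENNReal.ofReal_mul (abs_nonneg _), Par.ofReal_norm]
  exact h

theorem Par.core : NormedSpace.Core ℝ (P.Sp n q) where
  norm_nonneg _ := ENNReal.toReal_nonneg
  norm_smul c U := by
    refine le_antisymm (Par.norm_smul_le c U) ?_
    rcases eq_or_ne c 0 with rfl | hc
    · rw [norm_zero, zero_mul]
      exact ENNReal.toReal_nonneg
    · have h := Par.norm_smul_le c⁻¹ (c • U)
      rw [smul_smul, inv_mul_cancel₀ hc, one_smul, abs_inv] at h
      rw [Real.norm_eq_abs]
      exact (le_inv_mul_iff₀ (abs_pos.2 hc)).1 h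
  norm_triangle U V := by
    have h := eFF_add (k := P.k) (s := P.s) (δ := P.δ) P.hT P.hl P.hl' (Par.mem U).1 (Par.mem V).1
    refine ENNReal.toReal_le_of_le_ofReal (add_nonneg ENNReal.toReal_nonneg
      ENNReal.toReal_nonneg) ?_
    rw [ENNReal.ofReal_add (p := ‖U‖) (q := ‖V‖) ENNReal.toReal_nonneg ENNReal.toReal_nonneg,
      Par.ofReal_norm, Par.ofReal_norm]
    exact h
  norm_eq_zero_iff U := by
    constructor
    · intro h
      have h0 : P.eN U.1 = 0 := by rw [← Par.ofReal_norm, h, ENNReal.ofReal_zero]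
      exact Par.ext_of_eqOnT (eqOnT_zero_of_eFF P.hl P.hδ (Par.mem U).1 h0)
    · rintro rfl
      rw [Par.norm_def]
      have : P.eN (0 : FormT n q) = 0 := eFF_zero P.hT P.hl P.hl'
      exact (congrArg ENNReal.toReal this).trans ENNReal.toReal_zero

instance : NormedAddCommGroup (P.Sp n q) := NormedAddCommGroup.ofCore Par.core

instance : NormedSpace ℝ (P.Sp n q) := NormedSpace.ofCore Par.core

/-- The form `u` represents the element `U` on the time interval. -/
def Rep (U : P.Sp n q) (u : FormT n q) : Prop := EqOnT P.T U.1 u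

theorem Rep.mem {U : P.Sp n q} {u : FormT n q} (h : Rep U u) : P.Mem u :=
  (Par.mem U).congr P.hT P.hl P.hl' h

theorem Rep.eN_eq {U : P.Sp n q} {u : FormT n q} (h : Rep U u) :
    P.eN u = ENNReal.ofReal ‖U‖ := by
  rw [Par.ofReal_norm]
  exact (eFF_congr P.hl P.hl' h).symm

/-- The element represented by `u`. -/
def Par.ofMem {u : FormT n q} (hu : P.Mem u) : P.Sp n q :=
  ⟨cut P.T u, hu.congr P.hT P.hl P.hl' fun I t ht x => (eqOnT_cut P.T u I t ht x).symm,
    fun _ _ ht _ => if_neg ht⟩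

theorem Par.rep_ofMem {u : FormT n q} (hu : P.Mem u) : Rep (Par.ofMem hu) u := eqOnT_cut P.T u

theorem Rep.refl (U : P.Sp n q) : Rep U U.1 := fun _ _ _ _ => rfl

theorem Rep.add {U V : P.Sp n q} {u v : FormT n q} (h : Rep U u) (h' : Rep V v) :
    Rep (U + V) (u + v) := fun I t ht x => congrArg₂ (· + ·) (h I t ht x) (h' I t ht x)

theorem Rep.sub {U V : P.Sp n q} {u v : FormT n q} (h : Rep U u) (h' : Rep V v) :
    Rep (U - V) (u - v) := fun I t ht x => congrArg₂ (· - ·) (h I t ht x) (h' I t ht x)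

theorem Rep.eq {U V : P.Sp n q} {u : FormT n q} (h : Rep U u) (h' : Rep V u) : U = V :=
  Par.ext_of_eqOnT fun I t ht x => (h I t ht x).trans (h' I t ht x).symm

theorem Rep.congr {U : P.Sp n q} {u v : FormT n q} (h : Rep U u) (h' : EqOnT P.T u v) :
    Rep U v := fun I t ht x => (h I t ht x).trans (h' I t ht x)

theorem Rep.zero : Rep (0 : P.Sp n q) 0 := fun _ _ _ _ => rfl

theorem Rep.smul (c : ℝ) {U : P.Sp n q} {u : FormT n q} (h : Rep U u) : Rep (c • U) (c • u) :=
  fun I t ht x => congrArg (c * ·) (h I t ht x)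

theorem Rep.sum {ι : Type*} (S : Finset ι) {U : ι → P.Sp n q} {u : ι → FormT n q}
    (h : ∀ i, Rep (U i) (u i)) : Rep (∑ i ∈ S, U i) (∑ i ∈ S, u i) := by
  induction S using Finset.induction_on with
  | empty => simpa using Rep.zero
  | insert a S ha ih =>
    rw [Finset.sum_insert ha, Finset.sum_insert ha]
    exact (h a).add ih

theorem exists_limit_of_cauchy {z : ℕ → P.Sp n q}
    (hz : ∀ I, ∀ ε > 0, ∃ N, ∀ m ≥ N, ∀ p ≥ N, eFn P.T P.k P.s P.lam P.lam' P.δ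
      (fun t x => (z m).1 I t x - (z p).1 I t x) ≤ ENNReal.ofReal ε) :
    ∃ V, Tendsto z atTop (nhds V) := by
  choose v hv hvl using fun I => exists_limit P.hT P.hl P.hl' P.hδ
    (fun m => (Par.mem (z m)).1 I) (hz I)
  have hlim : ∀ ε > 0, ∃ N, ∀ m ≥ N, ∀ I, eFn P.T P.k P.s P.lam P.lam' P.δ
      (fun t x => (z m).1 I t x - v I t x) ≤ ENNReal.ofReal ε := fun ε hε => by
    choose N hN using fun I => hvl I ε hε
    obtain ⟨M, hM⟩ := Finite.exists_le N
    exact ⟨M, fun m hm I => hN I m ((hM I).trans hm)⟩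
  have hsum : ∀ ε > 0, ∃ N, ∀ m ≥ N, P.eN ((z m).1 - v) ≤ ENNReal.ofReal ε := fun ε hε => by
    obtain ⟨K, hK⟩ : ∃ K : ℝ, K = ((Finset.univ : Finset (Idx n q)).card : ℝ) := ⟨_, rfl⟩
    have hK0 : 0 ≤ K := hK ▸ Nat.cast_nonneg _
    obtain ⟨N, hN⟩ := hlim (ε / (K + 1)) (by positivity)
    refine ⟨N, fun m hm => ?_⟩
    have h : P.eN ((z m).1 - v) ≤ (Finset.univ : Finset (Idx n q)).card •
        ENNReal.ofReal (ε / (K + 1)) :=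
      Finset.sum_le_card_nsmul Finset.univ (fun I => eFn P.T P.k P.s P.lam P.lam' P.δ
        (((z m).1 - v) I)) _ fun I _ => hN m hm I
    refine h.trans ?_
    rw [nsmul_eq_mul, ← ENNReal.ofReal_natCast, ← ENNReal.ofReal_mul (by positivity)]
    refine ENNReal.ofReal_le_ofReal ?_
    rw [← hK, mul_div_assoc', div_le_iff₀ (by positivity)]
    nlinarith
  have hmem : P.Mem v := by
    obtain ⟨N, hN⟩ := hsum 1 one_pos
    have h1 : P.Mem ((z N).1 - v) := ⟨fun I => ((Par.mem (z N)).1 I).sub P.hT (hv I),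
      ne_top_of_le_ne_top ENNReal.ofReal_ne_top (hN N le_rfl)⟩
    have h2 := (Par.mem (z N)).add P.hT P.hl P.hl' (h1.smul P.hT P.hl P.hl' (-1))
    have e : (z N).1 + (-1 : ℝ) • ((z N).1 - v) = v := by
      rw [neg_one_smul]
      abel
    rwa [e] at h2
  refine ⟨Par.ofMem hmem, Metric.tendsto_atTop.2 fun ε hε => ?_⟩
  obtain ⟨N, hN⟩ := hsum (ε / 2) (by positivity)
  refine ⟨N, fun m hm => ?_⟩
  have h1 := ((Rep.refl (z m)).sub (Par.rep_ofMem hmem)).eN_eq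
  have h2 := hN m hm
  rw [h1, ENNReal.ofReal_le_ofReal_iff (by positivity)] at h2
  rw [dist_eq_norm]
  linarith

instance : CompleteSpace (P.Sp n q) := by
  refine Metric.complete_of_cauchySeq_tendsto fun z hz =>
    exists_limit_of_cauchy (P := P) (z := z) fun I ε hε => ?_
  obtain ⟨N, hN⟩ := Metric.cauchySeq_iff.1 hz ε hε
  refine ⟨N, fun m hm p hp => ?_⟩
  have h1 := ((Rep.refl (z m)).sub (Rep.refl (z p))).eN_eq
  have h2 := hN m hm p hp
  rw [dist_eq_norm] at h2
  exact (eFn_le_eFF ((z m).1 - (z p).1) I).trans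
    (h1.le.trans (ENNReal.ofReal_le_ofReal h2.le))

end Space

section BilinearMap

variable {q : ℕ} {P : Par} {μ : ℝ}

theorem eqOnT_volPot_bilc (hμ : 0 < μ) {T : ℝ} (hT : 0 < T)
    (c : Idx n q → Fin n → Idx n q → Idx n q → ℝ) {u u' v v' : FormT n q} (hu : EqOnT T u u')
    (hv : EqOnT T v v') : EqOnT T (volPotF μ (bilc c u v)) (volPotF μ (bilc c u' v')) :=
  fun I _ ht x => volPot_congr hμ hT (fun t ht x => by
    have h1 : ∀ J, u J t = u' J t := fun J => funext (hu J t ht)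
    have h2 : ∀ J, v J t = v' J t := fun J => funext (hv J t ht)
    simp only [bilc, h1, h2]) ht x

theorem exists_bilinear (hμ : 0 < μ) (hll : P.lam < P.lam') (hl1 : P.lam' < 1) (hδ : 1 ≤ P.δ)
    (hs : 1 ≤ P.s) (hk : 1 ≤ P.k) (c : Idx n q → Fin n → Idx n q → Idx n q → ℝ) :
    ∃ b : P.Sp n q →L[ℝ] P.Sp n q →L[ℝ] P.Sp n q, ∀ {U W : P.Sp n q} {u w : FormT n q},
      Rep U u → Rep W w → Rep (b U W) (volPotF μ (bilc c u w)) := by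
  obtain ⟨A, -, hA⟩ := exists_eFF_volPot_le (n := n) (q := q) hμ P.hT P.hl hll hl1 hδ hs hk c
  have hmem : ∀ U W : P.Sp n q, P.Mem (volPotF μ (bilc c U.1 W.1)) := fun U W =>
    (hA U.1 W.1 (Par.mem U) (Par.mem W)).1
  have hrep : ∀ {U W : P.Sp n q} {u w : FormT n q}, Rep U u → Rep W w →
      Rep (Par.ofMem (hmem U W)) (volPotF μ (bilc c u w)) := fun hu hw =>
    (Par.rep_ofMem (hmem _ _)).congr (eqOnT_volPot_bilc hμ P.hT c hu hw)
  have hleft : ∀ (a a' : ℝ) (U U' W : P.Sp n q), Par.ofMem (hmem (a • U + a' • U') W) =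
      a • Par.ofMem (hmem U W) + a' • Par.ofMem (hmem U' W) := fun a a' U U' W =>
    (hrep (((Rep.refl U).smul a).add ((Rep.refl U').smul a')) (Rep.refl W)).eq
      ((((Par.rep_ofMem (hmem U W)).smul a).add ((Par.rep_ofMem (hmem U' W)).smul a')).congr
        fun I t ht x => ((Par.mem U).volPot_bilc_linear_left hμ P.hT P.hl P.hl' P.hδ c
          (Par.mem U') (Par.mem W) a a' I t ht x).symm)
  have hright : ∀ (a a' : ℝ) (U W W' : P.Sp n q), Par.ofMem (hmem U (a • W + a' • W')) =
      a • Par.ofMem (hmem U W) + a' • Par.ofMem (hmem U W') := fun a a' U W W' =>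
    (hrep (Rep.refl U) (((Rep.refl W).smul a).add ((Rep.refl W').smul a'))).eq
      ((((Par.rep_ofMem (hmem U W)).smul a).add ((Par.rep_ofMem (hmem U W')).smul a')).congr
        fun I t ht x => ((Par.mem U).volPot_bilc_linear_right hμ P.hT P.hl P.hl' P.hδ c
          (Par.mem W) (Par.mem W') a a' I t ht x).symm)
  have h1 : ∀ a : ℝ, ∀ U V : P.Sp n q, a • U + (0 : ℝ) • V = a • U := fun a U V => by
    rw [zero_smul, add_zero]
  have h2 : ∀ U V : P.Sp n q, (1 : ℝ) • U + (1 : ℝ) • V = U + V := fun U V => by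
    rw [one_smul, one_smul]
  let L : P.Sp n q →ₗ[ℝ] P.Sp n q →ₗ[ℝ] P.Sp n q := LinearMap.mk₂ ℝ
    (fun U W => Par.ofMem (hmem U W))
    (fun U U' W => by simpa only [h2] using hleft 1 1 U U' W)
    (fun a U W => by simpa only [h1] using hleft a 0 U U W)
    (fun U W W' => by simpa only [h2] using hright 1 1 U W W')
    (fun a U W => by simpa only [h1] using hright a 0 U W W)
  refine ⟨L.mkContinuous₂ A fun U W => ?_, fun hu hw => hrep hu hw⟩
  have h3 := (Par.rep_ofMem (hmem U W)).eN_eq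
  have h4 := (hA U.1 W.1 (Par.mem U) (Par.mem W)).2
  change (P.eN (volPotF μ (bilc c U.1 W.1))).toReal ≤ _ at h4
  rw [h3, ENNReal.toReal_ofReal (norm_nonneg _)] at h4
  exact h4

theorem Rep.differentiable {U : P.Sp n q} {u : FormT n q} (h : Rep U u) {t : ℝ}
    (ht : t ∈ Set.Icc 0 P.T) (J : Idx n q) : Differentiable ℝ (u J t) :=
  (h.mem.1 J).differentiable ht

/-- The properties of the bilinear map `b` underlying `Ψ_{μ,q} 𝒩_q`. -/
structure IsBil (μ : ℝ) (M₁ : M1Type n q) (M₂ : M2Type n q)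
    (b : P.Sp n q →L[ℝ] P.Sp n q →L[ℝ] P.Sp n q) : Prop where
  nop : ∀ {U : P.Sp n q} {u : FormT n q}, Rep U u → Rep (b U U) (NopPot μ M₁ M₂ u)
  bop : ∀ {U V : P.Sp n q} {u v : FormT n q}, Rep U u → Rep V v →
    Rep (b U V + b V U) (volPotF μ (Bop M₁ M₂ v u))
  comp : ∀ u v : ℕ → P.Sp n q, (∃ C, ∀ m, ‖u m‖ ≤ C) → (∃ C, ∀ m, ‖v m‖ ≤ C) →
    ∃ φ : ℕ → ℕ, StrictMono φ ∧ ∃ g, Tendsto (fun m => b (u (φ m)) (v (φ m))) atTop (nhds g)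
  inj : ∀ v₁ v₂ h : P.Sp n q, h + (b h v₁ + b v₂ h) = 0 → h = 0

theorem exists_isBil (hμ : 0 < μ) (hll : P.lam < P.lam') (hl1 : P.lam' < 1) (hδ : 1 < P.δ)
    (hs : 1 ≤ P.s) (hk : 1 ≤ P.k) (M₁ : M1Type n q) (M₂ : M2Type n q) :
    ∃ b : P.Sp n q →L[ℝ] P.Sp n q →L[ℝ] P.Sp n q, IsBil μ M₁ M₂ b := by
  obtain ⟨c, hc⟩ := exists_bilc M₁ M₂
  obtain ⟨b, hb⟩ := exists_bilinear (P := P) (n := n) (q := q) hμ hll hl1 hδ.le hs hk c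
  have hle : ∀ (U : P.Sp n q) {R : ℝ}, ‖U‖ ≤ R → ∀ J, eFn P.T P.k P.s P.lam P.lam' P.δ (U.1 J) ≤
      ENNReal.ofReal R := fun U R hR J =>
    ((Par.mem U).eFn_le J).trans (ENNReal.ofReal_le_ofReal hR)
  refine ⟨b, fun {U u} hu => ?_, fun {U V u v} hu hv => ?_, fun u v hu hv => ?_,
    fun v₁ v₂ h hh => ?_⟩
  · refine (hb hu hu).congr fun I t ht x => volPot_congr hμ P.hT (fun t ht x => ?_) ht x
    exact (hc u u t (hu.differentiable ht) (hu.differentiable ht) I x).1.symm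
  · refine ((hb hu hv).add (hb hv hu)).congr fun I t ht x => ?_
    obtain ⟨C, hC⟩ := hu.mem.dat_bilc P.hT P.hl P.hl' P.hδ c hv.mem I
    obtain ⟨C', hC'⟩ := hv.mem.dat_bilc P.hT P.hl P.hl' P.hδ c hu.mem I
    have e := volPot_linear (a := 1) (b := 1) (h := Bop M₁ M₂ v u I) hμ P.hT hC hC'
      (fun t ht x => by
        rw [one_mul, one_mul]
        exact (hc u v t (hu.differentiable ht) (hv.differentiable ht) I x).2) ht x
    rw [one_mul, one_mul] at e
    exact e.symm
  · obtain ⟨C, hC⟩ := hu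
    obtain ⟨C', hC'⟩ := hv
    obtain ⟨φ, hφ, hz⟩ := exists_potential_subseq hμ P.hT P.hl hll hl1 hδ hs hk c
      (fun m => (u m).1) (fun m => (v m).1) (R := max C C')
      ((norm_nonneg _).trans ((hC 0).trans (le_max_left _ _)))
      (fun m => (Par.mem (u m)).1) (fun m => (Par.mem (v m)).1)
      (fun m => hle _ ((hC m).trans (le_max_left _ _)))
      (fun m => hle _ ((hC' m).trans (le_max_right _ _)))
    refine ⟨φ, hφ, exists_limit_of_cauchy fun I ε hε => ?_⟩
    obtain ⟨N, hN⟩ := hz I ε hε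
    refine ⟨N, fun m hm p hp => le_trans (le_of_eq ?_) (hN m hm p hp)⟩
    refine eFn_congr P.hl P.hl' fun t ht x => ?_
    have e : ∀ m, Rep (b (u m) (v m)) (volPotF μ (bilc c (u m).1 (v m).1)) := fun m =>
      hb (Rep.refl _) (Rep.refl _)
    exact congrArg₂ (· - ·) (e (φ m) I t ht x) (e (φ p) I t ht x)
  · obtain ⟨R, hR⟩ : ∃ R : ℝ, R = ‖v₁‖ + ‖v₂‖ + ‖h‖ := ⟨_, rfl⟩
    have n1 := norm_nonneg v₁
    have n2 := norm_nonneg v₂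
    have n3 := norm_nonneg h
    refine Par.ext_of_eqOnT (eq_zero_of_potential_eq hμ P.hT P.hl P.hl' P.hδ hk c (R := R)
      (v₁ := v₁.1) (v₂ := v₂.1) (by linarith) (Par.mem h).1 (Par.mem v₁).1 (Par.mem v₂).1
      (hle _ (by linarith)) (hle _ (by linarith)) (hle _ (by linarith)) fun I t ht x => ?_)
    have e : Rep (h + (b h v₁ + b v₂ h)) _ := (Rep.refl h).add
      ((hb (Rep.refl h) (Rep.refl v₁)).add (hb (Rep.refl v₂) (Rep.refl h)))
    rw [hh] at e
    exact (e I t ht x).symm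

theorem IsBil.tmap {M₁ : M1Type n q} {M₂ : M2Type n q}
    {b : P.Sp n q →L[ℝ] P.Sp n q →L[ℝ] P.Sp n q} (hb : IsBil μ M₁ M₂ b) {U : P.Sp n q}
    {u : FormT n q} (hu : Rep U u) : Rep (U + b U U) (TmapN μ M₁ M₂ u) :=
  hu.add (hb.nop hu)

theorem IsBil.lmap {M₁ : M1Type n q} {M₂ : M2Type n q}
    {b : P.Sp n q →L[ℝ] P.Sp n q →L[ℝ] P.Sp n q} (hb : IsBil μ M₁ M₂ b) {U V : P.Sp n q}
    {u v : FormT n q} (hu : Rep U u) (hv : Rep V v) :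
    Rep (quadDeriv b V U) (LmapB μ M₁ M₂ v u) := by
  rw [quadDeriv_apply]
  exact hu.add (hb.bop hu hv)

theorem exists_ofReal_le {ε : ℝ≥0∞} (hε : ε ≠ 0) : ∃ r : ℝ, 0 < r ∧ ENNReal.ofReal r ≤ ε := by
  have h : min ε 1 ≠ ⊤ := ne_top_of_le_ne_top ENNReal.one_ne_top (min_le_right _ _)
  exact ⟨(min ε 1).toReal, ENNReal.toReal_pos (by simp [hε]) h,
    (ENNReal.ofReal_toReal h).le.trans (min_le_left _ _)⟩

theorem Rep.continuous_lift {F : P.Sp n q → P.Sp n q} (hF : Continuous F)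
    {f : FormT n q → FormT n q} (hf : ∀ {U u}, Rep U u → Rep (F U) (f u)) {u : FormT n q}
    (hu : P.Mem u) {ε : ℝ≥0∞} (hε : ε ≠ 0) : ∃ ρ : ℝ≥0∞, ρ ≠ 0 ∧ ∀ v, P.Mem v →
      P.eN (v - u) < ρ → P.eN (f v - f u) < ε := by
  obtain ⟨r, hr, hrε⟩ := exists_ofReal_le hε
  have hU := Par.rep_ofMem hu
  obtain ⟨ρ, hρ, h⟩ := Metric.continuous_iff.1 hF (Par.ofMem hu) r hr
  refine ⟨ENNReal.ofReal ρ, by simpa using hρ, fun v hv hvu => ?_⟩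
  have hV := Par.rep_ofMem hv
  rw [(hV.sub hU).eN_eq, ENNReal.ofReal_lt_ofReal_iff hρ, ← dist_eq_norm] at hvu
  have h1 := h _ hvu
  rw [dist_eq_norm] at h1
  rw [((hf hV).sub (hf hU)).eN_eq]
  exact ((ENNReal.ofReal_lt_ofReal_iff hr).2 h1).trans_le hrε

end BilinearMap

/-- the map `Ψ_{μ,q}𝒩_q` on `𝓕^{k,𝐬(s,λ,λ',δ)}_{T,Λ^q}` is continuous and
compact, and `I + Ψ_{μ,q}𝒩_q` is continuous, Fredholm (its Fréchet derivative at every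
point is a bounded linear Fredholm operator), injective and open. -/
theorem stmt15 (n q s k : ℕ) (hn : 2 ≤ n) (hq : q ≤ n) (hs : 1 ≤ s) (hk : 1 ≤ k)
    (lam lam' δ μ T : ℝ) (h1 : 0 < lam) (h2 : lam < lam') (h3 : lam' < 1)
    (hδ : (n : ℝ) / 2 < δ) (hμ : 0 < μ) (hT : 0 < T)
    (M₁ : M1Type n q) (M₂ : M2Type n q) :
    -- `Ψ𝒩` maps the space into itself
    (∀ u : FormT n q, FMemF T k s lam lam' δ u →
      FMemF T k s lam lam' δ (NopPot μ M₁ M₂ u)) ∧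
    -- `Ψ𝒩` is continuous
    (∀ u : FormT n q, FMemF T k s lam lam' δ u → ∀ ε : ℝ≥0∞, ε ≠ 0 →
      ∃ ρ : ℝ≥0∞, ρ ≠ 0 ∧ ∀ v : FormT n q, FMemF T k s lam lam' δ v →
        eFF T k s lam lam' δ (v - u) < ρ →
        eFF T k s lam lam' δ (NopPot μ M₁ M₂ v - NopPot μ M₁ M₂ u) < ε) ∧
    -- `Ψ𝒩` is compact
    (∀ u : ℕ → FormT n q,
      (∃ C : ℝ≥0∞, C ≠ ⊤ ∧ ∀ m, FMemF T k s lam lam' δ (u m) ∧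
        eFF T k s lam lam' δ (u m) ≤ C) →
      ∃ φ : ℕ → ℕ, StrictMono φ ∧ ∃ g : FormT n q, FMemF T k s lam lam' δ g ∧
        Tendsto (fun m => eFF T k s lam lam' δ (NopPot μ M₁ M₂ (u (φ m)) - g))
          atTop (nhds 0)) ∧
    -- `I + Ψ𝒩` is continuous
    (∀ u : FormT n q, FMemF T k s lam lam' δ u → ∀ ε : ℝ≥0∞, ε ≠ 0 →
      ∃ ρ : ℝ≥0∞, ρ ≠ 0 ∧ ∀ v : FormT n q, FMemF T k s lam lam' δ v →
        eFF T k s lam lam' δ (v - u) < ρ →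
        eFF T k s lam lam' δ (TmapN μ M₁ M₂ v - TmapN μ M₁ M₂ u) < ε) ∧
    -- `I + Ψ𝒩` is Fredholm: at every point `v` the linear map `I + ΨB_q(v,·)` is its
    -- Fréchet derivative, is bounded, has finite dimensional kernel and cokernel and
    -- closed range
    (∀ v : FormT n q, FMemF T k s lam lam' δ v →
      (∀ ε : ℝ, 0 < ε → ∃ ρ : ℝ, 0 < ρ ∧ ∀ u : FormT n q, FMemF T k s lam lam' δ u →
        eFF T k s lam lam' δ (u - v) < ENNReal.ofReal ρ →
        eFF T k s lam lam' δ
            (TmapN μ M₁ M₂ u - TmapN μ M₁ M₂ v - LmapB μ M₁ M₂ v (u - v)) ≤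
          ENNReal.ofReal ε * eFF T k s lam lam' δ (u - v)) ∧
      (∃ C : ℝ, 0 < C ∧ ∀ u : FormT n q, FMemF T k s lam lam' δ u →
        FMemF T k s lam lam' δ (LmapB μ M₁ M₂ v u) ∧
        eFF T k s lam lam' δ (LmapB μ M₁ M₂ v u) ≤
          ENNReal.ofReal C * eFF T k s lam lam' δ u) ∧
      (∃ d : ℕ, ∀ (mm : ℕ) (g : Fin mm → FormT n q),
        (∀ i, FMemF T k s lam lam' δ (g i) ∧
          eFF T k s lam lam' δ (LmapB μ M₁ M₂ v (g i)) = 0) →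
        (∀ c : Fin mm → ℝ, eFF T k s lam lam' δ (∑ i, c i • g i) = 0 → ∀ i, c i = 0) →
        mm ≤ d) ∧
      (∀ f : FormT n q, FMemF T k s lam lam' δ f →
        (∀ ε : ℝ≥0∞, ε ≠ 0 → ∃ u : FormT n q, FMemF T k s lam lam' δ u ∧
          eFF T k s lam lam' δ (LmapB μ M₁ M₂ v u - f) < ε) →
        ∃ u : FormT n q, FMemF T k s lam lam' δ u ∧
          eFF T k s lam lam' δ (LmapB μ M₁ M₂ v u - f) = 0) ∧
      (∃ (d : ℕ) (g : Fin d → FormT n q), (∀ i, FMemF T k s lam lam' δ (g i)) ∧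
        ∀ f : FormT n q, FMemF T k s lam lam' δ f →
          ∃ (c : Fin d → ℝ) (u : FormT n q), FMemF T k s lam lam' δ u ∧
            eFF T k s lam lam' δ (f - LmapB μ M₁ M₂ v u - ∑ i, c i • g i) = 0)) ∧
    -- `I + Ψ𝒩` is injective
    (∀ u v : FormT n q, FMemF T k s lam lam' δ u → FMemF T k s lam lam' δ v →
      EqOnT T (TmapN μ M₁ M₂ u) (TmapN μ M₁ M₂ v) → EqOnT T u v) ∧
    -- `I + Ψ𝒩` is open
    (∀ u : FormT n q, FMemF T k s lam lam' δ u → ∀ r : ℝ≥0∞, r ≠ 0 →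
      ∃ ε : ℝ≥0∞, ε ≠ 0 ∧ ∀ f : FormT n q, FMemF T k s lam lam' δ f →
        eFF T k s lam lam' δ (f - TmapN μ M₁ M₂ u) < ε →
        ∃ v : FormT n q, FMemF T k s lam lam' δ v ∧
          eFF T k s lam lam' δ (v - u) < r ∧ EqOnT T (TmapN μ M₁ M₂ v) f) := by
  have hδ1 : 1 < δ := by
    have : (2 : ℝ) ≤ n := by exact_mod_cast hn
    linarith
  have h0 : 0 < lam' := h1.trans h2
  obtain ⟨P, hP⟩ : ∃ P : Par, P = ⟨T, lam, lam', δ, k, s, hT, h1, h0, (zero_lt_one.trans hδ1).le⟩ :=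
    ⟨_, rfl⟩
  obtain ⟨b, hb⟩ : ∃ b : P.Sp n q →L[ℝ] P.Sp n q →L[ℝ] P.Sp n q, IsBil μ M₁ M₂ b := by
    subst hP
    exact exists_isBil hμ h2 h3 hδ1 hs hk M₁ M₂
  have heF : ∀ u : FormT n q, eFF T k s lam lam' δ u = P.eN u := fun u => by rw [hP]; rfl
  have hM : ∀ u : FormT n q, FMemF T k s lam lam' δ u ↔ P.Mem u := fun u => by rw [hP]; rfl
  have hE : ∀ u v : FormT n q, EqOnT T u v ↔ EqOnT P.T u v := fun u v => by rw [hP]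
  simp only [heF, hM, hE]
  have hequiv := exists_equiv_quadDeriv b hb.comp hb.inj
  have hcont : Continuous fun U : P.Sp n q => b U U := 
    b.continuous₂.comp (continuous_id.prodMk continuous_id)
  refine ⟨fun u hu => (hb.nop (Par.rep_ofMem hu)).mem,
    fun u hu ε hε => Rep.continuous_lift hcont hb.nop hu hε, fun u hu => ?_,
    fun u hu ε hε => Rep.continuous_lift (continuous_id.add hcont) hb.tmap hu hε,
    fun v hv => ?_, fun u v hu hv huv => ?_, fun u hu r hr => ?_⟩
  · obtain ⟨C, hC, hu⟩ := hu
    have hn : ∃ C' : ℝ, ∀ m, ‖Par.ofMem (hu m).1‖ ≤ C' := ⟨C.toReal, fun m => by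
      have h := (hu m).2
      rw [(Par.rep_ofMem (hu m).1).eN_eq] at h
      exact (ENNReal.ofReal_le_iff_le_toReal hC).1 h⟩
    obtain ⟨φ, hφ, g, hg⟩ := hb.comp _ _ hn hn
    refine ⟨φ, hφ, g.1, Par.mem g, ?_⟩
    have h := ENNReal.tendsto_ofReal (tendsto_iff_norm_sub_tendsto_zero.1 hg)
    rw [ENNReal.ofReal_zero] at h
    exact h.congr fun m => ((hb.nop (Par.rep_ofMem (hu (φ m)).1)).sub (Rep.refl g)).eN_eq.symm
  · have hV := Par.rep_ofMem hv
    obtain ⟨e, he⟩ := hequiv (Par.ofMem hv)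
    have hsurj : ∀ F : P.Sp n q, ∃ u, P.Mem u ∧ Rep F (LmapB μ M₁ M₂ v u) := fun F => by
      have h : quadDeriv b (Par.ofMem hv) (e.symm F) = F := by
        rw [← he]
        exact e.apply_symm_apply _
      refine ⟨_, Par.mem (e.symm F), ?_⟩
      have h' := hb.lmap (Rep.refl (e.symm F)) hV
      rwa [h] at h'
    have hzero : ∀ {f g : FormT n q} (hf : P.Mem f), Rep (Par.ofMem hf) g → P.eN (g - f) = 0 :=
      fun hf hg => by
        rw [(hg.sub (Par.rep_ofMem hf)).eN_eq, sub_self, norm_zero, ENNReal.ofReal_zero]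
    refine ⟨fun ε hε => ?_, ?_, ⟨0, fun mm g hg hlin => ?_⟩, fun f hf _ => ?_,
      ⟨0, Fin.elim0, fun i => i.elim0, fun f hf => ?_⟩⟩
    · refine ⟨ε / (‖b‖ + 1), by positivity, fun u hu hlt => ?_⟩
      have hU := Par.rep_ofMem hu
      obtain ⟨H, hH⟩ : ∃ H, H = Par.ofMem hu - Par.ofMem hv := ⟨_, rfl⟩
      have hd := hU.sub hV
      have hrem : Rep (b H H) (TmapN μ M₁ M₂ u - TmapN μ M₁ M₂ v - LmapB μ M₁ M₂ v (u - v)) := by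
        have h := ((hb.tmap hU).sub (hb.tmap hV)).sub (hb.lmap hd hV)
        convert h using 1
        rw [quadDeriv_apply, hH]
        simp only [map_sub, _root_.sub_apply]
        abel
      rw [hrem.eN_eq, hd.eN_eq, ← ENNReal.ofReal_mul hε.le, ← hH]
      rw [hd.eN_eq, ENNReal.ofReal_lt_ofReal_iff (by positivity), ← hH,
        lt_div_iff₀ (by positivity)] at hlt
      refine ENNReal.ofReal_le_ofReal ((b.le_opNorm₂ H H).trans ?_)
      refine mul_le_mul_of_nonneg_right ?_ (norm_nonneg _)
      nlinarith [norm_nonneg H, norm_nonneg b]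
    · refine ⟨‖quadDeriv b (Par.ofMem hv)‖ + 1, by positivity, fun u hu => ?_⟩
      have hU := Par.rep_ofMem hu
      have hL := hb.lmap hU hV
      refine ⟨hL.mem, ?_⟩
      rw [hL.eN_eq, hU.eN_eq, ← ENNReal.ofReal_mul (by positivity)]
      refine ENNReal.ofReal_le_ofReal ((ContinuousLinearMap.le_opNorm _ _).trans ?_)
      exact mul_le_mul_of_nonneg_right (by linarith) (norm_nonneg _)
    · rcases Nat.eq_zero_or_pos mm with h | h
      · exact h.le
      · exfalso
        have hG : ∀ i, Rep (0 : P.Sp n q) (g i) := fun i => by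
          have hg1 := Par.rep_ofMem (hg i).1
          have h2 := (hg i).2
          rw [(hb.lmap hg1 hV).eN_eq, ENNReal.ofReal_eq_zero, ← he] at h2
          have h3 : e (Par.ofMem (hg i).1) = 0 := norm_le_zero_iff.1 h2
          rwa [(map_eq_zero_iff e e.injective).1 h3] at hg1
        have h4 := hlin (fun _ => 1) (by
          rw [(Rep.sum Finset.univ fun i => (hG i).smul 1).eN_eq]
          simp) ⟨0, h⟩
        exact one_ne_zero h4
    · obtain ⟨u, hu, h⟩ := hsurj (Par.ofMem hf)
      exact ⟨u, hu, hzero hf h⟩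
    · obtain ⟨u, hu, h⟩ := hsurj (Par.ofMem hf)
      refine ⟨Fin.elim0, u, hu, ?_⟩
      rw [Finset.univ_eq_empty, Finset.sum_empty, sub_zero, ((Par.rep_ofMem hf).sub h).eN_eq,
        sub_self, norm_zero, ENNReal.ofReal_zero]
  · have hU := Par.rep_ofMem hu
    have hV := Par.rep_ofMem hv
    have h := (hb.tmap hU).eq ((hb.tmap hV).congr fun I t ht x => (huv I t ht x).symm)
    have h4 := hb.inj (Par.ofMem hu) (Par.ofMem hv) (Par.ofMem hu - Par.ofMem hv) (by
      rw [map_sub, map_sub, _root_.sub_apply]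
      have h5 := sub_eq_zero.2 h
      rw [← h5]
      abel)
    rw [sub_eq_zero] at h4
    rw [h4] at hU
    exact fun I t ht x => (hU I t ht x).symm.trans (hV I t ht x)
  · obtain ⟨ρ, hρ, hρr⟩ := exists_ofReal_le hr
    have hU := Par.rep_ofMem hu
    obtain ⟨ε, hε, h⟩ := quad_open b hequiv (Par.ofMem hu) ρ hρ
    refine ⟨ENNReal.ofReal ε, by simpa using hε, fun f hf hlt => ?_⟩
    have hF := Par.rep_ofMem hf
    rw [(hF.sub (hb.tmap hU)).eN_eq, ENNReal.ofReal_lt_ofReal_iff hε] at hlt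
    obtain ⟨V, hVr, hV⟩ := h _ hlt
    refine ⟨V.1, Par.mem V, ?_, ?_⟩
    · rw [((Rep.refl V).sub hU).eN_eq]
      exact ((ENNReal.ofReal_lt_ofReal_iff hρ).2 hVr).trans_le hρr
    · have h6 := hb.tmap (Rep.refl V)
      rw [hV] at h6
      exact fun I t ht x => (h6 I t ht x).symm.trans (hF I t ht x)

end NSdeRham

end
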